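/- Let p be a prime with p ≠ 2, 3, 7. If p ≡ 1, 2 or 4 (mod 7), write p = x^2 + 7y^2 with integers x, y; then (−1)^{(p−1)/2}·Σ_{k=0}^{(p−1)/2} k^2·C(2k,k)^3/4096^k ≡ (43/1323)x^2 − (13/441)p − p^2/(1323x^2) (mod p^3) and (−1)^{(p−1)/2}·Σ_{k=0}^{(p−1)/2} k^3·C(2k,k)^3/4096^k ≡ (169/55566)x^2 − (31/74088)p − 71p^2/(444528x^2) (mod p^3). If p ≡ 3, 5 or 6 (mod 7), then (−1)^{(p−1)/2}·Σ_{k=0}^{(p−1)/2} k^2·C(2k,k)^3/4096^k ≡ (8/63)R_7(p) + (349/2646)p (mod p^2) and (−1)^{(p−1)/2}·Σ_{k=0}^{(p−1)/2} k^3·C(2k,k)^3/4096^k ≡ (4/1323)R_7(p) + (1013/222264)p (mod p^2). -/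

import Mathlib

/-- `a ≡ b (mod p^r)` for rationals: the numerator of `a - b` in lowest terms
is divisible by `p^r`. -/
def ratCongr (p r : ℕ) (a b : ℚ) : Prop := (p : ℤ)^r ∣ (a - b).num
/-- `R_7(p) = Σ_{k=0}^{(p-1)/2} C(2k,k)^3/(k+1)`. -/
def R7 (p : ℕ) : ℚ :=
  ∑ k ∈ Finset.range ((p-1)/2 + 1), ((2*k).choose k : ℚ)^3 / (k+1)

namespace Z7

section basic
variable {p : ℕ} [hp : Fact p.Prime]

/-- `x ∈ p^r ℤ_p`. -/
def V (p : ℕ) [hp : Fact p.Prime] (r : ℕ) (x : ℚ_[p]) : Prop :=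
  ∃ z : ℤ_[p], x = (p : ℚ_[p])^r * z

theorem V.add {r : ℕ} {x y : ℚ_[p]} (hx : V p r x) (hy : V p r y) : V p r (x + y) := by
  obtain ⟨a, rfl⟩ := hx; obtain ⟨b, rfl⟩ := hy
  exact ⟨a + b, by push_cast; ring⟩

theorem V.neg {r : ℕ} {x : ℚ_[p]} (hx : V p r x) : V p r (-x) := by
  obtain ⟨a, rfl⟩ := hx
  exact ⟨-a, by push_cast; ring⟩

theorem V.sub {r : ℕ} {x y : ℚ_[p]} (hx : V p r x) (hy : V p r y) : V p r (x - y) := by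
  rw [sub_eq_add_neg]; exact hx.add hy.neg

theorem V.mul {r s : ℕ} {x y : ℚ_[p]} (hx : V p r x) (hy : V p s y) : V p (r + s) (x * y) := by
  obtain ⟨a, rfl⟩ := hx; obtain ⟨b, rfl⟩ := hy
  exact ⟨a * b, by push_cast; ring⟩

theorem V.mono {r s : ℕ} {x : ℚ_[p]} (hx : V p s x) (h : r ≤ s) : V p r x := by
  obtain ⟨a, rfl⟩ := hx
  obtain ⟨t, rfl⟩ := Nat.exists_eq_add_of_le h
  exact ⟨(p:ℤ_[p])^t * a, by push_cast; ring⟩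

theorem V.mulL {r : ℕ} {x y : ℚ_[p]} (hx : V p 0 x) (hy : V p r y) : V p r (x * y) := by
  simpa using hx.mul hy

theorem V.mulR {r : ℕ} {x y : ℚ_[p]} (hx : V p r x) (hy : V p 0 y) : V p r (x * y) := by
  simpa using hx.mul hy

theorem V_zero (r : ℕ) : V p r (0 : ℚ_[p]) := ⟨0, by simp⟩
theorem V_one : V p 0 (1 : ℚ_[p]) := ⟨1, by simp⟩
theorem V_padic (z : ℤ_[p]) : V p 0 (z : ℚ_[p]) := ⟨z, by simp⟩
theorem V_nat (m : ℕ) : V p 0 (m : ℚ_[p]) := ⟨m, by simp⟩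
theorem V_int (m : ℤ) : V p 0 (m : ℚ_[p]) := ⟨m, by simp⟩
theorem V_ofNat (m : ℕ) [m.AtLeastTwo] : V p 0 (OfNat.ofNat m : ℚ_[p]) := V_nat m
theorem V_ppow (r : ℕ) : V p r ((p : ℚ_[p])^r) := ⟨1, by simp⟩
theorem V_p : V p 1 ((p : ℚ_[p])) := ⟨1, by simp⟩

theorem V.pow {x : ℚ_[p]} (hx : V p 0 x) (k : ℕ) : V p 0 (x^k) := by
  obtain ⟨a, rfl⟩ := hx
  exact ⟨a^k, by push_cast; ring⟩

theorem V.sq {r : ℕ} {x : ℚ_[p]} (hx : V p r x) : V p (2*r) (x^2) := by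
  obtain ⟨a, rfl⟩ := hx
  exact ⟨a^2, by push_cast; ring⟩

theorem V_sum {ι : Type*} {r : ℕ} (s : Finset ι) (f : ι → ℚ_[p]) (h : ∀ i ∈ s, V p r (f i)) :
    V p r (∑ i ∈ s, f i) := by
  classical
  induction s using Finset.induction_on with
  | empty => simpa using V_zero r
  | insert a s ha ih =>
    rw [Finset.sum_insert ha]
    exact (h a (by simp)).add (ih fun i hi => h i (by simp [hi]))

theorem V_prod {ι : Type*} (s : Finset ι) (f : ι → ℚ_[p]) (h : ∀ i ∈ s, V p 0 (f i)) :
    V p 0 (∏ i ∈ s, f i) := by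
  classical
  induction s using Finset.induction_on with
  | empty => simpa using V_one
  | insert a s ha ih =>
    rw [Finset.prod_insert ha]
    exact (h a (by simp)).mulL (ih fun i hi => h i (by simp [hi]))

theorem V_inv_of_unit {z : ℤ_[p]} (hz : IsUnit z) : V p 0 ((z : ℚ_[p])⁻¹) := by
  obtain ⟨u, rfl⟩ := hz
  refine ⟨(u⁻¹ : ℤ_[p]ˣ), ?_⟩
  have : ((u : ℤ_[p]) : ℚ_[p]) * ((u⁻¹ : ℤ_[p]ˣ) : ℤ_[p]) = 1 := by
    rw [← PadicInt.coe_mul, Units.mul_inv]; simp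
  rw [pow_zero, one_mul]
  exact inv_eq_of_mul_eq_one_right this

theorem isUnit_nat {m : ℕ} (h : ¬ p ∣ m) : IsUnit (m : ℤ_[p]) := by
  rw [PadicInt.isUnit_iff]
  have := PadicInt.norm_natCast_eq_one_iff (p := p) (n := m)
  rw [this]
  exact (Nat.Prime.coprime_iff_not_dvd hp.out).2 h

theorem V_inv_nat {m : ℕ} (h : ¬ p ∣ m) : V p 0 ((m : ℚ_[p])⁻¹) := by
  simpa using V_inv_of_unit (isUnit_nat h)

theorem V_inv_int {m : ℤ} (h : ¬ (p:ℤ) ∣ m) : V p 0 ((m : ℚ_[p])⁻¹) := by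
  have h2 : ¬ p ∣ m.natAbs := by rwa [← Int.natCast_dvd]
  have := V_inv_nat h2
  rcases Int.natAbs_eq m with h3 | h3
  · rw [h3]; simpa using this
  · rw [h3]; push_cast; rw [inv_neg]; simpa using this.neg

theorem V.cancel_nat {r m : ℕ} {x : ℚ_[p]} (h : V p r ((m : ℚ_[p]) * x)) (hm : ¬ p ∣ m) : V p r x := by
  have := (V_inv_nat hm).mulL h
  rwa [inv_mul_cancel_left₀] at this
  rintro h0
  rw [Nat.cast_eq_zero] at h0
  simp [h0] at hm

theorem V_nat_iff {r m : ℕ} : V p r (m : ℚ_[p]) ↔ p^r ∣ m := by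
  constructor
  · rintro ⟨z, hz⟩
    have : (m : ℤ_[p]) = (p:ℤ_[p])^r * z := by
      apply PadicInt.ext; push_cast; exact hz
    have h2 : (p:ℤ_[p])^r ∣ (m : ℤ_[p]) := ⟨z, this⟩
    have := (PadicInt.norm_le_pow_iff_mem_span_pow (m : ℤ_[p]) r).2 (Ideal.mem_span_singleton.2 h2)
    have h3 := (PadicInt.norm_int_le_pow_iff_dvd (p := p) (k := (m : ℤ)) (n := r)).1 (by simpa using this)
    exact_mod_cast h3
  · rintro ⟨z, rfl⟩
    exact ⟨z, by push_cast; ring⟩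

theorem ratCongr_of_V {r : ℕ} {a b : ℚ} (h : V p r (((a - b : ℚ)) : ℚ_[p])) : ratCongr p r a b := by
  unfold ratCongr
  set q := a - b
  have h1 : V p r ((q.num : ℤ) : ℚ_[p]) := by
    have : ((q.num : ℤ) : ℚ_[p]) = (q : ℚ_[p]) * (q.den : ℚ_[p]) := by
      have := Rat.mul_den_eq_num q
      rw [← Rat.cast_natCast, ← Rat.cast_mul, this]; simp
    rw [this]
    exact h.mulR (V_nat _)
  obtain ⟨z, hz⟩ := h1
  have : ((q.num : ℤ) : ℤ_[p]) = (p:ℤ_[p])^r * z := by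
    apply PadicInt.ext; push_cast; exact hz
  have h2 : (p:ℤ_[p])^r ∣ ((q.num:ℤ) : ℤ_[p]) := ⟨z, this⟩
  have := (PadicInt.norm_le_pow_iff_mem_span_pow ((q.num:ℤ) : ℤ_[p]) r).2 (Ideal.mem_span_singleton.2 h2)
  have h3 := (PadicInt.norm_int_le_pow_iff_dvd (p := p) (k := q.num) (n := r)).1 (by simpa using this)
  exact_mod_cast h3

end basic
end Z7

section
open Finset
namespace Z7

section sums
variable {K : Type*} [Field K] [CharZero K]

/-- central binomial -/
abbrev cb (k : ℕ) : ℕ := Nat.centralBinom k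

theorem cb_succ (k : ℕ) : ((k:K)+1) * (cb (k+1) : K) = 2*(2*k+1) * (cb k : K) := by
  have := Nat.succ_mul_centralBinom_succ k
  exact_mod_cast this

theorem cb_succ' (k : ℕ) : (cb (k+1) : K) = 2*(2*k+1) * (cb k : K) / (k+1) := by
  have := cb_succ (K := K) k
  have h : (k:K)+1 ≠ 0 := Nat.cast_add_one_ne_zero k
  field_simp; linear_combination this

variable (K) in
/-- The moments of `C(2k,k)^3/4096^k`. -/
def Sm (n j : ℕ) : K := ∑ k ∈ range (n+1), (k:K)^j * (cb k : K)^3 / 4096^k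

variable (K) in
/-- The moments of `C(2k,k)^3`. -/
def Tm (n j : ℕ) : K := ∑ k ∈ range (n+1), (k:K)^j * (cb k : K)^3

variable (K) in
def Rm (n : ℕ) : K := ∑ k ∈ range (n+1), (cb k : K)^3 / (k+1)

theorem S_tele (n : ℕ) : 504 * Sm K n 3 - 12 * Sm K n 2 - 6 * Sm K n 1 - Sm K n 0
    = -(2*n+1)^3 * ((cb n : K)^3 / 4096^n) := by
  induction n with
  | zero => simp [Sm]
  | succ n ih =>
    have e : ∀ j, Sm K (n+1) j = Sm K n j + ((n+1:ℕ):K)^j * (cb (n+1) : K)^3 / 4096^(n+1) := by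
      intro j; simp only [Sm]; rw [sum_range_succ]
    simp only [e]
    rw [cb_succ']
    have h : (n:K)+1 ≠ 0 := Nat.cast_add_one_ne_zero n
    push_cast
    field_simp at ih ⊢
    linear_combination (4096 * (n+1)^3) * ih

theorem R_tele (n : ℕ) : 8 * Rm K n = 63 * Tm K n 2 + 32 * Tm K n 1 + 16 * Tm K n 0
    - 8 * (2*n+1)^3 * (cb n : K)^3 / (n+1) := by
  induction n with
  | zero => simp [Rm, Tm]; norm_num
  | succ n ih =>
    have e : ∀ j, Tm K (n+1) j = Tm K n j + ((n+1:ℕ):K)^j * (cb (n+1) : K)^3 := by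
      intro j; simp only [Tm]; rw [sum_range_succ]
    have e2 : Rm K (n+1) = Rm K n + (cb (n+1) : K)^3 / ((n+1:ℕ)+1) := by
      simp only [Rm]; rw [sum_range_succ]
    simp only [e, e2]
    rw [cb_succ']
    have h : (n:K)+1 ≠ 0 := Nat.cast_add_one_ne_zero n
    have h2 : (n:K)+1+1 ≠ 0 := by exact_mod_cast Nat.cast_add_one_ne_zero (R := K) (n+1)
    push_cast
    field_simp at ih ⊢
    linear_combination ((n+1)^2 * (n+1+1)) * ih

/- A1 -/
theorem A1_tele (M J : ℕ) :
    2*(2*((M:K)+1)+1) * ∑ k ∈ range J, ((M+1+k).choose k : K)^2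
      - (M+1) * ∑ k ∈ range J, ((M+k).choose k : K)^2
      = J^2 * (2*J/(M+1)^2 + 3/(M+1)) * ((M+J).choose J : K)^2 := by
  have h : (M:K)+1 ≠ 0 := Nat.cast_add_one_ne_zero M
  induction J with
  | zero => simp
  | succ J ih =>
    have hJ : (J:K)+1 ≠ 0 := Nat.cast_add_one_ne_zero J
    rw [sum_range_succ, sum_range_succ]
    have h1 : ((M+1+J).choose J : K) = (M+1+J) * ((M+J).choose J : K) / (M+1) := by
      have := Nat.add_one_mul_choose_eq (M+J) M
      have e1 : (M+J).choose M = (M+J).choose J := by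
        rw [Nat.choose_symm_add]
      have e2 : (M+1+J).choose J = (M+J).succ.choose M.succ := by
        rw [show (M+J).succ = M+1+J by simp; ring]
        exact (Nat.choose_symm_add (a := M+1) (b := J)).symm
      rw [e2]
      rw [e1] at this
      have t2 : ((M:K)+J+1) * ((M+J).choose J : K) = ((M+J).succ.choose M.succ : K) * (M+1) := by
        exact_mod_cast this
      field_simp
      linear_combination -t2
    have h2 : ((M+(J+1)).choose (J+1) : K) = (M+1+J) * ((M+J).choose J : K) / (J+1) := by
      have := Nat.add_one_mul_choose_eq (M+J) J
      have t2 : ((M:K)+J+1) * ((M+J).choose J : K) = ((M+(J+1)).choose (J+1) : K) * (J+1) := by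
        exact_mod_cast this
      field_simp
      linear_combination -t2
    rw [h1, h2]
    push_cast
    field_simp at ih ⊢
    linear_combination ih

theorem A1_step (M : ℕ) :
    2*(2*((M:K)+1)+1) * ∑ k ∈ range (M+2), ((M+1+k).choose k : K)^2
      - (M+1) * ∑ k ∈ range (M+1), ((M+k).choose k : K)^2
      = (21*(M+1)+8)/4 * (cb (M+1) : K)^2 := by
  have h := A1_tele (K := K) M (M+1)
  have h0 : (M:K)+1 ≠ 0 := Nat.cast_add_one_ne_zero M
  rw [sum_range_succ, mul_add]
  have e1 : (M+1+(M+1)).choose (M+1) = cb (M+1) := by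
    rw [cb, Nat.centralBinom_eq_two_mul_choose, two_mul]
  have e2 : 2 * (M+(M+1)).choose (M+1) = cb (M+1) := by
    have := Nat.add_one_mul_choose_eq (M+(M+1)) M
    have e3 : (M+(M+1)).choose M = (M+(M+1)).choose (M+1) := by
      rw [Nat.choose_symm_add]
    rw [← e1]
    rw [e3] at this
    have e4 : M+(M+1)+1 = M+1+(M+1) := by ring
    rw [e4] at this
    have : (M+1) * (2 * (M+(M+1)).choose (M+1)) = (M+1) * (M+1+(M+1)).choose (M+1) := by
      rw [mul_comm (M+1) ((M+1+(M+1)).choose (M+1))]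
      rw [← this]; ring
    exact Nat.eq_of_mul_eq_mul_left (Nat.succ_pos M) this
  have e2' : ((M+(M+1)).choose (M+1) : K) = (cb (M+1) : K)/2 := by
    rw [← e2]; push_cast; ring
  rw [e1]
  rw [e2'] at h
  push_cast at h
  field_simp at h ⊢
  linear_combination h

theorem A1_exact (N : ℕ) :
    ∑ k ∈ range (N+1), (21*(k:K)+8) * (cb k : K)^3
      = 4*(N+1) * (cb (N+1) : K) * ∑ k ∈ range (N+1), ((N+k).choose k : K)^2 := by
  induction N with
  | zero => simp [cb, Nat.centralBinom]; norm_num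
  | succ N ih =>
    rw [sum_range_succ, ih]
    have h := A1_step (K := K) N
    have h0 : (N:K)+1+1 ≠ 0 := by exact_mod_cast Nat.cast_add_one_ne_zero (R := K) (N+1)
    rw [cb_succ' (N+1)]
    push_cast at h ⊢
    field_simp at h ⊢
    linear_combination - (cb (N+1) : K) * h
end sums

section A1p
variable {p : ℕ} [hp : Fact p.Prime]

theorem p_dvd_cb {n k : ℕ} (hn : p = 2*n+1) (h1 : n < k) (h2 : k < p) : p ∣ cb k := by
  rw [cb, Nat.centralBinom_eq_two_mul_choose]
  exact hp.out.dvd_choose h2 (by omega) (by omega)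

theorem p_eq {n : ℕ} (hn : p = 2*n+1) : (p : ℚ_[p]) = 2*n+1 := by
  have := congrArg (Nat.cast (R := ℚ_[p])) hn
  push_cast at this; exact this

theorem A1_padic {n : ℕ} (hn : p = 2*n+1) :
    V p 2 (21 * Tm ℚ_[p] n 1 + 8 * Tm ℚ_[p] n 0 - 8 * (p : ℚ_[p])) := by
  have h := A1_exact (K := ℚ_[p]) (2*n)
  have e0 : (((2*n:ℕ):ℚ_[p])+1) = p := by rw [p_eq hn]; push_cast; ring
  rw [e0, ← hn] at h
  have hs : ∑ k ∈ range p, (21*(k:ℚ_[p])+8) * (cb k : ℚ_[p])^3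
      = (21 * Tm ℚ_[p] n 1 + 8 * Tm ℚ_[p] n 0) +
        ∑ k ∈ Ico (n+1) p, (21*(k:ℚ_[p])+8) * (cb k : ℚ_[p])^3 := by
    rw [range_eq_Ico, ← sum_Ico_consecutive _ (Nat.zero_le (n+1)) (by omega : n+1 ≤ p)]
    congr 1
    simp only [Tm, mul_sum, ← sum_add_distrib, range_eq_Ico]
    refine sum_congr rfl fun k _ => ?_
    ring
  have h3 : V p 3 (∑ k ∈ Ico (n+1) p, (21*(k:ℚ_[p])+8) * (cb k : ℚ_[p])^3) := by
    refine V_sum _ _ fun k hk => ?_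
    rw [mem_Ico] at hk
    have hd := p_dvd_cb hn (by omega) hk.2
    have : V p 1 (cb k : ℚ_[p]) := V_nat_iff.2 (by simpa using hd)
    refine V.mulL ((((V_ofNat 21).mulL (V_nat k))).add (V_ofNat 8)) ?_
    obtain ⟨z, hz⟩ := this
    exact ⟨z^3, by rw [hz]; push_cast; ring⟩
  have h4 : V p 1 ((cb p : ℚ_[p]) - 2) := by
    have := Choose.choose_modEq_choose_mod_mul_choose_div_nat (n := 2*p) (k := p) (p := p)
    rw [Nat.mul_mod_left, Nat.mod_self, Nat.mul_div_cancel _ hp.out.pos, Nat.div_self hp.out.pos] at this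
    rw [cb, Nat.centralBinom_eq_two_mul_choose]
    have h5 : 2 ≤ (2*p).choose p := by
      rw [← Nat.centralBinom_eq_two_mul_choose]
      exact (Nat.two_dvd_centralBinom_of_one_le hp.out.one_le).elim fun c hc => by
        have := Nat.centralBinom_pos p
        omega
    have h6 : p ∣ (2*p).choose p - 2 := (Nat.modEq_iff_dvd' h5).1 (by simpa using this.symm)
    have := (V_nat_iff (p := p) (r := 1)).2 (by simpa using h6)
    rwa [Nat.cast_sub h5] at this
  have h5 : V p 1 (∑ k ∈ range p, ((2*n+k).choose k : ℚ_[p])^2 - 1) := by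
    rw [show range p = range (2*n+1) by rw [← hn], sum_range_succ']
    simp only [add_zero, Nat.choose_zero_right, Nat.cast_one, one_pow, add_sub_cancel_right]
    refine V_sum _ _ fun k hk => ?_
    rw [mem_range] at hk
    have := Nat.choose_succ_right_eq (2*n+(k+1)) k
    rw [show 2*n+(k+1)-k = p by omega] at this
    have hd : p ∣ (2*n+(k+1)).choose (k+1) * (k+1) := this ▸ Dvd.intro_left _ rfl
    have hd2 : p ∣ (2*n+(k+1)).choose (k+1) := by
      rcases hp.out.dvd_mul.1 hd with h | h
      · exact h
      · exact absurd (Nat.le_of_dvd (by omega) h) (by omega)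
    rw [sq]
    exact (V_nat_iff.2 (by simpa using hd2)).mulR (V_nat _)
  rw [hs] at h
  have e : 21 * Tm ℚ_[p] n 1 + 8 * Tm ℚ_[p] n 0 - 8 * p =
      (4 * p) * (((cb p : ℚ_[p]) - 2) * (∑ k ∈ range p, ((2*n+k).choose k : ℚ_[p])^2)
       + 2 * (∑ k ∈ range p, ((2*n+k).choose k : ℚ_[p])^2 - 1)) -
       (∑ k ∈ Ico (n+1) p, (21*(k:ℚ_[p])+8) * (cb k : ℚ_[p])^3) := by
    linear_combination h
  rw [e]
  refine V.sub ?_ (h3.mono (by norm_num))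
  refine ((V_ofNat 4).mulL V_p).mul (r := 1) (s := 1) (V.add (h4.mulR ?_) ((V_ofNat 2).mulL h5))
  exact V_sum _ _ fun k _ => (V_nat _).pow 2
end A1p
end Z7
end

section
open Finset
set_option linter.unusedSectionVars false
set_option linter.unusedSimpArgs false
set_option linter.unusedVariables false
namespace Z7

section A2
variable {K : Type*} [Field K] [CharZero K]

variable (K) in
def ph (m : ℕ) : K := ∏ l ∈ range m, ((l:K) + 1/2)

theorem ph_succ (m : ℕ) : ph K (m+1) = ph K m * (m + 1/2) := by
  simp only [ph, prod_range_succ]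

theorem half_ne (m : ℕ) : (m:K) + 1/2 ≠ 0 := by
  have : (2*(m:K)+1) ≠ 0 := by exact_mod_cast (by omega : 2*m+1 ≠ 0)
  intro h; apply this; linear_combination 2*h

theorem odd_ne (m : ℕ) : 2*(m:K) + 1 ≠ 0 := by exact_mod_cast (by omega : 2*m+1 ≠ 0)

theorem odd3_ne (m : ℕ) : 2*(m:K) + 3 ≠ 0 := by exact_mod_cast (by omega : 2*m+3 ≠ 0)

theorem ph_ne (m : ℕ) : ph K m ≠ 0 := by
  simp only [ph, prod_ne_zero_iff]; intro l _; exact half_ne l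

variable (K) in
def vv (M : ℕ) : K := (cb M : K) / 16^M

theorem vv_succ (M : ℕ) : vv K (M+1) = vv K M * (M+1/2) / (4*(M+1)) := by
  simp only [vv, cb_succ']
  have h : (M:K)+1 ≠ 0 := Nat.cast_add_one_ne_zero M
  field_simp
  ring

variable (K) in
def bb (M i : ℕ) : K := ph K (M+1) * ph K i / ((M+1+i).factorial : K)

theorem fac_ne (m : ℕ) : (m.factorial : K) ≠ 0 := by exact_mod_cast m.factorial_ne_zero

theorem bb_i (M i : ℕ) : bb K M (i+1) = bb K M i * (i+1/2) / (M+i+2) := by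
  simp only [bb, ph_succ i, show M+1+(i+1) = (M+1+i)+1 by ring, Nat.factorial_succ]
  have h := fac_ne (K := K) (M+1+i)
  have h2 : (M:K)+i+2 ≠ 0 := by exact_mod_cast (by omega : M+i+2 ≠ 0)
  push_cast
  have h3 : (M:K)+1+i+1 ≠ 0 := by convert h2 using 1; ring
  field_simp
  ring

theorem bb_M (M i : ℕ) : bb K (M+1) i = bb K M i * (M+3/2) / (M+i+2) := by
  simp only [bb, ph_succ (M+1), show M+1+1+i = (M+1+i)+1 by ring, Nat.factorial_succ]
  have h := fac_ne (K := K) (M+1+i)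
  have h2 : (M:K)+i+2 ≠ 0 := by exact_mod_cast (by omega : M+i+2 ≠ 0)
  push_cast
  have h3 : (M:K)+1+i+1 ≠ 0 := by convert h2 using 1; ring
  field_simp
  ring

theorem bb_diag (M : ℕ) : bb K M M = vv K M / 2 := by
  induction M with
  | zero => simp [bb, vv, ph, cb]
  | succ M ih =>
    rw [bb_M, bb_i, ih, vv_succ]
    have h2 : (M:K)+M+2 ≠ 0 := by exact_mod_cast (by omega : M+M+2 ≠ 0)
    have h : (M:K)+1 ≠ 0 := Nat.cast_add_one_ne_zero M
    have h4 := odd3_ne (K := K) M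
    push_cast
    rw [show (M:K)+(M+1)+2 = 2*M+3 by ring, show (M:K)+M+2 = 2*(M+1) by ring]
    field_simp
    ring

variable (K) in
def rt (M i : ℕ) : K := (i+1/2)^2 * ((2*i+1)/(M+1/2)^2 + 3/(M+1/2)) * bb K M i^2

theorem rt_step (M i : ℕ) :
    ((M:K)+3/2) * bb K (M+1) (i+1)^2 - 4*(M+1) * bb K M (i+1)^2 = rt K (M+1) (i+1) - rt K (M+1) i := by
  simp only [rt, bb_M, bb_i]
  have h2 : (M:K)+i+2 ≠ 0 := by exact_mod_cast (by omega : M+i+2 ≠ 0)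
  have h3 : (M:K)+i+3 ≠ 0 := by exact_mod_cast (by omega : M+i+3 ≠ 0)
  have h4 := odd3_ne (K := K) M
  push_cast
  rw [show (M:K)+(i+1)+2 = M+i+3 by ring, show (M:K)+3/2 = (2*M + 3)/2 by ring, show (M:K)+1+1/2 = (2*M + 3)/2 by ring]
  field_simp
  ring

theorem rt_step0 (i : ℕ) :
    (1/2) * bb K 0 (i+1)^2 = rt K 0 (i+1) - rt K 0 i := by
  simp only [rt, bb_i]
  have h2 : (i:K)+2 ≠ 0 := by exact_mod_cast (by omega : i+2 ≠ 0)
  push_cast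
  rw [zero_add]
  field_simp
  ring

variable (K) in
def sM (n M : ℕ) : K := ∑ i ∈ Ico (M+1) (n+1), bb K M i^2

theorem sM_zero (n : ℕ) : (1/2) * sM K n 0 = rt K 0 n - 5/8 := by
  simp only [sM]
  induction n with
  | zero => simp [rt, bb_diag, vv, cb]; norm_num
  | succ n ih =>
    rw [sum_Ico_succ_top (by omega), mul_add, ih]
    linear_combination rt_step0 (K := K) n

theorem sM_succ (M n : ℕ) (h : M+1 ≤ n) : (M+3/2) * sM K n (M+1) - 4*(M+1) * sM K n M
    = rt K (M+1) n - (42*(M+1)+5)/8 * vv K (M+1)^2 := by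
  have key : (M+3/2) * sM K n (M+1) - 4*(M+1) * ∑ i ∈ Ico (M+1+1) (n+1), bb K M i^2
     = rt K (M+1) n - rt K (M+1) (M+1) := by
    simp only [sM]
    induction n, h using Nat.le_induction with
    | base => simp
    | succ n hn ih =>
      rw [sum_Ico_succ_top (by omega : M+1+1 ≤ n+1), sum_Ico_succ_top (by omega : M+1+1 ≤ n+1)]
      linear_combination ih + rt_step (K := K) M n
  have e : sM K n M = bb K M (M+1)^2 + ∑ i ∈ Ico (M+1+1) (n+1), bb K M i^2 := by
    rw [sM, sum_eq_sum_Ico_succ_bot (by omega)]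
  rw [e]
  have e2 : rt K (M+1) (M+1) + 4*(M+1)*bb K M (M+1)^2 = (42*(M+1)+5)/8 * vv K (M+1)^2 := by
    rw [rt, bb_diag, bb_i, bb_diag, vv_succ]
    have h2 : (M:K)+M+2 ≠ 0 := by exact_mod_cast (by omega : M+M+2 ≠ 0)
    have h : (M:K)+1 ≠ 0 := Nat.cast_add_one_ne_zero M
    have h4 := odd3_ne (K := K) M
    push_cast
    rw [show (M:K)+1+1/2 = (2*M + 3)/2 by ring, show (M:K)+M+2 = 2*(M+1) by ring]
    field_simp
    ring
  linear_combination key - e2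

theorem A2_exact_aux (n m : ℕ) (h : m ≤ n) :
    ((m:K)+1/2) * vv K m * sM K n m =
      ∑ M ∈ range (m+1), (vv K M * rt K M n - (42*M+5)/8 * vv K M^3) := by
  induction m with
  | zero =>
    simp only [zero_add, sum_range_one]
    have := sM_zero (K := K) n
    simp [vv, cb] at this ⊢
    linear_combination this
  | succ m ih =>
    rw [sum_range_succ, ← ih (by omega)]
    have := sM_succ (K := K) m n h
    have h : (m:K)+1 ≠ 0 := Nat.cast_add_one_ne_zero m
    have hv : (m+1/2) * vv K m = 4*(m+1) * vv K (m+1) := by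
      rw [vv_succ]; field_simp
    rw [hv]
    push_cast
    linear_combination vv K (m+1) * this

theorem A2_exact (n : ℕ) : 42 * Sm K n 1 + 5 * Sm K n 0
    = 5 * (2*n+1) * vv K n^3 + 2 * (2*n+1)^2 *
      ∑ M ∈ range n, vv K M * (((2*n+1)/(M+1/2)^2 + 3/(M+1/2)) * bb K M n^2) := by
  have h := A2_exact_aux (K := K) n n le_rfl
  have e0 : sM K n n = 0 := by simp [sM]
  rw [e0, mul_zero, sum_sub_distrib] at h
  have e1 : 42 * Sm K n 1 + 5 * Sm K n 0 = 8 * ∑ M ∈ range (n+1), (42*(M:K)+5)/8 * vv K M^3 := by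
    simp only [Sm, mul_sum, ← sum_add_distrib, vv]
    refine sum_congr rfl fun k _ => ?_
    rw [div_pow, ← pow_mul, mul_comm k 3, pow_mul]; norm_num; ring
  rw [e1]
  have e2 : ∑ M ∈ range (n+1), vv K M * rt K M n = (1/4) * (2*n+1)^2 *
      (∑ M ∈ range n, vv K M * (((2*n+1)/(M+1/2)^2 + 3/(M+1/2)) * bb K M n^2)) +
      5/8 * (2*n+1) * vv K n^3 := by
    rw [sum_range_succ, mul_sum]
    congr 1
    · refine sum_congr rfl fun k _ => ?_
      rw [rt]; ring
    · rw [rt, bb_diag]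
      have := half_ne (K := K) n
      field_simp
      ring
  linear_combination 8 * e2 + 8 * h

/-- `C(n+k,2k)(-16)^k = C(2k,k) ∏ (1 - (2n+1)^2/(2l+1)^2)` -/
theorem choose_prod (n k : ℕ) : ((n+k).choose (2*k) : K) * (-16)^k =
    cb k * ∏ l ∈ range k, (1 - (2*(n:K)+1)^2/(2*l+1)^2) := by
  induction k with
  | zero => simp [cb]
  | succ k ih =>
    rw [prod_range_succ, cb_succ', pow_succ]
    have h1 := Nat.add_one_mul_choose_eq (n+k) (2*k+1)
    have h2 := Nat.choose_succ_right_eq (n+k) (2*k)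
    have h1' : ((n:K)+k+1) * ((n+k).choose (2*k+1) : K)
       = ((n+(k+1)).choose (2*(k+1)) : K) * (2*k+1+1) := by exact_mod_cast h1
    have h2' : ((n+k).choose (2*k+1) : K) * (2*k+1) = ((n+k).choose (2*k) : K) * (n - k) := by
      have e : (((n+k - 2*k : ℕ)) : K) * ((n+k).choose (2*k) : K) = (n - k) * ((n+k).choose (2*k) : K) := by
        rcases le_or_gt k n with hk | hk
        · rw [Nat.cast_sub (by omega)]; push_cast; ring
        · rw [Nat.choose_eq_zero_of_lt (by omega)]; simp
      have : ((n+k).choose (2*k+1) : K) * (2*k+1) = ((n+k).choose (2*k) : K) * ((n+k-2*k : ℕ):K) := by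
        exact_mod_cast h2
      rw [this, mul_comm, e, mul_comm]
    have h3 := odd_ne (K := K) k
    have h : (k:K)+1 ≠ 0 := Nat.cast_add_one_ne_zero k
    have key : (2*(2*(k:K)+1)*(cb k) / (k+1)) * ((∏ l ∈ range k, (1 - (2*(n:K)+1)^2/(2*l+1)^2)) *
        (1 - (2*(n:K)+1)^2/(2*k+1)^2)) = (cb k * (∏ l ∈ range k, (1 - (2*(n:K)+1)^2/(2*l+1)^2))) *
         (-8 * (n+k+1)*(n-k)/((k+1)*(2*k+1))) := by
      field_simp; ring
    rw [key, ← ih]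
    have h4 : ((n+(k+1)).choose (2*(k+1)) : K) = (n+k+1) * (((n+k).choose (2*k) : K) * (n - k) / (2*k+1)) / (2*(k+1)) := by
      rw [← h2', mul_div_cancel_right₀ _ h3]; field_simp; linear_combination -h1'
    rw [h4]
    field_simp
    ring

/- e(m,k) -/
def ee (m k : ℕ) : ℤ := (m+k+1).choose (2*k+1) + (m+k).choose (2*k+1)

theorem ee_rec (m k : ℕ) : ee (m+2) (k+1) + ee m (k+1) - 2 * ee (m+1) (k+1) = ee (m+1) k := by
  have P : ∀ a b : ℕ, ((a+1).choose (b+1) : ℤ) = a.choose b + a.choose (b+1) := by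
    intro a b; exact_mod_cast Nat.choose_succ_succ' a b
  simp only [ee]
  have key : ∀ m : ℕ, ((m+3).choose (2*k+3):ℤ) - 2 * (m+2).choose (2*k+3) + (m+1).choose (2*k+3)
     = (m+1).choose (2*k+1) := by
    intro m
    rw [P (m+2) (2*k+2), P (m+1) (2*k+2), P (m+1) (2*k+1)]; ring
  have k1 := key (m+k+1)
  have k2 := key (m+k)
  rw [show m+2+(k+1)+1 = m+k+1+3 by ring, show 2*(k+1)+1 = 2*k+3 by ring,
    show m+2+(k+1) = m+k+1+2 by ring, show m+(k+1)+1 = m+k+1+1 by ring,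
    show m+(k+1) = m+k+1 by ring, show m+1+(k+1)+1 = m+k+1+2 by ring,
    show m+1+(k+1) = m+k+1+1 by ring, show m+1+k+1 = m+k+1+1 by ring, show m+1+k = m+k+1 by ring]
  rw [show m+k+3 = m+k+1+2 by ring, show m+k+2 = m+k+1+1 by ring] at k2
  linear_combination k1 + k2

theorem ee_zero (m k : ℕ) (h : m < k) : ee m k = 0 := by
  simp only [ee]
  rw [Nat.choose_eq_zero_of_lt (by omega), Nat.choose_eq_zero_of_lt (by omega)]; simp

def aa (m : ℕ) : ℤ := ∑ k ∈ range (m+1), (-1)^k * ee m k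

theorem aa_eq (m N : ℕ) (h : m < N) : aa m = ∑ k ∈ range N, (-1)^k * ee m k := by
  simp only [aa]
  refine sum_subset (by intro x; simp; omega) ?_
  intro x _ hx
  rw [ee_zero _ _ (by simp at hx; omega), mul_zero]

theorem aa_rec (m : ℕ) : aa (m+2) = aa (m+1) - aa m := by
  rw [aa_eq (m+2) (m+3+1) (by omega), aa_eq m (m+3+1) (by omega)]
  have e1 := aa_eq (m+1) (m+3) (by omega)
  have e2 := aa_eq (m+1) (m+3+1) (by omega)
  rw [sum_range_succ'] at e2 ⊢
  rw [sum_range_succ' (fun k => (-1)^k * ee m k)]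
  have e3 : ∑ k ∈ range (m+3), ((-1)^(k+1) * ee (m+2) (k+1) + (-1)^(k+1) * ee m (k+1)
     - 2 * ((-1)^(k+1) * ee (m+1) (k+1))) = - ∑ k ∈ range (m+3), (-1)^k * ee (m+1) k := by
    rw [← sum_neg_distrib]
    refine sum_congr rfl fun k _ => ?_
    have := ee_rec m k
    rw [← this]; ring
  rw [sum_sub_distrib, sum_add_distrib, ← mul_sum] at e3
  have e4 : ee (m+2) 0 + ee m 0 - 2 * ee (m+1) 0 = 0 := by simp [ee]; ring
  linear_combination e3 + e1 - 2 * e2 + e4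

theorem aa_val (t : ℕ) : aa (3*t) = (-1)^t ∧ aa (3*t+1) = 2*(-1)^t := by
  induction t with
  | zero => constructor <;> decide
  | succ t ih =>
    have h2 := aa_rec (3*t)
    have h3 := aa_rec (3*t+1)
    have h4 := aa_rec (3*t+2)
    rw [show 3*(t+1) = 3*t+1+2 by ring, show 3*t+1+2+1 = 3*t+2+2 by ring]
    rw [show 3*t+2+1 = 3*t+1+2 by ring] at h4
    constructor
    · rw [h3, show 3*t+1+1 = 3*t+2 by ring, h2, ih.1, ih.2, pow_succ]; ring
    · rw [h4, h3, show 3*t+1+1 = 3*t+2 by ring, h2, ih.1, ih.2, pow_succ]; ring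

theorem aa_val' (m : ℕ) (h : m % 3 ≠ 1) : aa m = (-1)^m := by
  obtain ⟨t, rfl | rfl⟩ : ∃ t, m = 3*t ∨ m = 3*t+2 := ⟨m/3, by omega⟩
  · rw [(aa_val t).1, pow_mul]; norm_num
  · rw [aa_rec, (aa_val t).1, (aa_val t).2, pow_add, pow_mul]; norm_num; ring

theorem ee_eq (m k : ℕ) : (ee m k : K) = ((m+k).choose (2*k) : K) * (2*m+1)/(2*k+1) := by
  have h1 : ((m+k+1).choose (2*k+1) : K) * (2*k+1) = (m+k+1) * ((m+k).choose (2*k) : K) := by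
    have := Nat.add_one_mul_choose_eq (m+k) (2*k)
    have : ((m:K)+k+1) * ((m+k).choose (2*k) : K) = ((m+k+1).choose (2*k+1) : K) * (2*k+1) := by
      exact_mod_cast this
    rw [this]
  have h2 : ((m+k+1).choose (2*k+1) : K) = (m+k).choose (2*k) + (m+k).choose (2*k+1) := by
    exact_mod_cast Nat.choose_succ_succ' (m+k) (2*k)
  have h3 := odd_ne (K := K) k
  simp only [ee]
  push_cast
  field_simp
  linear_combination 2 * h1 - (2*k+1) * h2

theorem half_sum (n : ℕ) (h : n % 3 ≠ 1) :
    ∑ k ∈ range n, ((n+k).choose (2*k) : K) * (-1)^k / (2*k+1) = 0 := by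
  have h1 := aa_val' n h
  rw [aa, sum_range_succ] at h1
  have e0 : ee n n = 1 := by
    simp only [ee]
    rw [show n+n+1 = 2*n+1 by ring, Nat.choose_self, Nat.choose_eq_zero_of_lt (by omega)]; simp
  rw [e0, mul_one] at h1
  have h2 : ∑ k ∈ range n, (-1)^k * ee n k = 0 := by linarith
  have h3 : ((∑ k ∈ range n, (-1)^k * ee n k : ℤ) : K) = 0 := by rw [h2]; simp
  push_cast at h3
  have h4 := odd_ne (K := K) n
  have : (2*(n:K)+1) * ∑ k ∈ range n, ((n+k).choose (2*k) : K) * (-1)^k / (2*k+1) = 0 := by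
    rw [← h3, mul_sum]
    refine sum_congr rfl fun k _ => ?_
    rw [ee_eq]; ring
  exact (mul_eq_zero.1 this).resolve_left h4
end A2
end Z7
end

section
open Finset
set_option linter.unusedSectionVars false
set_option linter.unusedSimpArgs false
set_option linter.unusedVariables false
namespace Z7

section A2p
variable {p : ℕ} [hp : Fact p.Prime]

theorem V_inv_odd {n l : ℕ} (hn : p = 2*n+1) (h : l < n) : V p 0 ((2*(l:ℚ_[p])+1)⁻¹) := by
  have : ¬ p ∣ 2*l+1 := fun h2 => by have := Nat.le_of_dvd (by omega) h2; omega
  have := V_inv_nat this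
  push_cast at this; exact this

theorem V_half (hp2 : p ≠ 2) : V p 0 ((2:ℚ_[p])⁻¹) := by
  have : ¬ p ∣ 2 := fun h2 => hp2 ((Nat.prime_dvd_prime_iff_eq hp.out Nat.prime_two).1 h2)
  exact_mod_cast V_inv_nat this

theorem not_dvd_two_pow (hp2 : p ≠ 2) (k : ℕ) : ¬ p ∣ 2^k := fun h2 =>
  hp2 ((Nat.prime_dvd_prime_iff_eq hp.out Nat.prime_two).1 (hp.out.dvd_of_dvd_pow h2))

theorem V_prod_one {n k : ℕ} (hn : p = 2*n+1) (h : k ≤ n) :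
    V p 2 (∏ l ∈ range k, (1 - (p:ℚ_[p])^2/(2*l+1)^2) - 1) := by
  induction k with
  | zero => simpa using V_zero 2
  | succ k ih =>
    rw [prod_range_succ]
    have h1 := ih (by omega)
    have h2 : V p 2 ((p:ℚ_[p])^2/(2*k+1)^2) := by
      rw [div_eq_mul_inv, ← inv_pow]
      exact (V_ppow 2).mulR ((V_inv_odd hn (by omega)).pow 2)
    have h3 : V p 0 (1 - (p:ℚ_[p])^2/(2*k+1)^2) := V_one.sub (h2.mono (by omega))
    have := (h1.mulR h3).sub h2
    convert this using 1
    ring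

theorem V_vv (hp2 : p ≠ 2) (M : ℕ) : V p 0 (vv ℚ_[p] M) := by
  rw [vv, div_eq_mul_inv]
  refine (V_nat _).mulL ?_
  have := V_inv_nat (not_dvd_two_pow hp2 (4*M))
  rw [pow_mul] at this
  exact_mod_cast this

theorem choose_vv {n k : ℕ} (hn : p = 2*n+1) (hp2 : p ≠ 2) (h : k ≤ n) :
    V p 2 (((n+k).choose (2*k) : ℚ_[p]) * (-1)^k - vv ℚ_[p] k) := by
  have h1 := choose_prod (K := ℚ_[p]) n k
  rw [← p_eq hn] at h1
  have h2 := (V_vv hp2 k).mulL (V_prod_one hn h)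
  convert h2 using 1
  rw [vv]
  have e : (-16:ℚ_[p])^k = (-1)^k * 16^k := by rw [← mul_pow]; norm_num
  rw [e] at h1
  have h16 : (16:ℚ_[p])^k ≠ 0 := by simp
  field_simp
  linear_combination h1

theorem vv_n {n : ℕ} (hn : p = 2*n+1) (hp2 : p ≠ 2) : V p 2 (vv ℚ_[p] n - (-1)^n) := by
  have := (choose_vv hn hp2 (le_refl n)).neg
  rw [show n+n = 2*n by ring, Nat.choose_self] at this
  convert this using 1
  push_cast; ring

theorem V_ph_div {n M : ℕ} (hn : p = 2*n+1) (hp2 : p ≠ 2) (h : M < n) :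
    V p 1 (bb ℚ_[p] M n - ph ℚ_[p] n / n.factorial) ∧ V p 0 (ph ℚ_[p] n / (n.factorial : ℚ_[p])) := by
  have hp1 := p_eq hn
  have hpo := hp.out.two_le
  have h0 : V p 0 (ph ℚ_[p] n / (n.factorial : ℚ_[p])) := by
    rw [div_eq_mul_inv]
    refine V.mulL (V_prod _ _ fun l hl => (V_nat _).add (by simpa using V_half hp2)) (V_inv_nat ?_)
    rw [hp.out.dvd_factorial]; omega
  refine ⟨?_, h0⟩
  induction M with
  | zero =>
    have hx : V p 0 (((n+1:ℕ):ℚ_[p])⁻¹) := V_inv_nat fun h2 => by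
      have := Nat.le_of_dvd (by omega) h2; omega
    have : bb ℚ_[p] 0 n - ph ℚ_[p] n / n.factorial =
       (ph ℚ_[p] n / (n.factorial : ℚ_[p])) * ((((n+1:ℕ):ℚ_[p])⁻¹) * (-p * (2:ℚ_[p])⁻¹)) := by
      rw [bb, show 0+1+n = n+1 by ring, Nat.factorial_succ, hp1]
      have := fac_ne (K := ℚ_[p]) n
      have h : (n:ℚ_[p])+1 ≠ 0 := Nat.cast_add_one_ne_zero n
      simp [ph]
      field_simp
      ring
    rw [this]
    exact h0.mulL (hx.mulL (V_p.neg.mulR (V_half hp2)))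
  | succ M ih =>
    have hx : V p 0 (((M+n+2:ℕ):ℚ_[p])⁻¹) := V_inv_nat fun h2 => by
      have := Nat.le_of_dvd (by omega) h2; omega
    have : bb ℚ_[p] (M+1) n - ph ℚ_[p] n / n.factorial =
       (bb ℚ_[p] M n - ph ℚ_[p] n / n.factorial) * ((((M+n+2:ℕ):ℚ_[p])⁻¹) * ((2*M+3:ℕ) * (2:ℚ_[p])⁻¹)) +
       (ph ℚ_[p] n / (n.factorial : ℚ_[p])) * ((((M+n+2:ℕ):ℚ_[p])⁻¹) * (-p * (2:ℚ_[p])⁻¹)) := by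
      rw [bb_M, hp1]
      have := fac_ne (K := ℚ_[p]) n
      have h : (M:ℚ_[p])+n+2 ≠ 0 := by exact_mod_cast (by omega : M+n+2 ≠ 0)
      push_cast
      field_simp
      ring
    rw [this]
    refine V.add ((ih (by omega)).mulR (hx.mulL ((V_nat _).mulL (V_half hp2)))) ?_
    exact h0.mulL (hx.mulL (V_p.neg.mulR (V_half hp2)))

theorem V_half_sum {n : ℕ} (hn : p = 2*n+1) (hp2 : p ≠ 2) (hp3 : p ≠ 3) :
    V p 1 (∑ M ∈ range n, vv ℚ_[p] M * (2*(M:ℚ_[p])+1)⁻¹) := by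
  have h3 : n % 3 ≠ 1 := fun h => hp3 (by
    have : 3 ∣ p := by omega
    exact ((Nat.prime_dvd_prime_iff_eq Nat.prime_three hp.out).1 this).symm)
  have h := half_sum (K := ℚ_[p]) n h3
  have : ∑ M ∈ range n, vv ℚ_[p] M * (2*(M:ℚ_[p])+1)⁻¹ =
     ∑ M ∈ range n, (-(((n+M).choose (2*M) : ℚ_[p]) * (-1)^M - vv ℚ_[p] M)) * (2*(M:ℚ_[p])+1)⁻¹ := by
    rw [← sub_eq_zero, ← sum_sub_distrib, ← h]
    refine sum_congr rfl fun k _ => ?_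
    ring
  rw [this]
  refine V_sum _ _ fun k hk => ?_
  rw [mem_range] at hk
  exact ((choose_vv hn hp2 hk.le).neg.mono (by omega)).mulR (V_inv_odd hn hk)

theorem A2_padic {n : ℕ} (hn : p = 2*n+1) (hp2 : p ≠ 2) (hp3 : p ≠ 3) :
    V p 3 (42 * Sm ℚ_[p] n 1 + 5 * Sm ℚ_[p] n 0 - 5 * p * (-1)^n) := by
  have h := A2_exact (K := ℚ_[p]) n
  rw [← p_eq hn] at h
  set B := ph ℚ_[p] n / (n.factorial : ℚ_[p]) with hB
  have key : V p 1 (∑ M ∈ range n, vv ℚ_[p] M * (((p:ℚ_[p])/(M+1/2)^2 + 3/(M+1/2)) * bb ℚ_[p] M n^2)) := by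
    have e : ∑ M ∈ range n, vv ℚ_[p] M * (((p:ℚ_[p])/(M+1/2)^2 + 3/(M+1/2)) * bb ℚ_[p] M n^2)
       = ∑ M ∈ range n, (p * (vv ℚ_[p] M * 4 * ((2*(M:ℚ_[p])+1)⁻¹)^2 * bb ℚ_[p] M n^2)
         + (bb ℚ_[p] M n - B) * (vv ℚ_[p] M * 6 * (2*(M:ℚ_[p])+1)⁻¹ * (bb ℚ_[p] M n + B)))
         + 6 * B^2 * ∑ M ∈ range n, vv ℚ_[p] M * (2*(M:ℚ_[p])+1)⁻¹ := by
      rw [mul_sum, ← sum_add_distrib]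
      refine sum_congr rfl fun k _ => ?_
      have := odd_ne (K := ℚ_[p]) k
      have e : (k:ℚ_[p])+1/2 = (2*k+1)/2 := by ring
      rw [e]
      field_simp
      ring
    rw [e]
    refine V.add (V_sum _ _ fun M hM => ?_) ?_
    · rw [mem_range] at hM
      obtain ⟨h1, h2⟩ := V_ph_div hn hp2 hM
      have h3 : V p 0 (bb ℚ_[p] M n) := by
        have := (h1.mono (by omega : 0 ≤ 1)).add h2
        simpa using this
      have hv := V_vv hp2 M
      have hi := V_inv_odd hn hM
      refine V.add (V_p.mulR ?_) (h1.mulR ?_)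
      · exact ((hv.mulL (V_ofNat 4)).mulL (hi.pow 2)).mulL (h3.pow 2)
      · exact ((hv.mulL (V_ofNat 6)).mulL hi).mulL (h3.add h2)
    · rcases Nat.eq_zero_or_pos n with h0 | h0
      · rw [h0]; simpa using V_zero 1
      obtain ⟨h1, h2⟩ := V_ph_div (M := 0) hn hp2 h0
      exact ((V_ofNat 6).mulL (h2.pow 2)).mulL (V_half_sum hn hp2 hp3)
  have hv := vv_n hn hp2
  have hv0 := V_vv hp2 n
  set v := vv ℚ_[p] n
  have hs : ((-1:ℚ_[p])^n)^2 = 1 := by rw [← pow_mul, mul_comm, pow_mul]; norm_num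
  have h1 : V p 0 ((-1:ℚ_[p])^n) := V_one.neg.pow n
  have e : 42 * Sm ℚ_[p] n 1 + 5 * Sm ℚ_[p] n 0 - 5 * p * (-1)^n
    = 5 * (p * ((v - (-1)^n) * (v^2 + v * (-1)^n + 1))) + 2 * (p^2 * ∑ M ∈ range n, vv ℚ_[p] M * (((p:ℚ_[p])/(M+1/2)^2 + 3/(M+1/2)) * bb ℚ_[p] M n^2)) := by
    linear_combination h + (5 * p * v) * hs
  rw [e]
  refine V.add ((V_ofNat 5).mulL (V_p.mul (r := 1) (s := 2) (hv.mulR ?_))) ((V_ofNat 2).mulL ((V_ppow 2).mul (r := 2) (s := 1) key))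
  exact ((hv0.pow 2).add (hv0.mulL h1)).add V_one
end A2p
end Z7
end

section
open Finset
set_option linter.unusedSectionVars false
set_option linter.unusedSimpArgs false
set_option linter.unusedVariables false
namespace Z7

section J
open Polynomial
variable {K : Type*} [Field K] [CharZero K]

noncomputable def th (f : K[X]) : K[X] := X * derivative f

theorem th_add (f g : K[X]) : th (f+g) = th f + th g := by simp [th, mul_add]
theorem th_mul (f g : K[X]) : th (f*g) = th f * g + f * th g := by simp [th]; ring
theorem th_mon (a : K) (m : ℕ) : th (C a * X^m) = C (a * m) * X^m := by
  simp only [th, derivative_C_mul_X_pow]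
  rcases m with _ | m
  · simp
  · simp only [Nat.add_sub_cancel, pow_succ]; ring

variable (K) in
noncomputable def WW (n : ℕ) : K[X] := ∑ k ∈ range (n+1), C ((cb k : K)^3) * X^k

noncomputable def LL (f : K[X]) : K[X] :=
  (1 - 64 * X) * th (th (th f)) - 96 * X * th (th f) - 48 * X * th f - 8 * X * f

noncomputable def JJ (f : K[X]) : K[X] :=
  (1 - 64 * X) * (2 * f * th (th f) - (th f)^2) - 64 * X * f * th f - 16 * X * f^2

theorem th_JJ (f : K[X]) : th (JJ f) = 2 * f * LL f := by
  have hX : th (X : K[X]) = X := by simp [th]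
  have h64 : th (1 - 64 * X : K[X]) = - 64 * X := by
    simp [th]; ring
  have hsub : ∀ f g : K[X], th (f-g) = th f - th g := by intro f g; simp [th, mul_sub]
  have h2 : th (2 : K[X]) = 0 := by simp [th]
  have h16 : th (16 : K[X]) = 0 := by simp [th]
  have h64' : th (64 : K[X]) = 0 := by simp [th]
  simp only [JJ, LL, pow_two, hsub, th_mul, hX, h2, h16, h64']
  have h1 : th (1 : K[X]) = 0 := by simp [th]
  rw [h1]
  ring

theorem LL_WW (n : ℕ) : LL (WW K n) = C (-8 * (2*n+1)^3 * (cb n : K)^3) * X^(n+1) := by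
  have hadd : ∀ f g : K[X], LL (f+g) = LL f + LL g := by
    intro f g; simp only [LL, th_add]; ring
  have hmon : ∀ (a : K) (m : ℕ), LL (C a * X^m) = C (a * m^3) * X^m - C (8 * a * (2*m+1)^3) * X^(m+1) := by
    intro a m
    simp only [LL, th_mon, pow_succ X]
    simp only [map_mul, map_pow, map_add, map_one, map_ofNat, map_natCast, pow_zero]
    ring
  induction n with
  | zero =>
    simp only [WW, zero_add, sum_range_one]
    rw [hmon]; simp
  | succ n ih =>
    have e : WW K (n+1) = WW K n + C ((cb (n+1) : K)^3) * X^(n+1) := by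
      simp only [WW]; rw [sum_range_succ]
    rw [e, hadd, ih, hmon, cb_succ']
    have h : (n:K)+1 ≠ 0 := Nat.cast_add_one_ne_zero n
    rw [add_sub, ← add_mul, ← map_add]
    push_cast
    have e1 : -8 * (2*(n:K)+1)^3 * (cb n : K)^3 + (2*(2*n+1)*(cb n:K)/(n+1))^3 * (n+1)^3 = 0 := by
      field_simp; ring
    rw [e1]
    simp only [map_zero, zero_mul, zero_sub, ← neg_mul, ← map_neg]
    congr 2; ring

theorem WW_coeff (n k : ℕ) : (WW K n).coeff k = if k ≤ n then (cb k : K)^3 else 0 := by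
  simp only [WW, finset_sum_coeff, coeff_C_mul, coeff_X_pow]
  simp [Nat.lt_succ_iff]

theorem JJ_coeff (n k : ℕ) : (k:K) * (JJ (WW K n)).coeff k =
    if n + 1 ≤ k ∧ k ≤ 2*n+1 then -16 * (2*n+1)^3 * (cb n : K)^3 * (cb (k-(n+1)) : K)^3 else 0 := by
  have h := congrArg (fun f => coeff f k) (th_JJ (WW K n))
  simp only [LL_WW] at h
  have h1 : (th (JJ (WW K n))).coeff k = (k:K) * (JJ (WW K n)).coeff k := by
    rcases k with _ | k
    · simp [th]
    · simp [th, coeff_X_mul, coeff_derivative, mul_comm]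
  rw [← h1, h, show 2 * WW K n * (C (-8 * (2*(n:K)+1)^3 * (cb n : K)^3) * X^(n+1))
    = C (-16 * (2*(n:K)+1)^3 * (cb n : K)^3) * (WW K n * X^(n+1)) by
      simp only [map_mul, map_pow, map_add, map_one, map_ofNat, map_natCast, map_neg]; ring]
  rw [coeff_C_mul, coeff_mul_X_pow', WW_coeff]
  by_cases h2 : n + 1 ≤ k
  · by_cases h3 : k ≤ 2*n+1
    · simp [h2, h3, show k - (n+1) ≤ n by omega]
    · simp [h2, h3]; intro h; omega
  · simp [h2]

theorem WW_eval (n j : ℕ) (z : K) : ((fun f => th f)^[j] (WW K n)).eval z = ∑ k ∈ range (n+1), (k:K)^j * (cb k : K)^3 * z^k := by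
  have : (fun f => th f)^[j] (WW K n) = ∑ k ∈ range (n+1), C ((k:K)^j * (cb k : K)^3) * X^k := by
    induction j with
    | zero => simp [WW]
    | succ j ih =>
      rw [Function.iterate_succ_apply', ih]
      have hs : ∀ s : Finset ℕ, ∀ f : ℕ → K[X], th (∑ k ∈ s, f k) = ∑ k ∈ s, th (f k) := by
        intro s f; simp [th, mul_sum]
      rw [hs]
      refine sum_congr rfl fun k _ => ?_
      rw [th_mon]; congr 2; ring
  rw [this]
  simp [eval_finset_sum]

end J

section Jp
open Polynomial
variable {p : ℕ} [hp : Fact p.Prime]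

theorem V_eval {r : ℕ} {f : ℚ_[p][X]} (h : ∀ k, V p r (f.coeff k)) {z : ℚ_[p]} (hz : V p 0 z) :
    V p r (f.eval z) := by
  rw [eval_eq_sum_range]
  exact V_sum _ _ fun k _ => (h k).mulR (hz.pow k)

theorem V_fermat {a : ℕ} (h : ¬ p ∣ a) : V p 1 ((a:ℚ_[p])^(p-1) - 1) := by
  have h1 : 1 ≤ a^(p-1) := Nat.one_le_pow _ _ (Nat.pos_of_ne_zero (by rintro rfl; simp at h))
  have := Nat.ModEq.pow_totient ((Nat.Prime.coprime_iff_not_dvd hp.out).2 h).symm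
  rw [Nat.totient_prime hp.out] at this
  have h2 := (Nat.modEq_iff_dvd' h1).1 this.symm
  have := V_nat_iff (p := p).2 (by simpa using h2 : p^1 ∣ a^(p-1)-1)
  rw [Nat.cast_sub h1] at this
  exact_mod_cast this

theorem V_cb_sq {n : ℕ} (hn : p = 2*n+1) (hp2 : p ≠ 2) : V p 1 ((cb n : ℚ_[p])^2 - 1) := by
  have h1 := (vv_n hn hp2).mono (by omega : 1 ≤ 2)
  have h2 := V_fermat (not_dvd_two_pow (p := p) hp2 4)
  rw [show p-1 = n*2 by omega, pow_mul] at h2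
  have hs : ((-1:ℚ_[p])^n)^2 = 1 := by rw [← pow_mul, mul_comm, pow_mul]; norm_num
  have e : (cb n : ℚ_[p]) = vv ℚ_[p] n * 16^n := by rw [vv]; field_simp
  have : (cb n : ℚ_[p])^2 - 1 = (vv ℚ_[p] n - (-1)^n) * ((vv ℚ_[p] n + (-1)^n) * (16^n)^2) +
     (((2^4 : ℕ) : ℚ_[p])^n)^2 - 1 := by
    rw [e]; push_cast; norm_num
    linear_combination ((16^n)^2) * hs
  rw [this, add_sub_assoc]
  refine (h1.mulR ?_).add h2
  exact ((V_vv hp2 n).add (V_one.neg.pow n)).mulL (((V_ofNat 16).pow n).pow 2)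

theorem Sm_eq (n j : ℕ) : Sm ℚ_[p] n j = ∑ k ∈ range (n+1), (k:ℚ_[p])^j * (cb k : ℚ_[p])^3 * ((4096:ℚ_[p])⁻¹)^k := by
  simp only [Sm]
  refine sum_congr rfl fun k _ => ?_
  rw [div_eq_mul_inv, inv_pow]

theorem J_padic {n : ℕ} (hn : p = 2*n+1) (hp2 : p ≠ 2) :
    V p 3 (252 * (2 * Sm ℚ_[p] n 0 * Sm ℚ_[p] n 2 - Sm ℚ_[p] n 1^2) - 4 * Sm ℚ_[p] n 0 * Sm ℚ_[p] n 1
      - Sm ℚ_[p] n 0^2 + p^2) := by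
  have hpz : (p:ℚ_[p]) ≠ 0 := by exact_mod_cast hp.out.ne_zero
  set z : ℚ_[p] := (4096:ℚ_[p])⁻¹ with hz
  have hz0 : V p 0 z := by
    have := V_inv_nat (not_dvd_two_pow (p := p) hp2 12)
    rw [hz]; push_cast at this; norm_num at this ⊢; exact this
  have h0 : (WW ℚ_[p] n).eval z = Sm ℚ_[p] n 0 := by rw [Sm_eq, ← WW_eval]; rfl
  have h1 : (th (WW ℚ_[p] n)).eval z = Sm ℚ_[p] n 1 := by rw [Sm_eq, ← WW_eval]; rfl
  have h2 : (th (th (WW ℚ_[p] n))).eval z = Sm ℚ_[p] n 2 := by rw [Sm_eq, ← WW_eval]; rfl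
  have hJ : (JJ (WW ℚ_[p] n)).eval z = (63/64) * (2 * Sm ℚ_[p] n 0 * Sm ℚ_[p] n 2 - Sm ℚ_[p] n 1^2)
     - (1/64) * Sm ℚ_[p] n 0 * Sm ℚ_[p] n 1 - (1/256) * Sm ℚ_[p] n 0^2 := by
    simp only [JJ, eval_sub, eval_mul, eval_pow, eval_one, eval_ofNat, eval_X, h0, h1, h2]
    rw [hz]; ring
  have hc : ∀ k, V p 3 ((JJ (WW ℚ_[p] n) + C (16 * (p:ℚ_[p])^2 * (cb n : ℚ_[p])^6) * X^p).coeff k) := by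
    intro k
    have hk := JJ_coeff (K := ℚ_[p]) n k
    rw [← p_eq hn] at hk
    rw [coeff_add, coeff_C_mul, coeff_X_pow]
    rcases Nat.eq_zero_or_pos k with rfl | hk0
    · have : (JJ (WW ℚ_[p] n)).coeff 0 = 0 := by
        simp [JJ, th, mul_coeff_zero, pow_two]
      rw [this, if_neg hp.out.ne_zero.symm]; simpa using V_zero 3
    by_cases hkp : k = p
    · subst hkp
      rw [if_pos ⟨by omega, by omega⟩, show k - (n+1) = n by omega] at hk
      have : (JJ (WW ℚ_[k] n)).coeff k = -16 * (k:ℚ_[k])^2 * (cb n : ℚ_[k])^6 := by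
        apply mul_left_cancel₀ hpz; rw [hk]; ring
      rw [this]
      simpa using V_zero 3
    · rw [if_neg hkp, mul_zero, add_zero]
      split_ifs at hk with h3
      · have hlt : k < p := by omega
        have hkd : ¬ p ∣ k := fun h => by have := Nat.le_of_dvd hk0 h; omega
        refine V.cancel_nat ?_ hkd
        rw [hk]
        have : V p 3 ((p:ℚ_[p])^3 * (-16 * (cb n : ℚ_[p])^3 * (cb (k-(n+1)) : ℚ_[p])^3)) :=
          (V_ppow 3).mulR (((V_ofNat 16).neg.mulL ((V_nat _).pow 3)).mulL ((V_nat _).pow 3))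
        convert this using 1; ring
      · have : (k:ℚ_[p]) ≠ 0 := by exact_mod_cast hk0.ne'
        rw [(mul_eq_zero.1 hk).resolve_left this]; exact V_zero 3
  have hV := V_eval hc hz0
  simp only [eval_add, eval_mul, eval_C, eval_pow, eval_X, hJ] at hV
  have hzp : V p 1 (z^p - z) := by
    have h3 := V_fermat (not_dvd_two_pow (p := p) hp2 12)
    have : z^p - z = (-(z * z^(p-1))) * ((((2^12:ℕ):ℚ_[p]))^(p-1) - 1) := by
      have e : z^p = z * z^(p-1) := by
        rw [← pow_succ', Nat.sub_add_cancel hp.out.one_le]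
      have e2 : z^(p-1) * (((2^12:ℕ):ℚ_[p]))^(p-1) = 1 := by
        rw [← mul_pow, hz]; norm_num
      rw [e]; linear_combination z * e2
    rw [this]
    exact (hz0.mulL (hz0.pow _)).neg.mulL h3
  have hcb := V_cb_sq hn hp2
  have h6 : V p 1 ((cb n : ℚ_[p])^6 - 1) := by
    have : (cb n : ℚ_[p])^6 - 1 = ((cb n : ℚ_[p])^2 - 1) * ((cb n : ℚ_[p])^4 + (cb n : ℚ_[p])^2 + 1) := by ring
    rw [this]
    exact hcb.mulR ((((V_nat _).pow 4).add ((V_nat _).pow 2)).add V_one)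
  have e : 252 * (2 * Sm ℚ_[p] n 0 * Sm ℚ_[p] n 2 - Sm ℚ_[p] n 1^2) - 4 * Sm ℚ_[p] n 0 * Sm ℚ_[p] n 1
      - Sm ℚ_[p] n 0^2 + p^2 = 256 * (63 / 64 * (2 * Sm ℚ_[p] n 0 * Sm ℚ_[p] n 2 - Sm ℚ_[p] n 1 ^ 2) - 1 / 64 * Sm ℚ_[p] n 0 * Sm ℚ_[p] n 1 -
        1 / 256 * Sm ℚ_[p] n 0 ^ 2 +
      16 * (p:ℚ_[p]) ^ 2 * (cb n : ℚ_[p]) ^ 6 * z ^ p) - (p:ℚ_[p])^2 * (4096 * ((z^p - z) * (cb n : ℚ_[p])^6) + ((cb n : ℚ_[p])^6 - 1)) := by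
    have : 4096 * z = 1 := by rw [hz]; norm_num
    linear_combination  -(p:ℚ_[p])^2 * (cb n : ℚ_[p])^6 * this
  rw [e]
  refine ((V_ofNat 256).mulL hV).sub ((V_ppow 2).mul (r := 2) (s := 1) (V.add ?_ h6))
  exact (V_ofNat 4096).mulL (hzp.mulR ((V_nat _).pow 6))
end Jp
end Z7
end

section
open Finset
set_option linter.unusedSectionVars false
set_option linter.unusedSimpArgs false
set_option linter.unusedVariables false
namespace Z7

/-- `α_{j,k} = C(2k,k)^2 C(j+k,2k)` -/
def al (j k : ℕ) : ℕ := cb k ^2 * (j+k).choose (2*k)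

theorem choose_down (N m : ℕ) : ((N.choose (m+1) : ℕ) : ℤ) * (m+1) = N.choose m * (N - m) := by
  rcases le_or_gt m N with h | h
  · have := Nat.choose_succ_right_eq N m
    have h2 : ((N - m : ℕ) : ℤ) = N - m := by push_cast [h]; ring
    rw [← h2]; exact_mod_cast this
  · rw [Nat.choose_eq_zero_of_lt h, Nat.choose_eq_zero_of_lt (by omega : N < m+1)]; simp

theorem cc1 (N m : ℕ) : (((N+2).choose (m+2) : ℕ) : ℤ) * ((m+1) * (m+2)) = N.choose m * ((N+1)*(N+2)) := by
  have h1 := Nat.add_one_mul_choose_eq (N+1) (m+1)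
  have h2 := Nat.add_one_mul_choose_eq N m
  zify at h1 h2
  push_cast at h1 h2
  linear_combination -(m+1:ℤ) * h1 - (N+2) * h2

theorem cc2 (N m : ℕ) : (((N+1).choose (m+2) : ℕ) : ℤ) * ((m+1) * (m+2)) = N.choose m * ((N+1)*(N-m)) := by
  have h1 := Nat.add_one_mul_choose_eq N (m+1)
  have h2 := choose_down N m
  zify at h1
  push_cast at h1 h2
  linear_combination -(m+1:ℤ) * h1 + (N+1) * h2

theorem cc3 (N m : ℕ) : ((N.choose (m+2) : ℕ) : ℤ) * ((m+1) * (m+2)) = N.choose m * ((N-m)*(N-m-1)) := by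
  have h1 := choose_down N (m+1)
  have h2 := choose_down N m
  push_cast at h1 h2
  linear_combination (m+1:ℤ) * h1 + (N-m-1) * h2

theorem cbz (k : ℕ) : ((k:ℤ)+1) * cb (k+1) = 2*(2*k+1) * cb k := by
  have := Nat.succ_mul_centralBinom_succ k
  exact_mod_cast this

theorem al_a (j k : ℕ) : ((k:ℤ)+1)^3 * al (j+1) (k+1) = al j k * (2*(2*k+1)*(j+k+1)*(j+k+2)) := by
  have h1 := cc1 (j+k) (2*k)
  have h2 := cbz k
  simp only [al]
  rw [show j+1+(k+1) = j+k+2 by ring, show 2*(k+1) = 2*k+2 by ring]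
  push_cast at h1 ⊢
  have h3 : (2*(k:ℤ)+1) ≠ 0 := by positivity
  apply mul_left_cancel₀ h3
  have e : ((k:ℤ)+1)^2 * (cb (k+1))^2 = 4*(2*k+1)^2 * (cb k)^2 := by
    linear_combination (((k:ℤ)+1) * cb (k+1) + 2*(2*k+1) * cb k) * h2
  linear_combination ((2*(k:ℤ)+1)*(k+1)* ((j+k+2).choose (2*k+2):ℤ)) * e + 2*(2*k+1)^2 * (cb k:ℤ)^2 * h1

theorem al_b (j k : ℕ) : ((k:ℤ)+1)^3 * al j (k+1) = al j k * (2*(2*k+1)*(j+k+1)*(j-k)) := by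
  have h1 := cc2 (j+k) (2*k)
  have h2 := cbz k
  simp only [al]
  rw [show j+(k+1) = j+k+1 by ring, show 2*(k+1) = 2*k+2 by ring]
  push_cast at h1 ⊢
  have h3 : (2*(k:ℤ)+1) ≠ 0 := by positivity
  apply mul_left_cancel₀ h3
  have e : ((k:ℤ)+1)^2 * (cb (k+1))^2 = 4*(2*k+1)^2 * (cb k)^2 := by
    linear_combination (((k:ℤ)+1) * cb (k+1) + 2*(2*k+1) * cb k) * h2
  linear_combination ((2*(k:ℤ)+1)*(k+1)* ((j+k+1).choose (2*k+2):ℤ)) * e + 2*(2*k+1)^2 * (cb k:ℤ)^2 * h1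

theorem al_c (j k : ℕ) : ((k:ℤ)+1)^3 * al j (k+1) = al (j+1) k * (2*(2*k+1)*(j+1-k)*(j-k)) := by
  have h1 := cc3 (j+1+k) (2*k)
  have h2 := cbz k
  simp only [al]
  rw [show j+(k+1) = j+1+k by ring, show 2*(k+1) = 2*k+2 by ring]
  push_cast at h1 ⊢
  have h3 : (2*(k:ℤ)+1) ≠ 0 := by positivity
  apply mul_left_cancel₀ h3
  have e : ((k:ℤ)+1)^2 * (cb (k+1))^2 = 4*(2*k+1)^2 * (cb k)^2 := by
    linear_combination (((k:ℤ)+1) * cb (k+1) + 2*(2*k+1) * cb k) * h2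
  linear_combination ((2*(k:ℤ)+1)*(k+1)* ((j+1+k).choose (2*k+2):ℤ)) * e + 2*(2*k+1)^2 * (cb k:ℤ)^2 * h1

theorem al_zero (j : ℕ) : al j 0 = 1 := by simp [al, cb]
theorem al_gt {j k : ℕ} (h : j < k) : al j k = 0 := by
  simp [al, Nat.choose_eq_zero_of_lt (by omega : j+k < 2*k)]

theorem al_down (j k : ℕ) : (al (j+1) k : ℤ) * (j+1-k) = al j k * (j+1+k) := by
  have h := choose_down (j+k) (2*k)
  have h1 := Nat.add_one_mul_choose_eq (j+k) (2*k)
  have h2 := choose_down (j+k+1) (2*k)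
  simp only [al]
  rw [show j+1+k = j+k+1 by ring]
  zify at h1
  push_cast at *
  linear_combination (-(cb k:ℤ)^2) * h1 - (cb k:ℤ)^2 * h2

/-- three term identity -/
theorem al_rec (i k : ℕ) : ((i:ℤ)+2)^2 * al (i+2) (k+1) = (2*i+3)*(2*k+3) * al (i+1) (k+1)
    + 4*(2*i+3)*(2*k+1) * al (i+1) k + (i+1)^2 * al i (k+1) := by
  have h3 : ((k:ℤ)+1)^3 ≠ 0 := by positivity
  apply mul_left_cancel₀ h3
  have a := al_a (i+1) k
  have b := al_b (i+1) k
  have c := al_c i k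
  push_cast at *
  linear_combination ((i:ℤ)+2)^2 * a - (2*i+3)*(2*k+3) * b - (i+1)^2 * c

section
variable {R : Type*} [CommRing R] [IsDomain R] [CharZero R]

theorem clausen_aux {b d e : R} {Q : ℕ → R} (h0 : Q 0 = 1) (h1 : Q 1 = b)
    (hr : ∀ j : ℕ, ((j:R)+2) * Q (j+2) = (2*j+3) * b * Q (j+1) - (j+1) * d * Q j) (he : b^2 - d = 4*e) (j : ℕ) :
    (Q j^2 = ∑ k ∈ range (j+1), (al j k : R) * e^k * d^(j-k)) ∧
    (((j:R)+1) * Q (j+1) * Q j = b * ∑ k ∈ range (j+1), ((j:R)+1+k) * (al j k : R) * e^k * d^(j-k)) ∧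
    (Q (j+1)^2 = ∑ k ∈ range (j+2), (al (j+1) k : R) * e^k * d^(j+1-k)) := by
  induction j with
  | zero =>
    refine ⟨by simp [h0, al_zero], by simp [h0, h1, al_zero], ?_⟩
    simp [h1, sum_range_succ, al_zero]
    have : al 1 1 = 4 := by decide
    rw [this]; push_cast; linear_combination he
  | succ j ih =>
    obtain ⟨i1, i2, i3⟩ := ih
    have key : ((j:R)+1) * Q (j+1) * Q j * d = b * ∑ k ∈ range (j+2), ((j:R)+1-k) * (al (j+1) k : R) * e^k * d^(j+1-k) := by
      rw [i2, sum_range_succ _ (j+1)]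
      have : ((j:R)+1-((j+1:ℕ):R)) = 0 := by push_cast; ring
      rw [this]
      simp only [zero_mul, add_zero]
      rw [mul_assoc, sum_mul]
      congr 1
      refine sum_congr rfl fun k hk => ?_
      have hk' : k ≤ j := by simpa [Nat.lt_succ_iff] using hk
      have h := congrArg (Int.cast : ℤ → R) (al_down j k)
      push_cast at h
      rw [show j+1-k = (j-k)+1 by omega, pow_succ]
      linear_combination (-(e^k * (d^(j-k)*d))) * h
    have m : (((j+1:ℕ):R)+1) * Q (j+1+1) * Q (j+1) = b * ∑ k ∈ range (j+1+1), (((j+1:ℕ):R)+1+k) * (al (j+1) k : R) * e^k * d^(j+1-k) := by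
      have : (((j+1:ℕ):R)+1) * Q (j+1+1) * Q (j+1) = (2*j+3)*b*Q (j+1)^2 - ((j:R)+1) * Q (j+1) * Q j * d := by
        have := hr j
        push_cast
        linear_combination Q (j+1) * this
      rw [this, key, i3, mul_sum, mul_sum, mul_sum, ← sum_sub_distrib]
      refine sum_congr rfl fun k hk => ?_
      push_cast; ring
    refine ⟨i3, m, ?_⟩
    have hne : ((j:R)+2)^2 ≠ 0 := by
      apply pow_ne_zero; exact_mod_cast (by omega : j+2 ≠ 0)
    apply mul_left_cancel₀ hne
    have sq : ((j:R)+2)^2 * Q (j+1+1)^2 = (2*j+3)^2*b^2*Q (j+1)^2 - 2 * (2*j+3) * b * (((j:R)+1) * Q (j+1) * Q j * d)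
        + (j+1)^2*d^2 * Q j^2 := by
      have := hr j
      linear_combination (((j:R)+2) * Q (j+2) + ((2*j+3) * b * Q (j+1) - (j+1) * d * Q j)) * this
    rw [sq, key, i3, i1]
    have hb : b^2 = d + 4*e := by linear_combination he
    set X1 := ∑ k ∈ range (j+2), (al (j+1) k : R) * e^k * d^(j+1-k) with hX1
    set X2 := ∑ k ∈ range (j+2), ((j:R)+1-k) * (al (j+1) k : R) * e^k * d^(j+1-k) with hX2
    have e1 : (2*(j:R)+3)^2*b^2*X1 - 2*(2*j+3)*b*(b*X2) = (d+4*e) * ∑ k ∈ range (j+2), (2*(j:R)+3)*(2*k+1) * (al (j+1) k : R) * e^k * d^(j+1-k) := by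
      rw [← hb, hX1, hX2]; simp only [mul_sum]; rw [← sum_sub_distrib]
      refine sum_congr rfl fun k hk => ?_
      ring
    rw [e1]
    have e2 : d * ∑ k ∈ range (j+2), (2*(j:R)+3)*(2*k+1) * (al (j+1) k : R) * e^k * d^(j+1-k)
        = ∑ k ∈ range (j+3), (2*(j:R)+3)*(2*k+1) * (al (j+1) k : R) * e^k * d^(j+2-k) := by
      rw [sum_range_succ _ (j+2), al_gt (by omega : j+1 < j+2), mul_sum]
      simp only [Nat.cast_zero, mul_zero, zero_mul, add_zero]
      refine sum_congr rfl fun k hk => ?_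
      have hk' : k ≤ j+1 := by simp at hk; omega
      rw [show j+2-k = (j+1-k)+1 by omega]; ring
    have e3 : ((j:R)+1)^2*d^2*∑ k ∈ range (j+1), (al j k : R) * e^k * d^(j-k)
        = ∑ k ∈ range (j+3), ((j:R)+1)^2*(al j k : R) * e^k * d^(j+2-k) := by
      rw [sum_range_succ _ (j+2), sum_range_succ _ (j+1), al_gt (by omega : j < j+2), al_gt (by omega : j < j+1), mul_sum]
      simp only [Nat.cast_zero, mul_zero, zero_mul, add_zero]
      refine sum_congr rfl fun k hk => ?_
      have hk' : k ≤ j := by simp at hk; omega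
      rw [show j+2-k = (j-k)+2 by omega]; ring
    rw [add_mul, e2, e3]
    rw [show j+1+1+1 = j+2+1 from rfl, show j + 3 = j+2+1 from rfl, sum_range_succ' _ (j+2), sum_range_succ' _ (j+2), sum_range_succ' _ (j+2)]
    simp only [al_zero]
    rw [mul_add (((j:R)+2)^2), mul_sum, mul_sum]
    have e4 : ∑ k ∈ range (j+2), ((j:R)+2)^2 * ((al (j+1+1) (k+1) : R) * e^(k+1) * d^(j+1+1-(k+1)))
       = ∑ k ∈ range (j+2), (2*(j:R)+3)*(2*((k+1:ℕ):R)+1) * (al (j+1) (k+1) : R) * e^(k+1) * d^(j+2-(k+1))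
       + ∑ k ∈ range (j+2), 4*e*((2*(j:R)+3)*(2*k+1) * (al (j+1) k : R) * e^k * d^(j+1-k))
       + ∑ k ∈ range (j+2), ((j:R)+1)^2*(al j (k+1) : R) * e^(k+1) * d^(j+2-(k+1)) := by
      rw [← sum_add_distrib, ← sum_add_distrib]
      refine sum_congr rfl fun k hk => ?_
      have hk' : k ≤ j+1 := by simp at hk; omega
      have h := congrArg (Int.cast : ℤ → R) (al_rec j k)
      rw [show j+1+1-(k+1) = j+1-k by omega]
      push_cast at h ⊢
      linear_combination (e^(k+1) * d^(j+1-k)) * h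
    rw [e4]
    push_cast
    simp only [pow_zero, Nat.sub_zero]
    ring

theorem clausen {b d e : R} {Q : ℕ → R} (h0 : Q 0 = 1) (h1 : Q 1 = b)
    (hr : ∀ j : ℕ, ((j:R)+2) * Q (j+2) = (2*j+3) * b * Q (j+1) - (j+1) * d * Q j) (he : b^2 - d = 4*e) (j : ℕ) :
    (Q j^2 = ∑ k ∈ range (j+1), (al j k : R) * e^k * d^(j-k)) :=
  (clausen_aux h0 h1 hr he j).1
end
end Z7
end

section
open Finset
set_option linter.unusedSectionVars false
set_option linter.unusedSimpArgs false
set_option linter.unusedVariables false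
namespace Z7
section
open Polynomial

/-- The Wronskian-type expression. -/
noncomputable def Wr {F : Type*} [CommRing F] (A D : F[X]) : F[X] :=
  A*D + 2*X*(derivative A * D - A * derivative D)

noncomputable def YY (F : Type*) [CommRing F] : F[X] := 1 - 42*X + 448*X^2

theorem Wr_mul {F : Type*} [CommRing F] (g A D : F[X]) : Wr (g*A) (g*D) = g^2 * Wr A D := by
  simp only [Wr, derivative_mul]; ring

variable {F : Type*} [Field F]

theorem YY_coeff0 : (YY F).coeff 0 = 1 := by simp [YY, mul_coeff_zero]
theorem YY_ne : YY F ≠ 0 := fun h => by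
  have := YY_coeff0 (F := F); rw [h] at this; simp at this

theorem YY_natDegree (h2 : (2:F) ≠ 0) (h7 : (7:F) ≠ 0) : (YY F).natDegree = 2 := by
  have h448 : (448:F) ≠ 0 := by
    rw [show (448:F) = 2^6*7 by norm_num]; exact mul_ne_zero (pow_ne_zero _ h2) h7
  have : YY F = C 448 * X^2 + C (-42) * X + C 1 := by
    simp only [YY, map_ofNat, map_neg, map_one]; ring
  rw [this]; exact natDegree_quadratic h448

theorem YY_sqf (h2 : (2:F) ≠ 0) (h7 : (7:F) ≠ 0) : Squarefree (YY F) := by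
  apply Separable.squarefree
  have h28 : (28:F) ≠ 0 := by
    rw [show (28:F) = 2^2*7 by norm_num]; exact mul_ne_zero (pow_ne_zero _ h2) h7
  refine ⟨C (28⁻¹) * 1792, C (28⁻¹) * (42 - 896*X), ?_⟩
  have hc : (C (28⁻¹:F)) * 28 = 1 := by
    rw [show (28:F[X]) = C 28 from (map_ofNat C 28).symm, ← C_mul, inv_mul_cancel₀ h28, C_1]
  have hd : derivative (YY F) = -42 + 896 * X := by
    simp [YY]; ring
  rw [hd, YY]
  linear_combination hc

theorem YY_no_sq (h2 : (2:F) ≠ 0) (h7 : (7:F) ≠ 0) (N : ℕ) : ∀ (Z V : F[X]) (κ : F), κ ≠ 0 → V.natDegree ≤ N →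
    YY F * Z^2 = C κ * V^2 → V = 0 := by
  induction N using Nat.strong_induction_on with
  | _ N ih =>
  intro Z V κ hκ hV h
  by_contra hV0
  have hu : IsUnit (C κ) := isUnit_C.2 hκ.isUnit
  have hs := YY_sqf h2 h7
  have d1 : YY F ∣ V := by
    rw [← hs.dvd_pow_iff_dvd (n := 2) (by norm_num), ← hu.dvd_mul_left]
    exact ⟨_, h.symm⟩
  obtain ⟨V1, rfl⟩ := d1
  have h' : Z^2 = C κ * (YY F * V1^2) := by
    apply mul_left_cancel₀ (YY_ne (F := F)); rw [h]; ring
  have d2 : YY F ∣ Z := by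
    rw [← hs.dvd_pow_iff_dvd (n := 2) (by norm_num)]
    exact ⟨C κ * V1^2, by rw [h']; ring⟩
  obtain ⟨Z1, rfl⟩ := d2
  have h'' : YY F * Z1^2 = C κ * V1^2 := by
    apply mul_left_cancel₀ (YY_ne (F := F)); linear_combination h'
  have hV1 : V1 ≠ 0 := right_ne_zero_of_mul hV0
  have hd : (YY F * V1).natDegree = 2 + V1.natDegree := by
    rw [natDegree_mul YY_ne hV1, YY_natDegree h2 h7]
  exact hV1 (ih V1.natDegree (by omega) Z1 V1 κ hκ le_rfl h'')

theorem mono_of_dvd {p n : ℕ} [CharP F p] (hnp : n < p) {d : F[X]} (hd : d ≠ 0) (hdeg : d.natDegree ≤ n)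
    (h : d ∣ X * derivative d) : ∃ c : F, c ≠ 0 ∧ ∃ j ≤ n, d = C c * X^j := by
  obtain ⟨k, hk⟩ := h
  have hk0 : k.natDegree = 0 := by
    by_cases hk0 : k = 0
    · simp [hk0]
    have h1 : (X * derivative d).natDegree ≤ d.natDegree := by
      by_cases h0 : d.natDegree = 0
      · rw [eq_C_of_natDegree_eq_zero h0]; simp
      · refine (natDegree_mul_le).trans ?_
        have := natDegree_derivative_lt h0
        have h3 : (X : F[X]).natDegree ≤ 1 := natDegree_X_le
        omega
    rw [hk, natDegree_mul hd hk0] at h1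
    omega
  rw [eq_C_of_natDegree_eq_zero hk0] at hk
  set κ := k.coeff 0
  have hc : ∀ i : ℕ, (i:F) * d.coeff i = κ * d.coeff i := by
    intro i
    have := congrArg (fun f => coeff f i) hk
    rw [mul_comm d, coeff_C_mul] at this
    rw [← this]
    rcases i with _ | i
    · simp
    · simp [coeff_X_mul, coeff_derivative, mul_comm]
  have hl : d.coeff d.natDegree ≠ 0 := by simpa using hd
  refine ⟨_, hl, d.natDegree, hdeg, ?_⟩
  have hκ : κ = (d.natDegree : F) := (mul_right_cancel₀ hl (hc _)).symm
  ext i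
  rw [coeff_C_mul, coeff_X_pow]
  by_cases hi : i = d.natDegree
  · simp [hi]
  · rw [if_neg hi, mul_zero]
    by_contra hne
    have := mul_right_cancel₀ hne (hc i)
    rw [hκ, CharP.cast_eq_iff_mod_eq F p] at this
    have hi2 : i ≤ d.natDegree := le_natDegree_of_ne_zero hne
    rw [Nat.mod_eq_of_lt (by omega), Nat.mod_eq_of_lt (by omega)] at this
    exact hi this

theorem Wr_zero {p n : ℕ} [hp : Fact p.Prime] [CharP F p] (hn : p = 2*n+1) {A D : F[X]} (hA : A ≠ 0) (hD : D ≠ 0)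
    (hdA : A.natDegree ≤ n) (hdD : D.natDegree ≤ n) (h : Wr A D = 0) :
    ∃ a d : F, a ≠ 0 ∧ d ≠ 0 ∧ A = C a * X^n ∧ D = C d := by
  obtain ⟨a, d, c, hrp, rfl, rfl⟩ := UniqueFactorizationMonoid.exists_reduced_factors A hA D
  rw [Wr_mul] at h
  have hc0 : c ≠ 0 := left_ne_zero_of_mul hA
  have ha0 : a ≠ 0 := right_ne_zero_of_mul hA
  have hd0 : d ≠ 0 := right_ne_zero_of_mul hD
  rw [natDegree_mul hc0 ha0] at hdA
  rw [natDegree_mul hc0 hd0] at hdD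
  have h' : Wr a d = 0 := by
    rcases mul_eq_zero.1 h with h | h
    · exact absurd h (pow_ne_zero _ hc0)
    · exact h
  have h2 : (2:F) ≠ 0 := by
    have : ((2:ℕ):F) ≠ 0 := by
      rw [Ne, CharP.cast_eq_zero_iff F p]
      intro h; have := Nat.le_of_dvd (by norm_num) h; have := hp.out.two_le; omega
    exact_mod_cast this
  have hu2 : IsUnit (C (2:F)) := isUnit_C.2 h2.isUnit
  simp only [Wr] at h'
  have dd : d ∣ X * derivative d := by
    apply hrp.symm.dvd_of_dvd_mul_left
    rw [← hu2.dvd_mul_left]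
    refine ⟨a + 2 * X * derivative a, ?_⟩
    simp only [map_ofNat]; linear_combination - h'
  have da : a ∣ X * derivative a := by
    apply hrp.dvd_of_dvd_mul_left
    rw [← hu2.dvd_mul_left]
    refine ⟨-d + 2 * X * derivative d, ?_⟩
    simp only [map_ofNat]; linear_combination h'
  obtain ⟨c1, hc1, j, hj, rfl⟩ := mono_of_dvd (p := p) (n := n) (by omega) hd0 (by omega) dd
  obtain ⟨c2, hc2, i, hi, rfl⟩ := mono_of_dvd (p := p) (n := n) (by omega) ha0 (by omega) da
  have hX : ∀ (c : F) (j : ℕ), X * derivative (C c * X^j) = C (j:F) * (C c * X^j) := by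
    intro c j
    rcases j with _ | j
    · simp
    · rw [derivative_C_mul_X_pow]; simp only [Nat.add_sub_cancel, pow_succ, C_mul]; ring
  have e : C (1 + 2 * ((i:F) - j)) * ((C c2 * X^i) * (C c1 * X^j)) = 0 := by
    rw [← h']
    have h1 := hX c2 i
    have h3 := hX c1 j
    simp only [map_add, map_mul, map_sub, map_one, map_ofNat] at *
    linear_combination (-2 * (C c1 * X^j)) * h1 + (2 * (C c2 * X^i)) * h3
  have e1 : 1 + 2 * ((i:F) - j) = 0 := by
    rcases mul_eq_zero.1 e with h | h
    · rwa [C_eq_zero] at h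
    · exact absurd h (mul_ne_zero ha0 hd0)
  have e2 : (p:ℤ) ∣ 1 + 2 * ((i:ℤ) - j) := by
    rw [← CharP.intCast_eq_zero_iff F p]; push_cast; exact e1
  have hij : i = n ∧ j = 0 := by
    obtain ⟨t, ht⟩ := e2
    have hp5 : (p:ℤ) = 2*n+1 := by exact_mod_cast hn
    rw [hp5] at ht
    have t1 : t < 2 := by
      by_contra hh; push Not at hh
      nlinarith
    have t2 : -2 < t := by
      by_contra hh; push Not at hh
      nlinarith
    have : t = -1 ∨ t = 0 ∨ t = 1 := by omega
    rcases this with rfl | rfl | rfl <;> omega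
  obtain ⟨rfl, rfl⟩ := hij
  have hcc : c.natDegree = 0 := by
    rw [natDegree_C_mul_X_pow _ _ hc2] at hdA; omega
  rw [eq_C_of_natDegree_eq_zero hcc]
  have hc00 : c.coeff 0 ≠ 0 := by
    intro h0; apply hc0; rw [eq_C_of_natDegree_eq_zero hcc, h0, C_0]
  refine ⟨c.coeff 0 * c2, c.coeff 0 * c1, mul_ne_zero hc00 hc2, mul_ne_zero hc00 hc1, ?_, ?_⟩
  · rw [C_mul]; ring
  · rw [C_mul]; ring

/-- step D2 -/
theorem abar_sq {p : ℕ} [hp : Fact p.Prime] (hp2 : p ≠ 2) (hp3 : p ≠ 3) (hp7 : p ≠ 7) {a2 : ZMod p} (ha : a2 ≠ 0) {Z : (ZMod p)[X]}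
    (h : YY (ZMod p) * Z^2 = 1 - 42 * C a2 * X^p + 448 * C (a2^2) * X^(2*p)) : a2 = 1 := by
  have nz : ∀ q : ℕ, q.Prime → p ≠ q → ((q:ℕ):ZMod p) ≠ 0 := by
    intro q hq hne h0
    rw [ZMod.natCast_eq_zero_iff] at h0
    exact hne ((Nat.prime_dvd_prime_iff_eq hp.out hq).1 h0)
  have h2 : (2:ZMod p) ≠ 0 := by exact_mod_cast nz 2 Nat.prime_two hp2
  have h3 : (3:ZMod p) ≠ 0 := by exact_mod_cast nz 3 Nat.prime_three hp3
  have h7 : (7:ZMod p) ≠ 0 := by exact_mod_cast nz 7 (by norm_num) hp7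
  by_contra hne
  have hY : YY (ZMod p)^p = 1 - 42 * X^p + 448 * X^(2*p) := by
    rw [← ZMod.expand_card]; simp only [YY, map_add, map_sub, map_one, map_mul, map_pow, map_ofNat, expand_X]; ring
  have hL : (C (a2+1) - C (42*a2) * X)^p = C (a2+1) - C (42*a2) * X^p := by
    rw [← ZMod.expand_card]; simp
  have hdv : YY (ZMod p) ∣ C (a2-1) * (C (a2+1) - C (42*a2) * X)^p := by
    rw [hL]
    have e : C (a2-1) * (C (a2+1) - C (42*a2) * X^p) = C (a2^2) * YY (ZMod p)^p - YY (ZMod p) * Z^2 := by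
      rw [hY, h]; simp only [map_sub, map_add, map_mul, map_pow, map_one, map_ofNat]; ring
    rw [e]
    exact dvd_sub (dvd_mul_of_dvd_right (dvd_pow_self _ hp.out.ne_zero) _) (dvd_mul_right _ _)
  rw [(isUnit_C.2 (sub_ne_zero.2 hne).isUnit).dvd_mul_left, (YY_sqf h2 h7).dvd_pow_iff_dvd hp.out.ne_zero] at hdv
  have h42 : 42 * a2 ≠ 0 := by
    rw [show (42:ZMod p) = 2*3*7 by norm_num]
    exact mul_ne_zero (mul_ne_zero (mul_ne_zero h2 h3) h7) ha
  have hl : C (a2+1) - C (42*a2) * X = C (-(42*a2)) * X + C (a2+1) := by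
    simp only [map_neg]; ring
  have hdeg : (C (a2+1) - C (42*a2) * X).natDegree = 1 := by
    rw [hl]; exact natDegree_linear (neg_ne_zero.2 h42)
  have := natDegree_le_of_dvd hdv (by intro h0; rw [h0] at hdeg; simp at hdeg)
  rw [hdeg, YY_natDegree h2 h7] at this
  omega
end
end Z7
end

section
open Finset
set_option linter.unusedSectionVars false
set_option linter.unusedSimpArgs false
set_option linter.unusedVariables false
namespace Z7
section
open Polynomial

noncomputable def Rh {F : Type*} [CommRing F] (A D : F[X]) : F[X] :=
  D^4 - 42*X*A^2*D^2 + 448*X^2*A^4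

theorem Rh_mul {F : Type*} [CommRing F] (g A D : F[X]) : Rh (g*A) (g*D) = g^4 * Rh A D := by
  simp only [Rh]; ring

/-- the ODE -/
def ODE {F : Type*} [CommRing F] (α : F) (A D : F[X]) : Prop := YY F * (Wr A D)^2 = C (α^2) * Rh A D

theorem ODE.cancel {F : Type*} [CommRing F] [IsDomain F] {α : F} {g A D : F[X]} (hg : g ≠ 0) (h : ODE α (g*A) (g*D)) :
    ODE α A D := by
  unfold ODE at *
  rw [Wr_mul, Rh_mul] at h
  apply mul_left_cancel₀ (pow_ne_zero 4 hg)
  linear_combination h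

theorem ODE.mul {F : Type*} [CommRing F] {α : F} {A D : F[X]} (g : F[X]) (h : ODE α A D) :
    ODE α (g*A) (g*D) := by
  unfold ODE at *
  rw [Wr_mul, Rh_mul]
  linear_combination g^4 * h

theorem map_YY {F G : Type*} [CommRing F] [CommRing G] (f : F →+* G) : (YY F).map f = YY G := by
  simp [YY, Polynomial.map_ofNat]
theorem map_Wr {F G : Type*} [CommRing F] [CommRing G] (f : F →+* G) (A D : F[X]) : (Wr A D).map f = Wr (A.map f) (D.map f) := by
  simp [Wr, Polynomial.map_ofNat, derivative_map]
theorem map_Rh {F G : Type*} [CommRing F] [CommRing G] (f : F →+* G) (A D : F[X]) : (Rh A D).map f = Rh (A.map f) (D.map f) := by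
  simp [Rh, Polynomial.map_ofNat]

theorem ODE.of_map {F G : Type*} [CommRing F] [CommRing G] {f : F →+* G} (hf : Function.Injective f) {α : F} {A D : F[X]}
    (h : ODE (f α) (A.map f) (D.map f)) : ODE α A D := by
  unfold ODE at *
  apply Polynomial.map_injective f hf
  simp only [Polynomial.map_mul, Polynomial.map_pow, map_YY, map_Wr, map_Rh, Polynomial.map_C, map_pow]
  rw [h]; simp

variable {p : ℕ} [hp : Fact p.Prime]

theorem toZMod_zero {x : ℤ_[p]} : PadicInt.toZMod x = 0 ↔ (p:ℤ_[p]) ∣ x := by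
  rw [← RingHom.mem_ker, PadicInt.ker_toZMod, PadicInt.maximalIdeal_eq_span_p, Ideal.mem_span_singleton]

theorem V_of_dvd {x : ℤ_[p]} (h : (p:ℤ_[p]) ∣ x) : V p 1 (x:ℚ_[p]) := by
  obtain ⟨z, rfl⟩ := h
  exact ⟨z, by push_cast; ring⟩

theorem V_toZMod {x : ℤ_[p]} (h : PadicInt.toZMod x = 0) : V p 1 (x:ℚ_[p]) := V_of_dvd (toZMod_zero.1 h)

theorem red_zero {f : ℤ_[p][X]} (h : f.map PadicInt.toZMod = 0) : ∃ g, f = C (p:ℤ_[p]) * g := by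
  have : C (p:ℤ_[p]) ∣ f := by
    rw [C_dvd_iff_dvd_coeff]
    intro i
    rw [← toZMod_zero, ← coeff_map, h]; simp
  exact this

theorem scale (A D : ℚ_[p][X]) (hD : D ≠ 0) : ∃ m : ℚ_[p], m ≠ 0 ∧ ∃ A1 D1 : ℤ_[p][X],
    A1.map PadicInt.Coe.ringHom = C m * A ∧ D1.map PadicInt.Coe.ringHom = C m * D ∧
    (A1.map PadicInt.toZMod ≠ 0 ∨ D1.map PadicInt.toZMod ≠ 0) := by
  classical
  set S : Finset ℚ_[p] := A.support.image A.coeff ∪ D.support.image D.coeff with hS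
  have hne : S.Nonempty := by
    have : D.support.Nonempty := by simpa using hD
    obtain ⟨i, hi⟩ := this
    exact ⟨D.coeff i, by simp only [hS, mem_union, mem_image]; exact Or.inr ⟨i, hi, rfl⟩⟩
  obtain ⟨x, hx, hmax⟩ := exists_max_image S (fun x => ‖x‖) hne
  have hx0 : x ≠ 0 := by
    simp only [hS, mem_union, mem_image, mem_support_iff] at hx
    rcases hx with ⟨i, hi, rfl⟩ | ⟨i, hi, rfl⟩ <;> exact hi
  have key : ∀ f : ℚ_[p][X], (∀ i, f.coeff i ≠ 0 → f.coeff i ∈ S) → ∃ f1 : ℤ_[p][X], f1.map PadicInt.Coe.ringHom = C x⁻¹ * f := by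
    intro f hf
    have : C x⁻¹ * f ∈ lifts (PadicInt.Coe.ringHom (p := p)) := by
      rw [lifts_iff_coeff_lifts]
      intro i
      rw [coeff_C_mul]
      by_cases h0 : f.coeff i = 0
      · exact ⟨0, by simp [h0]⟩
      · have h1 := hmax _ (hf i h0)
        refine ⟨⟨x⁻¹ * f.coeff i, ?_⟩, rfl⟩
        rw [norm_mul, norm_inv, inv_mul_le_iff₀ (norm_pos_iff.2 hx0), mul_one]
        exact h1
    exact this
  obtain ⟨A1, hA1⟩ := key A (fun i hi => by
    simp only [hS, mem_union, mem_image, mem_support_iff]; exact Or.inl ⟨i, hi, rfl⟩)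
  obtain ⟨D1, hD1⟩ := key D (fun i hi => by
    simp only [hS, mem_union, mem_image, mem_support_iff]; exact Or.inr ⟨i, hi, rfl⟩)
  refine ⟨x⁻¹, inv_ne_zero hx0, A1, D1, hA1, hD1, ?_⟩
  have one : ∀ (f : ℚ_[p][X]) (f1 : ℤ_[p][X]) (i : ℕ), f1.map PadicInt.Coe.ringHom = C x⁻¹ * f → f.coeff i = x → f1.map PadicInt.toZMod ≠ 0 := by
    intro f f1 i h1 h2 h0
    have h3 := congrArg (fun g => coeff g i) h1
    simp only [coeff_map, coeff_C_mul, h2, inv_mul_cancel₀ hx0] at h3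
    have h4 : f1.coeff i = 1 := by
      apply PadicInt.ext; rw [PadicInt.coe_one]; exact h3
    have h5 := congrArg (fun g => coeff g i) h0
    simp [h4] at h5
  simp only [hS, mem_union, mem_image, mem_support_iff] at hx
  rcases hx with ⟨i, hi, h⟩ | ⟨i, hi, h⟩
  · exact Or.inl (one A A1 i hA1 h)
  · exact Or.inr (one D D1 i hD1 h)

theorem normalize {n : ℕ} (hn : p = 2*n+1) (hp2 : p ≠ 2) (hp3 : p ≠ 3) (hp7 : p ≠ 7) {α : ℚ_[p]} {w : ℤ_[p]} (hw : IsUnit w)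
    (hα : α = p * w) {A D : ℚ_[p][X]} (hA : A.natDegree ≤ n) (hD : D.natDegree ≤ n) (hD0 : D.coeff 0 ≠ 0)
    (h : ODE α A D) : ∃ A D : ℚ_[p][X], A.natDegree ≤ n ∧ D.natDegree ≤ n ∧ D.coeff 0 = 1 ∧ IsCoprime A D ∧ ODE α A D ∧
      (∀ i, V p 0 (A.coeff i)) ∧ (∀ i, i < n → V p 1 (A.coeff i)) ∧ (∀ i, 0 < i → V p 1 (D.coeff i)) ∧
      V p 1 (A.coeff n^2 - 1) := by
  have hDne : D ≠ 0 := by rintro rfl; simp at hD0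
  have hα0 : α ≠ 0 := by
    rw [hα]; apply mul_ne_zero
    · exact_mod_cast hp.out.ne_zero
    · intro h0; exact hw.ne_zero (PadicInt.ext (by rw [h0, PadicInt.coe_zero]))
  have hAne : A ≠ 0 := by
    rintro rfl
    unfold ODE at h
    have := congrArg (fun g => coeff g 0) h
    simp [Wr, Rh, mul_coeff_zero, pow_two] at this
    simp [coeff_zero_eq_eval_zero] at this hD0
    rcases this with h | h
    · exact hα0 h
    · exact hD0 h
  obtain ⟨A', D', c, hrp, rfl, rfl⟩ := UniqueFactorizationMonoid.exists_reduced_factors A hAne D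
  have hc : c ≠ 0 := left_ne_zero_of_mul hAne
  replace h := h.cancel hc
  have hA' : A' ≠ 0 := right_ne_zero_of_mul hAne
  have hD' : D' ≠ 0 := right_ne_zero_of_mul hDne
  rw [natDegree_mul hc hA'] at hA
  rw [natDegree_mul hc hD'] at hD
  rw [mul_coeff_zero] at hD0
  obtain ⟨m, hm, A1, D1, hA1, hD1, hor⟩ := scale A' D' hD'
  have hinj : Function.Injective (PadicInt.Coe.ringHom (p := p)) := fun x y h => PadicInt.ext h
  have h1 : ODE ((p:ℤ_[p]) * w) A1 D1 := by
    apply ODE.of_map hinj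
    rw [hA1, hD1]
    have : PadicInt.Coe.ringHom ((p:ℤ_[p])*w) = α := by
      rw [hα, map_mul, map_natCast]; rfl
    rw [this]
    exact h.mul _
  have hdA : A1.natDegree ≤ n := by
    rw [← natDegree_map_eq_of_injective hinj A1, hA1, natDegree_C_mul hm]; omega
  have hdD : D1.natDegree ≤ n := by
    rw [← natDegree_map_eq_of_injective hinj D1, hD1, natDegree_C_mul hm]; omega
  have hpne : (p:ℤ_[p]) ≠ 0 := by exact_mod_cast hp.out.ne_zero
  have hCp : C (p:ℤ_[p]) ≠ 0 := by simpa using hpne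
  have nz : ∀ q : ℕ, q.Prime → p ≠ q → ((q:ℕ):ZMod p) ≠ 0 := by
    intro q hq hne h0
    rw [ZMod.natCast_eq_zero_iff] at h0
    exact hne ((Nat.prime_dvd_prime_iff_eq hp.out hq).1 h0)
  have h2 : (2:ZMod p) ≠ 0 := by exact_mod_cast nz 2 Nat.prime_two hp2
  have h7 : (7:ZMod p) ≠ 0 := by exact_mod_cast nz 7 (by norm_num) hp7
  have h448 : (448:ZMod p) ≠ 0 := by
    rw [show (448:ZMod p) = 2^6*7 by norm_num]; exact mul_ne_zero (pow_ne_zero _ h2) h7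
  set r := PadicInt.toZMod (p := p) with hr
  have hw0 : r w ≠ 0 := (hw.map r).ne_zero
  have hrp0 : r (p:ℤ_[p]) = 0 := by simp
  -- both reductions nonzero
  have hDb : D1.map r ≠ 0 := by
    intro h0
    have hAb : A1.map r ≠ 0 := hor.resolve_right (by simpa using h0)
    obtain ⟨D2, rfl⟩ := red_zero h0
    have e : YY ℤ_[p] * (Wr A1 D2)^2 = C (w^2) * (C (p:ℤ_[p])^2 * (C (p:ℤ_[p])^2 * D2^4 - 42*X*A1^2*D2^2) + 448*X^2*A1^4) := by
      unfold ODE Wr Rh at h1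
      unfold Wr
      apply mul_left_cancel₀ (pow_ne_zero 2 hCp)
      simp only [derivative_mul, derivative_C, C_mul, C_pow] at h1 ⊢
      linear_combination h1
    have e2 := congrArg (Polynomial.map r) e
    simp only [Polynomial.map_mul, Polynomial.map_pow, map_YY, map_Wr, map_Rh, Polynomial.map_C, map_pow, Polynomial.map_add,
      hrp0, Polynomial.map_sub, Polynomial.map_ofNat, Polynomial.map_X] at e2
    have e3 : YY (ZMod p) * (Wr (A1.map r) (D2.map r))^2 = C ((r w)^2*448) * (X * (A1.map r)^2)^2 := by
      rw [e2]; simp only [C_mul, C_0, map_ofNat, C_pow]; ring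
    have := YY_no_sq h2 h7 _ _ _ _ (mul_ne_zero (pow_ne_zero 2 hw0) h448) le_rfl e3
    simp [hAb] at this
  have hAb : A1.map r ≠ 0 := by
    intro h0
    obtain ⟨A2, rfl⟩ := red_zero h0
    have e : YY ℤ_[p] * (Wr A2 D1)^2 = C (w^2) * (D1^4 + C (p:ℤ_[p])^2 * (C (p:ℤ_[p])^2 * 448 * X^2* A2^4 - 42*X*A2^2*D1^2)) := by
      unfold ODE Wr Rh at h1
      unfold Wr
      apply mul_left_cancel₀ (pow_ne_zero 2 hCp)
      simp only [derivative_mul, derivative_C, C_mul, C_pow] at h1 ⊢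
      linear_combination h1
    have e2 := congrArg (Polynomial.map r) e
    simp only [Polynomial.map_mul, Polynomial.map_pow, map_YY, map_Wr, map_Rh, Polynomial.map_C, map_pow, Polynomial.map_add,
      hrp0, Polynomial.map_sub, Polynomial.map_ofNat, Polynomial.map_X] at e2
    have e3 : YY (ZMod p) * (Wr (A2.map r) (D1.map r))^2 = C ((r w)^2) * ((D1.map r)^2)^2 := by
      rw [e2]; simp only [C_mul, C_0, map_ofNat, C_pow]; ring
    have := YY_no_sq h2 h7 _ _ _ _ (pow_ne_zero 2 hw0) le_rfl e3
    simp [hDb] at this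
  have hWr : Wr (A1.map r) (D1.map r) = 0 := by
    have e2 := congrArg (Polynomial.map r) h1
    simp only [Polynomial.map_mul, Polynomial.map_pow, map_YY, map_Wr, map_Rh, Polynomial.map_C, map_pow, map_mul, hrp0] at e2
    simpa [YY_ne] using e2
  obtain ⟨a, d, ha, hd, hAe, hDe⟩ := Wr_zero hn hAb hDb (natDegree_map_le.trans hdA) (natDegree_map_le.trans hdD) hWr
  have hd0 : r (D1.coeff 0) = d := by rw [← coeff_map, hDe]; simp
  have hu : IsUnit (D1.coeff 0) := by
    by_contra hnu
    have : D1.coeff 0 ∈ RingHom.ker r := by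
      rw [hr, PadicInt.ker_toZMod]; exact hnu
    rw [RingHom.mem_ker, hd0] at this; exact hd this
  obtain ⟨d', hd'⟩ := hu.exists_right_inv
  have hrd : r d' ≠ 0 := by
    intro h0
    have := congrArg r hd'
    rw [map_mul, h0] at this; simp at this
  have hd'0 : d' ≠ 0 := by rintro rfl; simp at hd'
  set A3 := C d' * A1 with hA3
  set D3 := C d' * D1 with hD3
  have h3 : ODE ((p:ℤ_[p]) * w) A3 D3 := h1.mul _
  have hD3r : D3.map r = 1 := by
    rw [hD3, Polynomial.map_mul, hDe, Polynomial.map_C, ← C_mul, ← hd0, ← map_mul, mul_comm, hd']; simp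
  set b := r d' * a with hb
  have hb0 : b ≠ 0 := mul_ne_zero hrd ha
  have hA3r : A3.map r = C b * X^n := by
    rw [hA3, Polynomial.map_mul, hAe, Polynomial.map_C, hb, C_mul]; ring
  have hb1 : b^2 = 1 := by
    have hz : (Wr A3 D3).map r = 0 := by
      rw [map_Wr]
      have e2 := congrArg (Polynomial.map r) h3
      simp only [Polynomial.map_mul, Polynomial.map_pow, map_YY, map_Wr, map_Rh, Polynomial.map_C, map_pow, map_mul, hrp0] at e2
      simpa [YY_ne] using e2
    obtain ⟨Z, hZ⟩ := red_zero hz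
    have e : YY ℤ_[p] * Z^2 = C (w^2) * Rh A3 D3 := by
      apply mul_left_cancel₀ (pow_ne_zero 2 hCp)
      unfold ODE at h3
      rw [hZ] at h3
      simp only [C_mul, C_pow] at h3 ⊢
      linear_combination h3
    have e2 := congrArg (Polynomial.map r) e
    simp only [Polynomial.map_mul, Polynomial.map_pow, map_YY, map_Rh, Polynomial.map_C, map_pow, hA3r, hD3r] at e2
    refine abar_sq hp2 hp3 hp7 (pow_ne_zero 2 hb0) (Z := C (r w)⁻¹ * Z.map r) ?_
    have hc : C (r w)⁻¹ * C (r w) = 1 := by rw [← C_mul, inv_mul_cancel₀ hw0, C_1]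
    have hcc : (C (r w)⁻¹)^2 * C (r w)^2 = 1 := by rw [← mul_pow, hc, one_pow]
    rw [mul_pow, ← mul_assoc, mul_comm (YY _), mul_assoc, e2, C_pow, ← mul_assoc, hcc, one_mul, Rh]
    simp only [C_pow]
    have hX : (X:(ZMod p)[X])^p = X * X^(2*n) := by rw [← pow_succ']; exact congrArg _ hn
    rw [show 2*p = p*2 by ring, pow_mul X p 2, hX, show 2*n = n*2 by ring, pow_mul]
    ring
  have hcoe : ∀ x : ℤ_[p], PadicInt.Coe.ringHom x = (x:ℚ_[p]) := fun x => rfl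
  have h4 : ODE α (A3.map PadicInt.Coe.ringHom) (D3.map PadicInt.Coe.ringHom) := by
    have e := congrArg (Polynomial.map PadicInt.Coe.ringHom) h3
    unfold ODE
    simp only [Polynomial.map_mul, Polynomial.map_pow, map_YY, map_Wr, map_Rh, Polynomial.map_C, map_pow] at e
    rw [e, hα, map_mul, hcoe, hcoe]; simp
  refine ⟨A3.map PadicInt.Coe.ringHom, D3.map PadicInt.Coe.ringHom, ?_, ?_, ?_, ?_, h4, ?_, ?_, ?_, ?_⟩
  · refine natDegree_map_le.trans ?_
    rw [hA3]; exact (natDegree_C_mul_le _ _).trans hdA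
  · refine natDegree_map_le.trans ?_
    rw [hD3]; exact (natDegree_C_mul_le _ _).trans hdD
  · rw [coeff_map, hD3, coeff_C_mul, mul_comm, hd']; simp
  · have : IsCoprime A' D' := hrp.isCoprime
    rw [hA3, hD3, Polynomial.map_mul, Polynomial.map_mul, hA1, hD1, ← mul_assoc, ← mul_assoc, Polynomial.map_C, ← C_mul]
    have hu : IsUnit (C (PadicInt.Coe.ringHom d' * m)) := by
      rw [isUnit_C, isUnit_iff_ne_zero]; exact mul_ne_zero (by rw [hcoe]; intro h0; exact hd'0 (PadicInt.ext (by rw [h0, PadicInt.coe_zero]))) hm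
    exact (isCoprime_mul_unit_left hu _ _).2 this
  · intro i; rw [coeff_map]; exact V_padic _
  · intro i hi; rw [coeff_map]; apply V_toZMod
    rw [← hr, ← coeff_map, hA3r]; simp; intro h; omega
  · intro i hi; rw [coeff_map]; apply V_toZMod
    rw [← hr, ← coeff_map, hD3r, coeff_one]; simp; omega
  · rw [coeff_map, hcoe]
    have := V_toZMod (p := p) (x := A3.coeff n^2 - 1) (by
      rw [← hr, map_sub, map_pow, ← coeff_map, hA3r]; simp [hb1])
    simpa using this
end
end Z7
end

section
open Finset
set_option linter.unusedSectionVars false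
set_option linter.unusedSimpArgs false
set_option linter.unusedVariables false
namespace Z7
section
variable {K : Type*} [Field K] [CharZero K]
open PowerSeries

theorem coe_ofN (m : ℕ) [m.AtLeastTwo] : ((OfNat.ofNat m : Polynomial K) : K⟦X⟧) = OfNat.ofNat m :=
  map_ofNat (Polynomial.coeToPowerSeries.ringHom (R := K)) m

theorem coe2 : ((2 : Polynomial K) : K⟦X⟧) = 2 := coe_ofN 2
theorem coe42 : ((42 : Polynomial K) : K⟦X⟧) = 42 := coe_ofN 42
theorem coe448 : ((448 : Polynomial K) : K⟦X⟧) = 448 := coe_ofN 448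

noncomputable def Ys (K : Type*) [Field K] : K⟦X⟧ := 1 - 42*X + 448*X^2

theorem coe_YY : ((YY K : Polynomial K) : K⟦X⟧) = Ys K := by
  simp only [YY, Ys, Polynomial.coe_add, Polynomial.coe_sub, Polynomial.coe_mul, Polynomial.coe_pow, coe2, coe42, coe448, Polynomial.coe_X, Polynomial.coe_one]

def vO (α : K) (v : K⟦X⟧) : Prop :=
  Ys K * (v + 2*X*(d⁄dX K) v)^2 = C (α^2) * (1 - 42*X*v^2 + 448*X^2*v^4)

theorem vO_of_ODE {α : K} {A D : Polynomial K} (hD : D.coeff 0 ≠ 0) (h : ODE α A D) {v : K⟦X⟧} (hv : v * (D : K⟦X⟧) = A) :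
    vO α v := by
  have hD0 : (D : K⟦X⟧) ≠ 0 := by
    intro h0; apply hD; rw [← Polynomial.coeff_coe, h0]; simp
  have h1 := congrArg (fun f : Polynomial K => (f : K⟦X⟧)) h
  simp only [Wr, Rh, Polynomial.coe_mul, Polynomial.coe_pow, Polynomial.coe_add, Polynomial.coe_sub, Polynomial.coe_C, coe_YY, ← derivative_coe, coe2, coe42, coe448, Polynomial.coe_X] at h1
  rw [← hv] at h1
  have hd : (d⁄dX K) (v * (D : K⟦X⟧)) = v * (d⁄dX K) (D : K⟦X⟧) + D * (d⁄dX K) v := by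
    rw [Derivation.leibniz]; simp
  rw [hd] at h1
  unfold vO
  apply mul_left_cancel₀ (pow_ne_zero 4 hD0)
  linear_combination h1

theorem vO_neg {α : K} {v : K⟦X⟧} (h : vO α v) : vO α (-v) := by
  unfold vO at *
  rw [map_neg]; linear_combination h

theorem vO_unique {α : K} {v w : K⟦X⟧} (hv : vO α v) (hw : vO α w) (h0 : constantCoeff v = constantCoeff w)
    (hne : constantCoeff v ≠ 0) : v = w := by
  have key : ∀ m, X^m ∣ v - w := by
    intro m
    induction m with
    | zero => simp
    | succ m ih =>
      obtain ⟨g, hg⟩ := ih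
      have hvw : v = w + X^m * g := by rw [← hg]; ring
      have hd : X * (d⁄dX K) (X^m * g) = X^m * ((m:K⟦X⟧) * g + X * (d⁄dX K) g) := by
        rw [Derivation.leibniz, Derivation.leibniz_pow]
        rcases m with _ | m
        · simp
        · simp [pow_succ]; ring
      have hsub : X * (d⁄dX K) v = X * (d⁄dX K) w + X^m * ((m:K⟦X⟧) * g + X * (d⁄dX K) g) := by
        rw [← hd, ← mul_add, ← map_add, ← hvw]
      set v1 := X * (d⁄dX K) v
      set w1 := X * (d⁄dX K) w
      set g1 := X * (d⁄dX K) g with hg1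
      have e : X^m * (Ys K * ((2*(m:K⟦X⟧)+1)*g + 2*g1) * ((v + 2*v1) + (w + 2*w1))) =
          X^m * (X * (C (α^2) * g * (-42*(v+w) + 448*X*(v^2+w^2)*(v+w)))) := by
        unfold vO at hv hw
        have hv' : Ys K * (v + 2*v1)^2 = C (α^2) * (1 - 42*X*v^2 + 448*X^2*v^4) := by rw [← hv]; ring
        have hw' : Ys K * (w + 2*w1)^2 = C (α^2) * (1 - 42*X*w^2 + 448*X^2*w^4) := by rw [← hw]; ring
        linear_combination hv' - hw' - Ys K * ((v + 2*v1) + (w + 2*w1)) * hvw - 2 * Ys K * ((v + 2*v1) + (w + 2*w1)) * hsub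
          + X * (C (α^2) * (-42*(v+w) + 448*X*(v^2+w^2)*(v+w))) * hvw
      have e2 := mul_left_cancel₀ (pow_ne_zero m X_ne_zero) e
      have e3 := congrArg (constantCoeff (R := K)) e2
      simp only [map_mul, map_add, constantCoeff_X, zero_mul, mul_zero, v1, w1, g1, map_ofNat, map_natCast, map_one, add_zero, Ys, map_sub, map_pow, sub_zero, one_mul] at e3
      have hY : (1:K) - 0 + 448 * 0^2 = 1 := by norm_num
      have : constantCoeff g = 0 := by
        rw [← h0] at e3
        have h2 : constantCoeff v + constantCoeff v ≠ 0 := by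
          rw [← two_mul]; exact mul_ne_zero two_ne_zero hne
        have h3 : (2*(m:K)+1) ≠ 0 := odd_ne m
        norm_num at e3
        rcases e3 with (h | h) | h
        · exact absurd h h3
        · exact h
        · exact absurd h hne
      obtain ⟨g', hg'⟩ := X_dvd_iff.2 this
      rw [hg, hg']
      exact ⟨g', by ring⟩
  rw [← sub_eq_zero]
  ext m
  exact (X_pow_dvd_iff.1 (key (m+1))) m (by omega)

theorem pair_unique {α : K} {A D B E : Polynomial K} (hD : D.coeff 0 ≠ 0) (hE : E.coeff 0 ≠ 0) (h1 : ODE α A D) (h2 : ODE α B E)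
    (hα : α ≠ 0) {s : K} (hs : s = 1 ∨ s = -1) (h : A.coeff 0 * E.coeff 0 = s * (B.coeff 0 * D.coeff 0)) :
    A * E = Polynomial.C s * (B * D) := by
  have cc : ∀ f : Polynomial K, constantCoeff (f : K⟦X⟧) = f.coeff 0 := fun f => by simp
  set v : K⟦X⟧ := A * (D : K⟦X⟧)⁻¹ with hv
  set w : K⟦X⟧ := B * (E : K⟦X⟧)⁻¹ with hw
  have hvD : v * D = A := by
    rw [hv, mul_assoc, mul_comm _ (D : K⟦X⟧), PowerSeries.mul_inv_cancel _ (by rwa [cc]), mul_one]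
  have hwE : w * E = B := by
    rw [hw, mul_assoc, mul_comm _ (E : K⟦X⟧), PowerSeries.mul_inv_cancel _ (by rwa [cc]), mul_one]
  have ov := vO_of_ODE hD h1 hvD
  have ow := vO_of_ODE hE h2 hwE
  have c1 := congrArg (constantCoeff (R := K)) hvD
  have c2 := congrArg (constantCoeff (R := K)) hwE
  rw [map_mul, cc, cc] at c1 c2
  have hv0 : constantCoeff v ≠ 0 := by
    intro h0
    unfold vO at ov
    have := congrArg (constantCoeff (R := K)) ov
    simp [Ys, h0] at this
    exact hα (by simpa using this.symm)
  have hvw : constantCoeff v = s * constantCoeff w := by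
    have : (D.coeff 0 * E.coeff 0) ≠ 0 := mul_ne_zero hD hE
    apply mul_right_cancel₀ this
    linear_combination E.coeff 0 * c1 - s * D.coeff 0 * c2 + h
  have hfin : v = C s * w := by
    rcases hs with rfl | rfl
    · rw [vO_unique ov ow (by rw [hvw, one_mul]) hv0]; simp
    · rw [vO_unique ov (vO_neg ow) (by rw [hvw, map_neg]; ring) hv0]; simp
  rw [← Polynomial.coe_inj]
  simp only [Polynomial.coe_mul, Polynomial.coe_C]
  rw [← hvD, ← hwE, hfin]; ring
end

section
open Polynomial
variable {K : Type*} [Field K] [CharZero K]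

/-- `u^n f(1/(448u))` -/
noncomputable def sh (n : ℕ) (f : K[X]) : K[X] := ∑ i ∈ range (n+1), C (f.coeff i * (448⁻¹)^i) * X^(n-i)

theorem sh_coeff (n : ℕ) (f : K[X]) {j : ℕ} (hj : j ≤ n) : (sh n f).coeff j = f.coeff (n-j) * (448⁻¹)^(n-j) := by
  simp only [sh, finsetSum_coeff, coeff_C_mul, coeff_X_pow]
  rw [sum_eq_single (n-j)]
  · rw [if_pos (by omega), mul_one]
  · intro i hi hne
    rw [if_neg, mul_zero]
    simp at hi; omega
  · intro h; exact absurd (mem_range.2 (by omega)) h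

theorem sh_deg (n : ℕ) (f : K[X]) : (sh n f).natDegree ≤ n := by
  apply natDegree_sum_le_of_forall_le
  intro i hi
  exact (natDegree_C_mul_X_pow_le _ _).trans (by omega)

theorem sh_eval {n : ℕ} {f : K[X]} (hf : f.natDegree ≤ n) {t : K} (ht : t ≠ 0) :
    (sh n f).eval t = t^n * f.eval (448*t)⁻¹ := by
  rw [eval_eq_sum_range' (by omega : f.natDegree < n+1), mul_sum]
  simp only [sh, eval_finsetSum, eval_mul, eval_C, eval_pow, eval_X]
  refine sum_congr rfl fun i hi => ?_
  have hi' : i ≤ n := by simp at hi; omega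
  rw [pow_sub₀ _ ht hi', mul_inv, mul_pow, inv_pow t]; ring

theorem sh_eval' {n : ℕ} {f : K[X]} (hf : f.natDegree ≤ n) {t : K} (ht : t ≠ 0) :
    t * (derivative (sh n f)).eval t = n * t^n * f.eval (448*t)⁻¹ - t^n * ((448*t)⁻¹ * (derivative f).eval (448*t)⁻¹) := by
  have h1 : ∀ (g : K[X]) (x : K), x * (derivative g).eval x = (X * derivative g).eval x := by intro g x; simp
  have h2 : ∀ (c : K) (j : ℕ), X * derivative (C c * X^j) = C (c*j) * X^j := by
    intro c j
    rcases j with _ | j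
    · simp
    · rw [derivative_C_mul_X_pow]; simp only [Nat.add_sub_cancel, pow_succ, C_mul]; ring
  have h3 : X * derivative f = ∑ i ∈ range (n+1), C (f.coeff i * i) * X^i := by
    conv_lhs => rw [as_sum_range_C_mul_X_pow' f (by omega : f.natDegree < n+1)]
    rw [derivative_sum, mul_sum]
    exact sum_congr rfl fun i _ => h2 _ _
  rw [h1, h1, h3, eval_eq_sum_range' (by omega : f.natDegree < n+1), sh, derivative_sum, mul_sum]
  simp only [h2, eval_finsetSum, eval_mul, eval_C, eval_pow, eval_X]
  rw [mul_sum, mul_sum, ← sum_sub_distrib]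
  refine sum_congr rfl fun i hi => ?_
  have hi' : i ≤ n := by simp at hi; omega
  rw [pow_sub₀ _ ht hi', mul_inv, mul_pow, inv_pow t]; push_cast [hi']; ring

theorem ODE_sh {n : ℕ} {α : K} {A D : K[X]} (hA : A.natDegree ≤ n) (hD : D.natDegree ≤ n) (h : ODE α A D) :
    ODE α (sh n D) (sh n A) := by
  unfold ODE at *
  have key : ∀ t : K, t ≠ 0 → (YY K * Wr (sh n D) (sh n A)^2).eval t = (C (α^2) * Rh (sh n D) (sh n A)).eval t := by
    intro t ht
    have e := congrArg (eval (448*t)⁻¹) h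
    simp only [YY, Wr, Rh, eval_mul, eval_add, eval_sub, eval_pow, eval_X, eval_C, eval_ofNat, eval_one] at e ⊢
    have d1 := sh_eval' hA ht
    have d2 := sh_eval' hD ht
    rw [sh_eval hA ht, sh_eval hD ht]
    set s := (448*t)⁻¹ with hs
    have hst : 448 * (s * t) = 1 := by rw [hs, mul_inv]; field_simp
    set a := A.eval s
    set d := D.eval s
    set a' := (derivative A).eval s
    set d' := (derivative D).eval s
    set b' := (derivative (sh n A)).eval t
    set c' := (derivative (sh n D)).eval t
    have w : t^n * d * (t^n * a) + 2 * t * (c' * (t^n * a) - t^n * d * b') = t^(2*n) * (a * d + 2 * s * (a' * d - a * d')) := by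
      have : t^(2*n) = t^n * t^n := by rw [← pow_add]; ring_nf
      rw [this]
      linear_combination (-2*t^n*d)*d1 + (2*t^n*a)*d2
    rw [w]
    have hY : 1 - 42*t + 448*t^2 = 448*t^2*(1 - 42*s + 448*s^2) := by
      linear_combination (42*t - 448 * s*t-1) * hst
    have : (t^(2*n))^2 = (t^n)^4 := by rw [← pow_mul, ← pow_mul]; ring_nf
    rw [hY, mul_pow, this]
    set T := t^n
    linear_combination (448*t^2*T^4) * e - α^2 * T^4 * (42*a^2*d^2*t - 448*(t*s+448⁻¹)*a^4) * hst
  have : X * (YY K * Wr (sh n D) (sh n A)^2) = X * (C (α^2) * Rh (sh n D) (sh n A)) := by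
    apply Polynomial.funext
    intro t
    by_cases ht : t = 0
    · simp [ht]
    · rw [eval_mul (p := X), eval_mul (p := X), key t ht]
  exact mul_left_cancel₀ X_ne_zero this

theorem symm_rel {n : ℕ} {α : K} (hα : α ≠ 0) {A D : K[X]} (hA : A.natDegree ≤ n) (hD : D.natDegree ≤ n) (h : ODE α A D)
    (hD0 : D.coeff 0 = 1) (hAn : A.coeff n ≠ 0) (hco : IsCoprime A D) :
    ∃ ε : K, (ε = 1 ∨ ε = -1) ∧ A.coeff n^2 = ε * 448^n ∧ ∀ i ≤ n, D.coeff (n-i) * A.coeff n = 448^(n-i) * A.coeff i := by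
  have h' := ODE_sh hA hD h
  have h448 : (448:K) ≠ 0 := by norm_num
  have c0 : (sh n A).coeff 0 = A.coeff n * (448⁻¹)^n := by rw [sh_coeff n A (Nat.zero_le n)]; simp
  have c1 : (sh n D).coeff 0 = D.coeff n * (448⁻¹)^n := by rw [sh_coeff n D (Nat.zero_le n)]; simp
  have hA0 : (sh n A).coeff 0 ≠ 0 := by rw [c0]; exact mul_ne_zero hAn (pow_ne_zero _ (inv_ne_zero h448))
  have at0 : ∀ {A D : K[X]}, ODE α A D → D.coeff 0 ≠ 0 → A.coeff 0^2 = α^2 * D.coeff 0^2 := by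
    intro A D h hD
    have := congrArg (fun f => coeff f 0) h
    simp only [YY, Wr, Rh, coeff_zero_eq_eval_zero, eval_mul, eval_add, eval_sub, eval_pow, eval_X, eval_C, eval_ofNat, eval_one] at this hD ⊢
    apply mul_right_cancel₀ (pow_ne_zero 2 hD)
    linear_combination this
  have a1 := at0 h (by rw [hD0]; exact one_ne_zero)
  have a2 := at0 h' hA0
  rw [hD0] at a1
  have : ∃ ε : K, (ε = 1 ∨ ε = -1) ∧ A.coeff 0 * (sh n A).coeff 0 = ε * ((sh n D).coeff 0 * D.coeff 0) := by
    have : (A.coeff 0 * (sh n A).coeff 0)^2 = ((sh n D).coeff 0 * D.coeff 0)^2 := by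
      rw [hD0]; linear_combination (sh n A).coeff 0^2 * a1 - a2
    rcases sq_eq_sq_iff_eq_or_eq_neg.1 this with h | h
    · exact ⟨1, Or.inl rfl, by rw [h]; ring⟩
    · exact ⟨-1, Or.inr rfl, by rw [h]; ring⟩
  obtain ⟨ε, hε, he⟩ := this
  have rel := pair_unique (by rw [hD0]; exact one_ne_zero) hA0 h h' hα hε he
  have dv : A ∣ sh n D := by
    apply hco.dvd_of_dvd_mul_right
    have hεu : IsUnit (C ε) := by rw [isUnit_C]; rcases hε with rfl | rfl <;> simp
    rw [← hεu.dvd_mul_left]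
    exact ⟨_, rel.symm⟩
  obtain ⟨k, hk⟩ := dv
  have hAne : A ≠ 0 := by rintro rfl; simp at hAn
  have hAd : A.natDegree = n := le_antisymm hA (le_natDegree_of_ne_zero hAn)
  have hk0 : k.natDegree = 0 := by
    by_cases hk0 : k = 0
    · simp [hk0]
    have := sh_deg n D
    rw [hk, natDegree_mul hAne hk0] at this; omega
  rw [eq_C_of_natDegree_eq_zero hk0] at hk
  set κ := k.coeff 0
  have hcf : ∀ i ≤ n, D.coeff (n-i) * (448⁻¹)^(n-i) = κ * A.coeff i := by
    intro i hi
    rw [← sh_coeff n D hi, hk, mul_comm A, coeff_C_mul]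
  have hκ : κ * A.coeff n = 1 := by
    rw [← hcf n le_rfl]; simp [hD0]
  refine ⟨ε, hε, ?_, ?_⟩
  · rw [hk] at rel
    have r2 : sh n A = C ε * (C κ * D) := by
      apply mul_left_cancel₀ hAne; rw [rel]; ring
    have := congrArg (fun f => coeff f 0) r2
    simp only [c0, coeff_C_mul, hD0] at this
    have hi : ((448:K)⁻¹)^n * 448^n = 1 := by rw [← mul_pow, inv_mul_cancel₀ h448, one_pow]
    linear_combination (A.coeff n * 448^n) * this - A.coeff n^2 * hi + ε * 448^n * hκ
  · intro i hi
    have := hcf i hi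
    have hi : ((448:K)⁻¹)^(n-i) * 448^(n-i) = 1 := by rw [← mul_pow, inv_mul_cancel₀ h448, one_pow]
    linear_combination (A.coeff n * 448^(n-i)) * this - A.coeff n * D.coeff (n-i) * hi + 448^(n-i) * A.coeff i * hκ
end
end Z7
end

section
open Finset
set_option linter.unusedSectionVars false
set_option linter.unusedSimpArgs false
set_option linter.unusedVariables false
namespace Z7
section
variable (K : Type*) [Field K] [CharZero K]
open PowerSeries

/-- Legendre-type numbers: coefficients of `(1-42u+448u^2)^{-1/2}`. -/
noncomputable def ph7 : ℕ → K
  | 0 => 1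
  | 1 => 21
  | (j+2) => ((2*j+3) * 21 * ph7 (j+1) - (j+1) * 448 * ph7 j) / (j+2)

theorem ph7_rec (j : ℕ) : ((j:K)+2) * ph7 K (j+2) = (2*j+3) * 21 * ph7 K (j+1) - (j+1) * 448 * ph7 K j := by
  have : ((j:K)+2) ≠ 0 := by exact_mod_cast (by omega : j+2 ≠ 0)
  conv_lhs => rw [ph7]
  field_simp

theorem ph7_sq (j : ℕ) : ph7 K j^2 = ∑ k ∈ range (j+1), (al j k : K) * (-7/4)^k * 448^(j-k) :=
  clausen (b := 21) (d := 448) (e := -7/4) (by rw [ph7]) (by rw [ph7]) (ph7_rec K) (by norm_num) j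

noncomputable def Ph : K⟦X⟧ := mk (ph7 K)

theorem Ph_ode : Ys K * (d⁄dX K) (Ph K) = (21 - 448*X) * Ph K := by
  ext m
  have e1 : Ys K * (d⁄dX K) (Ph K) = (d⁄dX K) (Ph K) - C (42:K) * (X * (d⁄dX K) (Ph K)) + C (448:K) * (X * (X * (d⁄dX K) (Ph K))) := by
    have h1 : (C (42:K)) = (42 : K⟦X⟧) := map_ofNat C 42
    have h2 : (C (448:K)) = (448 : K⟦X⟧) := map_ofNat C 448
    rw [h1, h2, Ys]; ring
  have e2 : (21 - 448*X) * Ph K = C (21:K) * Ph K - C (448:K) * (X * Ph K) := by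
    have h1 : (C (21:K)) = (21 : K⟦X⟧) := map_ofNat C 21
    have h2 : (C (448:K)) = (448 : K⟦X⟧) := map_ofNat C 448
    rw [h1, h2]; ring
  rw [e1, e2]
  simp only [map_add, map_sub, coeff_C_mul]
  rcases m with _ | _ | m
  · simp [Ph, coeff_derivative, ph7]
  · simp only [zero_add, coeff_derivative, Ph, coeff_mk, coeff_succ_X_mul, coeff_zero_X_mul]
    have := ph7_rec K 0
    norm_num at this ⊢
    linear_combination this
  · simp only [coeff_succ_X_mul, coeff_derivative, Ph, coeff_mk]
    have := ph7_rec K (m+1)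
    push_cast at this ⊢
    rw [show m+1+1+1 = m+1+2 from rfl]
    linear_combination this

theorem Ys_Ph : Ys K * Ph K^2 = 1 := by
  apply derivative.ext
  · have hY : (d⁄dX K) (Ys K) = -42 + 896 * X := by
      have : Ys K = ((YY K : Polynomial K) : K⟦X⟧) := coe_YY.symm
      rw [this, derivative_coe]
      have : Polynomial.derivative (YY K) = -Polynomial.C 42 + Polynomial.C 896 * Polynomial.X := by
        unfold YY
        rw [show (42 : Polynomial K) = Polynomial.C 42 from (map_ofNat Polynomial.C 42).symm, show (448 : Polynomial K) = Polynomial.C 448 from (map_ofNat Polynomial.C 448).symm]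
        simp only [Polynomial.derivative_add, Polynomial.derivative_sub, Polynomial.derivative_one, Polynomial.derivative_C_mul_X, Polynomial.derivative_C_mul_X_pow]
        norm_num
      rw [this]
      simp only [Polynomial.coe_add, Polynomial.coe_neg, Polynomial.coe_mul, Polynomial.coe_C, Polynomial.coe_X]
      rw [show (C (42:K)) = (42 : K⟦X⟧) from map_ofNat C 42, show (C (896:K)) = (896 : K⟦X⟧) from map_ofNat C 896]
    rw [Derivation.leibniz, Derivation.leibniz_pow, hY]
    simp only [smul_eq_mul, map_one_eq_zero, Derivation.map_one_eq_zero]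
    simp only [Nat.add_one_sub_one, pow_one, nsmul_eq_mul, Nat.cast_ofNat]
    linear_combination (2 * Ph K) * Ph_ode K
  · simp [Ys, Ph, ph7]

theorem trunc_sq (N : ℕ) : (Polynomial.X^N : Polynomial K) ∣ YY K * (trunc N (Ph K))^2 - 1 := by
  rw [Polynomial.X_pow_dvd_iff]
  have h : (X^N : K⟦X⟧) ∣ Ys K * (trunc N (Ph K) : K⟦X⟧)^2 - 1 := by
    have h1 : (X^N : K⟦X⟧) ∣ (trunc N (Ph K) : K⟦X⟧) - Ph K := by
      rw [X_pow_dvd_iff]; intro m hm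
      simp [coeff_trunc, hm]
    have : Ys K * (trunc N (Ph K) : K⟦X⟧)^2 - 1 = Ys K * ((trunc N (Ph K) : K⟦X⟧) + Ph K) * ((trunc N (Ph K) : K⟦X⟧) - Ph K) := by
      linear_combination Ys_Ph K
    rw [this]; exact h1.mul_left _
  rw [X_pow_dvd_iff] at h
  intro d hd
  have := h d hd
  rw [← coe_YY, ← Polynomial.coe_pow, ← Polynomial.coe_mul, ← Polynomial.coe_one, ← Polynomial.coe_sub, Polynomial.coeff_coe] at this
  exact this

variable {K}
theorem unit_of_cc {f : K⟦X⟧} (h : constantCoeff f ≠ 0) : IsUnit f := by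
  rw [isUnit_iff_constantCoeff]; exact isUnit_iff_ne_zero.2 h

theorem cc_v {α : K} {v : K⟦X⟧} (hv : vO α v) : constantCoeff v^2 = α^2 := by
  unfold vO at hv
  have := congrArg (constantCoeff (R := K)) hv
  simpa [Ys] using this

theorem extract_dvd {α : K} (hα : α ≠ 0) {v : K⟦X⟧} (hv : vO α v) {N : ℕ} (hN : 0 < N) :
    (X^N : K⟦X⟧) ∣ (v + 2*X*(d⁄dX K) v) * (Polynomial.aeval (X*v^2) (trunc N (Ph K))) - C (constantCoeff v) * Ph K := by
  have hc := cc_v hv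
  have hc0 : constantCoeff v ≠ 0 := by
    intro h0; rw [h0] at hc; apply hα; simpa using hc.symm
  set G := v + 2*X*(d⁄dX K) v with hG
  set T := Polynomial.aeval (X*v^2) (trunc N (Ph K)) with hT
  have hd : (X^N : K⟦X⟧) ∣ (1 - 42*(X*v^2) + 448*(X*v^2)^2) * T^2 - 1 := by
    obtain ⟨q, hq⟩ := trunc_sq K N
    have := congrArg (Polynomial.aeval (X*v^2 : K⟦X⟧)) hq
    simp only [YY, map_sub, map_add, map_mul, map_pow, map_one, Polynomial.aeval_X, map_ofNat] at this
    rw [← hT] at this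
    rw [this, mul_pow, mul_assoc]
    exact Dvd.intro _ rfl
  have hcT : constantCoeff T = 1 := by
    rw [hT, Polynomial.aeval_def, Polynomial.hom_eval₂]
    simp only [map_mul, constantCoeff_X, zero_mul]
    rw [Polynomial.eval₂_at_zero, coeff_trunc, if_pos hN]
    simp [Ph, ph7]
  have key : (X^N : K⟦X⟧) ∣ (Ys K * (G * T + C (constantCoeff v) * Ph K)) * (G * T - C (constantCoeff v) * Ph K) := by
    have : (Ys K * (G * T + C (constantCoeff v) * Ph K)) * (G * T - C (constantCoeff v) * Ph K)
       = C (α^2) * ((1 - 42*(X*v^2) + 448*(X*v^2)^2) * T^2 - 1) := by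
      have e : C (constantCoeff v)^2 = C (α^2) := by rw [← map_pow, hc]
      unfold vO at hv
      linear_combination T^2 * hv - C (α^2) * Ys_Ph K - (Ys K * Ph K^2) * e
    rw [this]; exact hd.mul_left _
  have hu : IsUnit (Ys K * (G * T + C (constantCoeff v) * Ph K)) := by
    apply unit_of_cc
    simp only [map_mul, map_add, hcT, hG, constantCoeff_C, Ys, Ph]
    simp [ph7]
    exact hc0
  exact (hu.dvd_mul_left).1 key

theorem extract {α : K} (hα : α ≠ 0) {v : K⟦X⟧} (hv : vO α v) (j : ℕ) :
    ∑ k ∈ range (j+1), ph7 K k * ((2*j+1)/(2*k+1) * coeff (j-k) (v^(2*k+1))) = constantCoeff v * ph7 K j := by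
  have h := extract_dvd hα hv (Nat.succ_pos j)
  rw [X_pow_dvd_iff] at h
  have h := h j (by omega)
  rw [map_sub, coeff_C_mul, sub_eq_zero] at h
  rw [Ph, coeff_mk] at h
  rw [← h, Polynomial.aeval_eq_sum_range' (n := j+1) (natDegree_trunc_lt _ _), mul_sum, map_sum]
  refine sum_congr rfl fun k hk => ?_
  have hk' : k ≤ j := by simp at hk; omega
  rw [coeff_trunc, if_pos (by omega), coeff_mk, mul_smul_comm, coeff_smul, smul_eq_mul]
  congr 1
  have h2 : (v + 2*X*(d⁄dX K) v) * (X*v^2)^k = X^k * (v^(2*k+1) + C (2/(2*(k:K)+1)) * (X * (d⁄dX K) (v^(2*k+1)))) := by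
    rw [Derivation.leibniz_pow]
    have : C (2/(2*(k:K)+1)) * (2*(k:K⟦X⟧)+1) = 2 := by
      have e : (2*(k:K⟦X⟧)+1) = C (2*(k:K)+1) := by
        rw [map_add, map_mul, map_natCast, map_one, show (C (2:K)) = (2 : K⟦X⟧) from map_ofNat C 2]
      rw [e, ← map_mul, div_mul_cancel₀ _ (odd_ne k)]; exact map_ofNat C 2
    simp only [Nat.add_sub_cancel, nsmul_eq_mul, smul_eq_mul]
    push_cast
    have e2 : v^(2*k+1) = v^(2*k) * v := pow_succ _ _
    rw [mul_pow, ← pow_mul, e2]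
    linear_combination (-X^k * X * v^(2*k) * (d⁄dX K) v) * this
  rw [h2, coeff_X_pow_mul', if_pos hk', map_add, coeff_C_mul]
  have h3 : coeff (j-k) (X * (d⁄dX K) (v^(2*k+1))) = ((j:K)-k) * coeff (j-k) (v^(2*k+1)) := by
    rcases Nat.exists_eq_add_of_le hk' with ⟨m, rfl⟩
    rw [Nat.add_sub_cancel_left]
    rcases m with _ | m
    · simp
    · rw [coeff_succ_X_mul, coeff_derivative]; push_cast; ring
  rw [h3]
  have := odd_ne (K := K) k
  field_simp
  ring
end
end Z7
end

section
open Finset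
set_option linter.unusedSectionVars false
set_option linter.unusedSimpArgs false
set_option linter.unusedVariables false
namespace Z7
section
variable {p : ℕ} [hp : Fact p.Prime]
open PowerSeries

theorem V0_iff {x : ℚ_[p]} : V p 0 x ↔ ‖x‖ ≤ 1 := by
  constructor
  · rintro ⟨z, hz⟩; rw [hz, pow_zero, one_mul]; exact z.2
  · intro h; exact ⟨⟨x, h⟩, by simp⟩

theorem V0_of_sq {x : ℚ_[p]} (h : V p 0 (x^2)) : V p 0 x := by
  rw [V0_iff] at *
  rw [norm_pow] at h
  by_contra hc
  push Not at hc
  have := one_lt_pow₀ hc (two_ne_zero)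
  linarith

theorem V.cancel_p {r : ℕ} {x : ℚ_[p]} (h : V p (r+1) ((p:ℚ_[p]) * x)) : V p r x := by
  obtain ⟨z, hz⟩ := h
  have hp0 : (p:ℚ_[p]) ≠ 0 := by exact_mod_cast hp.out.ne_zero
  exact ⟨z, mul_left_cancel₀ hp0 (by rw [hz, pow_succ]; ring)⟩

theorem V_ph7 (hp2 : p ≠ 2) (j : ℕ) : V p 0 (ph7 ℚ_[p] j) := by
  apply V0_of_sq
  rw [ph7_sq]
  apply V_sum; intro k _
  refine ((V_nat _).mulL (V.pow ?_ _)).mulL ((V_ofNat 448).pow _)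
  have : (-7/4 : ℚ_[p]) = -(7 * ((2:ℚ_[p])⁻¹ * (2:ℚ_[p])⁻¹)) := by norm_num
  rw [this]
  exact ((V_ofNat 7).mulL ((V_half hp2).mulL (V_half hp2))).neg

theorem V_coeff_pow {v : ℚ_[p]⟦X⟧} {m : ℕ} (h : ∀ i ≤ m, V p 1 (coeff i v)) (k : ℕ) : ∀ i ≤ m, V p k (coeff i (v^k)) := by
  induction k with
  | zero => 
    intro i _; rw [pow_zero, coeff_one]; split_ifs
    · exact V_one
    · exact V_zero 0
  | succ k ih =>
    intro i hi
    rw [pow_succ, coeff_mul]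
    apply V_sum
    intro x hx
    have := mem_antidiagonal.1 hx
    exact (ih x.1 (by omega)).mul (h x.2 (by omega))

theorem coeff_v {v : ℚ_[p]⟦X⟧} {A D : Polynomial ℚ_[p]} (hv : v * (D : ℚ_[p]⟦X⟧) = A) (hD0 : D.coeff 0 = 1) (i : ℕ) :
    coeff i v + ∑ l ∈ range i, coeff l v * D.coeff (i-l) = A.coeff i := by
  have := congrArg (coeff i) hv
  rw [coeff_mul, Finset.Nat.sum_antidiagonal_eq_sum_range_succ_mk, Polynomial.coeff_coe, sum_range_succ] at this
  simp only [Polynomial.coeff_coe, Nat.sub_self, hD0, mul_one] at this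
  rw [← this]; ring

theorem split_core {n : ℕ} (hn : p = 2*n+1) (hp2 : p ≠ 2) (hp3 : p ≠ 3) {α β ε : ℚ_[p]} (hβ : V p 0 β) (hαβ : α * β = p)
    (hα1 : V p 1 α)
    {A D : Polynomial ℚ_[p]} (hD0 : D.coeff 0 = 1) (h : ODE α A D) (hA0 : ∀ i, V p 0 (A.coeff i)) (hA1 : ∀ i, i < n → V p 1 (A.coeff i))
    (hD1 : ∀ i, 0 < i → V p 1 (D.coeff i)) (hε : A.coeff n^2 = ε * 448^n)
    (hs : ∀ i ≤ n, D.coeff (n-i) * A.coeff n = 448^(n-i) * A.coeff i) :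
    V p 3 (ph7 ℚ_[p] n^2 - (ε * β^2 * 448^n - 2*p^2 * ∑ i ∈ range n, 448^(n-i) * (ph7 ℚ_[p] i^2 * ((2*(i:ℚ_[p])+1)⁻¹)^2))) := by
  have hp0 : (p:ℚ_[p]) ≠ 0 := by exact_mod_cast hp.out.ne_zero
  have hα : α ≠ 0 := by rintro rfl; rw [zero_mul] at hαβ; exact hp0 hαβ.symm
  have hn2 : 2 ≤ n := by
    have := hp.out.two_le
    by_contra hc
    have : n = 0 ∨ n = 1 := by omega
    rcases this with h | h <;> omega
  set v : ℚ_[p]⟦X⟧ := A * (D : ℚ_[p]⟦X⟧)⁻¹ with hv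
  have hvD : v * D = A := by
    rw [hv, mul_assoc, mul_comm _ (D : ℚ_[p]⟦X⟧), PowerSeries.mul_inv_cancel _ (by simp [hD0]), mul_one]
  clear_value v
  have ov := vO_of_ODE (by rw [hD0]; exact one_ne_zero) h hvD
  have hc := cc_v ov
  have hex := extract hα ov
  have E := coeff_v hvD hD0
  have hvi : ∀ i, i < n → V p 1 (coeff i v) := by
    intro i
    induction i using Nat.strong_induction_on with
    | _ i ih =>
      intro hi
      have : coeff i v = A.coeff i - ∑ l ∈ range i, coeff l v * D.coeff (i-l) := by rw [← E i]; ring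
      rw [this]
      refine (hA1 i hi).sub (V_sum _ _ fun l hl => ?_)
      have hl' := mem_range.1 hl
      exact ((ih l hl' (by omega)).mul (hD1 (i-l) (by omega))).mono (by omega)
  set a0 := constantCoeff v with ha0
  have hva : V p 1 a0 := by
    have := hvi 0 (by omega)
    rwa [coeff_zero_eq_constantCoeff_apply] at this
  have F1 : ∀ j, j < n → V p 3 ((2*(j:ℚ_[p])+1) * coeff j v - a0 * ph7 ℚ_[p] j) := by
    intro j hj
    rw [← hex j, sum_range_succ']
    have : (2*(j:ℚ_[p])+1) * coeff j v - (∑ k ∈ range j, ph7 ℚ_[p] (k+1) * ((2*(j:ℚ_[p])+1)/(2*((k+1:ℕ):ℚ_[p])+1) * coeff (j-(k+1)) (v^(2*(k+1)+1))) + ph7 ℚ_[p] 0 * ((2*(j:ℚ_[p])+1)/(2*((0:ℕ):ℚ_[p])+1) * coeff (j-0) (v^(2*0+1))))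
       = -∑ k ∈ range j, ph7 ℚ_[p] (k+1) * ((2*(j:ℚ_[p])+1)/(2*((k+1:ℕ):ℚ_[p])+1) * coeff (j-(k+1)) (v^(2*(k+1)+1))) := by
      simp [ph7]
    rw [this]
    refine (V_sum _ _ fun k hk => ?_).neg
    have hk' := mem_range.1 hk
    refine (V_ph7 hp2 _).mulL (V.mulL ?_ ?_)
    · rw [div_eq_mul_inv]
      refine V.mulL ?_ (V_inv_odd hn (by omega))
      exact_mod_cast V_nat (p := p) (2*j+1)
    · exact (V_coeff_pow (m := j) (fun i hi => hvi i (by omega)) (2*(k+1)+1) (j-(k+1)) (by omega)).mono (by omega)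
  have F2 : V p 4 ((p:ℚ_[p]) * coeff n v - a0 * ph7 ℚ_[p] n) := by
    rw [← hex n, sum_range_succ']
    obtain ⟨m, rfl⟩ : ∃ m, n = m+1 := ⟨n-1, by omega⟩
    rw [sum_range_succ, ← p_eq hn]
    have : (p:ℚ_[p]) * coeff (m+1) v - (∑ k ∈ range m, ph7 ℚ_[p] (k+1) * ((p:ℚ_[p])/(2*((k+1:ℕ):ℚ_[p])+1) * coeff (m+1-(k+1)) (v^(2*(k+1)+1))) + ph7 ℚ_[p] (m+1) * ((p:ℚ_[p])/p * coeff (m+1-(m+1)) (v^(2*(m+1)+1))) + ph7 ℚ_[p] 0 * ((p:ℚ_[p])/(2*((0:ℕ):ℚ_[p])+1) * coeff (m+1-0) (v^(2*0+1))))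
       = -(∑ k ∈ range m, ph7 ℚ_[p] (k+1) * ((p:ℚ_[p])/(2*((k+1:ℕ):ℚ_[p])+1) * coeff (m+1-(k+1)) (v^(2*(k+1)+1)))) - ph7 ℚ_[p] (m+1) * (coeff 0 (v^(2*(m+1)+1))) := by
      rw [div_self hp0, Nat.sub_self]
      simp [ph7]; ring
    rw [this]
    refine V.sub (V_sum _ _ fun k hk => ?_).neg ?_
    · have hk' := mem_range.1 hk
      refine (V_ph7 hp2 _).mulL ?_
      rw [div_eq_mul_inv, mul_assoc]
      refine ((V_p).mul (V.mulL (V_inv_odd hn (by omega)) (V_coeff_pow (m := m) (fun i hi => hvi i (by omega)) (2*(k+1)+1) (m+1-(k+1)) (by omega)))).mono (by omega)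
    · exact ((V_ph7 hp2 _).mulL (V_coeff_pow (m := 0) (fun i hi => hvi i (by omega)) (2*(m+1)+1) 0 le_rfl)).mono (by omega)
  set φ := ph7 ℚ_[p]
  set c : ℚ_[p] := 448
  have Vc : V p 0 c := V_ofNat 448
  -- v_n integral
  have hsig : V p 2 (∑ l ∈ range n, coeff l v * D.coeff (n-l)) := by
    refine V_sum _ _ fun l hl => ?_
    have hl' := mem_range.1 hl
    exact (hvi l hl').mul (hD1 _ (by omega))
  have hvn : V p 0 (coeff n v) := by
    have : coeff n v = A.coeff n - ∑ l ∈ range n, coeff l v * D.coeff (n-l) := by rw [← E n]; ring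
    rw [this]; exact (hA0 n).sub (hsig.mono (by omega))
  have G : V p 3 (coeff n v^2 - (ε * c^n - 2 * α^2 * ∑ i ∈ range n, c^(n-i) * (φ i^2 * ((2*(i:ℚ_[p])+1)⁻¹)^2))) := by
    have e1 : coeff n v^2 - (ε * c^n - 2 * α^2 * ∑ i ∈ range n, c^(n-i) * (φ i^2 * ((2*(i:ℚ_[p])+1)⁻¹)^2))
      = (∑ l ∈ range n, coeff l v * D.coeff (n-l))^2 - 2 * ∑ i ∈ range n, c^(n-i) * (coeff i v * A.coeff i - α^2 * (φ i^2 * ((2*(i:ℚ_[p])+1)⁻¹)^2)) := by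
      have e2 : ∑ i ∈ range n, c^(n-i) * (coeff i v * A.coeff i - α^2 * (φ i^2 * ((2*(i:ℚ_[p])+1)⁻¹)^2))
         = A.coeff n * (∑ l ∈ range n, coeff l v * D.coeff (n-l)) - α^2 * ∑ i ∈ range n, c^(n-i) * (φ i^2 * ((2*(i:ℚ_[p])+1)⁻¹)^2) := by
        rw [mul_sum, mul_sum, ← sum_sub_distrib]
        refine sum_congr rfl fun i hi => ?_
        linear_combination (-coeff i v) * hs i (by have := mem_range.1 hi; omega)
      rw [e2, ← hε, ← E n]; ring
    rw [e1]
    refine ((hsig.sq).mono (by omega)).sub ((V_ofNat 2).mulL (V_sum _ _ fun i hi => ?_))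
    have hi' := mem_range.1 hi
    refine (Vc.pow _).mulL ?_
    have hI := V_inv_odd hn hi'
    have hne := odd_ne (K := ℚ_[p]) i
    set q := (2*(i:ℚ_[p])+1)⁻¹
    have hq : q * (2*(i:ℚ_[p])+1) = 1 := inv_mul_cancel₀ hne
    have e3 : coeff i v * A.coeff i - α^2 * (φ i^2 * q^2) = coeff i v * (∑ l ∈ range i, coeff l v * D.coeff (i-l))
        + q * ((2*(i:ℚ_[p])+1) * coeff i v - a0 * φ i) * (coeff i v + a0 * φ i * q) := by
      rw [← E i, ← hc]
      linear_combination (-coeff i v ^2 - coeff i v * q * a0 * φ i) * hq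
    rw [e3]
    refine V.add (((hvi i hi').mul (V_sum (r := 2) _ _ fun l hl => ?_)).mono (by omega)) (V.mulR (hI.mulL (F1 i hi')) ?_)
    · have hl' := mem_range.1 hl
      exact ((hvi l (by omega)).mul (hD1 _ (by omega)))
    · exact ((hvi i hi').mono (by omega)).add (((hva.mulR (V_ph7 hp2 i)).mulR hI).mono (by omega))
  -- φ_n
  have Vφ := V_ph7 (p := p) hp2 n
  have H : V p 3 (φ n^2 - β^2 * coeff n v^2) := by
    have hsg : a0 = α ∨ a0 = -α := sq_eq_sq_iff_eq_or_eq_neg.1 hc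
    have h4 := hβ.mulL F2
    rcases hsg with hs | hs
    · have : β * ((p:ℚ_[p]) * coeff n v - a0 * φ n) = p * (β * coeff n v - φ n) := by
        rw [hs]; linear_combination (-φ n) * hαβ
      rw [this] at h4
      have h5 := h4.cancel_p
      have e : φ n^2 - β^2 * coeff n v^2 = -((β * coeff n v - φ n) * (β * coeff n v + φ n)) := by ring
      rw [e]; exact (h5.mulR ((hβ.mulL hvn).add Vφ)).neg
    · have : β * ((p:ℚ_[p]) * coeff n v - a0 * φ n) = p * (β * coeff n v + φ n) := by
        rw [hs]; linear_combination (φ n) * hαβ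
      rw [this] at h4
      have h5 := h4.cancel_p
      have e : φ n^2 - β^2 * coeff n v^2 = -((β * coeff n v + φ n) * (β * coeff n v - φ n)) := by ring
      rw [e]; exact (h5.mulR ((hβ.mulL hvn).sub Vφ)).neg
  have := H.add ((hβ.pow 2).mulL G)
  have e : φ n^2 - (ε * β^2 * c^n - 2*p^2 * ∑ i ∈ range n, c^(n-i) * (φ i^2 * ((2*(i:ℚ_[p])+1)⁻¹)^2)) =
    φ n^2 - β^2 * coeff n v^2 + β^2 * (coeff n v^2 - (ε * c^n - 2 * α^2 * ∑ i ∈ range n, c^(n-i) * (φ i^2 * ((2*(i:ℚ_[p])+1)⁻¹)^2))) := by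
    rw [← hαβ]; ring
  rw [e]; exact this
end
end Z7
end

section
open Finset
set_option linter.unusedSectionVars false
set_option linter.unusedSimpArgs false
set_option linter.unusedVariables false
namespace Z7
section
variable {K : Type*} [Field K] [CharZero K]
/-- `∏_{l<k} (1 - x²/(2l+1)²)` -/
def Qk (k : ℕ) (x : K) : K := ∏ l ∈ range k, (1 - x^2/(2*(l:K)+1)^2)

theorem Qk_succ (k : ℕ) (x : K) : Qk (k+1) x = Qk k x * (1 - x^2/(2*(k:K)+1)^2) := by
  rw [Qk, prod_range_succ, ← Qk]

theorem Qk_shift (n k : ℕ) : Qk k (2*(n:K)+3) * (n+1-k) = (n+k+1) * Qk k (2*(n:K)+1) := by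
  induction k with
  | zero => simp [Qk]
  | succ k ih =>
    rw [Qk_succ, Qk_succ]
    have h := odd_ne (K := K) k
    have e1 : (1 - (2*(n:K)+3)^2/(2*(k:K)+1)^2) = -4*(n+1-k)*(n+k+2)/(2*k+1)^2 := by field_simp; ring
    have e2 : (1 - (2*(n:K)+1)^2/(2*(k:K)+1)^2) = -4*(n-k)*(n+k+1)/(2*k+1)^2 := by field_simp; ring
    rw [e1, e2]; push_cast
    linear_combination (-4*(n+k+2)*(n-k)/(2*k+1)^2) * ih

theorem Qk_sum (n k : ℕ) : (2*(k:K)+1) * ∑ i ∈ range n, Qk k (2*(i:K)+1) = (n-k) * Qk k (2*(n:K)+1) := by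
  induction n with
  | zero =>
    rcases k with _ | k
    · simp
    · simp only [range_zero, sum_empty, mul_zero]
      have : Qk (k+1) (2*((0:ℕ):K)+1) = 0 := by
        apply prod_eq_zero (i := 0) (by simp); simp
      rw [this, mul_zero]
  | succ n ih =>
    rw [sum_range_succ, mul_add, ih]
    have := Qk_shift (K := K) n k
    have e : 2*((n+1:ℕ):K)+1 = 2*(n:K)+3 := by push_cast; ring
    rw [e]; push_cast; linear_combination -this

theorem Qk_zero {i k : ℕ} (h : i < k) : Qk k (2*(i:K)+1) = 0 := by
  apply prod_eq_zero (i := i) (by simpa using h)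
  have := odd_ne (K := K) i
  rw [div_self (pow_ne_zero 2 this), sub_self]

theorem P_sq {i n : ℕ} (h : i ≤ n) : ph7 K i^2 = 448^i * ∑ k ∈ range (n+1), (cb k : K)^3 / 4096^k * Qk k (2*(i:K)+1) := by
  rw [ph7_sq, mul_sum]
  rw [← sum_subset (range_subset_range.2 (by omega : i+1 ≤ n+1))]
  · refine sum_congr rfl fun k hk => ?_
    have hk' : k ≤ i := by have := mem_range.1 hk; omega
    have := choose_prod (K := K) i k
    rw [← Qk] at this
    have e1 : (4096:K)^k = (-16)^k * (-256)^k := by rw [← mul_pow]; norm_num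
    have e2 : (448:K)^i = 448^(i-k) * 448^k := by rw [← pow_add]; congr 1; omega
    have e3 : (448:K)^k = (-7/4)^k * (-256)^k := by rw [← mul_pow]; norm_num
    have h1 : (-16:K)^k ≠ 0 := pow_ne_zero _ (by norm_num)
    have h2 : (-256:K)^k ≠ 0 := pow_ne_zero _ (by norm_num)
    rw [e1, e2, e3, al]
    push_cast
    field_simp
    linear_combination (cb k:K)^2 * this
  · intro k hk hk'
    have : i < k := by simp at hk'; omega
    rw [Qk_zero this, mul_zero, mul_zero]
end

section
variable {p : ℕ} [hp : Fact p.Prime]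

def Os (K : Type*) [Field K] (k : ℕ) : K := ∑ l ∈ range k, ((2*(l:K)+1)⁻¹)^2

theorem V_Os {n k : ℕ} (hn : p = 2*n+1) (h : k ≤ n) : V p 0 (Os ℚ_[p] k) :=
  V_sum _ _ fun l hl => (V_inv_odd hn (by have := mem_range.1 hl; omega)).pow 2

theorem Qk_p {n k : ℕ} (hn : p = 2*n+1) (h : k ≤ n) : V p 3 (Qk k (p:ℚ_[p]) - (1 - p^2 * Os ℚ_[p] k)) := by
  induction k with
  | zero => simp [Qk, Os]; exact V_zero 3
  | succ k ih =>
    have h1 := ih (by omega)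
    have hI := V_inv_odd hn (show k < n by omega)
    have h2 := V_prod_one hn (show k ≤ n by omega)
    rw [← Qk] at h2
    rw [Qk_succ, Os, sum_range_succ, ← Os]
    set q := (2*(k:ℚ_[p])+1)⁻¹ with hq
    have e : Qk k (p:ℚ_[p]) * (1 - (p:ℚ_[p])^2/(2*(k:ℚ_[p])+1)^2) - (1 - (p:ℚ_[p])^2 * (Os ℚ_[p] k + q^2))
      = (Qk k (p:ℚ_[p]) - (1 - p^2 * Os ℚ_[p] k)) - p^2 * (q^2 * (Qk k (p:ℚ_[p]) - 1)) := by
      rw [div_eq_mul_inv, ← inv_pow, ← hq]; ring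
    rw [e]
    exact h1.sub (((V_ppow 2).mul ((hI.pow 2).mulL h2)).mono (by omega))

/-- `s_k` -/
def sk (K : Type*) [Field K] (n k : ℕ) : K := ∑ i ∈ range n, ((2*(i:K)+1)⁻¹)^2 * Qk k (2*(i:K)+1)

theorem sk_step {n k : ℕ} (hn : p = 2*n+1) (hp2 : p ≠ 2) (h : k < n) :
    V p 1 (2 * sk ℚ_[p] n (k+1) - 2 * sk ℚ_[p] n k - ((2*(k:ℚ_[p])+1)⁻¹)^2) := by
  have hI := V_inv_odd hn h
  have hne := odd_ne (K := ℚ_[p]) k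
  have h2 := V_prod_one hn (show k ≤ n by omega)
  rw [← Qk] at h2
  have hs := Qk_sum (K := ℚ_[p]) n k
  rw [← p_eq hn] at hs
  set q := (2*(k:ℚ_[p])+1)⁻¹ with hq
  have hqq : q * (2*(k:ℚ_[p])+1) = 1 := inv_mul_cancel₀ hne
  have e1 : sk ℚ_[p] n (k+1) - sk ℚ_[p] n k = - q^2 * ∑ i ∈ range n, Qk k (2*(i:ℚ_[p])+1) := by
    rw [sk, sk, ← sum_sub_distrib, mul_sum]
    refine sum_congr rfl fun i _ => ?_
    have := odd_ne (K := ℚ_[p]) i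
    rw [Qk_succ, hq]
    field_simp
    ring
  have e2 : 2 * sk ℚ_[p] n (k+1) - 2 * sk ℚ_[p] n k - q^2 = q^2 * (Qk k (p:ℚ_[p]) - 1) - p * (q^3 * Qk k (p:ℚ_[p])) := by
    have hp' := p_eq hn
    linear_combination 2 * e1 - 2*q^3 * hs + (q^3 * Qk k (p:ℚ_[p])) * hp' + (q^2 * Qk k (p:ℚ_[p]) + 2 * q^2 * ∑ i ∈ range n, Qk k (2*(i:ℚ_[p])+1)) * hqq
  rw [e2]
  have hQ : V p 0 (Qk k (p:ℚ_[p])) := by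
    have : Qk k (p:ℚ_[p]) = (Qk k (p:ℚ_[p]) - 1) + 1 := by ring
    rw [this]; exact (h2.mono (by omega)).add V_one
  exact ((hI.pow 2).mulL (h2.mono (by omega))).sub (V_p.mulR ((hI.pow 3).mulL hQ))

theorem sk_val {n k : ℕ} (hn : p = 2*n+1) (hp2 : p ≠ 2) (hp3 : p ≠ 3) (h : k ≤ n) :
    V p 1 (2 * sk ℚ_[p] n k - Os ℚ_[p] k) := by
  have h1 : ∀ k ≤ n, V p 1 (2 * sk ℚ_[p] n k - 2 * sk ℚ_[p] n 0 - Os ℚ_[p] k) := by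
    intro k
    induction k with
    | zero => intro _; simp [Os]; exact V_zero 1
    | succ k ih =>
      intro hk
      have := (ih (by omega)).add (sk_step hn hp2 (show k < n by omega))
      rw [Os, sum_range_succ, ← Os]
      have e : 2 * sk ℚ_[p] n (k+1) - 2 * sk ℚ_[p] n 0 - (Os ℚ_[p] k + ((2*(k:ℚ_[p])+1)⁻¹)^2) =
        (2 * sk ℚ_[p] n k - 2 * sk ℚ_[p] n 0 - Os ℚ_[p] k) + (2 * sk ℚ_[p] n (k+1) - 2 * sk ℚ_[p] n k - ((2*(k:ℚ_[p])+1)⁻¹)^2) := by ring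
      rw [e]; exact this
  have h0 : sk ℚ_[p] n 0 = Os ℚ_[p] n := by simp [sk, Os, Qk]
  have hz : sk ℚ_[p] n n = 0 := by
    apply sum_eq_zero; intro i hi
    rw [Qk_zero (mem_range.1 hi), mul_zero]
  have h3 := h1 n le_rfl
  rw [hz, h0] at h3
  have h4 : V p 1 (((3:ℕ):ℚ_[p]) * Os ℚ_[p] n) := by
    have : ((3:ℕ):ℚ_[p]) * Os ℚ_[p] n = -(2 * 0 - 2 * Os ℚ_[p] n - Os ℚ_[p] n) := by push_cast; ring
    rw [this]; exact h3.neg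
  have h5 := h4.cancel_nat (fun hd => hp3 ((Nat.prime_dvd_prime_iff_eq hp.out Nat.prime_three).1 hd))
  have := (h1 k h).add ((V_ofNat 2).mulL h5)
  rw [h0] at this
  have e : 2 * sk ℚ_[p] n k - Os ℚ_[p] k = 2 * sk ℚ_[p] n k - 2 * Os ℚ_[p] n - Os ℚ_[p] k + 2 * Os ℚ_[p] n := by ring
  rw [e]; exact this

theorem V_u (hp2 : p ≠ 2) (k : ℕ) : V p 0 ((cb k : ℚ_[p])^3 / 4096^k) := by
  have : (4096:ℚ_[p])^k = ((2^(12*k) : ℕ) : ℚ_[p]) := by push_cast; rw [pow_mul]; norm_num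
  rw [div_eq_mul_inv, this]
  exact ((V_nat _).pow 3).mulL (V_inv_nat (not_dvd_two_pow hp2 _))

theorem V_inv448 (hp2 : p ≠ 2) (hp7 : p ≠ 7) (k : ℕ) : V p 0 (((448:ℚ_[p])^k)⁻¹) := by
  have : (448:ℚ_[p])^k = ((448^k : ℕ) : ℚ_[p]) := by push_cast; rfl
  rw [this]
  apply V_inv_nat
  intro h
  have h := hp.out.dvd_of_dvd_pow h
  rw [show 448 = 2^6*7 by norm_num] at h
  rcases (hp.out.dvd_mul).1 h with h | h
  · exact not_dvd_two_pow hp2 6 h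
  · exact hp7 ((Nat.prime_dvd_prime_iff_eq hp.out (by norm_num)).1 h)

theorem S0_of_core {n : ℕ} (hn : p = 2*n+1) (hp2 : p ≠ 2) (hp3 : p ≠ 3) (hp7 : p ≠ 7) {β ε : ℚ_[p]}
    (h : V p 3 (ph7 ℚ_[p] n^2 - (ε * β^2 * 448^n - 2*p^2 * ∑ i ∈ range n, 448^(n-i) * (ph7 ℚ_[p] i^2 * ((2*(i:ℚ_[p])+1)⁻¹)^2)))) :
    V p 3 (Sm ℚ_[p] n 0 - ε * β^2) := by
  have e1 : ∑ i ∈ range n, (448:ℚ_[p])^(n-i) * (ph7 ℚ_[p] i^2 * ((2*(i:ℚ_[p])+1)⁻¹)^2)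
      = 448^n * ∑ k ∈ range (n+1), (cb k : ℚ_[p])^3 / 4096^k * sk ℚ_[p] n k := by
    simp only [sk, mul_sum]
    rw [sum_comm]
    refine sum_congr rfl fun i hi => ?_
    have hi' := mem_range.1 hi
    rw [P_sq (n := n) (by omega), mul_sum, sum_mul, mul_sum]
    refine sum_congr rfl fun k hk => ?_
    have : (448:ℚ_[p])^n = 448^(n-i) * 448^i := by rw [← pow_add]; congr 1; omega
    rw [this]; ring
  rw [e1, P_sq (n := n) le_rfl, ← p_eq hn] at h
  have h' := (V_inv448 hp2 hp7 n).mulL h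
  have hc : ((448:ℚ_[p])^n)⁻¹ * 448^n = 1 := inv_mul_cancel₀ (pow_ne_zero _ (by norm_num))
  set W := ((448:ℚ_[p])^n)⁻¹
  have h2 : V p 3 (∑ k ∈ range (n+1), (cb k : ℚ_[p])^3 / 4096^k * ((Qk k (p:ℚ_[p]) - (1 - p^2 * Os ℚ_[p] k)) + p^2 * (2 * sk ℚ_[p] n k - Os ℚ_[p] k))) := by
    refine V_sum _ _ fun k hk => ?_
    have hk' : k ≤ n := by have := mem_range.1 hk; omega
    exact (V_u hp2 k).mulL ((Qk_p hn hk').add ((V_ppow 2).mul (sk_val hn hp2 hp3 hk')))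
  have e2 : Sm ℚ_[p] n 0 = ∑ k ∈ range (n+1), (cb k : ℚ_[p])^3 / 4096^k := by
    simp [Sm]
  have h3 := h'.sub h2
  have e3 : ∑ k ∈ range (n+1), (cb k : ℚ_[p])^3 / 4096^k * ((Qk k (p:ℚ_[p]) - (1 - p^2 * Os ℚ_[p] k)) + p^2 * (2 * sk ℚ_[p] n k - Os ℚ_[p] k))
    = (∑ k ∈ range (n+1), (cb k : ℚ_[p])^3 / 4096^k * Qk k (p:ℚ_[p])) - Sm ℚ_[p] n 0 + 2*p^2 * ∑ k ∈ range (n+1), (cb k : ℚ_[p])^3 / 4096^k * sk ℚ_[p] n k := by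
    rw [e2, mul_sum, ← sum_sub_distrib, ← sum_add_distrib]
    refine sum_congr rfl fun k hk => ?_
    ring
  rw [e3] at h3
  refine (congrArg (V p 3) ?_).mp h3
  linear_combination ((∑ k ∈ range (n+1), (cb k : ℚ_[p])^3 / 4096^k * Qk k (p:ℚ_[p])) - ε * β^2 + 2*p^2 * ∑ k ∈ range (n+1), (cb k : ℚ_[p])^3 / 4096^k * sk ℚ_[p] n k) * hc
end
end Z7
end

section
open Finset
set_option linter.unusedSectionVars false
set_option linter.unusedSimpArgs false
set_option linter.unusedVariables false
namespace Z7
section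
variable {p : ℕ} [hp : Fact p.Prime]

theorem unit_fermat {z : ℤ_[p]} (hz : IsUnit z) : V p 1 ((z:ℚ_[p])^(p-1) - 1) := by
  have h : V p 1 (((z^(p-1) - 1 : ℤ_[p])) : ℚ_[p]) := by
    apply V_toZMod
    rw [map_sub, map_pow, map_one, ZMod.pow_card_sub_one_eq_one, sub_self]
    exact (hz.map PadicInt.toZMod).ne_zero
  push_cast at h; exact h

theorem V1_not_unit {x : ℚ_[p]} (h : V p 1 x) (h' : V p 0 x⁻¹) (hx : x ≠ 0) : False := by
  have := h.mulR h'
  rw [mul_inv_cancel₀ hx] at this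
  have h2 := V_nat_iff (p := p) (r := 1) (m := 1)
  rw [Nat.cast_one] at h2
  have := h2.1 this
  rw [pow_one] at this
  exact hp.out.one_lt.ne' (Nat.dvd_one.1 this)

theorem split_S0 {n : ℕ} (hn : p = 2*n+1) (hp2 : p ≠ 2) (hp3 : p ≠ 3) (hp7 : p ≠ 7) {θ w b : ℤ_[p]} (hθ : θ^2 = -7)
    {α : ℚ_[p]} (hw : IsUnit w) (hwb : w * b = 1) (hα : α = p * w)
    (hE : ∃ A D : Polynomial ℚ_[p], A.natDegree ≤ n ∧ D.natDegree ≤ n ∧ D.coeff 0 ≠ 0 ∧ ODE α A D) :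
    V p 3 (Sm ℚ_[p] n 0 - (-1)^n * (b:ℚ_[p])^2) := by
  obtain ⟨A, D, hA, hD, hD0, h⟩ := hE
  obtain ⟨A, D, hA, hD, hD0, hco, h, hA0, hA1, hD1, hAn⟩ := normalize hn hp2 hp3 hp7 hw hα hA hD hD0 h
  have hα0 : α ≠ 0 := by
    rw [hα]; apply mul_ne_zero
    · exact_mod_cast hp.out.ne_zero
    · intro h0; exact hw.ne_zero (PadicInt.ext (by rw [h0, PadicInt.coe_zero]))
  have hAn0 : A.coeff n ≠ 0 := by
    intro h0; rw [h0] at hAn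
    apply V1_not_unit (p := p) hAn
    · norm_num; exact V_one.neg
    · norm_num
  obtain ⟨ε, hε, h1, h2⟩ := symm_rel hα0 hA hD h hD0 hAn0 hco
  have hwb' : (w:ℚ_[p]) * b = 1 := by exact_mod_cast congrArg (fun z : ℤ_[p] => (z:ℚ_[p])) hwb
  have core := split_core hn hp2 hp3 (V_padic b) (by rw [hα, mul_assoc, hwb', mul_one]) (by rw [hα]; exact V_p.mulR (V_padic w))
    hD0 h hA0 hA1 hD1 h1 h2
  have S := S0_of_core hn hp2 hp3 hp7 core
  suffices hs : ε = (-1)^n by rw [hs] at S; exact S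
  have h8 : IsUnit (8*θ) := by
    have : IsUnit ((448:ℕ) : ℤ_[p]) := by
      apply isUnit_nat
      intro hd
      rw [show 448 = 2^6*7 by norm_num] at hd
      rcases (hp.out.dvd_mul).1 hd with h | h
      · exact not_dvd_two_pow hp2 6 h
      · exact hp7 ((Nat.prime_dvd_prime_iff_eq hp.out (by norm_num)).1 h)
    have e : ((448:ℕ) : ℤ_[p]) = (8*θ) * (-(8*θ)) := by push_cast; linear_combination 64*hθ
    rw [e] at this
    exact isUnit_of_mul_isUnit_left this
  have hf := unit_fermat h8
  have hθ' : (θ:ℚ_[p])^2 = -7 := by exact_mod_cast congrArg (fun z : ℤ_[p] => (z:ℚ_[p])) hθ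
  have hnp : p - 1 = 2*n := by omega
  rw [hnp, pow_mul] at hf
  have e8 : ((8*θ : ℤ_[p]) : ℚ_[p]) = 8 * (θ:ℚ_[p]) := by
    rw [PadicInt.coe_mul]; rfl
  rw [e8] at hf
  rw [mul_pow, hθ', show ((8:ℚ_[p])^2 * -7) = -448 by norm_num, neg_pow] at hf
  rw [h1] at hAn
  have hd := (V_inv448 hp2 hp7 n).mulL (hAn.sub hf)
  have hc : ((448:ℚ_[p])^n)⁻¹ * 448^n = 1 := inv_mul_cancel₀ (pow_ne_zero _ (by norm_num))
  have e : ((448:ℚ_[p])^n)⁻¹ * (ε * 448^n - 1 - ((-1)^n * 448^n - 1)) = ε - (-1)^n := by linear_combination (ε - (-1)^n)*hc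
  rw [e] at hd
  by_contra hne
  apply V1_not_unit hd _ (sub_ne_zero.2 hne)
  have h12 : ε - (-1)^n = 2 ∨ ε - (-1)^n = -2 := by
    rcases hε with rfl | rfl <;> rcases neg_one_pow_eq_or ℚ_[p] n with h | h <;> rw [h] at hne ⊢ <;> first | (norm_num; done) | (exfalso; exact hne rfl)
  rcases h12 with h | h <;> rw [h]
  · exact V_half hp2
  · rw [inv_neg]; exact (V_half hp2).neg

theorem hensel7 {x y : ℤ_[p]} (hp2 : p ≠ 2) (hx : IsUnit x) (hy : IsUnit y) (h : (p:ℤ_[p]) ∣ x^2 + 7*y^2) : ∃ θ : ℤ_[p], θ^2 = -7 := by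
  obtain ⟨y', hy'⟩ := hy.exists_right_inv
  have hy'u : IsUnit y' := IsUnit.of_mul_eq_one_right y hy'
  have h2 : IsUnit (2 : ℤ_[p]) := by
    have := isUnit_nat (p := p) (m := 2) (by have := not_dvd_two_pow hp2 1; simpa using this)
    exact_mod_cast this
  have hn : ‖(Polynomial.X^2 + Polynomial.C 7 : Polynomial ℤ_[p]).aeval (x*y')‖ < ‖(Polynomial.derivative (Polynomial.X^2 + Polynomial.C 7 : Polynomial ℤ_[p])).aeval (x*y')‖^2 := by
    have e1 : (Polynomial.X^2 + Polynomial.C 7 : Polynomial ℤ_[p]).aeval (x*y') = (x^2+7*y^2)*y'^2 := by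
      simp
      linear_combination (-7 * (1 + y*y')) * hy'
    have e2 : (Polynomial.derivative (Polynomial.X^2 + Polynomial.C 7 : Polynomial ℤ_[p])).aeval (x*y') = 2*(x*y') := by
      simp
      left; norm_num
    rw [e1, e2, PadicInt.isUnit_iff.1 (h2.mul (hx.mul hy'u)), one_pow]
    have : (p:ℤ_[p]) ∣ (x^2+7*y^2)*y'^2 := h.mul_right _
    rw [PadicInt.norm_lt_one_iff_dvd]; exact this
  obtain ⟨z, hz, -⟩ := hensels_lemma hn
  refine ⟨z, ?_⟩
  simp at hz
  linear_combination hz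

theorem isUnit_int {m : ℤ} (h : ¬ (p:ℤ) ∣ m) : IsUnit (m : ℤ_[p]) := by
  rw [PadicInt.isUnit_iff]
  have h1 := PadicInt.norm_int_lt_one_iff_dvd (p := p) m
  rcases (PadicInt.norm_le_one (m:ℤ_[p])).lt_or_eq with h2 | h2
  · exact absurd (h1.1 h2) h
  · exact h2

theorem padic_dvd_or_unit (z : ℤ_[p]) : (p:ℤ_[p]) ∣ z ∨ IsUnit z := by
  rcases (PadicInt.norm_le_one z).lt_or_eq with h2 | h2
  · left; exact PadicInt.norm_lt_one_iff_dvd z |>.1 h2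
  · right; exact PadicInt.isUnit_iff.2 h2

theorem setup {x y : ℤ} (hp2 : p ≠ 2) (hp7 : p ≠ 7) (h : (p:ℤ) = x^2+7*y^2) :
    ¬ (p:ℤ) ∣ x ∧ ∃ θ w b : ℤ_[p], θ^2 = -7 ∧ w * b = 1 ∧ (x:ℤ_[p]) + y*θ = p * w ∧ (x:ℤ_[p]) - y*θ = b := by
  have hpz : Prime (p:ℤ) := Nat.prime_iff_prime_int.1 hp.out
  have hp0 : (p:ℤ) ≠ 0 := hpz.ne_zero
  have hxy : ¬ ((p:ℤ) ∣ x ∧ (p:ℤ) ∣ y) := by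
    rintro ⟨⟨a, rfl⟩, ⟨b, rfl⟩⟩
    have : (p:ℤ) * (p * (a^2+7*b^2)) = p * 1 := by linear_combination -h
    have := mul_left_cancel₀ hp0 this
    exact hpz.not_isUnit (IsUnit.of_mul_eq_one _ this)
  have hy : ¬ (p:ℤ) ∣ y := fun hy => hxy ⟨hpz.dvd_of_dvd_pow (n := 2) (by
    have : x^2 = p - y * (7*y) := by rw [h]; ring
    rw [this]; exact dvd_sub_self_left.2 (hy.mul_right _)), hy⟩
  have hx : ¬ (p:ℤ) ∣ x := fun hx => by
    have : (p:ℤ) ∣ 7*y^2 := by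
      have : 7*y^2 = p - x * x := by rw [h]; ring
      rw [this]; exact dvd_sub_self_left.2 (hx.mul_right _)
    rcases hpz.dvd_mul.1 this with h7 | h7
    · apply hp7
      have : p ∣ 7 := by exact_mod_cast h7
      exact (Nat.prime_dvd_prime_iff_eq hp.out (by norm_num)).1 this
    · exact hy (hpz.dvd_of_dvd_pow h7)
  refine ⟨hx, ?_⟩
  have hz : (p:ℤ_[p]) = (x:ℤ_[p])^2 + 7*(y:ℤ_[p])^2 := by exact_mod_cast congrArg (fun z : ℤ => (z:ℤ_[p])) h
  obtain ⟨θ, hθ⟩ := hensel7 hp2 (isUnit_int hx) (isUnit_int hy) ⟨1, by rw [mul_one, hz]⟩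
  have hpp : Prime (p:ℤ_[p]) := PadicInt.prime_p
  have main : ∀ θ : ℤ_[p], θ^2 = -7 → (p:ℤ_[p]) ∣ (x:ℤ_[p]) + y*θ → ∃ θ w b : ℤ_[p], θ^2 = -7 ∧ w * b = 1 ∧ (x:ℤ_[p]) + y*θ = p * w ∧ (x:ℤ_[p]) - y*θ = b := by
    rintro θ hθ ⟨w, hw⟩
    refine ⟨θ, w, (x:ℤ_[p]) - y*θ, hθ, ?_, hw, rfl⟩
    apply mul_left_cancel₀ hpp.ne_zero
    rw [← mul_assoc, ← hw]
    linear_combination (-(y:ℤ_[p])^2)*hθ - hz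
  have : (p:ℤ_[p]) ∣ ((x:ℤ_[p]) + y*θ) * ((x:ℤ_[p]) - y*θ) := ⟨1, by linear_combination (-(y:ℤ_[p])^2)*hθ - hz⟩
  rcases hpp.dvd_or_dvd this with h1 | h1
  · exact main θ hθ h1
  · exact main (-θ) (by rw [neg_sq, hθ]) (by convert h1 using 1; ring)

theorem Sm_nat_dvd {r : ℕ} (hp2 : p ≠ 2) (n j : ℕ) : V p 0 (Sm ℚ_[p] n j) := by
  refine V_sum _ _ fun k _ => ?_
  rw [mul_div_assoc]
  exact ((V_nat k).pow j).mulL (V_u hp2 k)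

theorem V_cancel_237 (hp2 : p ≠ 2) (hp3 : p ≠ 3) (hp7 : p ≠ 7) (a b c : ℕ) {r : ℕ} {x : ℚ_[p]} {m : ℕ} (hm : m = 2^a*3^b*7^c)
    (h : V p r ((m:ℚ_[p]) * x)) : V p r x := by
  apply h.cancel_nat
  rw [hm]
  intro hd
  rcases hp.out.dvd_mul.1 hd with hd | hd
  · rcases hp.out.dvd_mul.1 hd with hd | hd
    · exact not_dvd_two_pow hp2 a hd
    · exact hp3 ((Nat.prime_dvd_prime_iff_eq hp.out (by norm_num)).1 (hp.out.dvd_of_dvd_pow hd))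
  · exact hp7 ((Nat.prime_dvd_prime_iff_eq hp.out (by norm_num)).1 (hp.out.dvd_of_dvd_pow hd))

theorem split_final {n : ℕ} (hn : p = 2*n+1) (hp2 : p ≠ 2) (hp3 : p ≠ 3) (hp7 : p ≠ 7) {x y : ℤ} (h : (p:ℤ) = x^2+7*y^2)
    (hE : ∀ θ : ℚ_[p], θ^2 = -7 → ∃ A D : Polynomial ℚ_[p], A.natDegree ≤ n ∧ D.natDegree ≤ n ∧ D.coeff 0 ≠ 0 ∧ ODE ((x:ℚ_[p])+y*θ) A D) :
    V p 3 ((-1)^n * Sm ℚ_[p] n 2 - (43/1323*(x:ℚ_[p])^2 - 13/441*(p:ℚ_[p]) - (p:ℚ_[p])^2/(1323*(x:ℚ_[p])^2))) ∧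
    V p 3 ((-1)^n * Sm ℚ_[p] n 3 - (169/55566*(x:ℚ_[p])^2 - 31/74088*(p:ℚ_[p]) - 71*(p:ℚ_[p])^2/(444528*(x:ℚ_[p])^2))) := by
  obtain ⟨hx, θ, w, b, hθ, hwb, hα, hβ⟩ := setup hp2 hp7 h
  have hθ' : (θ:ℚ_[p])^2 = -7 := by exact_mod_cast congrArg (fun z : ℤ_[p] => (z:ℚ_[p])) hθ
  have hα' : (x:ℚ_[p]) + y*θ = p * w := by exact_mod_cast congrArg (fun z : ℤ_[p] => (z:ℚ_[p])) hα
  have hβ' : (x:ℚ_[p]) - y*θ = b := by exact_mod_cast congrArg (fun z : ℤ_[p] => (z:ℚ_[p])) hβ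
  have hwb' : (w:ℚ_[p]) * b = 1 := by exact_mod_cast congrArg (fun z : ℤ_[p] => (z:ℚ_[p])) hwb
  have h0 := split_S0 hn hp2 hp3 hp7 hθ (IsUnit.of_mul_eq_one b hwb) hwb hα' (hE θ hθ')
  have h1 := A2_padic hn hp2 hp3
  have hJ := J_padic hn hp2
  have hT := S_tele (K := ℚ_[p]) n
  rw [← p_eq hn] at hT
  have hs : ((-1:ℚ_[p])^n)^2 = 1 := by rw [← pow_mul, mul_comm, pow_mul]; simp
  have Vs : V p 0 ((-1:ℚ_[p])^n) := V_one.neg.pow n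
  have VS := fun j => Sm_nat_dvd (p := p) (r := 0) hp2 n j
  have v0 := VS 0
  have v1 := VS 1
  have v2 := VS 2
  have v3 := VS 3
  have Vu := V_u (p := p) hp2 n
  set s := (-1:ℚ_[p])^n
  set S0 := Sm ℚ_[p] n 0
  set S1 := Sm ℚ_[p] n 1
  set S2 := Sm ℚ_[p] n 2
  set S3 := Sm ℚ_[p] n 3
  set B : ℚ_[p] := (b:ℚ_[p])
  set W : ℚ_[p] := (w:ℚ_[p])
  have VB : V p 0 B := V_padic b
  have VW : V p 0 W := V_padic w
  have hPP : V p 0 (p:ℚ_[p]) := V_nat p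
  set P : ℚ_[p] := (p:ℚ_[p])
  -- S2
  have k2 : V p 3 (10584 * (s*S2) - (86*B^2 - 140*P + 54*(P*W)^2)) := by
    have key : B^2 * (10584 * (s*S2) - (86*B^2 - 140*P + 54*(P*W)^2)) =
       21 * (252 * (2 * S0 * S2 - S1^2) - 4 * S0 * S1 - S0^2 + P^2) 
        + (42*S1 + 5*S0 - 5*P*s) * (3 * (42*S1 + 5*P*s - 5*S0) + 2*S0)
        + (S0 - s*B^2) * (86*(S0 + s*B^2) - 140*P*s - 10584 * S2) := by
      linear_combination (86*B^4 - 140*P*B^2 + 75*P^2) * hs - 54*P^2*(W*B+1) * hwb'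
    have e : (10584 * (s*S2) - (86*B^2 - 140*P + 54*(P*W)^2)) = W^2 * (B^2 * (10584 * (s*S2) - (86*B^2 - 140*P + 54*(P*W)^2))) := by
      linear_combination (-(W*B+1) * (10584 * (s*S2) - (86*B^2 - 140*P + 54*(P*W)^2))) * hwb'
    rw [e, key]
    refine (VW.pow 2).mulL (((V_ofNat 21).mulL hJ).add (h1.mulR ?_) |>.add (h0.mulR ?_))
    · exact ((V_ofNat 3).mulL ((((V_ofNat 42).mulL v1).add (((V_ofNat 5).mulL hPP).mulL Vs)).sub ((V_ofNat 5).mulL v0))).add ((V_ofNat 2).mulL v0)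
    · exact (((V_ofNat 86).mulL (v0.add (Vs.mulL (VB.pow 2)))).sub (((V_ofNat 140).mulL hPP).mulL Vs)).sub ((V_ofNat 10584).mulL v2)
  have k3 : V p 3 (444528 * (s*S3) - (338*B^2 + 490*P + 54*(P*W)^2)) := by
    have e : (444528 * (s*S3) - (338*B^2 + 490*P + 54*(P*W)^2)) = (10584 * (s*S2) - (86*B^2 - 140*P + 54*(P*W)^2))
       + s * (126 * (42*S1 + 5*S0 - 5*P*s)) + s*(252 * (S0 - s*B^2)) - P^3 * (882 * s * ((cb n : ℚ_[p])^3 / 4096^n)) := by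
      linear_combination (882 * s) * hT + (252 * B^2 + 630*P) * hs
    rw [e]
    refine ((k2.add (Vs.mulL ((V_ofNat 126).mulL h1))).add (Vs.mulL ((V_ofNat 252).mulL h0))).sub ((V_ppow 3).mulR (((V_ofNat 882).mulL Vs).mulL Vu))
  -- x
  have hx2 : 2 * (x:ℚ_[p]) = P*W + B := by rw [← hα', ← hβ']; ring
  have hxI := V_inv_int (p := p) hx
  have hx0 : (x:ℚ_[p]) ≠ 0 := by
    have : x ≠ 0 := by rintro rfl; simp at hx
    exact_mod_cast this
  set Z := ((x:ℤ):ℚ_[p])⁻¹ with hZ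
  have hZx : Z * (x:ℚ_[p]) = 1 := inv_mul_cancel₀ hx0
  have k4 : V p 3 (P^2 * Z^2 - 4*(P*W)^2) := by
    have e : P^2 * Z^2 - 4*(P*W)^2 = P^3 * (- Z^2 * W^3 * (P*W + 2*B)) := by
      have hB4 : 4 * (x:ℚ_[p])^2 = (P*W+B)^2 := by rw [← hx2]; ring
      linear_combination (4*P^2*W^2*(Z*x+1)) * hZx - P^2*W^2*Z^2 * hB4 - P^2*Z^2*(W*B+1)*hwb'
    rw [e]
    exact (V_ppow 3).mulR ((((hxI.pow 2).neg).mulL (VW.pow 3)).mulL ((hPP.mulL VW).add ((V_ofNat 2).mulL VB)))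
  have x4 : 4 * (x:ℚ_[p])^2 = (P*W)^2 + B^2 + 2*P := by
    have hB4 : 4 * (x:ℚ_[p])^2 = (P*W+B)^2 := by rw [← hx2]; ring
    rw [hB4]; linear_combination 2*P*hwb'
  constructor
  · apply V_cancel_237 hp2 hp3 hp7 3 3 2 (m := 10584) (by norm_num)
    refine (congrArg (V p 3) ?_).mp (k2.add ((V_ofNat 8).mulL k4))
    have eZ : P^2/(1323*(x:ℚ_[p])^2) = P^2*Z^2/1323 := by rw [hZ]; field_simp
    rw [eZ]
    norm_num only
    linear_combination 86 * x4
  · apply V_cancel_237 hp2 hp3 hp7 4 4 3 (m := 444528) (by norm_num)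
    refine (congrArg (V p 3) ?_).mp (k3.add ((V_ofNat 71).mulL k4))
    have eZ : 71*P^2/(444528*(x:ℚ_[p])^2) = 71*P^2*Z^2/444528 := by rw [hZ]; field_simp
    rw [eZ]
    norm_num only
    linear_combination 338 * x4
end
end Z7
end

section
open Finset
set_option linter.unusedSectionVars false
set_option linter.unusedSimpArgs false
set_option linter.unusedVariables false
namespace Z7
section
open Polynomial
variable {K : Type*} [Field K]

/-- polynomial as rational function -/
noncomputable abbrev am (a : K[X]) : RatFunc K := algebraMap K[X] (RatFunc K) a

theorem am_ne {a : K[X]} (h : a ≠ 0) : am a ≠ 0 := RatFunc.algebraMap_ne_zero h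
theorem am_inj {a b : K[X]} (h : am a = am b) : a = b := RatFunc.algebraMap_injective K h

noncomputable def hgt (f : RatFunc K) : ℕ := max f.num.natDegree f.denom.natDegree

theorem hgt_le {A B : K[X]} (hB : B ≠ 0) {m : ℕ} (h1 : A.natDegree ≤ m) (h2 : B.natDegree ≤ m) : hgt (am A / am B) ≤ m := by
  by_cases hA : A = 0
  · subst hA
    simp [hgt]
  · refine max_le ((natDegree_le_of_dvd (RatFunc.num_div_dvd A hB) hA).trans h1)
      ((natDegree_le_of_dvd (RatFunc.denom_div_dvd A B) hB).trans h2)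

theorem rep (f : RatFunc K) : f = am f.num / am f.denom := (RatFunc.num_div_denom f).symm

theorem hgt_eq {A B : K[X]} (hB : B ≠ 0) (h : IsCoprime A B) : hgt (am A / am B) = max A.natDegree B.natDegree := by
  apply le_antisymm (hgt_le hB (le_max_left _ _) (le_max_right _ _))
  set f := am A / am B with hf
  have e : am A * am f.denom = am f.num * am B := by
    have h1 := rep f
    have hd := am_ne f.denom_ne_zero
    have hb := am_ne hB
    field_simp at h1 hf
    rw [← hf, ← h1]; ring
  rw [← map_mul, ← map_mul] at e
  have e := RatFunc.algebraMap_injective K e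
  have dA : A ∣ f.num := h.dvd_of_dvd_mul_right ⟨f.denom, e.symm⟩
  have dB : B ∣ f.denom := h.symm.dvd_of_dvd_mul_left ⟨f.num, by rw [e]; ring⟩
  by_cases hA : A = 0
  · subst hA
    have := natDegree_le_of_dvd dB f.denom_ne_zero
    simp [hgt]; right; exact this
  · have hn : f.num ≠ 0 := by
      intro h0; rw [h0, zero_mul] at e
      rcases mul_eq_zero.1 e with h | h
      · exact hA h
      · exact f.denom_ne_zero h
    exact max_le_max (natDegree_le_of_dvd dA hn) (natDegree_le_of_dvd dB f.denom_ne_zero)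

theorem deg_pair {a b c d : K[X]} {m : ℕ} (hb : b ≠ 0) (hd : d ≠ 0)
   (h1 : (b*d).natDegree ≤ m) (h2 : (a*c).natDegree ≤ m) (h3 : (a*d+c*b).natDegree ≤ m) :
   max a.natDegree b.natDegree + max c.natDegree d.natDegree ≤ m := by
  rw [natDegree_mul hb hd] at h1
  by_cases ha : a = 0
  · subst ha
    simp at h3 ⊢
    by_cases hc : c = 0
    · subst hc; simp; exact h1
    · rw [natDegree_mul hc hb] at h3
      omega
  by_cases hc : c = 0
  · subst hc
    simp at h3 ⊢
    rw [natDegree_mul ha hd] at h3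
    omega
  rw [natDegree_mul ha hc] at h2
  have e1 := natDegree_mul ha hd
  have e2 := natDegree_mul hc hb
  rcases lt_trichotomy (a*d).natDegree (c*b).natDegree with h | h | h
  · rw [natDegree_add_eq_right_of_natDegree_lt h] at h3
    omega
  · omega
  · rw [natDegree_add_eq_left_of_natDegree_lt h] at h3
    omega

theorem hgt_pair {x y : RatFunc K} {A B C : K[X]} (hA : A ≠ 0) {m : ℕ} (h1 : A.natDegree ≤ m) (h2 : B.natDegree ≤ m) (h3 : C.natDegree ≤ m)
    (hs : am A * (x + y) = am B) (hp : am A * (x * y) = am C) : hgt x + hgt y ≤ m := by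
  have hx := rep x
  have hy := rep y
  have cx := RatFunc.isCoprime_num_denom x
  have cy := RatFunc.isCoprime_num_denom y
  have nx := RatFunc.denom_ne_zero x
  have ny := RatFunc.denom_ne_zero y
  rw [hx, hy] at hs hp
  unfold hgt
  generalize x.num = a at *
  generalize x.denom = b at *
  generalize y.num = c at *
  generalize y.denom = d at *
  have nb := am_ne nx
  have nd := am_ne ny
  field_simp at hs hp
  simp only [← map_mul, ← map_add] at hs hp
  have hs := RatFunc.algebraMap_injective K hs
  have hp := RatFunc.algebraMap_injective K hp
  have d1 : b ∣ A * d * a := ⟨d * B - A * c, by linear_combination hs⟩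
  have d2 : b ∣ A * c * a := ⟨C * d, by linear_combination hp⟩
  have d1 := cx.symm.dvd_of_dvd_mul_right d1
  have d2 := cx.symm.dvd_of_dvd_mul_right d2
  have dA : b ∣ A := by
    obtain ⟨s, t, hst⟩ := cy
    have : A = s * (A * c) + t * (A * d) := by linear_combination (-A) * hst
    rw [this]; exact dvd_add (d2.mul_left _) (d1.mul_left _)
  obtain ⟨A', rfl⟩ := dA
  have hs' : A' * (a*d + c*b) = d * B := mul_left_cancel₀ nx (by linear_combination hs)
  have hp' : A' * (a * c) = d * C := mul_left_cancel₀ nx (by linear_combination hp)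
  have d3 : d ∣ A' * b * c := ⟨B - A' * a, by linear_combination hs'⟩
  have d4 : d ∣ A' * a * c := ⟨C, by linear_combination hp'⟩
  have d3 := cy.symm.dvd_of_dvd_mul_right d3
  have d4 := cy.symm.dvd_of_dvd_mul_right d4
  have dA : d ∣ A' := by
    obtain ⟨s, t, hst⟩ := cx
    have : A' = s * (A' * a) + t * (A' * b) := by linear_combination (-A') * hst
    rw [this]; exact dvd_add (d4.mul_left _) (d3.mul_left _)
  obtain ⟨e, rfl⟩ := dA
  have he : e ≠ 0 := by rintro rfl; simp at hA
  have eB : B = (a*d+c*b)*e := mul_left_cancel₀ ny (by linear_combination -hs')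
  have eC : C = (a*c)*e := mul_left_cancel₀ ny (by linear_combination -hp')
  have key : ∀ f : K[X], (f*e).natDegree ≤ m → f.natDegree ≤ m := fun f hf => by
    by_cases h0 : f = 0
    · subst h0; simp
    · rw [natDegree_mul h0 he] at hf; omega
  exact deg_pair nx ny (key _ (by convert h1 using 2; ring)) (key _ (eC ▸ h3)) (key _ (eB ▸ h2))

/-- lower bound for duplication -/
theorem hgt_dup {x z : RatFunc K} {f g : K[X] → K[X] → K[X]} {c : K} (hc : c ≠ 0)
    {a1 b1 a2 b2 : K[X]} (N M : K[X]) (hNM : IsCoprime N M) {F G : K[X]} (hG : G ≠ 0) {d : ℕ} (hz : z = am F / am G)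
    (ha1 : a1.natDegree ≤ 3*d) (hb1 : b1.natDegree ≤ 3*d) (ha2 : a2.natDegree ≤ 3*d) (hb2 : b2.natDegree ≤ 3*d)
    (h1 : a1 * F + b1 * G = Polynomial.C c * N^7) (h2 : a2 * F + b2 * G = Polynomial.C c * M^7)
    (hd : d = max N.natDegree M.natDegree) : 4*d ≤ hgt z := by
  have hu : IsUnit (Polynomial.C c) := isUnit_C.2 hc.isUnit
  have co : IsCoprime F G := by
    obtain ⟨s, t, hst⟩ := (hNM.pow (m := 7) (n := 7))
    obtain ⟨c', hc'⟩ := hu.exists_right_inv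
    refine ⟨c' * (s * a1 + t * a2), c' * (s * b1 + t * b2), ?_⟩
    linear_combination (c' * s) * h1 + (c' * t) * h2 + (Polynomial.C c * c') * hst + hc'
  rw [hz, hgt_eq hG co]
  have key : ∀ (a b N : K[X]), a.natDegree ≤ 3*d → b.natDegree ≤ 3*d → a * F + b * G = Polynomial.C c * N^7 → 7 * N.natDegree ≤ 3*d + max F.natDegree G.natDegree := by
    intro a b N ha hb h
    have e : (Polynomial.C c * N^7).natDegree = 7 * N.natDegree := by
      rw [natDegree_C_mul hc, natDegree_pow]
    rw [← e, ← h]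
    refine (natDegree_add_le _ _).trans (max_le (natDegree_mul_le.trans ?_) (natDegree_mul_le.trans ?_))
    · have := le_max_left F.natDegree G.natDegree; omega
    · have := le_max_right F.natDegree G.natDegree; omega
  have k1 := key _ _ _ ha1 hb1 h1
  have k2 := key _ _ _ ha2 hb2 h2
  omega

/-! derivation -/
noncomputable def drf (f : RatFunc K) : RatFunc K :=
  am (derivative f.num * f.denom - f.num * derivative f.denom) / am f.denom ^ 2

theorem drf_div (a : K[X]) {b : K[X]} (hb : b ≠ 0) : drf (am a / am b) = am (derivative a * b - a * derivative b) / am b ^ 2 := by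
  set f := am a / am b with hf
  unfold drf
  have nd := am_ne f.denom_ne_zero
  have nb := am_ne hb
  have e : am a * am f.denom = am f.num * am b := by
    have h1 := rep f
    field_simp at h1 hf
    rw [← hf, ← h1]; ring
  have e := RatFunc.algebraMap_injective K (by rw [map_mul, map_mul]; exact e : algebraMap K[X] (RatFunc K) (a * f.denom) = algebraMap K[X] (RatFunc K) (f.num * b))
  have e' := congrArg derivative e
  rw [derivative_mul, derivative_mul] at e'
  rw [div_eq_div_iff (pow_ne_zero _ nd) (pow_ne_zero _ nb)]
  rw [← map_pow, ← map_pow, ← map_mul, ← map_mul]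
  congr 1
  generalize f.num = N at *
  have hM := f.denom_ne_zero
  generalize f.denom = M at *
  linear_combination (derivative M * b + M * derivative b) * e - (b * M) * e'

theorem drf_add (f g : RatFunc K) : drf (f + g) = drf f + drf g := by
  have nf := f.denom_ne_zero
  have ng := g.denom_ne_zero
  have e : f + g = am (f.num * g.denom + g.num * f.denom) / am (f.denom * g.denom) := by
    have := am_ne nf
    have := am_ne ng
    conv_lhs => rw [rep f, rep g]
    simp only [map_add, map_mul]
    field_simp
  rw [e, drf_div _ (mul_ne_zero nf ng)]
  unfold drf
  have := am_ne nf
  have := am_ne ng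
  simp only [map_add, map_mul, derivative_mul, map_sub]
  field_simp
  ring

theorem drf_mul (f g : RatFunc K) : drf (f * g) = f * drf g + g * drf f := by
  have nf := f.denom_ne_zero
  have ng := g.denom_ne_zero
  have h1 := am_ne nf
  have h2 := am_ne ng
  have e : f * g = am (f.num * g.num) / am (f.denom * g.denom) := by
    conv_lhs => rw [rep f, rep g]
    simp only [map_add, map_mul]
    field_simp
  rw [e, drf_div _ (mul_ne_zero nf ng)]
  have e1 := rep f
  have e2 := rep g
  unfold drf
  generalize f.num = a at *
  generalize f.denom = b at *
  generalize g.num = c at *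
  generalize g.denom = d at *
  rw [e1, e2]
  simp only [map_add, map_mul, derivative_mul, map_sub]
  field_simp
  ring

theorem drf_am (a : K[X]) : drf (am a) = am (derivative a) := by
  have := drf_div a (b := 1) one_ne_zero
  simpa using this

structure IsDer {F : Type*} [CommRing F] (D : F → F) : Prop where
  add : ∀ a b, D (a+b) = D a + D b
  mul : ∀ a b, D (a*b) = a * D b + b * D a

theorem isDer_drf : IsDer (drf (K := K)) := ⟨drf_add, drf_mul⟩

namespace IsDer
variable {F : Type*} [CommRing F] {D : F → F}
theorem zero (h : IsDer D) : D 0 = 0 := by have := h.add 0 0; simpa using this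
theorem one (h : IsDer D) : D 1 = 0 := by have := h.mul 1 1; simpa using this
theorem neg (h : IsDer D) (a : F) : D (-a) = - D a := by
  have := h.add a (-a); rw [add_neg_cancel, h.zero] at this; linear_combination -this
theorem sub (h : IsDer D) (a b : F) : D (a - b) = D a - D b := by rw [sub_eq_add_neg, h.add, h.neg]; ring
theorem sq (h : IsDer D) (a : F) : D (a^2) = 2 * a * D a := by rw [pow_two, h.mul]; ring
theorem cube (h : IsDer D) (a : F) : D (a^3) = 3 * a^2 * D a := by rw [pow_succ, h.mul, h.sq]; ring
theorem nat (h : IsDer D) (m : ℕ) : D m = 0 := by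
  induction m with
  | zero => simpa using h.zero
  | succ k ih => rw [Nat.cast_succ, h.add, ih, h.one, add_zero]
end IsDer
end
end Z7
end

section
open Finset
set_option linter.unusedSectionVars false
set_option linter.unusedSimpArgs false
set_option linter.unusedVariables false
namespace Z7
section
variable {F : Type*} [Field F]

/-- the twisted curve -/
def WC (δ : F) : WeierstrassCurve.Affine F := ⟨0, -42*δ, 0, 448*δ^2, 0⟩

abbrev Pt (δ : F) := (WC δ).Point

def hC (x : F) : F := x^3 - 42*x^2 + 448*x

variable [CharZero F]

theorem WC_ns {δ : F} (hδ : δ ≠ 0) {x y : F} (h : δ*y^2 = hC x) : (WC δ).Nonsingular (δ*x) (δ^2*y) := by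
  have hΔ : (WC δ).Δ ≠ 0 := by
    have : (WC δ).Δ = -(16*28*448^2) * δ^6 := by
      simp only [WC, WeierstrassCurve.Δ, WeierstrassCurve.b₂, WeierstrassCurve.b₄, WeierstrassCurve.b₆, WeierstrassCurve.b₈]; ring
    rw [this]; exact mul_ne_zero (by norm_num) (pow_ne_zero _ hδ)
  apply (WeierstrassCurve.Affine.equation_iff_nonsingular_of_Δ_ne_zero hΔ).1
  rw [WeierstrassCurve.Affine.equation_iff]
  simp only [WC]
  unfold hC at h
  linear_combination δ^3 * h

def mkP {δ : F} (hδ : δ ≠ 0) (x y : F) (h : δ*y^2 = hC x) : Pt δ := .some (δ*x) (δ^2*y) (WC_ns hδ h)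

theorem pt_cases {δ : F} (hδ : δ ≠ 0) (R : Pt δ) : R = 0 ∨ ∃ x y h, R = mkP hδ x y h := by
  rcases R with _ | ⟨X, Y, h⟩
  · left; rfl
  · right
    refine ⟨X/δ, Y/δ^2, ?_, ?_⟩
    · have := h.1
      rw [WeierstrassCurve.Affine.equation_iff] at this
      simp only [WC] at this
      unfold hC
      field_simp
      linear_combination this
    · unfold mkP
      congr 1 <;> field_simp

theorem mkP_inj {δ : F} (hδ : δ ≠ 0) {x y x' y' : F} {h h'} : mkP hδ x y h = mkP hδ x' y' h' ↔ x = x' ∧ y = y' := by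
  unfold mkP
  rw [WeierstrassCurve.Affine.Point.some.injEq]
  constructor
  · rintro ⟨h1, h2⟩
    exact ⟨mul_left_cancel₀ hδ h1, mul_left_cancel₀ (pow_ne_zero 2 hδ) h2⟩
  · rintro ⟨rfl, rfl⟩; exact ⟨rfl, rfl⟩

theorem mkP_ne_zero {δ : F} (hδ : δ ≠ 0) {x y : F} {h} : mkP hδ x y h ≠ 0 := WeierstrassCurve.Affine.Point.some_ne_zero _

theorem neg_h {δ : F} {x y : F} (h : δ*y^2 = hC x) : δ*(-y)^2 = hC x := by rw [neg_sq]; exact h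

theorem mkP_neg {δ : F} (hδ : δ ≠ 0) {x y : F} {h} : -mkP hδ x y h = mkP hδ x (-y) (neg_h h) := by
  unfold mkP
  rw [WeierstrassCurve.Affine.Point.neg_some]
  congr 1
  simp [WeierstrassCurve.Affine.negY, WC]

variable [DecidableEq F]

theorem mkP_add {δ : F} (hδ : δ ≠ 0) {x y x' y' : F} {h h'} (hx : x ≠ x') {m x3 y3 : F} (hm : m * (x - x') = y - y')
   (h3 : x3 = δ*m^2 + 42 - x - x') (hy : y3 = -(m*(x3-x)+y)) : ∃ h'', mkP hδ x y h + mkP hδ x' y' h' = mkP hδ x3 y3 h'' := by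
  have hX : δ*x ≠ δ*x' := fun e => hx (mul_left_cancel₀ hδ e)
  have hxx := sub_ne_zero.2 hx
  have hsl : (WC δ).slope (δ*x) (δ*x') (δ^2*y) (δ^2*y') = δ*m := by
    rw [WeierstrassCurve.Affine.slope_of_X_ne hX, div_eq_iff (sub_ne_zero.2 hX)]
    linear_combination (-δ^2) * hm
  have e := WeierstrassCurve.Affine.Point.add_of_X_ne (h₁ := WC_ns hδ h) (h₂ := WC_ns hδ h') hX
  have eX : (WC δ).addX (δ*x) (δ*x') ((WC δ).slope (δ*x) (δ*x') (δ^2*y) (δ^2*y')) = δ*x3 := by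
    rw [hsl, h3]; simp only [WeierstrassCurve.Affine.addX, WC]; ring
  have eY : (WC δ).addY (δ*x) (δ*x') (δ^2*y) ((WC δ).slope (δ*x) (δ*x') (δ^2*y) (δ^2*y')) = δ^2*y3 := by
    unfold WeierstrassCurve.Affine.addY WeierstrassCurve.Affine.negAddY
    rw [eX, hsl, hy]; simp only [WeierstrassCurve.Affine.negY, WC]; ring
  have hh : δ*y3^2 = hC x3 := by
    unfold hC at *
    have key : x^2+x*x'+x'^2 - 42*(x+x')+448 = δ*m*(y+y') := by
      apply mul_left_cancel₀ hxx
      linear_combination (-1 : F) * h + h' - δ * (y+y') * hm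
    have k1 : (3*x^2-84*x+448) - 2*δ*m*y = (x-x')*(x-x3) := by rw [h3]; linear_combination key + δ*m*hm
    have hm3 : δ*m^2 = x3+x+x'-42 := by rw [h3]; ring
    rw [hy]
    linear_combination h - (x3-x)*k1 + (x3-x)^2*hm3
  refine ⟨hh, ?_⟩
  unfold mkP
  rw [e]
  congr 1

theorem mkP_dup {δ : F} (hδ : δ ≠ 0) {x y : F} {h} (hy0 : y ≠ 0) :
   ∃ y3 h'', mkP hδ x y h + mkP hδ x y h = mkP hδ ((x^2-448)^2/(4*hC x)) y3 h'' := by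
  have h2 : (2:F) ≠ 0 := by norm_num
  have hne : δ^2*y ≠ (WC δ).negY (δ*x) (δ^2*y) := by
    simp only [WeierstrassCurve.Affine.negY, WC]
    intro e
    have : 2 * (δ^2*y) = 0 := by linear_combination e
    rcases mul_eq_zero.1 this with h | h
    · exact h2 h
    · rcases mul_eq_zero.1 h with h | h
      · exact pow_ne_zero 2 hδ h
      · exact hy0 h
  have e := WeierstrassCurve.Affine.Point.add_self_of_Y_ne (h₁ := WC_ns hδ h) hne
  have hsl : (WC δ).slope (δ*x) (δ*x) (δ^2*y) (δ^2*y) = (3*x^2-84*x+448)/(2*y) := by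
    rw [WeierstrassCurve.Affine.slope_of_Y_ne rfl hne]
    simp only [WeierstrassCurve.Affine.negY, WC]
    rw [show δ ^ 2 * y - (-(δ ^ 2 * y) - 0 * (δ * x) - 0) = 2*δ^2*y by ring]
    field_simp
    ring
  obtain h0 | ⟨x3, y3, h3, e3⟩ := pt_cases hδ (mkP hδ x y h + mkP hδ x y h)
  · unfold mkP at h0; rw [e] at h0
    exact absurd h0 (WeierstrassCurve.Affine.Point.some_ne_zero _)
  · have e4 := e3
    unfold mkP at e4; rw [e, WeierstrassCurve.Affine.Point.some.injEq] at e4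
    have eX := e4.1
    rw [hsl] at eX
    simp only [WeierstrassCurve.Affine.addX, WC] at eX
    have hh : hC x ≠ 0 := by rw [← h]; exact mul_ne_zero hδ (pow_ne_zero 2 hy0)
    have : x3 = (x^2-448)^2/(4*hC x) := by
      rw [eq_div_iff (mul_ne_zero (by norm_num) hh), ← h]
      have e5 : ((3*x^2-84*x+448)/(2*y))^2 * (4*y^2) = (3*x^2-84*x+448)^2 := by field_simp; norm_num
      unfold hC at h
      linear_combination (-4*y^2) * eX + e5 + 4*(42-2*x)*h
    subst this
    exact ⟨y3, h3, e3⟩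

theorem mkP_dup0 {δ : F} (hδ : δ ≠ 0) {x : F} {h} : mkP hδ x 0 h + mkP hδ x 0 h = 0 := by
  unfold mkP
  exact WeierstrassCurve.Affine.Point.add_self_of_Y_eq (by simp [WeierstrassCurve.Affine.negY, WC])

/-- sum/difference formulas -/
theorem sumdiff {δ x y x' y' m m' x3 x4 : F} (h : δ*y^2 = hC x) (h' : δ*y'^2 = hC x') (hx : x ≠ x')
   (hm : m * (x-x') = y - y') (hm' : m' * (x-x') = y + y') (h3 : x3 = δ*m^2 + 42 - x - x') (h4 : x4 = δ*m'^2 + 42 - x - x') :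
   (x-x')^2*(x3+x4) = 2*(x*x'+448)*(x+x') - 168*(x*x') ∧ (x-x')^2*(x3*x4) = (x*x'-448)^2 := by
  have hxx := sub_ne_zero.2 hx
  unfold hC at *
  have e3 : (x-x')^2*x3 = δ*(y-y')^2 + (42-x-x')*(x-x')^2 := by rw [h3, ← hm]; ring
  have e4 : (x-x')^2*x4 = δ*(y+y')^2 + (42-x-x')*(x-x')^2 := by rw [h4, ← hm']; ring
  constructor
  · linear_combination e3 + e4 + 2*h + 2*h'
  · apply mul_left_cancel₀ (pow_ne_zero 2 hxx)
    have : (x - x') ^ 2 * ((x - x') ^ 2 * (x3 * x4)) = ((x-x')^2*x3)*((x-x')^2*x4) := by ring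
    rw [this, e3, e4]
    have hA : δ*(y-y')^2 = (x^3-42*x^2+448*x) + (x'^3-42*x'^2+448*x') - 2*(δ*y*y') := by linear_combination h + h'
    have hB : δ*(y+y')^2 = (x^3-42*x^2+448*x) + (x'^3-42*x'^2+448*x') + 2*(δ*y*y') := by linear_combination h + h'
    have hC : (δ*y*y')^2 = (x^3-42*x^2+448*x) * (x'^3-42*x'^2+448*x') := by rw [← h, ← h']; ring
    rw [hA, hB]
    linear_combination (-4)*hC

/-- derivation step -/
theorem der_step {D : F → F} (hD : IsDer D) {δ x y x' y' m x3 y3 l l' : F} (hδ : δ ≠ 0) (h : δ*y^2 = hC x) (h' : δ*y'^2 = hC x') (hx : x ≠ x')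
   (hy0 : y ≠ 0) (hy0' : y' ≠ 0)
   (hm : m * (x-x') = y - y') (h3 : x3 = δ*m^2 + 42 - x - x') (hy : y3 = -(m*(x3-x)+y)) (hl : D x = l*y) (hl' : D x' = l'*y') :
   D x3 = (l+l')*y3 := by
  have hxx := sub_ne_zero.2 hx
  have hc : ∀ m : ℕ, ∀ a, D (m*a) = m * D a := fun m a => by rw [hD.mul, hD.nat]; ring
  have h42 : D 42 = 0 := by exact_mod_cast hD.nat 42
  have c42 : ∀ a, D (42*a) = 42 * D a := fun a => by exact_mod_cast hc 42 a
  have c448 : ∀ a, D (448*a) = 448 * D a := fun a => by exact_mod_cast hc 448 a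
  have second : ∀ {x y l : F}, δ*y^2 = hC x → y ≠ 0 → D x = l*y → 2*δ*D y = (3*x^2-84*x+448)*l - D δ * y := by
    intro x y l h hy0 hl
    have e := congrArg D h
    unfold hC at e
    rw [hD.mul, hD.sq, hD.add, hD.sub, hD.cube, c42, hD.sq, c448, hl] at e
    apply mul_left_cancel₀ hy0
    linear_combination e
  have s1 := second h hy0 hl
  have s2 := second h' hy0' hl'
  have em := congrArg D hm
  rw [hD.mul, hD.sub, hD.sub, hl, hl'] at em
  unfold hC at h h'
  have key : x^2+x*x'+x'^2 - 42*(x+x')+448 = δ*m*(y+y') := by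
    apply mul_left_cancel₀ hxx
    linear_combination (-1 : F) * h + h' - δ * (y+y') * hm
  have hy' : y' = y - m * (x-x') := by linear_combination hm
  have e3 := congrArg D h3
  rw [hD.sub, hD.sub, hD.add, hD.mul, hD.sq, h42, hl, hl'] at e3
  have k1 : (3*x^2-84*x+448) - 2*δ*m*y = (x-x')*(x-x3) := by rw [h3]; linear_combination key + δ*m*hm
  have k2 : (3*x'^2-84*x'+448) - 2*δ*m*y' = (x'-x)*(x'-x3) := by rw [h3]; linear_combination key - δ*m*hm
  have dm : 2*δ*D m = l'*(x'-x3) + l*(x-x3) - D δ * m := by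
    apply mul_left_cancel₀ hxx
    linear_combination 2*δ*em + s1 - s2 + l * k1 - l' * k2 + D δ * hm
  rw [e3, hy]
  linear_combination m * dm - l' * hm
end
end Z7
end

section
open Finset
set_option linter.unusedSectionVars false
set_option linter.unusedSimpArgs false
set_option linter.unusedVariables false
namespace Z7
section
open Polynomial

def xi {F : Type*} [Field F] {δ : F} : Pt δ → F
  | .zero => 0
  | .some X _ _ => X/δ

variable {K : Type*} [Field K] [CharZero K]

instance : CharZero (RatFunc K) := charZero_of_injective_algebraMap (RatFunc.algebraMap_injective K |>.comp (C_injective) : Function.Injective ((algebraMap K[X] (RatFunc K)).comp C))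

theorem xi_mkP {F : Type*} [Field F] [CharZero F] {δ : F} (hδ : δ ≠ 0) {x y : F} {h} : xi (mkP hδ x y h) = x := by
  show δ*x/δ = x
  field_simp
theorem xi_zero {F : Type*} [Field F] {δ : F} : xi (0 : Pt δ) = 0 := rfl

noncomputable def hg {δ : RatFunc K} (R : Pt δ) : ℕ := hgt (xi R)

theorem hgt_zero : hgt (0 : RatFunc K) = 0 := by simp [hgt]
theorem hgt_const (c : K) : hgt (am (C c)) = 0 := by simp [hgt]
theorem hg_zero {δ : RatFunc K} : hg (0 : Pt δ) = 0 := hgt_zero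

theorem hg_neg {δ : RatFunc K} (hδ : δ ≠ 0) (R : Pt δ) : hg (-R) = hg R := by
  rcases pt_cases hδ R with rfl | ⟨x, y, h, rfl⟩
  · rfl
  · rw [mkP_neg]; unfold hg; rw [xi_mkP, xi_mkP]

theorem dle_mul {a b : K[X]} {i j k : ℕ} (h1 : a.natDegree ≤ i) (h2 : b.natDegree ≤ j) (hk : i + j ≤ k) : (a*b).natDegree ≤ k :=
  natDegree_mul_le.trans ((add_le_add h1 h2).trans hk)
theorem dle_add {a b : K[X]} {k : ℕ} (h1 : a.natDegree ≤ k) (h2 : b.natDegree ≤ k) : (a+b).natDegree ≤ k :=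
  natDegree_add_le_of_degree_le h1 h2
theorem dle_sub {a b : K[X]} {k : ℕ} (h1 : a.natDegree ≤ k) (h2 : b.natDegree ≤ k) : (a-b).natDegree ≤ k :=
  natDegree_sub_le_of_le h1 h2 |>.trans (by simp)
theorem dle_num (m : ℕ) {a : K[X]} {k : ℕ} (h1 : a.natDegree ≤ k) : ((m:K[X])*a).natDegree ≤ k :=
  dle_mul (i := 0) (by simp) h1 (by simp)
theorem dle_pow {a : K[X]} {i k : ℕ} (m : ℕ) (h1 : a.natDegree ≤ i) (hk : m*i ≤ k) : (a^m).natDegree ≤ k :=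
  (natDegree_pow_le).trans ((Nat.mul_le_mul_left m h1).trans hk)

theorem hg_dup_eq_zero {x : RatFunc K} {θ : K} (hθ : θ^2 = -7) (h : hC x = 0) : hgt x = 0 := by
  unfold hC at h
  have ht : am (C θ)^2 = -7 := by rw [← map_pow, ← C_pow, hθ, map_neg, map_neg, map_ofNat, map_ofNat]
  have : x * ((x - am (C (21+θ))) * (x - am (C (21-θ)))) = 0 := by
    simp only [map_add, map_sub, map_ofNat]
    linear_combination h - x*ht
  rcases mul_eq_zero.1 this with h | h
  · rw [h]; exact hgt_zero
  · rcases mul_eq_zero.1 h with h | h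
    · rw [sub_eq_zero.1 h]; exact hgt_const _
    · rw [sub_eq_zero.1 h]; exact hgt_const _

variable [DecidableEq (RatFunc K)]

theorem dup_data {x : RatFunc K} (hx : hC x ≠ 0) : 4 * hgt x ≤ hgt ((x^2-448)^2/(4*hC x)) ∧ hgt ((x^2-448)^2/(4*hC x)) ≤ 4 * hgt x := by
  have hr := rep x
  have co := RatFunc.isCoprime_num_denom x
  have hM := x.denom_ne_zero
  have hd : hgt x = max x.num.natDegree x.denom.natDegree := rfl
  generalize x.num = N at *
  generalize x.denom = M at *
  have hM' := am_ne hM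
  set d := hgt x
  have dN : N.natDegree ≤ d := by rw [hd]; exact le_max_left _ _
  have dM : M.natDegree ≤ d := by rw [hd]; exact le_max_right _ _
  set F := (N^2-(448:ℕ)*M^2)^2 with hF
  set G := (4:ℕ)*(N*M*(N^2-(42:ℕ)*(N*M)+(448:ℕ)*M^2)) with hG
  have eG : am G = 4 * hC x * am M^4 := by
    rw [hG, hr]; unfold hC
    simp only [map_mul, map_sub, map_add, map_pow, map_natCast]
    push_cast
    field_simp
  have eF : am F = (x^2-448)^2 * am M^4 := by
    rw [hF, hr]
    simp only [map_mul, map_sub, map_add, map_pow, map_natCast]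
    push_cast
    field_simp
  have nG : G ≠ 0 := by
    intro h0
    rw [h0] at eG; simp only [am, map_zero] at eG
    exact mul_ne_zero (mul_ne_zero (by norm_num) hx) (pow_ne_zero 4 hM') eG.symm
  have hz : (x^2-448)^2/(4*hC x) = am F / am G := by
    rw [eF, eG]
    have : (4:RatFunc K) ≠ 0 := by norm_num
    field_simp
  have d2 : (N^2).natDegree ≤ 2*d := dle_pow 2 dN le_rfl
  have d2' : (M^2).natDegree ≤ 2*d := dle_pow 2 dM le_rfl
  have dNM : (N*M).natDegree ≤ 2*d := dle_mul dN dM (by omega)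
  have m0 : (M^3).natDegree ≤ 3*d := dle_pow 3 dM le_rfl
  have m1 : (N*M^2).natDegree ≤ 3*d := dle_mul dN d2' (by omega)
  have m2 : (N^2*M).natDegree ≤ 3*d := dle_mul d2 dM (by omega)
  have m3 : (N^3).natDegree ≤ 3*d := dle_pow 3 dN le_rfl
  constructor
  · refine hgt_dup (x := x) (f := fun a b => a) (g := fun a b => a) (c := (22478848:K)) (by norm_num) N M co nG hz
      (a1 := ((483385147392:ℕ):K[X])*(N*M^2) - ((30211571712:ℕ):K[X])*(N^2*M) + ((22478848:ℕ):K[X])*N^3)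
      (b1 := ((201410478080:ℕ):K[X])*(N^2*M) + ((7552892928:ℕ):K[X])*N^3 - ((54139136507904:ℕ):K[X])*M^3 - ((1691848015872:ℕ):K[X])*(N*M^2))
      (a2 := ((112:ℕ):K[X])*M^3 - ((336:ℕ):K[X])*(N*M^2) + ((12:ℕ):K[X])*(N^2*M))
      (b2 := ((37632:ℕ):K[X])*M^3 + ((2240:ℕ):K[X])*(N*M^2) - ((42:ℕ):K[X])*(N^2*M) - ((3:ℕ):K[X])*N^3)
      ?_ ?_ ?_ ?_ ?_ ?_ hd
    · exact dle_add (dle_sub (dle_num _ m1) (dle_num _ m2)) (dle_num _ m3)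
    · exact dle_sub (dle_sub (dle_add (dle_num _ m2) (dle_num _ m3)) (dle_num _ m0)) (dle_num _ m1)
    · exact dle_add (dle_sub (dle_num _ m0) (dle_num _ m1)) (dle_num _ m2)
    · exact dle_sub (dle_sub (dle_add (dle_num _ m0) (dle_num _ m1)) (dle_num _ m2)) (dle_num _ m3)
    · rw [hF, hG, map_ofNat]; push_cast; ring
    · rw [hF, hG, map_ofNat]; push_cast; ring
  · rw [hz]
    apply hgt_le nG
    · exact dle_pow 2 (dle_sub d2 (dle_num _ d2')) (by omega)
    · exact dle_num _ (dle_mul dNM (dle_add (dle_sub d2 (dle_num _ dNM)) (dle_num _ d2')) (by omega))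

theorem hg_dup {δ : RatFunc K} (hδ : δ ≠ 0) {θ : K} (hθ : θ^2 = -7) (R : Pt δ) : hg (R+R) = 4 * hg R := by
  rcases pt_cases hδ R with rfl | ⟨x, y, h, rfl⟩
  · simp [hg_zero]
  · by_cases hy : y = 0
    · subst hy
      rw [mkP_dup0, hg_zero]; unfold hg; rw [xi_mkP, hg_dup_eq_zero hθ (by rw [← h]; ring)]
    · obtain ⟨y3, h3, e⟩ := mkP_dup hδ (h := h) hy
      rw [e]; unfold hg; rw [xi_mkP, xi_mkP]
      have := dup_data (x := x) (by rw [← h]; exact mul_ne_zero hδ (pow_ne_zero 2 hy))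
      omega

set_option maxHeartbeats 1000000 in
theorem par_aux {x x' x3 x4 : RatFunc K} (hxx : x - x' ≠ 0) (s1 : (x-x')^2*(x3+x4) = 2*(x*x'+448)*(x+x') - 168*(x*x')) (s2 : (x-x')^2*(x3*x4) = (x*x'-448)^2) :
   hgt x3 + hgt x4 ≤ 2*(hgt x + hgt x') := by
  have hr := rep x
  have hr' := rep x'
  have hM := x.denom_ne_zero
  have hM' := x'.denom_ne_zero
  have dN : x.num.natDegree ≤ hgt x := le_max_left _ _
  have dM : x.denom.natDegree ≤ hgt x := le_max_right _ _
  have dN' : x'.num.natDegree ≤ hgt x' := le_max_left _ _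
  have dM' : x'.denom.natDegree ≤ hgt x' := le_max_right _ _
  generalize x.num = N at *
  generalize x.denom = M at *
  generalize x'.num = N' at *
  generalize x'.denom = M' at *
  have aM := am_ne hM
  have aM' := am_ne hM'
  set d := hgt x
  set d' := hgt x'
  have q1 : (N*N').natDegree ≤ d+d' := dle_mul dN dN' le_rfl
  have q2 : (M*M').natDegree ≤ d+d' := dle_mul dM dM' le_rfl
  have q3 : (N*M').natDegree ≤ d+d' := dle_mul dN dM' le_rfl
  have q4 : (N'*M).natDegree ≤ d+d' := dle_mul dN' dM (by omega)
  have eA : am ((N*M'-N'*M)^2) = (x-x')^2 * am M^2 * am M'^2 := by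
    rw [hr, hr']; simp only [map_mul, map_sub, map_pow]; field_simp
  apply hgt_pair (A := (N*M'-N'*M)^2) (B := ((2:ℕ):K[X])*((N*N'+((448:ℕ):K[X])*(M*M'))*(N*M'+N'*M)) - ((168:ℕ):K[X])*((N*N')*(M*M'))) (C := (N*N'-((448:ℕ):K[X])*(M*M'))^2)
  · intro h0; rw [h0] at eA; simp only [am, map_zero] at eA
    exact mul_ne_zero (mul_ne_zero (pow_ne_zero 2 hxx) (pow_ne_zero 2 aM)) (pow_ne_zero 2 aM') eA.symm
  · exact dle_pow 2 (dle_sub q3 q4) (by omega)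
  · exact dle_sub (dle_num _ (dle_mul (dle_add q1 (dle_num _ q2)) (dle_add q3 q4) (by omega))) (dle_num _ (dle_mul q1 q2 (by omega)))
  · exact dle_pow 2 (dle_sub q1 (dle_num _ q2)) (by omega)
  · rw [eA]
    have : (x - x') ^ 2 * am M ^ 2 * am M' ^ 2 * (x3 + x4) = am M^2 * am M'^2 * (2 * (x * x' + 448) * (x + x') - 168 * (x * x')) := by rw [← s1]; ring
    rw [this, hr, hr']
    simp only [map_mul, map_sub, map_pow, map_add, map_natCast]; push_cast; field_simp
  · rw [eA]
    have : (x - x') ^ 2 * am M ^ 2 * am M' ^ 2 * (x3 * x4) = am M^2 * am M'^2 * (x * x' - 448)^2 := by rw [← s2]; ring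
    rw [this, hr, hr']
    simp only [map_mul, map_sub, map_pow, map_add, map_natCast]; push_cast; field_simp

theorem hg_par_le {δ : RatFunc K} (hδ : δ ≠ 0) {θ : K} (hθ : θ^2 = -7) (R S : Pt δ) : hg (R+S) + hg (R-S) ≤ 2 * (hg R + hg S) := by
  rcases pt_cases hδ R with rfl | ⟨x, y, h, rfl⟩
  · rw [zero_add, zero_sub, hg_neg hδ, hg_zero]; omega
  rcases pt_cases hδ S with rfl | ⟨x', y', h', rfl⟩
  · rw [add_zero, sub_zero, hg_zero]; omega
  by_cases hx : x = x'
  · subst hx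
    have : y = y' ∨ y = -y' := by
      apply sq_eq_sq_iff_eq_or_eq_neg.1
      apply mul_left_cancel₀ hδ; rw [h, h']
    rcases this with rfl | rfl
    · rw [sub_self, hg_dup hδ hθ, hg_zero]; omega
    · have e : mkP hδ x (-y') h = - mkP hδ x y' h' := by rw [mkP_neg]
      rw [e, neg_add_cancel, hg_zero, ← neg_add', hg_neg hδ, hg_neg hδ, hg_dup hδ hθ]; omega
  have hxx := sub_ne_zero.2 hx
  obtain ⟨m, hm⟩ : ∃ m, m * (x-x') = y-y' := ⟨(y-y')/(x-x'), by field_simp⟩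
  obtain ⟨m', hm'⟩ : ∃ m, m * (x-x') = y+y' := ⟨(y+y')/(x-x'), by field_simp⟩
  obtain ⟨x3, hx3⟩ : ∃ x3, x3 = δ*m^2+42-x-x' := ⟨_, rfl⟩
  obtain ⟨x4, hx4⟩ : ∃ x3, x3 = δ*m'^2+42-x-x' := ⟨_, rfl⟩
  obtain ⟨h3, e3⟩ := mkP_add hδ (h := h) (h' := h') hx hm hx3 rfl
  obtain ⟨h4, e4⟩ := mkP_add hδ (h := h) (h' := neg_h h') hx (by rw [hm']; ring) hx4 rfl
  rw [sub_eq_add_neg (mkP hδ x y h), mkP_neg, e3, e4]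
  unfold hg
  simp only [xi_mkP]
  obtain ⟨s1, s2⟩ := sumdiff h h' hx hm hm' hx3 hx4
  exact par_aux hxx s1 s2

theorem hg_par {δ : RatFunc K} (hδ : δ ≠ 0) {θ : K} (hθ : θ^2 = -7) (R S : Pt δ) : hg (R+S) + hg (R-S) = 2 * (hg R + hg S) := by
  apply le_antisymm (hg_par_le hδ hθ R S)
  have := hg_par_le hδ hθ (R+S) (R-S)
  rw [show R + S + (R - S) = R + R by abel, show R + S - (R - S) = S + S by abel, hg_dup hδ hθ, hg_dup hδ hθ] at this
  omega

theorem lin_zero {g : ℤ → ℤ} (h : ∀ k, g (k+1) + g (k-1) = 2 * g k) (h0 : g 0 = 0) (h1 : g 1 = 0) (k : ℤ) : g k = 0 := by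
  have key : ∀ m : ℕ, g m = 0 ∧ g (m+1) = 0 := by
    intro m; induction m with
    | zero => exact ⟨by simpa using h0, by simpa using h1⟩
    | succ j ih => 
      refine ⟨by simpa using ih.2, ?_⟩
      have := h (j+1); push_cast
      rw [ih.2, add_sub_cancel_right, ih.1] at this; linarith
  have key' : ∀ m : ℕ, g (-m) = 0 ∧ g (-m+1) = 0 := by
    intro m; induction m with
    | zero => exact ⟨by simpa using h0, by simpa using h1⟩
    | succ j ih =>
      have := h (-j)
      rw [ih.1, ih.2] at this
      refine ⟨?_, ?_⟩
      · push_cast; rw [show -((j:ℤ)+1) = -j - 1 by ring]; linarith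
      · push_cast; rw [show -((j:ℤ)+1)+1 = -j by ring]; exact ih.1
  obtain ⟨m, rfl | rfl⟩ := k.eq_nat_or_neg
  · exact (key m).1
  · exact (key' m).1

theorem hg_quad {δ : RatFunc K} (hδ : δ ≠ 0) {θ : K} (hθ : θ^2 = -7) {P Q : Pt δ} (hP : hg P = 1) (hQ : hg Q = 2) (hPQ : hg (P - Q) = 2) (a b : ℤ) :
    (hg (a•P+b•Q) : ℤ) = a^2 + a*b + 2*b^2 := by
  have par := fun R S : Pt δ => by
    have := hg_par hδ hθ R S
    have : (hg (R+S) : ℤ) + hg (R-S) = 2 * (hg R + hg S) := by exact_mod_cast this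
    exact this
  have hPQ' : hg (P + Q) = 4 := by have := hg_par hδ hθ P Q; omega
  have stepQ : ∀ (R : Pt δ) (b : ℤ), (hg (R + (b+1)•Q) : ℤ) + hg (R + (b-1)•Q) = 2 * hg (R + b•Q) + 4 := by
    intro R b
    have := par (R + b•Q) Q
    rw [hQ] at this
    rw [show R + (b+1)•Q = R + b•Q + Q by rw [add_smul, one_smul, add_assoc], show R + (b-1)•Q = R + b•Q - Q by rw [sub_smul, one_smul, add_sub_assoc], this]
    push_cast; ring
  have h0 : ∀ b : ℤ, (hg (b•Q) : ℤ) - 2*b^2 = 0 := by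
    apply lin_zero
    · intro k
      have := stepQ 0 k
      simp only [zero_add] at this
      linarith
    · simp [hg_zero]
    · rw [one_smul, hQ]; norm_num
  have h1 : ∀ b : ℤ, (hg (P + b•Q) : ℤ) - (1+b+2*b^2) = 0 := by
    apply lin_zero
    · intro k
      have := stepQ P k
      linarith
    · rw [zero_smul, add_zero, hP]; norm_num
    · rw [one_smul, hPQ']; norm_num
  have h2 : ∀ a : ℤ, (hg (a•P + b•Q) : ℤ) - (a^2+a*b+2*b^2) = 0 := by
    apply lin_zero
    · intro k
      have := par (k•P + b•Q) P
      rw [hP] at this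
      rw [show (k+1)•P + b•Q = k•P + b•Q + P by rw [add_smul, one_smul]; abel, show (k-1)•P + b•Q = k•P + b•Q - P by rw [sub_smul, one_smul]; abel]
      push_cast at this
      linarith
    · rw [zero_smul, zero_add]; have := h0 b; linarith
    · rw [one_smul]; have := h1 b; linarith
  have := h2 a; linarith
end
end Z7
end

section
open Finset
set_option linter.unusedSectionVars false
set_option linter.unusedSimpArgs false
set_option linter.unusedVariables false
namespace Z7
section
variable {F : Type*} [Field F] [CharZero F]

theorem Qeq {u w d d1 : F} (hw : w^2 = w - 2) (hu : u ≠ 0) (e1 : d1 = 1 - (22-2*w)*u) (h1 : d1 ≠ 0) (hd : d = u*(1-42*u+448*u^2)) :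
   d * ((1-(32-8*w)*u)*(1-(12+4*w)*u)/(w^3*u^2*d1^2))^2 = hC ((1-(32-8*w)*u)^2/(w^2*u*d1)) := by
  have hw0 : w ≠ 0 := by rintro rfl; norm_num at hw
  unfold hC
  rw [hd]
  field_simp
  subst e1
  grind

theorem PQx {u w d m d1 d2 : F} (hw : w^2 = w - 2) (hu : u ≠ 0) (e1 : d1 = 1 - (22-2*w)*u) (h1 : d1 ≠ 0) (e2 : d2 = 1 - (20+2*w)*u) (h2 : d2 ≠ 0) (hd : d = u*(1-42*u+448*u^2)) 
   (hx : (1/u - (1-(32-8*w)*u)^2/(w^2*u*d1)) ≠ 0)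
   (hm : m * (1/u - (1-(32-8*w)*u)^2/(w^2*u*d1)) = 1/u^2 + (1-(32-8*w)*u)*(1-(12+4*w)*u)/(w^3*u^2*d1^2)) :
   d * m^2 + 42 - 1/u - (1-(32-8*w)*u)^2/(w^2*u*d1) = (1-(24+8*w)*u)^2/((1-w)^2*u*d2) := by
  have hw0 : w ≠ 0 := by rintro rfl; norm_num at hw
  have hw1 : 1-w ≠ 0 := by
    intro h
    have : w = 1 := by linear_combination -h
    rw [this] at hw; norm_num at hw
  apply mul_left_cancel₀ (pow_ne_zero 2 hx)
  have : (1 / u - (1 - (32 - 8 * w) * u) ^ 2 / (w ^ 2 * u * d1)) ^ 2 * (d * m ^ 2 + 42 - 1 / u - (1 - (32 - 8 * w) * u) ^ 2 / (w ^ 2 * u * d1))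
    = d * (m*(1 / u - (1 - (32 - 8 * w) * u) ^ 2 / (w ^ 2 * u * d1)))^2 + (1 / u - (1 - (32 - 8 * w) * u) ^ 2 / (w ^ 2 * u * d1)) ^ 2 * (42 - 1 / u - (1 - (32 - 8 * w) * u) ^ 2 / (w ^ 2 * u * d1)) := by ring
  rw [this, hm, hd]
  generalize e3 : 1 - w = w1 at *
  field_simp
  subst e1 e2 e3
  clear hm this hx hw0 h1 h2 hd hw1 hu
  grind
end
section
open Polynomial
variable {K : Type*} [Field K] [CharZero K]

theorem am_pow (a : K[X]) (m : ℕ) : am (a^m) = am a^m := map_pow _ _ _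
theorem am_mul (a b : K[X]) : am (a*b) = am a * am b := map_mul _ _ _

theorem der1 (a : K) : derivative ((1 - C a * X)^2) = -2 * C a * (1 - C a * X) := by
  rw [pow_two, derivative_mul, derivative_sub, derivative_one, derivative_C_mul, derivative_X]; ring
theorem der2 (c e : K) : derivative (C c * X * (1 - C e * X)) = C c * (1 - 2 * C e * X) := by
  rw [mul_assoc, derivative_C_mul, derivative_mul, derivative_sub, derivative_one, derivative_C_mul, derivative_X]; ring

theorem am_C1 (a : K) : am (1 - C a * X) = 1 - am (C a) * am X := by simp [am]

theorem hgt_shape {a e c : K} (hc : c ≠ 0) (he : e ≠ 0) (hae : a ≠ e) :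
    hgt ((1 - am (C a) * am X)^2/(am (C c) * am X * (1 - am (C e) * am X))) = 2 := by
  have e1 : (1 - am (C a) * am X)^2/(am (C c) * am X * (1 - am (C e) * am X)) = am ((1 - C a * X)^2)/am (C c * X * (1 - C e * X)) := by
    simp [am]
  have q : C c * X * (1 - C e * X) = C (-(c*e)) * X^2 + C c * X + C 0 := by simp only [map_neg, map_mul, map_zero]; ring
  have hq : (C c * X * (1 - C e * X)).natDegree = 2 := by
    rw [q]; exact natDegree_quadratic (neg_ne_zero.2 (mul_ne_zero hc he))
  rw [e1, hgt_eq]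
  · rw [hq]
    apply max_eq_right
    apply dle_pow 2 (i := 1) _ (by norm_num)
    apply dle_sub (by simp)
    exact natDegree_mul_le.trans (by simp)
  · intro h; rw [h] at hq; simp at hq
  · apply IsCoprime.pow_left
    apply IsCoprime.mul_right
    · apply IsCoprime.mul_right
      · exact isCoprime_one_right.of_isCoprime_of_dvd_right (isUnit_C.2 (IsUnit.mk0 c hc)).dvd
      · exact ⟨1, C a, by ring⟩
    · have := sub_ne_zero.2 hae
      refine ⟨C (-e/(a-e)), C (a/(a-e)), ?_⟩
      have h1 : C (-e/(a-e)) + C (a/(a-e)) = 1 := by rw [← C_add, ← C_1]; congr 1; field_simp; ring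
      have h2 : C (-e/(a-e)) * C a + C (a/(a-e)) * C e = 0 := by rw [← C_mul, ← C_mul, ← C_add, ← C_0]; congr 1; field_simp; ring
      linear_combination h1 - X * h2

/-- good points -/
def Gd {δ : RatFunc K} (hδ : δ ≠ 0) (l : RatFunc K) (R : Pt δ) : Prop := ∃ x y h, R = mkP hδ x y h ∧ - drf x = l * y

theorem isDer_n : IsDer (fun f : RatFunc K => - drf f) :=
  ⟨fun a b => by rw [isDer_drf.add]; ring, fun a b => by rw [isDer_drf.mul]; ring⟩

theorem Gd_neg {δ : RatFunc K} {hδ : δ ≠ 0} {l : RatFunc K} {R : Pt δ} (h : Gd hδ l R) : Gd hδ (-l) (-R) := by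
  obtain ⟨x, y, h, rfl, h1⟩ := h
  exact ⟨x, -y, neg_h h, mkP_neg hδ, by rw [h1]; ring⟩

section
variable [DecidableEq (RatFunc K)]

theorem Gd_add {δ : RatFunc K} {hδ : δ ≠ 0} {l l' : RatFunc K} {R R' : Pt δ} (h : Gd hδ l R) (h' : Gd hδ l' R')
   (n1 : R - R' ≠ 0) (n2 : R + R' ≠ 0) (n3 : R + R ≠ 0) (n4 : R' + R' ≠ 0) : Gd hδ (l+l') (R + R') := by
  obtain ⟨x, y, h, rfl, d⟩ := h
  obtain ⟨x', y', h', rfl, d'⟩ := h'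
  have hx : x ≠ x' := by
    rintro rfl
    have : y = y' ∨ y = -y' := by
      apply sq_eq_sq_iff_eq_or_eq_neg.1
      apply mul_left_cancel₀ hδ; rw [h, h']
    rcases this with rfl | rfl
    · exact n1 (sub_self _)
    · apply n2
      have e : mkP hδ x (-y') h = - mkP hδ x y' h' := by rw [mkP_neg]
      rw [e, neg_add_cancel]
  have hy : y ≠ 0 := by rintro rfl; exact n3 (mkP_dup0 hδ)
  have hy' : y' ≠ 0 := by rintro rfl; exact n4 (mkP_dup0 hδ)
  have hxx := sub_ne_zero.2 hx
  obtain ⟨m, hm⟩ : ∃ m, m * (x-x') = y-y' := ⟨(y-y')/(x-x'), by field_simp⟩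
  obtain ⟨x3, hx3⟩ : ∃ x3, x3 = δ*m^2+42-x-x' := ⟨_, rfl⟩
  obtain ⟨y3, hy3⟩ : ∃ y3, y3 = -(m*(x3-x)+y) := ⟨_, rfl⟩
  obtain ⟨h3, e3⟩ := mkP_add hδ (h := h) (h' := h') hx hm hx3 hy3
  exact ⟨x3, y3, h3, e3, der_step (D := fun f => - drf f) isDer_n hδ h h' hx hy hy' hm hx3 hy3 d d'⟩

end
noncomputable def dl (K : Type*) [Field K] : RatFunc K := am (X * YY K)
theorem dl_eq : dl K = am X * (1 - 42*am X + 448*am X^2) := by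
  unfold dl YY; simp only [am, map_mul, map_add, map_sub, map_pow, map_one, map_ofNat]
theorem dl_ne : dl K ≠ 0 := by
  apply am_ne
  intro h
  have := congrArg (fun q => coeff q 1) h
  rw [show (1:ℕ) = 0 + 1 from rfl] at this
  simp only [coeff_X_mul, YY] at this
  simp at this

theorem u_ne : am (X : K[X]) ≠ 0 := am_ne X_ne_zero

theorem P_eq : dl K * (1/am X^2)^2 = hC (1/am (X:K[X])) := by
  have := u_ne (K := K)
  rw [dl_eq]; unfold hC; field_simp

noncomputable def PP (K : Type*) [Field K] [CharZero K] : Pt (dl K) := mkP dl_ne (1/am X) (1/am X^2) P_eq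

theorem hg_PP : hg (PP K) = 1 := by
  unfold hg PP; rw [xi_mkP]
  have : 1/am (X:K[X]) = am 1/am X := by simp [am]
  rw [this, hgt_eq X_ne_zero isCoprime_one_left]; simp

theorem Gd_PP : Gd dl_ne 1 (PP K) := by
  refine ⟨_, _, _, rfl, ?_⟩
  have : 1/am (X:K[X]) = am 1/am X := by simp [am]
  rw [this, drf_div _ X_ne_zero]
  simp [am]
  ring

theorem QQ_ex [DecidableEq (RatFunc K)] {θ : K} (hθ : θ^2 = -7) : ∃ Q : Pt (dl K), hg Q = 2 ∧ hg (PP K - Q) = 2 ∧ Gd dl_ne (am (C ((1+θ)/2))) Q := by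
  have hw0 : ((1+θ)/2)^2 = (1+θ)/2 - 2 := by field_simp; linear_combination hθ
  generalize (1+θ)/2 = w0 at *
  have h00 : w0 ≠ 0 := by rintro rfl; norm_num at hw0
  have h01 : w0 ≠ 1 := by rintro rfl; norm_num at hw0
  have hnat : ∀ a : ℚ, w0 ≠ a := by
    intro a h
    rw [h] at hw0
    have : a^2 = a - 2 := by exact_mod_cast hw0
    nlinarith [sq_nonneg (a-1/2)]
  set w := am (C w0) with hwd
  have hw : w^2 = w - 2 := by
    rw [hwd, ← map_pow, ← C_pow, hw0]; simp only [am, map_sub, map_ofNat]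
  have hw' : w ≠ 0 := am_ne (C_ne_zero.2 h00)
  have amc : ∀ a b : ℕ, am (C ((a:K)+b*w0)) = a + b * w := by
    intro a b; simp only [am, hwd, map_add, map_mul, map_natCast]
  have amd : ∀ a b : ℕ, am (C ((a:K)-b*w0)) = a - b * w := by
    intro a b; simp only [am, hwd, map_sub, map_mul, map_natCast]
  have a1 : am (C (22-2*w0)) = 22-2*w := by exact_mod_cast amd 22 2
  have a2 : am (C (32-8*w0)) = 32-8*w := by exact_mod_cast amd 32 8
  have a3 : am (C (20+2*w0)) = 20+2*w := by exact_mod_cast amc 20 2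
  have a4 : am (C (24+8*w0)) = 24+8*w := by exact_mod_cast amc 24 8
  have lin : ∀ c : K, am (1 - C c * X) ≠ 0 := by
    intro c; apply am_ne; intro h
    have := congrArg (fun q => coeff q 0) h
    simp at this
  have hu := u_ne (K := K)
  obtain ⟨d1, e1⟩ : ∃ d1, d1 = 1 - (22-2*w)*am X := ⟨_, rfl⟩
  obtain ⟨d2, e2⟩ : ∃ d2, d2 = 1 - (20+2*w)*am X := ⟨_, rfl⟩
  have h1 : d1 ≠ 0 := by rw [e1, ← a1, ← am_C1]; exact lin _
  have h2 : d2 ≠ 0 := by rw [e2, ← a3, ← am_C1]; exact lin _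
  have hQ := Qeq hw hu e1 h1 dl_eq
  have hgQ : hgt ((1-(32-8*w)*am X)^2/(w^2*am X*d1)) = 2 := by
    have := hgt_shape (a := 32-8*w0) (e := 22-2*w0) (c := w0^2) (pow_ne_zero 2 h00)
      (fun h => hnat 11 (by push_cast; linear_combination (-1/2)*h)) (fun h => hnat (10/6) (by push_cast; linear_combination (-1/6)*h))
    rwa [a1, a2, ← e1, C_pow, am_pow] at this
  have hgPQ : hgt ((1-(24+8*w)*am X)^2/((1-w)^2*am X*d2)) = 2 := by
    have := hgt_shape (a := 24+8*w0) (e := 20+2*w0) (c := (1-w0)^2) (pow_ne_zero 2 (sub_ne_zero.2 (Ne.symm h01)))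
      (fun h => hnat (-10) (by push_cast; linear_combination (1/2)*h)) (fun h => hnat (-4/6) (by push_cast; linear_combination (1/6)*h))
    rw [a3, a4, ← e2, C_pow, am_pow] at this
    simpa only [am, map_sub, map_one] using this
  refine ⟨mkP dl_ne _ _ hQ, ?_, ?_, _, _, hQ, rfl, ?_⟩
  · unfold hg; rw [xi_mkP]; exact hgQ
  · have hx : 1/am X ≠ (1-(32-8*w)*am X)^2/(w^2*am X*d1) := by
      intro h
      have g1 := hg_PP (K := K)
      unfold hg PP at g1; rw [xi_mkP, h, hgQ] at g1
      norm_num at g1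
    have hxx := sub_ne_zero.2 hx
    obtain ⟨m, hm⟩ : ∃ m, m * (1/am X - (1-(32-8*w)*am X)^2/(w^2*am X*d1)) = 1/am X^2 + (1-(32-8*w)*am X)*(1-(12+4*w)*am X)/(w^3*am X^2*d1^2) :=
      ⟨(1/am X^2 + (1-(32-8*w)*am X)*(1-(12+4*w)*am X)/(w^3*am X^2*d1^2))/(1/am X - (1-(32-8*w)*am X)^2/(w^2*am X*d1)), div_mul_cancel₀ _ hxx⟩
    have k := PQx hw hu e1 h1 e2 h2 dl_eq hxx hm
    obtain ⟨h3, e3⟩ := mkP_add dl_ne (h := P_eq) (h' := neg_h hQ) hx (m := m) (by rw [hm]; ring) k.symm rfl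
    rw [sub_eq_add_neg, mkP_neg]
    unfold PP
    rw [e3]; unfold hg; rw [xi_mkP]; exact hgPQ
  · have e : (1-(32-8*w)*am X)^2/(w^2*am X*d1) = am ((1 - C (32-8*w0) * X)^2)/am (C (w0^2) * X * (1 - C (22-2*w0) * X)) := by
      rw [am_pow, am_C1, a2, am_mul, am_C1, a1, am_mul, C_pow, am_pow, e1]
    rw [e, drf_div]
    · rw [der1, der2]
      simp only [map_mul, map_sub, map_pow, map_neg, map_one, map_ofNat]
      change -((-2 * (32 - 8 * w) * (1 - (32 - 8 * w) * am X) * (w^2 * am X * (1 - (22 - 2 * w) * am X)) -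
          (1 - (32 - 8 * w) * am X) ^ 2 * (w ^ 2 * (1 - 2 * (22 - 2 * w) * am X))) /
        (w ^ 2 * am X * (1 - (22 - 2 * w) * am X)) ^ 2) = _
      rw [← e1]
      generalize am (X : K[X]) = u at *
      clear_value w
      field_simp
      subst e1
      clear lin amc amd hQ hgQ hgPQ h1 h2 e a1 a2 a3 a4 hnat
      grind
    · refine mul_ne_zero (mul_ne_zero (C_ne_zero.2 (pow_ne_zero 2 h00)) X_ne_zero) (fun h => lin (22-2*w0) ?_)
      rw [h]; exact map_zero _
end
end Z7
end

section
open Finset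
set_option linter.unusedSectionVars false
set_option linter.unusedSimpArgs false
set_option linter.unusedVariables false
namespace Z7
section
open Polynomial
variable {K : Type*} [Field K] [CharZero K]

theorem nform_pos {a b : ℤ} (h : a ≠ 0 ∨ b ≠ 0) : a^2+a*b+2*b^2 ≠ 0 := by
  intro h0
  have : (2*a+b)^2 + 7*b^2 = 0 := by linear_combination 4*h0
  have hb : b = 0 := by
    by_contra hb; have := sq_nonneg (2*a+b); have := pow_pos (abs_pos.2 hb) 2; rw [sq_abs] at this; linarith
  subst hb
  have ha : a = 0 := by nlinarith
  subst ha; simp at h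

section
variable [DecidableEq (RatFunc K)]

theorem path {w : RatFunc K} {δ : RatFunc K} {hδ : δ ≠ 0} {P Q : Pt δ} (hP : Gd hδ 1 P) (hQ : Gd hδ w Q)
    (nz : ∀ a b : ℤ, (a ≠ 0 ∨ b ≠ 0) → a•P+b•Q ≠ 0) {a : ℤ} (ha : a ≠ 0) (b : ℤ) : Gd hδ (a+b*w) (a•P+b•Q) := by
  have add : ∀ {a b c d : ℤ}, Gd hδ (a+b*w) (a•P+b•Q) → Gd hδ (c+d*w) (c•P+d•Q) → (a ≠ 0 ∨ b ≠ 0) → (c ≠ 0 ∨ d ≠ 0) →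
     (a - c ≠ 0 ∨ b - d ≠ 0) → (a + c ≠ 0 ∨ b + d ≠ 0) → Gd hδ ((a+c:ℤ)+(b+d:ℤ)*w) ((a+c)•P+(b+d)•Q) := by
    intro a b c d h1 h2 n1 n2 n3 n4
    have e : (a+c)•P+(b+d)•Q = (a•P+b•Q) + (c•P+d•Q) := by rw [add_smul, add_smul]; abel
    have e' : (a-c)•P+(b-d)•Q = (a•P+b•Q) - (c•P+d•Q) := by rw [sub_smul, sub_smul]; abel
    have e2 : ∀ a b : ℤ, (a+a)•P+(b+b)•Q = (a•P+b•Q) + (a•P+b•Q) := by intro a b; rw [add_smul, add_smul]; abel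
    have := Gd_add h1 h2 (by rw [← e']; exact nz _ _ n3) (by rw [← e]; exact nz _ _ n4)
      (by rw [← e2]; exact nz _ _ (by omega)) (by rw [← e2]; exact nz _ _ (by omega))
    rw [e]
    convert this using 1
    push_cast; ring
  have p1 : Gd hδ ((1:ℤ)+(0:ℤ)*w) ((1:ℤ)•P+(0:ℤ)•Q) := by simpa using hP
  have p2 : Gd hδ ((-1:ℤ)+(0:ℤ)*w) ((-1:ℤ)•P+(0:ℤ)•Q) := by simpa using Gd_neg hP
  have q1 : Gd hδ ((0:ℤ)+(1:ℤ)*w) ((0:ℤ)•P+(1:ℤ)•Q) := by simpa using hQ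
  have q2 : Gd hδ ((0:ℤ)+(-1:ℤ)*w) ((0:ℤ)•P+(-1:ℤ)•Q) := by simpa using Gd_neg hQ
  have s1 : ∀ a : ℤ, Gd hδ (a+(1:ℤ)*w) (a•P+(1:ℤ)•Q) := by
    intro a
    induction a using Int.induction_on with
    | zero => exact q1
    | succ i ih => have := add ih p1 (by omega) (by omega) (by omega) (by omega); simpa only [add_zero] using this
    | pred i ih => have := add ih p2 (by omega) (by omega) (by omega) (by omega); simpa only [add_zero, ← sub_eq_add_neg] using this
  have s2 : ∀ b : ℤ, Gd hδ (a+(b+1:ℤ)*w) (a•P+(b+1:ℤ)•Q) := by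
    intro b
    induction b using Int.induction_on with
    | zero => simpa only [zero_add] using s1 a
    | succ i ih => have := add ih q1 (by omega) (by omega) (by omega) (by omega); simpa only [add_zero] using this
    | pred i ih =>
      have := add ih q2 (by omega) (by omega) (by omega) (by omega)
      rw [show (-(i:ℤ) + 1 + -1) = -(i:ℤ) - 1 + 1 by ring] at this
      simpa only [add_zero] using this
  have := s2 (b-1)
  rwa [sub_add_cancel] at this

theorem chord_sq {F : Type*} [Field F] {δ x y x' y' m x3 : F} (h : δ*y^2 = hC x) (h' : δ*y'^2 = hC x') (hx : x ≠ x')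
   (hm : m * (x-x') = y - y') (h3 : x3 = δ*m^2 + 42 - x - x') : x*x'*x3 = δ*(y-m*x)^2 := by
  have hxx := sub_ne_zero.2 hx
  unfold hC at *
  have key : x^2+x*x'+x'^2 - 42*(x+x')+448 = δ*m*(y+y') := by
    apply mul_left_cancel₀ hxx
    linear_combination (-1 : F) * h + h' - δ * (y+y') * hm
  rw [h3]
  linear_combination (-1:F)*h - x*key - x*δ*m*hm

theorem is_sq {R T : Pt (dl K)} (hR : R = PP K + (T + T)) (n0 : T + T ≠ 0 → (T+T)+(T+T) ≠ 0) (n1 : PP K - (T+T) ≠ 0) (n2 : PP K + (T+T) ≠ 0)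
   : ∃ s, am X * xi R = s^2 := by
  have hu := u_ne (K := K)
  have hδ := dl_ne (K := K)
  by_cases h0 : T + T = 0
  · rw [hR, h0, add_zero]; unfold PP; rw [xi_mkP]; exact ⟨1, by field_simp⟩
  · have n0 := n0 h0
    rcases pt_cases hδ T with rfl | ⟨x, y, h, rfl⟩
    · simp at h0
    have hy : y ≠ 0 := by rintro rfl; exact h0 (mkP_dup0 hδ)
    obtain ⟨x2, y3, h3, hx2, e⟩ : ∃ x2 y3 h3, x2 = (x^2-448)^2/(4*hC x) ∧ mkP hδ x y h + mkP hδ x y h = mkP hδ x2 y3 h3 := by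
      obtain ⟨y3, h3, e⟩ := mkP_dup hδ (h := h) hy
      exact ⟨_, _, _, rfl, e⟩
    rw [e] at n0 n1 n2 hR
    have hc : hC x ≠ 0 := by rw [← h]; exact mul_ne_zero hδ (pow_ne_zero 2 hy)
    have x2ne : x2 ≠ 0 := by
      intro h0
      subst h0
      have : y3 = 0 := by
        have : dl K * y3^2 = 0 := by rw [h3]; simp [hC]
        rcases mul_eq_zero.1 this with h | h
        · exact absurd h hδ
        · exact pow_eq_zero_iff two_ne_zero |>.1 h
      subst this
      exact n0 (mkP_dup0 hδ)
    have qne : x^2-448 ≠ 0 := by intro h; apply x2ne; rw [hx2, h]; simp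
    have hx2' : x2 * (4*(dl K*y^2)) = (x^2-448)^2 := by rw [hx2, h]; field_simp
    have hne : 1/am X ≠ x2 := by
      intro hh
      subst hh
      have : 1/am X^2 = y3 ∨ 1/am X^2 = -y3 := by
        apply sq_eq_sq_iff_eq_or_eq_neg.1
        apply mul_left_cancel₀ hδ; rw [P_eq, h3]
      rcases this with rfl | hh
      · exact n1 (sub_self _)
      · apply n2
        have : PP K = - mkP hδ (1/am X) y3 h3 := by unfold PP; rw [mkP_neg, mkP_inj]; exact ⟨rfl, hh⟩
        rw [this, neg_add_cancel]
    have hxx := sub_ne_zero.2 hne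
    obtain ⟨m, hm⟩ : ∃ m, m * (1/am X-x2) = 1/am X^2-y3 := ⟨(1/am X^2-y3)/(1/am X-x2), div_mul_cancel₀ _ hxx⟩
    obtain ⟨x3, hx3⟩ : ∃ x3, x3 = dl K*m^2+42-1/am X-x2 := ⟨_, rfl⟩
    obtain ⟨h4, e4⟩ := mkP_add hδ (h := P_eq) (h' := h3) hne hm hx3 rfl
    unfold PP at hR
    rw [hR, e4, xi_mkP]
    have c := chord_sq P_eq h3 hne hm hx3
    refine ⟨am X * dl K * (1/am X^2 - m*(1/am X)) * (2*y)/(x^2-448), ?_⟩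
    rw [div_pow, eq_div_iff (pow_ne_zero 2 qne), ← hx2']
    have c' : x2 * x3 = am X * (dl K*(1/am X^2 - m*(1/am X))^2) := by rw [← c]; field_simp
    linear_combination 4*am X*dl K*y^2*c'
end

theorem out {ξ s : RatFunc K} {α : K} {n : ℕ} (hα : α ≠ 0) (hs : am X * ξ = s^2) (hh : hgt ξ = 2*n+1) (hd : dl K * (drf ξ)^2 = am (C α)^2 * hC ξ) :
    ∃ A D : K[X], A.natDegree ≤ n ∧ D.natDegree ≤ n ∧ D.coeff 0 ≠ 0 ∧ ODE α A D := by
  have hu := u_ne (K := K)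
  have hr := rep s
  have co := RatFunc.isCoprime_num_denom s
  have hM := s.denom_ne_zero
  generalize s.num = N at *
  generalize s.denom = M at *
  have aM := am_ne hM
  by_cases hN : N.coeff 0 = 0
  · obtain ⟨A, rfl⟩ := X_dvd_iff.2 hN
    have M0 : M.coeff 0 ≠ 0 := by
      intro h
      obtain ⟨B, rfl⟩ := X_dvd_iff.2 h
      exact not_isUnit_X (co.isUnit_of_dvd' (dvd_mul_right _ _) (dvd_mul_right _ _))
    have hξ : ξ = am (X*A^2)/am (M^2) := by
      apply mul_left_cancel₀ hu
      rw [hs, hr]; simp only [am, map_mul, map_pow]; field_simp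
    have hA : A ≠ 0 := by
      rintro rfl
      rw [hξ] at hh; simp [am, hgt_zero] at hh
    have cop : IsCoprime (X*A^2) (M^2) := by
      apply IsCoprime.pow_right
      exact (co.of_mul_left_left).mul_left (IsCoprime.pow_left co.of_mul_left_right)
    have aA := am_ne hA
    have dd := hh
    rw [hξ, hgt_eq (pow_ne_zero 2 hM) cop, natDegree_X_mul (pow_ne_zero 2 hA), natDegree_pow, natDegree_pow] at dd
    have hdr : drf ξ = am A * am (Wr A M) / am M^3 := by
      rw [hξ, drf_div _ (pow_ne_zero 2 hM)]
      have : derivative (X*A^2) * M^2 - X*A^2*derivative (M^2) = A * M * Wr A M := by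
        unfold Wr; simp only [pow_two, derivative_mul, derivative_X]; ring
      rw [this]; simp only [am, map_mul, map_pow]; 
      have := aM; unfold am at this; field_simp
    have key : YY K * Wr A M^2 = C (α^2) * (448*M^4 - 42*X*A^2*M^2 + X^2*A^4) := by
      apply am_inj
      rw [hdr, hξ] at hd
      unfold dl hC at hd
      simp only [am_mul, am_pow] at hd
      have e : am (YY K * Wr A M^2) = am (YY K) * am (Wr A M)^2 := by rw [am_mul, am_pow]
      have e' : am (C (α^2) * (448*M^4 - 42*X*A^2*M^2 + X^2*A^4)) = am (C α)^2 * (448*am M^4 - 42*am X*am A^2*am M^2 + am X^2*am A^4) := by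
        simp only [am, map_add, map_sub, map_mul, map_pow, map_ofNat]
      rw [e, e']
      generalize am (Wr A M) = W at *
      generalize am (YY K) = Y at *
      generalize am (C α) = a at *
      generalize am A = A' at *
      generalize am M = M' at *
      generalize am (X : K[X]) = u at *
      field_simp at hd
      linear_combination hd
    have k0 := congrArg (fun q => coeff q 0) key
    simp only [mul_coeff_zero, coeff_C_zero, coeff_add, coeff_sub, coeff_zero_eq_eval_zero, eval_pow, eval_mul, eval_X, YY, Wr, eval_add, eval_sub, eval_one, eval_C, eval_ofNat] at k0
    have M0' : M.eval 0 ≠ 0 := by rwa [← coeff_zero_eq_eval_zero]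
    obtain ⟨r, hr⟩ : ∃ r, r = A.eval 0 / (α * M.eval 0) := ⟨_, rfl⟩
    have hr2 : r^2 = 448 := by
      rw [hr]; field_simp; apply mul_left_cancel₀ (pow_ne_zero 2 M0'); linear_combination k0
    have r0 : r ≠ 0 := by rintro rfl; norm_num at hr2
    refine ⟨C (1/r) * A, M, ?_, ?_, M0, ?_⟩
    · exact dle_mul (i := 0) (j := n) (by simp) (by omega) (by omega)
    · omega
    · unfold ODE Rh
      have w : Wr (C (1/r) * A) M = C (1/r) * Wr A M := by
        unfold Wr; rw [derivative_C_mul]; ring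
      have c2 : C (1/r)^2 * 448 = 1 := by
        rw [← C_pow, ← map_ofNat C 448, ← hr2, ← C_mul, ← C_1]; congr 1; field_simp
      rw [w]
      linear_combination C (1/r)^2 * key + C (α^2) * (M^4 - X^2*A^4*C (1/r)^2) * c2
  · have hξ : ξ = am (N^2)/am (X*M^2) := by
      apply mul_left_cancel₀ hu
      rw [hs, hr]; simp only [am_mul, am_pow]; field_simp
    have hN0 : N ≠ 0 := by rintro rfl; simp at hN
    have aN := am_ne hN0
    have nz : X*M^2 ≠ 0 := mul_ne_zero X_ne_zero (pow_ne_zero 2 hM)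
    have cX : IsCoprime N X := by
      apply IsCoprime.symm
      rw [Irreducible.coprime_iff_not_dvd irreducible_X]
      exact fun h => hN (X_dvd_iff.1 h)
    have cop : IsCoprime (N^2) (X*M^2) := by
      apply IsCoprime.pow_left
      exact cX.mul_right co.pow_right
    have dd := hh
    rw [hξ, hgt_eq nz cop, natDegree_X_mul (pow_ne_zero 2 hM), natDegree_pow, natDegree_pow] at dd
    have hdr : drf ξ = -(am N * am (Wr M N) / (am X^2 * am M^3)) := by
      rw [hξ, drf_div _ nz]
      have : derivative (N^2) * (X*M^2) - N^2*derivative (X*M^2) = -(N * M * Wr M N) := by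
        unfold Wr; simp only [pow_two, derivative_mul, derivative_X]; ring
      have e : am (-(N * M * Wr M N)) = -(am N * am M * am (Wr M N)) := by simp only [am, map_neg, map_mul]
      rw [this, e, am_mul, am_pow]; field_simp
    refine ⟨M, N, by omega, by omega, hN, ?_⟩
    apply am_inj
    rw [hdr, hξ] at hd
    unfold dl hC at hd
    simp only [am_mul, am_pow] at hd
    have e : am (YY K * Wr M N^2) = am (YY K) * am (Wr M N)^2 := by rw [am_mul, am_pow]
    have e' : am (C (α^2) * Rh M N) = am (C α)^2 * (am N^4 - 42*am X*am M^2*am N^2 + 448*am X^2*am M^4) := by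
      unfold Rh; simp only [am, map_add, map_sub, map_mul, map_pow, map_ofNat]
    rw [e, e']
    generalize am (Wr M N) = W at *
    generalize am (YY K) = Y at *
    generalize am (C α) = a at *
    generalize am N = A' at *
    generalize am M = M' at *
    generalize am (X : K[X]) = u at *
    field_simp at hd
    linear_combination hd

theorem exists_AD {θ : K} (hθ : θ^2 = -7) {n : ℕ} {x y : ℤ} (h : ((2*n+1 : ℕ):ℤ) = x^2+7*y^2) :
    ∃ A D : K[X], A.natDegree ≤ n ∧ D.natDegree ≤ n ∧ D.coeff 0 ≠ 0 ∧ ODE ((x:K)+y*θ) A D := by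
  classical
  obtain ⟨Q, hQ, hPQ, gQ⟩ := QQ_ex hθ
  have quad := hg_quad dl_ne hθ hg_PP hQ hPQ
  have nz : ∀ a b : ℤ, (a ≠ 0 ∨ b ≠ 0) → a•PP K+b•Q ≠ 0 := by
    intro a b hab h0
    have := quad a b
    rw [h0, hg_zero] at this
    exact nform_pos hab (by exact_mod_cast this.symm)
  have hodd : (x - y) % 2 = 1 := by
    have h2 : (x^2+7*y^2) % 2 = 1 := by rw [← h]; push_cast; omega
    rcases Int.emod_two_eq_zero_or_one x with hx | hx <;> rcases Int.emod_two_eq_zero_or_one y with hy | hy <;>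
      simp [pow_two, Int.add_emod, Int.mul_emod, hx, hy, Int.sub_emod] at h2 ⊢
  have ha : x - y ≠ 0 := by intro h0; rw [h0] at hodd; norm_num at hodd
  obtain ⟨c, hc⟩ : ∃ c, x - y = 1 + 2*c := ⟨(x-y)/2, by omega⟩
  obtain ⟨ξ, η, hh, hR, hD⟩ := path Gd_PP gQ nz ha (2*y)
  have hl : (((x - y : ℤ) : RatFunc K) + ((2*y : ℤ) : RatFunc K) * am (C ((1+θ)/2))) = am (C ((x:K)+y*θ)) := by
    have : C ((x:K)+y*θ) = ((x-y:ℤ):K[X]) + ((2*y:ℤ):K[X]) * C ((1+θ)/2) := by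
      have : (x:K)+y*θ = ((x-y:ℤ):K) + ((2*y:ℤ):K) * ((1+θ)/2) := by push_cast; field_simp; ring
      rw [this]; simp only [map_add, map_mul, map_intCast]
    rw [this]; simp only [am, map_add, map_mul, map_intCast]
  have hht : hgt ξ = 2*n+1 := by
    have := quad (x-y) (2*y)
    rw [hR] at this; unfold hg at this; rw [xi_mkP] at this
    have e : ((hgt ξ : ℕ):ℤ) = ((2*n+1:ℕ):ℤ) := by rw [this, h]; ring
    exact_mod_cast e
  have hα : (x:K)+y*θ ≠ 0 := by
    intro h0
    have h1 : ((x:K)+y*θ)*(x-y*θ) = ((2*n+1 : ℕ):K) := by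
      have : (((2*n+1 : ℕ):ℤ):K) = ((x^2+7*y^2:ℤ):K) := by rw [h]
      push_cast at this ⊢
      linear_combination -this - y^2*hθ
    rw [h0, zero_mul] at h1
    exact Nat.cast_ne_zero.2 (by omega) h1.symm
  have hTT : (c•PP K + y•Q) + (c•PP K + y•Q) = (2*c)•PP K + (2*y)•Q := by rw [two_mul, two_mul, add_smul, add_smul]; abel
  obtain ⟨s, hs⟩ := is_sq (R := (x-y)•PP K + (2*y)•Q) (T := c•PP K + y•Q)
    (by rw [hTT, hc, add_smul, one_smul, add_assoc])
    (by
      rw [hTT]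
      intro h0
      have : ((2*c)•PP K + (2*y)•Q) + ((2*c)•PP K + (2*y)•Q) = (2*c+2*c)•PP K + (2*y+2*y)•Q := by rw [add_smul, add_smul]; abel
      rw [this]
      apply nz
      by_contra hcon
      push Not at hcon
      apply h0
      rw [show 2*c = 0 by omega, show 2*y = 0 by omega]; simp)
    (by
      rw [hTT]
      have : PP K - ((2*c)•PP K + (2*y)•Q) = (1-2*c)•PP K + (-(2*y))•Q := by rw [sub_smul, neg_smul, one_smul]; abel
      rw [this]; apply nz; omega)
    (by
      rw [hTT]
      have : PP K + ((2*c)•PP K + (2*y)•Q) = (1+2*c)•PP K + (2*y)•Q := by rw [add_smul, one_smul]; abel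
      rw [this]; apply nz; omega)
  rw [hR, xi_mkP] at hs
  refine out hα hs hht ?_
  rw [hl] at hD
  rw [← hh]
  have : (drf ξ)^2 = (am (C ((x:K)+y*θ)) * η)^2 := by rw [← hD]; ring
  rw [this]; ring
end
end Z7
end

section
open Finset
set_option linter.unusedSectionVars false
set_option linter.unusedSimpArgs false
set_option linter.unusedVariables false
namespace Z7
section inertB

theorem al_up_sq (n k : ℕ) : ((n:ℤ)+1)^2 * al (n+1) (k+1) =
    (((n:ℤ)+1)^2 + 2*(n+1)*(k+1) + 2*(k+1)^2) * al n (k+1) + 4*(2*k+1)*(n+1+k) * al n k := by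
  have h1 := al_a n k
  have h2 := al_b n k
  have h3 : ((k:ℤ)+1)^3 ≠ 0 := by positivity
  apply mul_left_cancel₀ h3
  linear_combination ((n:ℤ)+1)^2 * h1 - (((n:ℤ)+1)^2 + 2*(n+1)*(k+1) + 2*(k+1)^2) * h2

theorem clausen_up {R : Type*} [CommRing R] [IsDomain R] [CharZero R] {b d e : R} {Q : ℕ → R} (h0 : Q 0 = 1) (h1 : Q 1 = b)
    (hr : ∀ j : ℕ, ((j:R)+2) * Q (j+2) = (2*j+3) * b * Q (j+1) - (j+1) * d * Q j) (he : b^2 - d = 4*e) (n : ℕ) :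
    ((n:R)+1)^2 * Q (n+1)^2 = ∑ k ∈ range (n+1), (al n k : R) * e^k * d^(n-k) *
      (d * (((n:R)+1)^2 + 2*(n+1)*k + 2*k^2) + 4*e*(2*k+1)*(n+1+k)) := by
  rw [(clausen_aux h0 h1 hr he n).2.2]
  have e1 : ∀ k, ((n:R)+1)^2 * (al (n+1) (k+1) : R) =
    (((n:R)+1)^2 + 2*(n+1)*(k+1) + 2*(k+1)^2) * al n (k+1) + 4*(2*k+1)*(n+1+k) * al n k := by
    intro k
    exact_mod_cast congrArg (Int.cast (R := R)) (al_up_sq n k)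
  have e2 : ∑ k ∈ range (n+1), (al n k : R) * e^k * d^(n-k) *
      (d * (((n:R)+1)^2 + 2*(n+1)*k + 2*k^2) + 4*e*(2*k+1)*(n+1+k)) =
      ∑ k ∈ range (n+2), (((n:R)+1)^2 + 2*(n+1)*k + 2*k^2) * (al n k : R) * e^k * d^(n+1-k) +
      ∑ k ∈ range (n+1), 4*(2*k+1)*(n+1+k) * (al n k : R) * e^(k+1) * d^(n-k) := by
    rw [sum_range_succ _ (n+1), al_gt (by omega : n < n+1)]
    simp only [Nat.cast_zero, mul_zero, zero_mul, add_zero]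
    rw [← sum_add_distrib]
    refine sum_congr rfl fun k hk => ?_
    have : n+1-k = n-k+1 := by simp at hk; omega
    rw [this]; ring
  rw [e2, sum_range_succ' _ (n+1), sum_range_succ' _ (n+1), mul_add, mul_sum]
  have e3 : ∀ k, ((n:R)+1)^2 * ((al (n+1) (k+1) : R) * e^(k+1) * d^(n+1-(k+1))) =
     (((n:R)+1)^2 + 2*(n+1)*((k+1:ℕ):R) + 2*((k+1:ℕ):R)^2) * (al n (k+1) : R) * e^(k+1) * d^(n+1-(k+1))
      + 4*(2*k+1)*(n+1+k) * (al n k : R) * e^(k+1) * d^(n-k) := by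
    intro k
    rw [show n+1-(k+1) = n-k by omega]
    push_cast
    linear_combination (e^(k+1) * d^(n-k)) * e1 k
  rw [sum_congr rfl fun k _ => e3 k, sum_add_distrib]
  simp [al_zero]
  ring

variable {p : ℕ} [hp : Fact p.Prime]

theorem V_al {n k : ℕ} (hn : p = 2*n+1) (hk : k ≤ n) : V p 2 ((al n k : ℚ_[p]) * (-16)^k - (cb k : ℚ_[p])^3) := by
  have h := choose_prod (K := ℚ_[p]) n k
  rw [← p_eq hn] at h
  have h2 := ((V_nat (p := p) (cb k)).pow 3).mulL (V_prod_one hn hk)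
  convert h2 using 1
  simp only [al]; push_cast
  linear_combination (cb k:ℚ_[p])^2 * h

/-- general moments -/
noncomputable def Mz (z : ℚ_[p]) (n j : ℕ) : ℚ_[p] := ∑ k ∈ range (n+1), (k:ℚ_[p])^j * (cb k : ℚ_[p])^3 * z^k

theorem V_sum_al {n : ℕ} (hn : p = 2*n+1) {d e z : ℚ_[p]} (hz : V p 0 z) (hd : V p 0 d) (he : e = -16*d*z)
    (w : ℕ → ℚ_[p]) (hw : ∀ k, V p 0 (w k)) :
    V p 2 (∑ k ∈ range (n+1), (al n k : ℚ_[p]) * e^k * d^(n-k) * w k - d^n * ∑ k ∈ range (n+1), (cb k : ℚ_[p])^3 * z^k * w k) := by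
  have e1 : ∑ k ∈ range (n+1), (al n k : ℚ_[p]) * e^k * d^(n-k) * w k - d^n * ∑ k ∈ range (n+1), (cb k : ℚ_[p])^3 * z^k * w k
     = ∑ k ∈ range (n+1), ((al n k : ℚ_[p]) * (-16)^k - (cb k : ℚ_[p])^3) * (d^n * z^k * w k) := by
    rw [mul_sum, ← sum_sub_distrib]
    refine sum_congr rfl fun k hk => ?_
    have : d^n = d^k * d^(n-k) := by rw [← pow_add]; congr 1; simp at hk; omega
    rw [he, this, mul_pow, mul_pow]; ring
  rw [e1]
  refine V_sum _ _ fun k hk => (V_al hn (by simp at hk; omega)).mulR (((hd.pow n).mulL (hz.pow k)).mulL (hw k))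

theorem cl_padic {n : ℕ} (hn : p = 2*n+1) {b d e z : ℚ_[p]} (hz : V p 0 z) (hd : V p 0 d) (hez : e = -16*d*z)
    {Q : ℕ → ℚ_[p]} (h0 : Q 0 = 1) (h1 : Q 1 = b)
    (hr : ∀ j : ℕ, ((j:ℚ_[p])+2) * Q (j+2) = (2*j+3) * b * Q (j+1) - (j+1) * d * Q j) (he : b^2 - d = 4*e) :
    V p 2 (Q n^2 - d^n * Mz z n 0) ∧
    V p 2 (((n:ℚ_[p])+1)^2 * Q (n+1)^2 - d^n * (d * (((n:ℚ_[p])+1)^2 * Mz z n 0 + 2*(n+1) * Mz z n 1 + 2 * Mz z n 2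
      - 64*z*(2 * Mz z n 2 + (2*n+3) * Mz z n 1 + (n+1) * Mz z n 0)))) := by
  constructor
  · rw [clausen h0 h1 hr he n]
    have := V_sum_al hn hz hd hez (fun _ => 1) (fun _ => V_one)
    simpa [Mz] using this
  · rw [clausen_up h0 h1 hr he n]
    have hv : V p 0 e := by
      rw [hez]; exact ((V_ofNat 16).neg.mulL hd).mulL hz
    have := V_sum_al hn hz hd hez (fun k => (d * (((n:ℚ_[p])+1)^2 + 2*(n+1)*k + 2*k^2) + 4*e*(2*k+1)*(n+1+k))) (fun k => by
      have a := V_nat (p := p) n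
      have b := V_nat (p := p) k
      have a1 := a.add V_one
      refine (hd.mulL (((a1.pow 2).add (((V_ofNat 2).mulL a1).mulL b)).add ((V_ofNat 2).mulL (b.pow 2)))).add ?_
      exact (((V_ofNat 4).mulL hv).mulL (((V_ofNat 2).mulL b).add V_one)).mulL (a1.add b))
    convert this using 3
    simp only [Mz, mul_sum, ← sum_add_distrib, ← sum_sub_distrib]
    refine sum_congr rfl fun k hk => ?_
    rw [hez]; ring

variable (p) in
noncomputable def ta7 : ℕ → ℚ_[p]
  | 0 => 1
  | 1 => 21
  | (j+2) => ((2*j+3) * 21 * ta7 (j+1) - (j+1) * (-7) * ta7 j) / (j+2)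

theorem ta7_rec (j : ℕ) : ((j:ℚ_[p])+2) * ta7 p (j+2) = (2*j+3) * 21 * ta7 p (j+1) - (j+1) * (-7) * ta7 p j := by
  have : (j:ℚ_[p])+2 ≠ 0 := by exact_mod_cast (by omega : j+2 ≠ 0)
  conv_lhs => rw [ta7]
  field_simp

theorem V_ta7 (j : ℕ) : V p 0 (ta7 p j) := by
  apply V0_of_sq
  rw [clausen (b := 21) (d := -7) (e := 112) (Q := ta7 p) (by rw [ta7]) (by rw [ta7]) ta7_rec (by norm_num) j]
  apply V_sum; intro k _
  exact ((V_nat _).mulL ((V_ofNat 112).pow k)).mulL ((V_ofNat 7).neg.pow _)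

theorem Mz_one (n j : ℕ) : Mz (1:ℚ_[p]) n j = Tm ℚ_[p] n j := by simp [Mz, Tm]
theorem Mz_S (n j : ℕ) : Mz ((4096:ℚ_[p])⁻¹) n j = Sm ℚ_[p] n j := by rw [Sm_eq]; rfl

theorem inertB {n : ℕ} (hn : p = 2*n+1) (hp2 : p ≠ 2) (hp3 : p ≠ 3) (hp7 : p ≠ 7)
    (hφ : V p 1 (ph7 ℚ_[p] n)) (hτ : V p 1 (ta7 p n)) (key : V p 2 (ph7 ℚ_[p] (n+1) + (-1)^n * 8^n * ta7 p (n+1))) :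
    V p 2 ((-1)^n * Sm ℚ_[p] n 2 - (8/63 * Rm ℚ_[p] n + 349/2646*(p:ℚ_[p]))) ∧
    V p 2 ((-1)^n * Sm ℚ_[p] n 3 - (4/1323 * Rm ℚ_[p] n + 1013/222264*(p:ℚ_[p]))) := by
  have hnot : ∀ a b c : ℕ, ¬ p ∣ 2^a*3^b*7^c := by
    intro a b c hd
    have h1 := V_cancel_237 (p := p) hp2 hp3 hp7 a b c (r := 1) (x := 1) rfl (by rw [mul_one, V_nat_iff]; simpa using hd)
    have := V_nat_iff (p := p) (r := 1) (m := 1)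
    rw [Nat.cast_one] at this
    have h2 := this.1 h1
    simp at h2; exact hp.out.one_lt.ne' h2
  have hv4096 : V p 0 ((4096:ℚ_[p])⁻¹) := by
    have := V_inv_nat (hnot 12 0 0); norm_num at this; simpa using this
  obtain ⟨f1, f2⟩ := cl_padic hn (b := 21) (d := 448) (e := -7/4) (z := (4096:ℚ_[p])⁻¹) hv4096 (V_ofNat 448) (by norm_num)
    (Q := ph7 ℚ_[p]) (by rw [ph7]) (by rw [ph7]) (ph7_rec _) (by norm_num)
  obtain ⟨t1, t2⟩ := cl_padic hn (b := 21) (d := -7) (e := 112) (z := (1:ℚ_[p])) V_one (V_ofNat 7).neg (by norm_num)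
    (Q := ta7 p) (by rw [ta7]) (by rw [ta7]) ta7_rec (by norm_num)
  simp only [Mz_one, Mz_S] at f1 f2 t1 t2
  have hA1 := A1_padic (p := p) hn
  have hA2 := (A2_padic hn hp2 hp3).mono (by omega : 2 ≤ 3)
  have hR := R_tele (K := ℚ_[p]) n
  have hS := S_tele (K := ℚ_[p]) n
  have hpn := p_eq (p := p) hn
  rw [← hpn] at hR hS
  have hs : ((-1:ℚ_[p])^n)^2 = 1 := by rw [← pow_mul, mul_comm, pow_mul]; norm_num
  have hs0 : V p 0 ((-1:ℚ_[p])^n) := V_one.neg.pow n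
  have hnn : (n:ℚ_[p]) = (p-1)/2 := by rw [hpn]; ring
  -- S0, T0
  have hS0 : V p 2 (Sm ℚ_[p] n 0) := by
    have h1 : V p 2 ((448:ℚ_[p])^n * Sm ℚ_[p] n 0) := by
      have := (hφ.sq).sub f1; convert this using 1; ring
    refine V.cancel_nat (m := 448^n) (by push_cast; exact h1) ?_
    have := hnot (6*n) 0 n
    rwa [pow_mul, pow_zero, mul_one, ← mul_pow] at this
  have hT0 : V p 2 (Tm ℚ_[p] n 0) := by
    have h1 : V p 2 ((-7:ℚ_[p])^n * Tm ℚ_[p] n 0) := by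
      have := (hτ.sq).sub t1; convert this using 1; ring
    have h3 := hs0.mulL h1
    rw [← mul_assoc, ← mul_pow, show (-1:ℚ_[p]) * -7 = 7 by norm_num] at h3
    refine V.cancel_nat (m := 7^n) (by push_cast; exact h3) ?_
    simpa using hnot 0 0 n
  have hSM : ∀ j, V p 0 (Sm ℚ_[p] n j) := fun j => by
    rw [Sm_eq]; exact V_sum _ _ fun k _ => (((V_nat k).pow j).mulL ((V_nat _).pow 3)).mulL (hv4096.pow k)
  have hTM : ∀ j, V p 0 (Tm ℚ_[p] n j) := fun j => by
    rw [Tm]; exact V_sum _ _ fun k _ => (((V_nat k).pow j).mulL ((V_nat _).pow 3))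
  have hS1 : V p 2 (42 * Sm ℚ_[p] n 1 - 5 * p * (-1)^n) := by
    have := hA2.sub ((V_ofNat 5).mulL hS0); convert this using 1; ring
  have hT1 : V p 2 (21 * Tm ℚ_[p] n 1 - 8 * p) := by
    have := hA1.sub ((V_ofNat 8).mulL hT0); convert this using 1; ring
  have hpS1 : V p 2 (42 * p * Sm ℚ_[p] n 1) := by
    have h1 := (V_nat (p := p) p).mulL hS1
    have h2 : V p 2 ((p:ℚ_[p])^2 * (5 * (-1)^n)) := (V_ppow 2).mulR ((V_ofNat 5).mulL hs0)
    convert h1.add h2 using 1; ring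
  have hpT1 : V p 2 (21 * p * Tm ℚ_[p] n 1) := by
    have h1 := (V_nat (p := p) p).mulL hT1
    have h2 : V p 2 ((p:ℚ_[p])^2 * 8) := (V_ppow 2).mulR (V_ofNat 8)
    convert h1.add h2 using 1; ring
  have hphi := V_ph7 (p := p) hp2 (n+1)
  have hta := V_ta7 (p := p) (n+1)
  have h8 : V p 0 ((-1:ℚ_[p])^n * 8^n) := hs0.mulL ((V_ofNat 8).pow n)
  have hsq : V p 2 (((n:ℚ_[p])+1)^2 * ph7 ℚ_[p] (n+1)^2 - ((n:ℚ_[p])+1)^2 * (64^n * ta7 p (n+1)^2)) := by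
    have h1 := (((V_nat (p := p) n).add V_one).pow 2).mulL (key.mulR (hphi.sub (h8.mulL hta)))
    convert h1 using 1
    have : (64:ℚ_[p])^n = (8^n)^2 := by rw [← pow_mul, mul_comm, pow_mul]; norm_num
    rw [this]
    linear_combination (((n:ℚ_[p])+1)^2 * ((8^n)^2 * ta7 p (n+1)^2)) * hs
  have h448 : (448:ℚ_[p])^n = 64^n * 7^n := by rw [← mul_pow]; norm_num
  have h7 : (-7:ℚ_[p])^n = (-1)^n * 7^n := by rw [← mul_pow]; norm_num
  have main1 : V p 2 ((((2^7*3^1*7^1 * (448)^n:ℕ)):ℚ_[p]) * (882 * Sm ℚ_[p] n 2 + 434 * Sm ℚ_[p] n 1 - (-1)^n * (882 * Tm ℚ_[p] n 2 + 889 * Tm ℚ_[p] n 1))) := by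
    have h1 := (f2.sub (((V_ofNat 64).pow n).mulL t2)).sub hsq
    have c1 : V p 0 ((448:ℚ_[p])^n) := (V_ofNat 448).pow n
    have hv2 := V_half (p := p) hp2
    have h2 := ((V_ofNat 2688).mulL h1).neg
    have hN := (V_nat (p := p) n)
    have h3 := (c1.mulL (hS0.mulR (((V_nat 1204224).mulL ((hN.add V_one).pow 2)).sub ((V_nat 18816).mulL (hN.add V_one))))).neg
    have h4 := (c1.mulL (hpS1.mulR (V_nat 28224))).neg
    have h5 := (hs0.mulL (c1.mulL (hT0.mulR (((V_nat 18816).neg.mulL ((hN.add V_one).pow 2)).add ((V_nat 1204224).mulL (hN.add V_one))))))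
    have h6 := hs0.mulL (c1.mulL (hpT1.mulR (V_nat 56448)))
    convert ((((h2.add h3).add h4).add h5).add h6) using 1
    push_cast
    rw [h7, h448, hnn]
    ring
  have main2 := main1.cancel_nat (by
    have := hnot (7+6*n) 1 (1+n)
    rwa [show 2^(7+6*n)*3^1*7^(1+n) = 2^7*3^1*7^1*448^n by
      rw [pow_add, pow_add, pow_mul, show (448:ℕ) = 2^6*7 by norm_num, mul_pow]; ring] at this)
  have hcb : V p 2 ((p:ℚ_[p])^3 * (cb n : ℚ_[p])^3 / (n+1)) := by
    rw [div_eq_mul_inv]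
    refine (((V_ppow 3).mono (by omega)).mulR ((V_nat _).pow 3)).mulR ?_
    have : ¬ p ∣ n+1 := fun h => by have := Nat.le_of_dvd (by omega) h; have := hp.out.two_le; omega
    have := V_inv_nat this
    push_cast at this; exact this
  have hcb2 : V p 2 ((p:ℚ_[p])^3 * ((cb n : ℚ_[p])^3 / 4096^n)) := by
    rw [div_eq_mul_inv, ← inv_pow]
    exact ((V_ppow 3).mono (by omega)).mulR (((V_nat _).pow 3).mulL (hv4096.pow n))
  have g1 : V p 2 (2646 * ((-1)^n * Sm ℚ_[p] n 2 - (8/63 * Rm ℚ_[p] n + 349/2646*(p:ℚ_[p])))) := by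
    have := ((((V_ofNat 3).mulL (hs0.mulL main2)).sub ((V_ofNat 31).mulL (hs0.mulL hS1))).add ((V_ofNat 63).mulL hT1)).sub ((V_ofNat 672).mulL hT0) |>.add ((V_ofNat 336).mulL hcb)
    convert this using 1
    linear_combination (-42:ℚ_[p]) * hR - (155 * p - 3 * (882 * Tm ℚ_[p] n 2 + 889 * Tm ℚ_[p] n 1)) * hs
  refine ⟨V_cancel_237 hp2 hp3 hp7 1 3 2 (m := 2646) (by norm_num) (by exact_mod_cast g1), ?_⟩
  refine V_cancel_237 hp2 hp3 hp7 3 4 3 (m := 222264) (by norm_num) ?_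
  have := (((V_ofNat 2).mulL g1).add ((V_ofNat 63).mulL (hs0.mulL hS1))).add (((V_ofNat 441).mulL (hs0.mulL hS0)).sub ((V_ofNat 441).mulL (hs0.mulL hcb2)))
  convert this using 1
  push_cast
  linear_combination (441 * (-1)^n) * hS + (315 * p) * hs
end inertB
end Z7
end

section
open Finset
set_option linter.unusedSectionVars false
set_option linter.unusedSimpArgs false
set_option linter.unusedVariables false
namespace Z7
section I0
open PowerSeries

theorem i0_ident {R : Type*} [CommRing R] {w u : R} (hw : w^2 = w - 2) :
    ((1-(32-8*w)*u)^4 - 42 * (w^2*u*(1-(22-2*w)*u)) * (1-(32-8*w)*u)^2 + 448*(w^2*u*(1-(22-2*w)*u))^2) * (1-(22-2*w)*u)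
     = (1-42*u+448*u^2) * (1-(12+4*w)*u)^2 := by
  grind

theorem i0_deriv {K : Type*} [Field K] {p n : ℕ} [CharP K p] (hn : p = 2*n+1) {k : ℕ} (hk : k < n) (e a b : K) (hb : b = 2*e-a) :
    (coeff n) ((X:K⟦X⟧)^k * (1 - C e * X)^(k+n) * (1 - C a * X)^(4*n-2*k) * (1 - C b * X)) = 0 := by
  obtain ⟨t, ht⟩ : ∃ t, 4*n-2*k = t := ⟨_, rfl⟩
  rw [ht]
  have hpK : (2*(n:K)+1) = 0 := by
    have := CharP.cast_eq_zero K p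
    rw [hn] at this; push_cast at this; exact this
  set H : K⟦X⟧ := X^k * (1 - C e * X)^(k+n+1) * (1 - C a * X)^(t+1) with hH
  have ht2 : (t:K) + 1 = -(2*k+1) := by
    have : t + 2*k = 4*n := by omega
    have := congrArg (Nat.cast (R := K)) this
    push_cast at this
    linear_combination this + 2 * hpK
  have h1 : 2 * X * derivative K H + H =
    (C (2*(k:K)+1)) * (X^k * (1 - C e * X)^(k+n) * (1 - C a * X)^t * (1 - C b * X)) := by
    have hX : (X:K⟦X⟧) * derivative K (X^k) = (k:K⟦X⟧) * X^k := by
      rw [Derivation.leibniz_pow, derivative_X]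
      rcases k with _ | k
      · simp
      · simp [pow_succ]; ring
    have hd : ∀ c : K, ∀ m : ℕ, derivative K ((1 - C c * X)^(m+1)) = -((m+1 : ℕ):K⟦X⟧) * C c * (1 - C c * X)^m := by
      intro c m
      rw [Derivation.leibniz_pow]
      simp [derivative_C]
      ring
    have hnK : (C (2*(n:K)+1) : K⟦X⟧) = 0 := by rw [hpK]; simp
    have htK : (C ((t:K)+1) : K⟦X⟧) = C (-(2*(k:K)+1)) := by rw [ht2]
    simp only [map_add, map_mul, map_natCast, map_ofNat, map_one, map_neg] at hnK htK
    rw [hH, Derivation.leibniz, Derivation.leibniz, hd, hd, hb]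
    simp only [smul_eq_mul, map_sub, map_add, map_mul, map_natCast, map_ofNat, map_one]
    push_cast
    set D := derivative K (X^k : K⟦X⟧)
    set P := (1 - C e * X : K⟦X⟧)
    have hP : P = 1 - C e * X := rfl
    set M := (1 - C a * X : K⟦X⟧)
    have hM : M = 1 - C a * X := rfl
    rw [pow_succ P, pow_succ M]
    have key : 2*((k:K⟦X⟧)*P*M - ((k:K⟦X⟧)+(n:K⟦X⟧)+1)*C e*X*M - ((t:K⟦X⟧)+1)*C a*X*P) + P*M = (2*(k:K⟦X⟧)+1)*(1 - (2*C e - C a)*X) := by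
      rw [htK, hP, hM]
      linear_combination (-C e * X * (1 - C a * X)) * hnK
    linear_combination (2*P^(k+n)*P*M^t*M) * hX + (X^k * P^(k+n) * M^t) * key
  have h2 := congrArg (coeff n) h1
  have h3 : (coeff n) (2 * X * derivative K H + H) = 0 := by
    have hn0 : n = (n-1)+1 := by omega
    have : (coeff n) (2 * X * derivative K H + H) = (2*(n:K)+1) * coeff n H := by
      rw [map_add, show (2 * X * derivative K H : K⟦X⟧) = C 2 * (X * derivative K H) by rw [map_ofNat]; ring, coeff_C_mul, hn0,
        coeff_succ_X_mul, coeff_derivative]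
      push_cast; ring
    rw [this, hpK, zero_mul]
  rw [h3, coeff_C_mul] at h2
  rcases mul_eq_zero.1 h2.symm with h | h
  · exfalso
    have : ((2*k+1 : ℕ) : K) = 0 := by push_cast; exact h
    rw [CharP.cast_eq_zero_iff K p] at this
    have := Nat.le_of_dvd (by omega) this
    omega
  · exact h

theorem I0_field {K : Type*} [Field K] {p n : ℕ} [hp : Fact p.Prime] [CharP K p] (hn : p = 2*n+1) {θ : K} (hθ : θ^2 = -7) (hf : θ^p = -θ) (h2 : (2:K) ≠ 0) (h7 : (7:K) ≠ 0) :
    ((1 - 42 * Polynomial.X + 448 * Polynomial.X^2 : Polynomial K)^n).coeff n = 0 := by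
  obtain ⟨ω, hω⟩ : ∃ ω : K, 2*ω = 1 + θ := ⟨(1+θ)/2, by field_simp⟩
  have hw : ω^2 = ω - 2 := by
    have : (2:K)^2 * ω^2 = 2^2 * (ω - 2) := by
      linear_combination (2*ω + 1 + θ) * hω + hθ - 2 * hω
    exact mul_left_cancel₀ (pow_ne_zero 2 h2) this
  set q := (1 - 42 * Polynomial.X + 448 * Polynomial.X^2 : Polynomial K) with hq
  set w : K⟦X⟧ := C ω with hwd
  have hw' : w^2 = w - 2 := by rw [hwd, ← map_pow, hw, map_sub, map_ofNat C 2]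
  have hid := i0_ident (u := (X:K⟦X⟧)) hw'
  set m0 : K⟦X⟧ := 1 - C (32-8*ω) * X with hm0
  set m1 : K⟦X⟧ := 1 - C (22-2*ω) * X with hm1
  set mb : K⟦X⟧ := 1 - C (12+4*ω) * X with hmb
  have e0 : (1 - (32-8*w)*X : K⟦X⟧) = m0 := by simp [hm0, hwd, map_ofNat C 32, map_ofNat C 8, map_ofNat C 4, map_ofNat C 2]
  have e1 : (1 - (22-2*w)*X : K⟦X⟧) = m1 := by simp [hm1, hwd, map_ofNat C 22, map_ofNat C 8, map_ofNat C 4, map_ofNat C 2]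
  have eb : (1 - (12+4*w)*X : K⟦X⟧) = mb := by simp [hmb, hwd, map_ofNat C 12, map_ofNat C 8, map_ofNat C 4, map_ofNat C 2]
  rw [e0, e1, eb] at hid
  obtain ⟨i0, hi0⟩ : ∃ i0 : K⟦X⟧, m0 * i0 = 1 := ⟨m0⁻¹, PowerSeries.mul_inv_cancel _ (by simp [hm0])⟩
  have hdeg : (q^n).natDegree < 2*n+1 := by
    have h1 : q.natDegree ≤ 2 := by rw [hq]; compute_degree
    have := Polynomial.natDegree_pow_le_of_le n h1
    omega
  have hev := Polynomial.aeval_eq_sum_range' hdeg (w^2 * X * m1 * i0^2)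
  rw [map_pow] at hev
  have hev2 : m0^4 * Polynomial.aeval (w^2 * X * m1 * i0^2) q = m0^4 - 42 * (w^2*X*m1) * m0^2 + 448*(w^2*X*m1)^2 := by
    rw [hq]
    simp only [map_add, map_sub, map_mul, map_one, map_pow, Polynomial.aeval_X, map_ofNat]
    linear_combination (-42*w^2*X*m1*m0^2*(m0*i0+1) + 448*w^4*X^2*m1^2*(m0^2*i0^2+1)*(m0*i0+1)) * hi0
  have hmain : ∑ k ∈ range (2*n+1), C ((q^n).coeff k * ω^(2*k)) * (X^k * m1^(k+n) * m0^(4*n-2*k) * mb) = (1-42*X+448*X^2)^n * mb^p := by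
    have h1 : (1-42*X+448*X^2)^n * mb^p = (m0^4)^n * (Polynomial.aeval (w^2 * X * m1 * i0^2) q)^n * m1^n * mb := by
      rw [← mul_pow, hev2, ← mul_pow, hid, mul_pow, ← pow_mul, hn, pow_succ]; ring
    rw [h1, hev, mul_sum, sum_mul, sum_mul]
    refine sum_congr rfl fun k hk => ?_
    have hk' : k < 2*n+1 := by simpa using hk
    have h3 : (m0^4)^n * (i0^2)^k = m0^(4*n-2*k) := by
      rw [← pow_mul, ← pow_mul, show 4*n = (4*n-2*k) + 2*k by omega, pow_add, mul_assoc, ← mul_pow, hi0]; simp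
    rw [← h3, Algebra.smul_def, PowerSeries.algebraMap_apply, Algebra.algebraMap_self_apply, map_mul, mul_pow, mul_pow, mul_pow, map_pow, ← hwd, ← pow_mul, pow_add]
    ring
  have hc := congrArg (coeff n) hmain
  have hR : coeff n (((1-42*X+448*X^2)^n * mb^p : K⟦X⟧)) = (q^n).coeff n := by
    have : CharP K⟦X⟧ p := by
      refine charP_of_injective_algebraMap (R := K) (A := K⟦X⟧) ?_ p
      exact (algebraMap K K⟦X⟧).injective
    rw [hmb, sub_pow_char, one_pow, mul_sub, mul_one, map_sub, mul_pow, show ((1-42*X+448*X^2:K⟦X⟧)^n * (C (12+4*ω)^p * X^p)) = ((1-42*X+448*X^2:K⟦X⟧)^n * (C (12+4*ω)^p)) * X^p by ring,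
      coeff_mul_X_pow', if_neg (by omega), sub_zero, ← Polynomial.coeff_coe]
    congr 1
    rw [Polynomial.coe_pow, hq]
    congr 1
    simp only [Polynomial.coe_add, Polynomial.coe_sub, Polynomial.coe_mul, Polynomial.coe_one, Polynomial.coe_pow, Polynomial.coe_X]
    have c1 : ((42:Polynomial K):K⟦X⟧) = 42 := map_ofNat (Polynomial.coeToPowerSeries.ringHom (R:=K)) 42
    have c2 : ((448:Polynomial K):K⟦X⟧) = 448 := map_ofNat (Polynomial.coeToPowerSeries.ringHom (R:=K)) 448
    rw [c1, c2]
  rw [hR, map_sum, sum_eq_single n] at hc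
  · rw [coeff_C_mul, show (X:K⟦X⟧)^n * m1^(n+n) * m0^(4*n-2*n) * mb = m1^(n+n) * m0^(4*n-2*n) * mb * X^n by ring, coeff_mul_X_pow', if_pos le_rfl,
      Nat.sub_self] at hc
    simp [hm0, hm1, hmb] at hc
    have hc2 : (q^n).coeff n * (ω^(2*n) - 1) = 0 := by linear_combination hc
    rcases mul_eq_zero.1 hc2 with h | h
    · exact h
    exfalso
    have h4 : ω^p = ω := by rw [hn, pow_succ]; linear_combination ω * h
    have h5 : (2:K)^p = 2 := by
      have := map_ofNat (frobenius K p) 2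
      exact this
    have h6 := congrArg (·^p) hω
    simp only [mul_pow, add_pow_char, one_pow] at h6
    rw [h4, h5, hf] at h6
    have h8 : 2 * θ = 0 := by linear_combination h6 - hω
    have h9 : θ = 0 := by simpa [h2] using h8
    rw [h9] at hθ
    apply h7; linear_combination hθ
  · intro k hk hkn
    rw [coeff_C_mul]
    have hk' : k < 2*n+1 := by simpa using hk
    rcases lt_or_gt_of_ne hkn with h | h
    · rw [i0_deriv hn h _ _ _ (by ring), mul_zero]
    · rw [show (X:K⟦X⟧)^k * m1^(k+n) * m0^(4*n-2*k) * mb = m1^(k+n) * m0^(4*n-2*k) * mb * X^k by ring, coeff_mul_X_pow', if_neg (by omega), mul_zero]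
  · intro h; exact absurd (by simp; omega) h


theorem legendre_neg7 {p n : ℕ} [hp : Fact p.Prime] (hn : p = 2*n+1) (h7 : p % 7 = 3 ∨ p % 7 = 5 ∨ p % 7 = 6) :
    (-7 : ZMod p)^n = -1 := by
  haveI : Fact (Nat.Prime 7) := ⟨by norm_num⟩
  have hp2 : p ≠ 2 := by omega
  have hp7 : p ≠ 7 := by omega
  have h1 := legendreSym.eq_pow p (-7)
  have hn2 : p / 2 = n := by omega
  have h2 := legendreSym.quadratic_reciprocity' (p := p) (q := 7) hp2 (by norm_num)
  have h3 := legendreSym.at_neg_one (p := p) hp2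
  have h4 : legendreSym p (-7) = legendreSym p (-1) * legendreSym p 7 := by
    rw [← legendreSym.mul]; norm_num
  have h6 : legendreSym 7 (p:ℤ) = -1 := by
    rw [legendreSym.mod 7 (p:ℤ)]
    have h8 : ((p:ℤ) % (7:ℕ)) = 3 ∨ ((p:ℤ) % (7:ℕ)) = 5 ∨ ((p:ℤ) % (7:ℕ)) = 6 := by omega
    rcases h8 with h | h | h <;> rw [h] <;> norm_num
  have h5 : legendreSym p (-7) = -1 := by
    rw [h4, h3, ZMod.χ₄_eq_neg_one_pow (by omega)]
    rw [h6, hn2] at h2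
    have h9 : ((-1:ℤ)^(n*(7/2))) = (-1)^n := by
      rw [show 7/2 = 3 by norm_num, mul_comm, pow_mul]; norm_num
    rw [h9] at h2
    rw [hn2]
    push_cast at h2
    have hs : ((-1:ℤ)^n)^2 = 1 := by rw [← pow_mul, mul_comm, pow_mul]; norm_num
    linear_combination -h2
  rw [h5, hn2] at h1
  push_cast at h1
  exact h1.symm

theorem I0_int {p n : ℕ} [hp : Fact p.Prime] (hn : p = 2*n+1) (h7 : p % 7 = 3 ∨ p % 7 = 5 ∨ p % 7 = 6) :
    (p:ℤ) ∣ ((1 - 42 * Polynomial.X + 448 * Polynomial.X^2 : Polynomial ℤ)^n).coeff n := by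
  let K := AlgebraicClosure (ZMod p)
  haveI : CharP K p := charP_of_injective_algebraMap (algebraMap (ZMod p) K).injective p
  obtain ⟨θ, hθ⟩ := IsAlgClosed.exists_pow_nat_eq (-7 : K) (n := 2) (by norm_num)
  have hm : ∀ m : ℕ, ¬ p ∣ m → (m:K) ≠ 0 := fun m h => by rwa [Ne, CharP.cast_eq_zero_iff K p]
  have hl := congrArg (algebraMap (ZMod p) K) (legendre_neg7 hn h7)
  simp only [map_pow, map_neg, map_one, map_ofNat] at hl
  have hf : θ^p = -θ := by
    have : θ^p = (θ^2)^n * θ := by rw [← pow_mul, ← pow_succ]; exact congrArg (θ^·) hn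
    rw [this, hθ, hl]; ring
  have h := I0_field (K := K) hn hθ hf
    (by exact_mod_cast hm 2 (fun h => by have := Nat.le_of_dvd (by norm_num) h; have := hp.out.two_le; omega))
    (by exact_mod_cast hm 7 (fun h => by have := (Nat.prime_dvd_prime_iff_eq hp.out (by norm_num : Nat.Prime 7)).1 h; omega))
  rw [← CharP.intCast_eq_zero_iff K p, ← eq_intCast (Int.castRingHom K), ← Polynomial.coeff_map, ← h]
  simp [Polynomial.map_pow]
end I0
end Z7
end

section
open Finset
set_option linter.unusedSectionVars false
set_option linter.unusedSimpArgs false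
set_option linter.unusedVariables false
namespace Z7
section count
variable {p : ℕ} [hp : Fact p.Prime]

theorem isUnit_zmod2 {m : ℤ} (h : ¬ (p:ℤ) ∣ m) : IsUnit (m : ZMod (p^2)) := by
  rw [ZMod.coe_int_isUnit_iff_isCoprime]
  push_cast
  apply IsCoprime.pow_left
  exact (Prime.coprime_iff_not_dvd (Nat.prime_iff_prime_int.1 hp.out)).2 h

theorem zeta_exists : ∃ ζ : ZMod (p^2), ∀ k, ∑ j ∈ range (p-1), (ζ^k)^j = if (p-1) ∣ k then ((p-1:ℕ):ZMod (p^2)) else 0 := by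
  obtain ⟨g, hg⟩ := IsCyclic.exists_generator (α := (ZMod p)ˣ)
  have ho : orderOf g = p - 1 := by
    rw [orderOf_eq_card_of_forall_mem_zpowers hg, Nat.card_eq_fintype_card, ZMod.card_units]
  obtain ⟨h, hh⟩ := ZMod.natCast_zmod_surjective (g : ZMod p)
  have hph : ¬ p ∣ h := by
    intro hd
    have : (h : ZMod p) = 0 := (ZMod.natCast_eq_zero_iff h p).2 hd
    rw [this] at hh
    exact g.ne_zero hh.symm
  have hcop : Nat.Coprime h (p^2) := Nat.Coprime.pow_right 2 ((Nat.Prime.coprime_iff_not_dvd hp.out).2 hph).symm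
  refine ⟨(h:ZMod (p^2))^p, fun k => ?_⟩
  have h1 : ((h:ZMod (p^2))^p)^(p-1) = 1 := by
    have := ZMod.pow_totient (ZMod.unitOfCoprime h hcop)
    have h2 := congrArg Units.val this
    rw [Nat.totient_prime_pow hp.out (by norm_num)] at h2
    simp at h2
    rw [← pow_mul]; exact h2
  split_ifs with hk
  · obtain ⟨m, rfl⟩ := hk
    rw [pow_mul, h1]; simp
  · have hu : IsUnit (((h:ZMod (p^2))^p)^k - 1) := by
      have : ((((h:ℤ)^p)^k - 1 : ℤ) : ZMod (p^2)) = ((h:ZMod (p^2))^p)^k - 1 := by push_cast; ring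
      rw [← this]
      apply isUnit_zmod2
      intro hd
      have h3 := (ZMod.intCast_zmod_eq_zero_iff_dvd _ p).2 hd
      push_cast at h3
      rw [hh, ZMod.pow_card, sub_eq_zero] at h3
      apply hk
      rw [← ho]
      apply orderOf_dvd_of_pow_eq_one
      apply Units.ext; push_cast; exact h3
    have := geom_sum_mul (((h:ZMod (p^2))^p)^k) (p-1)
    rw [← pow_mul _ k (p-1), mul_comm k, pow_mul, h1, one_pow, sub_self] at this
    exact (hu.mul_left_eq_zero).1 this

theorem p_sq_zero : (p : ZMod (p^2))^2 = 0 := by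
  have := ZMod.natCast_self (p^2); push_cast at this; exact this

theorem chi_exists {n : ℕ} (hn : p = 2*n+1) (hn2 : 2 ≤ n) (w : ZMod (p^2)) :
    ∃ a c : ℤ, (a : ZMod (p^2)) = w ∧ |c| ≤ 1 ∧ (p:ℤ) ∣ a^n - c ∧ 3 * w^n - w^(3*n) = 2 * (c : ZMod (p^2)) := by
  obtain ⟨a, ha⟩ := ZMod.intCast_surjective w
  refine ⟨a, legendreSym p a, ha, ?_, ?_, ?_⟩
  · by_cases h : (a : ZMod p) = 0
    · rw [(legendreSym.eq_zero_iff p a).2 h]; norm_num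
    · rcases legendreSym.eq_one_or_neg_one p h with h | h <;> rw [h] <;> norm_num
  · rw [← ZMod.intCast_zmod_eq_zero_iff_dvd]
    push_cast
    rw [legendreSym.eq_pow, show p/2 = n by omega, sub_self]
  · rw [← ha]
    by_cases h : (a : ZMod p) = 0
    · rw [(legendreSym.eq_zero_iff p a).2 h]
      obtain ⟨b, rfl⟩ := (ZMod.intCast_zmod_eq_zero_iff_dvd _ p).1 h
      have e : ∀ m, 2 ≤ m → (((p*b:ℤ)) : ZMod (p^2))^m = 0 := by
        intro m hm
        obtain ⟨r, rfl⟩ := Nat.exists_eq_add_of_le hm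
        push_cast
        rw [pow_add, mul_pow, p_sq_zero]; ring
      rw [e n hn2, e (3*n) (by omega)]; simp
    · have h2 : (p:ℤ) ∣ a^n - legendreSym p a := by
        rw [← ZMod.intCast_zmod_eq_zero_iff_dvd]
        push_cast
        rw [legendreSym.eq_pow, show p/2 = n by omega, sub_self]
      have h3 : (legendreSym p a)^2 = 1 := legendreSym.sq_one p h
      obtain ⟨t, ht⟩ := h2
      have h4 := congrArg (Int.cast (R := ZMod (p^2))) ht
      have h5 := congrArg (Int.cast (R := ZMod (p^2))) h3
      push_cast at h4 h5
      have h6 : (a : ZMod (p^2))^n = legendreSym p a + p * t := by linear_combination h4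
      rw [mul_comm 3 n, pow_mul, h6]
      have := p_sq_zero (p := p)
      set l := ((legendreSym p a : ℤ) : ZMod (p^2))
      linear_combination (-3 * l * (t:ZMod (p^2))^2 - p * t^3) * this + (-l - 3 * p * t) * h5

noncomputable abbrev qZ : Polynomial ℤ := 1 - 42 * Polynomial.X + 448 * Polynomial.X^2

theorem qZ_deg (N : ℕ) : (qZ^N).natDegree < 2*N+1 := by
  have h1 : qZ.natDegree ≤ 2 := by unfold qZ; compute_degree
  have := Polynomial.natDegree_pow_le_of_le N h1
  omega

theorem sum_w {ζ : ZMod (p^2)} (hζ : ∀ k, ∑ j ∈ range (p-1), (ζ^k)^j = if (p-1) ∣ k then ((p-1:ℕ):ZMod (p^2)) else 0) (N : ℕ) :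
    ∑ j ∈ range (p-1), (Polynomial.aeval (ζ^j) qZ * ζ^(j*(p-2)))^N = ((p-1:ℕ) : ZMod (p^2)) * 
      ∑ k ∈ range (2*N+1), if (p-1) ∣ k + (p-2)*N then ((qZ^N).coeff k : ZMod (p^2)) else 0 := by
  have h1 : ∀ j, (Polynomial.aeval (ζ^j) qZ * ζ^(j*(p-2)))^N = ∑ k ∈ range (2*N+1), ((qZ^N).coeff k : ZMod (p^2)) * (ζ^(k+(p-2)*N))^j := by
    intro j
    rw [mul_pow, ← map_pow, Polynomial.aeval_eq_sum_range' (qZ_deg N), sum_mul]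
    refine sum_congr rfl fun k _ => ?_
    rw [zsmul_eq_mul, mul_assoc]
    congr 1
    rw [← pow_mul, ← pow_mul, ← pow_add, ← pow_mul]; congr 1; ring
  rw [sum_congr rfl fun j _ => h1 j, sum_comm, mul_sum]
  refine sum_congr rfl fun k _ => ?_
  rw [← mul_sum, hζ]; split_ifs <;> ring

theorem count_main {n : ℕ} (hn : p = 2*n+1) (hn2 : 2 ≤ n) (h0 : (p:ℤ) ∣ (qZ^n).coeff n) :
    3 * ((qZ^n).coeff n : ZMod (p^2)) = (qZ^(3*n)).coeff n + (qZ^(3*n)).coeff (3*n) + (qZ^(3*n)).coeff (5*n) := by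
  obtain ⟨ζ, hζ⟩ := zeta_exists (p := p)
  set w : ℕ → ZMod (p^2) := fun j => Polynomial.aeval (ζ^j) qZ * ζ^(j*(p-2)) with hw
  choose a c ha hc hac h3 using fun j => chi_exists hn hn2 (w j)
  have s1 := sum_w hζ n
  have s3 := sum_w hζ (3*n)
  have hdiv : ∀ m k : ℕ, (p-1) ∣ k + (p-2)*(m*n) ↔ (2*(n:ℤ)) ∣ ((k:ℤ) - m * n) := by
    intro m k
    have h1 : p - 1 = 2*n := by omega
    have h2 : p - 2 = 2*n-1 := by omega
    rw [h1, h2]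
    have e : ((k + (2*n-1)*(m*n) : ℕ) : ℤ) = ((k:ℤ) - m*n) + (2*n)*(m*n) := by
      push_cast [Nat.cast_sub (by omega : 1 ≤ 2*n)]; ring
    rw [← Int.natCast_dvd_natCast, e]
    push_cast
    exact Int.dvd_add_left (Dvd.intro _ rfl)
  have t1 : (∑ k ∈ range (2*n+1), if (p-1) ∣ k + (p-2)*n then ((qZ^n).coeff k : ZMod (p^2)) else 0) = (qZ^n).coeff n := by
    rw [sum_eq_single n]
    · rw [if_pos]
      have := (hdiv 1 n).2 (by simp); simpa using this
    · intro k hk hkn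
      rw [if_neg]
      intro hd
      have := (hdiv 1 k).1 (by simpa using hd)
      obtain ⟨r, hr⟩ := this
      simp at hk
      push_cast at hr
      have : r < 1 := by nlinarith
      have : -1 < r := by nlinarith
      have : r = 0 := by omega
      subst this; apply hkn; omega
    · intro h; exact absurd (by simp; omega) h
  have t3 : (∑ k ∈ range (2*(3*n)+1), if (p-1) ∣ k + (p-2)*(3*n) then ((qZ^(3*n)).coeff k : ZMod (p^2)) else 0) =
      (qZ^(3*n)).coeff n + (qZ^(3*n)).coeff (3*n) + (qZ^(3*n)).coeff (5*n) := by
    rw [← sum_filter]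
    have : (range (2*(3*n)+1)).filter (fun k => (p-1) ∣ k + (p-2)*(3*n)) = {n, 3*n, 5*n} := by
      ext k
      rw [mem_filter, hdiv 3 k]
      simp only [mem_range, mem_insert, mem_singleton]
      constructor
      · rintro ⟨hk, r, hr⟩
        push_cast at hr
        have : r < 2 := by nlinarith
        have : -2 < r := by nlinarith
        have : r = -1 ∨ r = 0 ∨ r = 1 := by omega
        rcases this with rfl | rfl | rfl
        · left; omega
        · right; left; omega
        · right; right; omega
      · rintro (rfl | rfl | rfl)
        · exact ⟨by omega, -1, by push_cast; ring⟩
        · exact ⟨by omega, 0, by push_cast; ring⟩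
        · exact ⟨by omega, 1, by push_cast; ring⟩
    rw [this, sum_insert, sum_insert, sum_singleton, add_assoc]
    · simp; omega
    · simp; omega
  rw [t1] at s1
  rw [t3] at s3
  have hI : (∑ j ∈ range (p-1), c j) = 0 := by
    have hd1 : (p:ℤ) ∣ ∑ j ∈ range (p-1), (a j)^n := by
      have h1 : ((∑ j ∈ range (p-1), (a j)^n - ((p-1:ℕ):ℤ) * (qZ^n).coeff n : ℤ) : ZMod (p^2)) = 0 := by
        push_cast
        rw [sub_eq_zero, ← s1]
        refine sum_congr rfl fun j _ => ?_
        rw [ha]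
      have h2 := (ZMod.intCast_zmod_eq_zero_iff_dvd _ (p^2)).1 h1
      have h3 : (p:ℤ) ∣ ∑ j ∈ range (p-1), (a j)^n - ((p-1:ℕ):ℤ) * (qZ^n).coeff n :=
        dvd_trans (by push_cast; exact dvd_pow_self _ (by norm_num)) h2
      have := dvd_add h3 (h0.mul_left ((p-1:ℕ):ℤ))
      simpa using this
    have hd2 : (p:ℤ) ∣ ∑ j ∈ range (p-1), c j := by
      have h1 : (p:ℤ) ∣ ∑ j ∈ range (p-1), ((a j)^n - c j) := dvd_sum fun j _ => hac j
      rw [sum_sub_distrib] at h1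
      have := dvd_sub hd1 h1
      simpa using this
    have hb : |∑ j ∈ range (p-1), c j| ≤ (p-1:ℕ) := by
      refine (abs_sum_le_sum_abs _ _).trans ?_
      refine (sum_le_sum fun j _ => hc j).trans ?_
      simp
    apply Int.eq_zero_of_abs_lt_dvd hd2
    have := hp.out.two_le
    omega
  have hfin : 3 * (((p-1:ℕ):ZMod (p^2)) * (qZ^n).coeff n) - ((p-1:ℕ):ZMod (p^2)) * ((qZ^(3*n)).coeff n + (qZ^(3*n)).coeff (3*n) + (qZ^(3*n)).coeff (5*n)) = 0 := by
    rw [← s1, ← s3, mul_sum, ← sum_sub_distrib]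
    rw [sum_congr rfl fun j _ => h3 j, ← mul_sum, ← Int.cast_sum, hI]; simp
  have hu : IsUnit (((p-1:ℕ):ℤ) : ZMod (p^2)) := isUnit_zmod2 (by
    intro hd
    have := Int.natCast_dvd_natCast.1 hd
    have := Nat.le_of_dvd (by have := hp.out.two_le; omega) this
    have := hp.out.two_le; omega)
  push_cast at hu
  apply hu.mul_left_cancel
  linear_combination hfin
end count
end Z7
end

section
open Finset
set_option linter.unusedSectionVars false
set_option linter.unusedSimpArgs false
set_option linter.unusedVariables false
namespace Z7
section Sring
variable {S : Type*} [CommRing S] {p n : ℕ} [hp : Fact p.Prime]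

theorem unitS (hpS : (p:S)^2 = 0) {m : ℤ} (h : ¬ (p:ℤ) ∣ m) : IsUnit (m:S) := by
  have h1 : IsCoprime m ((p:ℤ)^2) :=
    (IsCoprime.pow_left ((Prime.coprime_iff_not_dvd (Nat.prime_iff_prime_int.1 hp.out)).2 h)).symm
  obtain ⟨a, b, hab⟩ := h1
  have := congrArg (Int.cast (R := S)) hab
  push_cast at this
  rw [hpS, mul_zero, add_zero] at this
  exact IsUnit.of_mul_eq_one _ (by rw [mul_comm]; exact this)

variable (S) in
/-- inverse of an integer in `S` (when it exists) -/
noncomputable def iv (m : ℕ) : S := Ring.inverse (m:S)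

theorem iv_mul (hpS : (p:S)^2 = 0) {m : ℕ} (h : ¬ p ∣ m) : (m:S) * iv S m = 1 := by
  apply Ring.mul_inverse_cancel
  have := unitS hpS (m := (m:ℤ)) (by rwa [Int.natCast_dvd_natCast])
  simpa using this

theorem not_dvd_lt {m : ℕ} (h0 : 0 < m) (h : m < p) : ¬ p ∣ m := fun hd => by
  have := Nat.le_of_dvd h0 hd; omega

theorem iv_odd (hn : p = 2*n+1) (hpS : (p:S)^2 = 0) {l : ℕ} (hl : l < n) : (2*(l:S)+1) * iv S (2*l+1) = 1 := by
  have := iv_mul hpS (not_dvd_lt (p := p) (m := 2*l+1) (by omega) (by omega))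
  push_cast at this; exact this

theorem pn (hn : p = 2*n+1) : (p:S) = 2*n+1 := by
  have := congrArg (Nat.cast (R := S)) hn
  push_cast at this; exact this

variable (S) in
/-- odd harmonic sums -/
noncomputable def oS (i : ℕ) : S := ∑ l ∈ range i, iv S (2*l+1)

theorem oS_succ (i : ℕ) : oS S (i+1) = oS S i + iv S (2*i+1) := sum_range_succ _ _
theorem oS_zero : oS S 0 = 0 := sum_range_zero _

variable (S) in
def fS (n i : ℕ) : S := (n.choose i : S)^2

theorem fS_step (n i : ℕ) : ((i:S)+1)^2 * fS S n (i+1) = ((n:S)-i)^2 * fS S n i := by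
  have := congrArg (Int.cast (R := S)) (choose_down n i)
  push_cast at this
  simp only [fS]
  linear_combination ((n.choose (i+1) : S)*(i+1) + (n.choose i:S) * (n - i)) * this

theorem fS_gt {n i : ℕ} (h : n < i) : fS S n i = 0 := by simp [fS, Nat.choose_eq_zero_of_lt h]
theorem fS_symm {n i : ℕ} (h : i ≤ n) : fS S n (n-i) = fS S n i := by simp [fS, Nat.choose_symm h]

/-- weighted sums -/
def Ew (X : S) (n : ℕ) (w : ℕ → S) : S := ∑ i ∈ range (n+1), w i * fS S n i * X^i

theorem Ew_shift (X : S) (n : ℕ) (α β : ℕ → S) (h0 : α 0 * fS S n 0 = 0) (hβ : β n * fS S n n = 0)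
    (h : ∀ i < n, α (i+1) * fS S n (i+1) = β i * fS S n i) : Ew X n α = X * Ew X n β := by
  rw [Ew, Ew, sum_range_succ', sum_range_succ, h0, hβ, mul_add, mul_sum]
  simp only [zero_mul, mul_zero, add_zero]
  refine sum_congr rfl fun i hi => ?_
  rw [h i (by simpa using hi)]; ring

theorem Ew_add (X : S) (n : ℕ) (v w : ℕ → S) : Ew X n (fun i => v i + w i) = Ew X n v + Ew X n w := by
  simp only [Ew, ← sum_add_distrib]; exact sum_congr rfl fun i _ => by ring
theorem Ew_mul (X : S) (n : ℕ) (c : S) (w : ℕ → S) : Ew X n (fun i => c * w i) = c * Ew X n w := by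
  simp only [Ew, mul_sum]; exact sum_congr rfl fun i _ => by ring
theorem Ew_congr (X : S) (n : ℕ) {v w : ℕ → S} (h : ∀ i ≤ n, v i = w i) : Ew X n v = Ew X n w := by
  simp only [Ew]; exact sum_congr rfl fun i hi => by rw [h i (by simp at hi; omega)]

/-- named sums -/
def g0 (X : S) (n : ℕ) : S := Ew X n (fun _ => 1)
def g1 (X : S) (n : ℕ) : S := Ew X n (fun i => (i:S))
def g2 (X : S) (n : ℕ) : S := Ew X n (fun i => (i:S)^2)
noncomputable def A0 (X : S) (n : ℕ) : S := Ew X n (fun i => oS S i)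
noncomputable def A1 (X : S) (n : ℕ) : S := Ew X n (fun i => (i:S) * oS S i)
noncomputable def A2 (X : S) (n : ℕ) : S := Ew X n (fun i => (i:S)^2 * oS S i)
noncomputable def B0 (X : S) (n : ℕ) : S := Ew X n (fun i => oS S (n-i))
noncomputable def B1 (X : S) (n : ℕ) : S := Ew X n (fun i => (i:S) * oS S (n-i))
noncomputable def B2 (X : S) (n : ℕ) : S := Ew X n (fun i => (i:S)^2 * oS S (n-i))

theorem ER1 (X : S) (n : ℕ) : g2 X n = X * (n^2 * g0 X n - 2*n * g1 X n + g2 X n) := by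
  have h := Ew_shift X n (fun i => (i:S)^2) (fun i => ((n:S)-i)^2) (by simp) (by simp)
    (fun i _ => by simpa using fS_step n i)
  have e : Ew X n (fun i => ((n:S)-i)^2) = n^2 * g0 X n - 2*n * g1 X n + g2 X n := by
    simp only [g0, g1, g2, Ew, mul_sum, ← sum_add_distrib, ← sum_sub_distrib]
    exact sum_congr rfl fun i _ => by ring
  rw [e] at h
  exact h

theorem ER2 (hn : p = 2*n+1) (hpS : (p:S)^2 = 0) (X : S) :
    4 * p * A2 X n = p * X * (A0 X n + 4 * A1 X n + 4 * A2 X n + 2 * g1 X n + g0 X n) := by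
  have hpn := pn (S := S) hn
  have h := Ew_shift X n (fun i => 4 * p * ((i:S)^2 * oS S i)) (fun i => p * ((2*i+1)^2 * oS S i + (2*i+1))) (by simp)
    (by rw [← hpn]; linear_combination (fS S n n * (p * oS S n + 1)) * hpS)
    (fun i hi => by
      have h1 := fS_step (S := S) n i
      have h2 := iv_odd hn hpS hi
      rw [oS_succ]
      push_cast
      have h3 : 2*((n:S)-i) = p - (2*i+1) := by rw [hpn]; ring
      have h4 : 4 * p * ((n:S)-i)^2 = p * (2*i+1)^2 := by
        linear_combination p * (2*((n:S)-i) + p - (2*i+1)) * h3 + (p - 2*(2*i+1)) * hpS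
      linear_combination 4 * p * (oS S i + iv S (2*i+1)) * h1 + (oS S i + iv S (2*i+1)) * fS S n i * h4 + fS S n i * p * (2*i+1) * h2)
  have e1 : Ew X n (fun i => 4 * p * ((i:S)^2 * oS S i)) = 4 * p * A2 X n := Ew_mul _ _ _ _
  have e2 : Ew X n (fun i => p * ((2*(i:S)+1)^2 * oS S i + (2*i+1)))
      = p * (A0 X n + 4 * A1 X n + 4 * A2 X n + 2 * g1 X n + g0 X n) := by
    simp only [g0, g1, A0, A1, A2, Ew, mul_sum, ← sum_add_distrib, ← sum_sub_distrib]
    exact sum_congr rfl fun i _ => by ring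
  rw [e1, e2] at h
  linear_combination h

theorem ER3 (hn : p = 2*n+1) (hp2 : p ≠ 2) (hpS : (p:S)^2 = 0) (X : S) :
    4 * p * B2 X n = p * X * (B0 X n + 4 * B1 X n + 4 * B2 X n) + 2 * p * g1 X n := by
  have hpn := pn (S := S) hn
  have h := Ew_shift X n (fun i => p * (4 * ((i:S)^2 * oS S (n-i)) - 2 * i)) (fun i => p * ((2*i+1)^2 * oS S (n-i))) (by simp)
    (by simp [oS_zero])
    (fun i hi => by
      have h1 := fS_step (S := S) n i
      obtain ⟨m, hm⟩ : ∃ m, n = i + 1 + m := ⟨n-i-1, by omega⟩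
      have e1 : n - i = m+1 := by omega
      have e2 : n - (i+1) = m := by omega
      have h2 := iv_odd hn hpS (l := m) (by omega)
      rw [e1, e2, oS_succ]
      have hm2 : (n:S) = i + 1 + m := by rw [hm]; push_cast; ring
      push_cast
      have h3 : 2*((n:S)-i) = p - (2*i+1) := by rw [hpn]; ring
      have h4 : 4 * p * ((n:S)-i)^2 = p * (2*i+1)^2 := by
        linear_combination p * (2*((n:S)-i) + p - (2*i+1)) * h3 + (p - 2*(2*i+1)) * hpS
      have h5 : p * (2*(m:S)+1) = - (2 * p * ((i:S)+1)) := by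
        have : (2*(m:S)+1) = p - 2*(i+1) := by rw [hpn, hm2]; ring
        rw [this]; linear_combination hpS
      have h6 : p + 2 * p * ((i:S)+1) * iv S (2*m+1) = 0 := by
        linear_combination -(p:S) * h2 + iv S (2*m+1) * h5
      linear_combination 4 * p * (oS S m + iv S (2*m+1)) * h1 + (oS S m + iv S (2*m+1)) * fS S n i * h4 - 2 * ((i:S)+1) * fS S n (i+1) * h6)
  have e : Ew X n (fun i => p * (4 * ((i:S)^2 * oS S (n-i)) - 2 * i)) = 4 * p * B2 X n - 2 * p * g1 X n := by
    rw [B2, g1, ← Ew_mul, sub_eq_add_neg, ← neg_one_mul, ← Ew_mul, ← Ew_mul, ← Ew_add]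
    apply Ew_congr; intro i _; ring
  have e2 : Ew X n (fun i => p * ((2*(i:S)+1)^2 * oS S (n-i))) = p * (B0 X n + 4 * B1 X n + 4 * B2 X n) := by
    rw [B0, B1, B2, ← Ew_mul, ← Ew_mul, ← Ew_add, ← Ew_add, ← Ew_mul]
    apply Ew_congr; intro i _; ring
  rw [e, e2] at h
  linear_combination h

end Sring
end Z7
end

section
open Finset
set_option linter.unusedSectionVars false
set_option linter.unusedSimpArgs false
set_option linter.unusedVariables false
namespace Z7
section Sring
variable {S : Type*} [CommRing S] {p n : ℕ} [hp : Fact p.Prime]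

theorem iv_zero : iv S 0 = 0 := by
  rcases subsingleton_or_nontrivial S with h | h
  · exact Subsingleton.elim _ _
  · simp [iv]

variable (S) in
/-- convolution of `1/i` with the squares of binomials -/
noncomputable def dS (n N : ℕ) : S := ∑ a ∈ range (N+1), iv S a * fS S n (N-a)

theorem fS_stepp (hn : p = 2*n+1) (hpS : (p:S)^2 = 0) (i : ℕ) :
    4 * p * (((i:S)+1)^2 * fS S n (i+1)) = p * ((2*i+1)^2 * fS S n i) := by
  have h3 : 2*((n:S)-i) = p - (2*i+1) := by rw [pn (S := S) hn]; ring
  have h4 : 4 * p * ((n:S)-i)^2 = p * (2*i+1)^2 := by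
    linear_combination p * (2*((n:S)-i) + p - (2*i+1)) * h3 + (p - 2*(2*i+1)) * hpS
  rw [fS_step]; linear_combination fS S n i * h4

theorem dS_succ (N : ℕ) : dS S n N = ∑ a ∈ range N, iv S (a+1) * fS S n (N-(a+1)) := by
  rw [dS, sum_range_succ', iv_zero]; simp

theorem dS_rec (hn : p = 2*n+1) (hpS : (p:S)^2 = 0) {N : ℕ} (hN : N + 1 < p) :
    4 * p * (((N:S)+1)^2 * dS S n (N+1)) = p * ((2*N+1)^2 * dS S n N) + 4 * p * ((2*N+1) * fS S n N) := by
  have key : ∀ a ∈ range N, 4 * p * (((N:S)+1)^2 * (iv S (a+1) * fS S n (N+1-(a+1))))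
      - p * ((2*N+1)^2 * (iv S (a+1) * fS S n (N-(a+1)))) =
      4 * p * (2*(N+1)-(a+1)) * fS S n (N - a) - 4 * p * (2*(N+1)-((a+1:ℕ)+1)) * fS S n (N-(a+1)) := by
    intro a ha
    have ha' : a < N := by simpa using ha
    obtain ⟨m, rfl⟩ : ∃ m, N = a + 1 + m := ⟨N-a-1, by omega⟩
    have e1 : a + 1 + m + 1 - (a+1) = m+1 := by omega
    have e2 : a + 1 + m - (a+1) = m := by omega
    have e3 : a + 1 + m - a = m+1 := by omega
    rw [e1, e2, e3]
    have h1 := fS_stepp hn hpS (S := S) m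
    have h2 := iv_mul hpS (not_dvd_lt (p := p) (m := a+1) (by omega) (by omega))
    push_cast at h2 ⊢
    linear_combination iv S (a+1) * h1 + (4 * p * (2*(m+1)+(a+1)) * fS S n (m+1) - p * (4*(2*m+1)+4*(a+1)) * fS S n m) * h2
  have hs := sum_congr rfl key
  have tele := sum_range_sub' (fun a => 4 * (p:S) * (2*(N+1)-((a:S)+1)) * fS S n (N - a)) N
  rw [tele, sum_sub_distrib, ← mul_sum, ← mul_sum, ← mul_sum, ← mul_sum] at hs
  have h2 := iv_mul hpS (not_dvd_lt (p := p) (m := N+1) (by omega) (by omega))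
  rw [dS_succ, dS_succ, sum_range_succ]
  simp only [Nat.sub_self, Nat.sub_zero, Nat.cast_zero, zero_add, Nat.add_sub_add_right] at hs ⊢
  push_cast at h2 hs
  linear_combination hs + 4 * p * (N+1) * fS S n 0 * h2

theorem dS_eq (hn : p = 2*n+1) (hp2 : p ≠ 2) (hpS : (p:S)^2 = 0) {N : ℕ} (hN : N < p) :
    p * dS S n N = 4 * p * (oS S N * fS S n N) := by
  induction N with
  | zero => simp [dS, oS_zero, iv_zero]
  | succ N ih =>
    have ih := ih (by omega)
    have hr := dS_rec hn hpS hN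
    have hf := fS_stepp hn hpS (S := S) N
    have u : IsUnit (4 * ((N:S)+1)^2) := by
      have := unitS hpS (S := S) (m := (4 * ((N:ℤ)+1)^2)) (by
        intro hd
        have hpp := Nat.prime_iff_prime_int.1 hp.out
        rcases hpp.dvd_or_dvd hd with h | h
        · have : p ∣ 2^2 := by exact_mod_cast h
          exact hp2 ((Nat.prime_dvd_prime_iff_eq hp.out Nat.prime_two).1 (hp.out.dvd_of_dvd_pow this))
        · have := hpp.dvd_of_dvd_pow h
          exact not_dvd_lt (p := p) (m := N+1) (by omega) hN (by exact_mod_cast this))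
      push_cast at this; exact this
    apply u.mul_left_cancel
    rcases lt_trichotomy N n with h | h | h
    · have h2 := iv_odd hn hpS h
      rw [oS_succ]
      linear_combination hr + (2*N+1)^2 * ih - 4 * (oS S N + iv S (2*N+1)) * hf - 4 * p * (2*N+1) * fS S n N * h2
    · subst h
      rw [fS_gt (Nat.lt_succ_self N)]
      have hpn := pn (S := S) hn
      rw [← hpn] at hr
      linear_combination hr + (p * dS S N N + 4 * fS S N N) * hpS
    · rw [fS_gt (show n < N+1 by omega)]
      rw [fS_gt h] at hr ih
      linear_combination hr + (2*N+1)^2 * ih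

open Polynomial in
/-- polynomial with weights -/
noncomputable def pl (n : ℕ) (w : ℕ → S) : S[X] := ∑ i ∈ range (n+1), C (w i * fS S n i) * X^i

open Polynomial in
theorem pl_coeff (n : ℕ) (w : ℕ → S) (k : ℕ) : (pl n w).coeff k = w k * fS S n k := by
  rw [pl, finsetSum_coeff]
  simp only [coeff_C_mul, coeff_X_pow]
  by_cases h : k ≤ n
  · rw [sum_eq_single k (fun b _ hb => by simp [hb.symm]) (fun h' => by simp at h'; omega)]; simp
  · rw [fS_gt (by omega), mul_zero]
    refine sum_eq_zero fun i hi => ?_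
    simp only [mem_range] at hi
    rw [if_neg (by omega), mul_zero]

open Polynomial in
theorem pl_eval (X : S) (n : ℕ) (w : ℕ → S) : (pl n w).eval X = Ew X n w := by
  rw [pl, eval_finsetSum, Ew]; exact sum_congr rfl fun i _ => by simp

open Polynomial in
theorem pl_deriv (X : S) (n : ℕ) (w : ℕ → S) :
    X * (derivative (pl n w)).eval X = Ew X n (fun i => (i:S) * w i) := by
  rw [pl, derivative_sum, eval_finsetSum, Ew, mul_sum]
  refine sum_congr rfl fun i _ => ?_
  rcases i with _ | i
  · simp
  · rw [derivative_C_mul_X_pow]; simp only [eval_mul, eval_C, eval_pow, eval_X, Nat.add_sub_cancel]; ring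

open Polynomial in
variable (S) in
noncomputable def La (p : ℕ) : S[X] := ∑ i ∈ range p, C (iv S i) * X^i

open Polynomial in
theorem La_coeff (k : ℕ) : (La S p).coeff k = if k < p then iv S k else 0 := by
  rw [La, finsetSum_coeff]
  simp only [coeff_C_mul, coeff_X_pow]
  split_ifs with h
  · rw [sum_eq_single k (fun b _ hb => by simp [hb.symm]) (fun h' => by simp at h'; omega)]; simp
  · refine sum_eq_zero fun i hi => ?_
    simp only [mem_range] at hi
    rw [if_neg (by omega), mul_zero]

theorem iv_refl (hpS : (p:S)^2 = 0) {a : ℕ} (h0 : 0 < a) (ha : a < p) : p * iv S (p-a) = - (p * iv S a) := by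
  have h1 := iv_mul hpS (not_dvd_lt (p := p) (m := a) h0 ha)
  have h2 := iv_mul hpS (not_dvd_lt (p := p) (m := p-a) (by omega) (by omega))
  rw [Nat.cast_sub ha.le] at h2
  linear_combination -p * iv S a * h2 - p * iv S (p-a) * h1 + iv S a * iv S (p-a) * hpS

open Polynomial in
theorem c6 (hn : p = 2*n+1) (hp2 : p ≠ 2) (hpS : (p:S)^2 = 0) :
    C (p:S) * (La S p * pl n (fun _ => 1)) =
      C (p:S) * (C 4 * pl n (fun i => oS S i) - C 4 * (X^p * pl n (fun i => oS S (n-i)))) := by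
  ext N
  rw [coeff_C_mul, coeff_C_mul, coeff_sub, coeff_C_mul, coeff_C_mul, coeff_X_pow_mul', coeff_mul,
    Finset.Nat.sum_antidiagonal_eq_sum_range_succ (fun a b => (La S p).coeff a * (pl n (fun _ => (1:S))).coeff b)]
  simp only [La_coeff, pl_coeff, one_mul]
  rcases lt_or_ge N p with h | h
  · rw [if_neg (by omega)]
    have : ∑ a ∈ range N.succ, (if a < p then iv S a else 0) * fS S n (N-a) = dS S n N :=
      sum_congr rfl fun a ha => by rw [mem_range] at ha; rw [if_pos (by omega)]
    rw [this, dS_eq hn hp2 hpS h]; ring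
  · obtain ⟨M, rfl⟩ : ∃ M, N = p + M := ⟨N-p, by omega⟩
    rw [if_pos h, fS_gt (show n < p + M by omega), Nat.add_sub_cancel_left]
    have e1 : ∑ a ∈ range (p+M).succ, (if a < p then iv S a else 0) * fS S n (p+M-a)
        = ∑ a ∈ range p, iv S a * fS S n (p+M-a) := by
      rw [show (p+M).succ = p + (M+1) by omega, sum_range_add]
      rw [sum_eq_zero (s := range (M+1)) (fun a _ => by rw [if_neg (by omega), zero_mul]), add_zero]
      exact sum_congr rfl fun a ha => by rw [mem_range] at ha; rw [if_pos ha]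
    obtain ⟨q, hq⟩ : ∃ q, p = q + 1 := ⟨2*n, hn⟩
    have e2 : p * ∑ a ∈ range p, iv S a * fS S n (p+M-a) = - (p * ∑ b ∈ range q, iv S (b+1) * fS S n (M+(b+1))) := by
      have : range p = range (q+1) := by rw [hq]
      rw [this, sum_range_succ', iv_zero, zero_mul, add_zero, ← sum_range_reflect, mul_sum, mul_sum, ← sum_neg_distrib]
      refine sum_congr rfl fun b hb => ?_
      rw [mem_range] at hb
      rw [show q - 1 - b + 1 = p - (b+1) by omega, show p + M - (p - (b+1)) = M+(b+1) by omega]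
      linear_combination fS S n (M+(b+1)) * iv_refl hpS (S := S) (a := b+1) (by omega) (by omega)
    rw [e1, e2]
    rcases le_or_gt M n with hM | hM
    · have e3 : ∑ b ∈ range q, iv S (b+1) * fS S n (M+(b+1)) = dS S n (n-M) := by
        rw [dS_succ, show q = (n-M) + (q-(n-M)) by omega, sum_range_add]
        rw [sum_eq_zero (s := range (q-(n-M))) (fun a _ => by rw [fS_gt (by omega), mul_zero]), add_zero]
        refine sum_congr rfl fun a ha => ?_
        rw [mem_range] at ha
        rw [← fS_symm (show n - M - (a+1) ≤ n by omega)]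
        congr 2; omega
      rw [e3, dS_eq hn hp2 hpS (by omega), fS_symm hM]; ring
    · rw [fS_gt hM, sum_eq_zero (fun b _ => by rw [fS_gt (by omega), mul_zero])]; ring

theorem C1r (hn : p = 2*n+1) (hp2 : p ≠ 2) (hpS : (p:S)^2 = 0) (X : S) (hX : p * (X * X^p) = p)
    (hg : p * g0 X n = 0) : p * (X * A0 X n) = p * B0 X n := by
  have h := congrArg (Polynomial.eval X) (c6 (S := S) hn hp2 hpS)
  simp only [Polynomial.eval_mul, Polynomial.eval_C, Polynomial.eval_sub, Polynomial.eval_pow, Polynomial.eval_X, pl_eval] at h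
  change (p:S) * (_ * g0 X n) = p * (4 * A0 X n - 4 * (X^p * B0 X n)) at h
  have u : IsUnit (4:S) := by
    have := unitS hpS (S := S) (m := 4) (by
      intro hd
      have : p ∣ 2^2 := by exact_mod_cast hd
      exact hp2 ((Nat.prime_dvd_prime_iff_eq hp.out Nat.prime_two).1 (hp.out.dvd_of_dvd_pow this)))
    push_cast at this; exact this
  apply u.mul_left_cancel
  linear_combination -X * h + (Polynomial.eval X (La S p)) * X * hg - 4 * B0 X n * (-hX)

theorem C2r (hn : p = 2*n+1) (hp2 : p ≠ 2) (hpS : (p:S)^2 = 0) (X : S) (hX : p * (X * X^p) = p)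
    (hg : p * g0 X n = 0) :
    p * (X * ((La S p).eval X * g1 X n)) = 4 * p * (X * A1 X n - B1 X n) := by
  have h := congrArg (fun P => X * Polynomial.eval X (Polynomial.derivative P)) (c6 (S := S) hn hp2 hpS)
  simp only [Polynomial.derivative_mul, Polynomial.derivative_C, Polynomial.derivative_sub, Polynomial.derivative_X_pow,
    Polynomial.eval_add, Polynomial.eval_mul, Polynomial.eval_C, Polynomial.eval_sub, Polynomial.eval_pow, Polynomial.eval_X, pl_eval, Polynomial.eval_zero, Polynomial.eval_natCast] at h
  have d0 := pl_deriv X n (fun _ => (1:S))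
  have d1 := pl_deriv X n (fun i => oS S i)
  have d2 := pl_deriv X n (fun i => oS S (n-i))
  have d0' : Ew X n (fun i => (i:S) * 1) = g1 X n := by simp [g1]
  rw [d0'] at d0
  change _ = A1 X n at d1
  change _ = B1 X n at d2
  change X * (_ + (p:S) * (_ * g0 X n + _)) = _ at h
  linear_combination X * h - X^2 * (Polynomial.eval X (Polynomial.derivative (La S p))) * hg - p * X * (Polynomial.eval X (La S p)) * d0 + 4 * p * X * d1 - 4 * p * X * X^p * d2 - 4 * B1 X n * hX - 4 * X^2 * X^(p-1) * Ew X n (fun i => oS S (n-i)) * hpS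

end Sring
end Z7
end

section
open Finset
set_option linter.unusedSectionVars false
set_option linter.unusedSimpArgs false
set_option linter.unusedVariables false
namespace Z7
section Sring
variable {S : Type*} [CommRing S] {p n : ℕ} [hp : Fact p.Prime] {θ q2 c7 η1 η2 X : S}

/-- the data used in the inert case -/
structure Ctx (S : Type*) [CommRing S] (p n : ℕ) (θ q2 c7 η1 η2 X : S) : Prop where
  hn : p = 2*n+1
  hp2 : p ≠ 2
  hp3 : p ≠ 3
  hp7 : p ≠ 7
  hpS : (p:S)^2 = 0
  hθ : θ^2 = -7
  h7 : (-7:S)^n = -1 + p * c7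
  h4 : (4:S)^n = 1 + p * q2
  he1 : (21-θ)^p = 21+θ + p * η1
  he2 : (21+θ)^p = 21-θ + p * η2
  hX : X * (21+θ) = 21-θ

theorem unit237 (hp2 : p ≠ 2) (hp3 : p ≠ 3) (hp7 : p ≠ 7) (hpS : (p:S)^2 = 0) (a b c : ℕ) :
    IsUnit ((2:S)^a * 3^b * 7^c) := by
  have f : ∀ q : ℕ, q.Prime → p ≠ q → IsUnit (q:S) := fun q hq h => by
    have := unitS hpS (S := S) (m := q) (by
      rw [Int.natCast_dvd_natCast]
      exact fun hd => h ((Nat.prime_dvd_prime_iff_eq hp.out hq).1 hd))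
    simpa using this
  have h2 := f 2 (by norm_num) hp2
  have h3 := f 3 (by norm_num) hp3
  have h7 := f 7 (by norm_num) hp7
  exact_mod_cast ((h2.pow a).mul (h3.pow b)).mul (h7.pow c)

theorem cast_eq_of_mod (m : ℤ) (k : ℤ) (h : (m : ZMod p) = k) : ∃ c : S, (m:S) = k + p * c := by
  have h' := (ZMod.intCast_eq_intCast_iff_dvd_sub k m p).1 h.symm
  obtain ⟨c, hc⟩ := h'
  refine ⟨c, ?_⟩
  have := congrArg (Int.cast (R := S)) hc
  push_cast at this
  linear_combination this

theorem ctx_exists (hn : p = 2*n+1) (hp2 : p ≠ 2) (hp3 : p ≠ 3) (hp7 : p ≠ 7) (hpS : (p:S)^2 = 0)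
    (hθ : θ^2 = -7) (h7 : p % 7 = 3 ∨ p % 7 = 5 ∨ p % 7 = 6) :
    ∃ q2 c7 η1 η2 X : S, Ctx S p n θ q2 c7 η1 η2 X := by
  obtain ⟨c7, hc7⟩ := cast_eq_of_mod (S := S) (p := p) ((-7)^n) (-1) (by
    push_cast; exact legendre_neg7 hn h7)
  obtain ⟨q2, hq2⟩ := cast_eq_of_mod (S := S) (p := p) (4^n) 1 (by
    push_cast
    have : (2:ZMod p)^(p-1) = 1 := ZMod.pow_card_sub_one_eq_one (by
      intro h
      have : p ∣ 2 := (ZMod.natCast_eq_zero_iff 2 p).1 (by exact_mod_cast h)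
      exact hp2 ((Nat.prime_dvd_prime_iff_eq hp.out Nat.prime_two).1 this))
    rw [show p - 1 = 2*n by omega, pow_mul] at this
    norm_num at this; exact this)
  push_cast at hc7 hq2
  obtain ⟨c21, h21⟩ := cast_eq_of_mod (S := S) (p := p) (21^p) 21 (by
    push_cast; exact ZMod.pow_card _)
  push_cast at h21
  have hpo : θ^p = θ * (-7)^n := by
    have : θ^p = θ^(2*n+1) := by rw [← hn]
    rw [this, pow_succ, pow_mul, hθ]; ring
  have hodd : Odd p := ⟨n, hn⟩
  obtain ⟨r1, hr1⟩ := exists_add_pow_prime_eq hp.out (21:S) (-θ)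
  obtain ⟨r2, hr2⟩ := exists_add_pow_prime_eq hp.out (21:S) θ
  rw [hodd.neg_pow, hpo, hc7, h21] at hr1
  rw [hpo, hc7, h21] at hr2
  have u : IsUnit (448:S) := by
    have := unit237 (S := S) hp2 hp3 hp7 hpS 6 0 1
    norm_num at this; exact this
  obtain ⟨v, hv⟩ := u.exists_right_inv
  refine ⟨q2, c7, c21 - θ * c7 + 21 * (-θ) * r1, c21 + θ * c7 + 21 * θ * r2, (21-θ)^2 * v, hn, hp2, hp3, hp7, hpS, hθ, hc7, hq2, ?_, ?_, ?_⟩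
  · rw [sub_eq_add_neg, hr1]; ring
  · rw [hr2]; ring
  · linear_combination (21-θ) * hv - v * (21-θ) * hθ

theorem p_choose (hpS : (p:S)^2 = 0) {j : ℕ} (hj : j < p) : p * ((p-1).choose j : S) = p * (-1)^j := by
  induction j with
  | zero => simp
  | succ j ih =>
    have ih := ih (by omega)
    have h : p.choose (j+1) = (p-1).choose j + (p-1).choose (j+1) := by
      obtain ⟨q, hq⟩ : ∃ q, p = q+1 := ⟨p-1, by omega⟩
      rw [hq]; simp [Nat.choose_succ_succ]
    obtain ⟨c, hc⟩ := hp.out.dvd_choose_self (Nat.succ_ne_zero j) hj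
    rw [Nat.succ_eq_add_one, h] at hc
    have hc := congrArg (Nat.cast (R := S)) hc
    push_cast at hc
    linear_combination p * hc - ih + c * hpS

theorem choose_p (hpS : (p:S)^2 = 0) {i : ℕ} (h0 : 0 < i) (hi : i < p) : (p.choose i : S) = - (p * iv S i * (-1)^i) := by
  obtain ⟨j, rfl⟩ : ∃ j, i = j+1 := ⟨i-1, by omega⟩
  have h1 := p_choose hpS (S := S) (j := j) (by omega)
  have h2 := Nat.add_one_mul_choose_eq (p-1) j
  rw [Nat.sub_add_cancel hp.out.one_le] at h2
  have h2 := congrArg (Nat.cast (R := S)) h2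
  have h3 := iv_mul hpS (not_dvd_lt (p := p) h0 hi)
  push_cast at h2 h3
  linear_combination -(p.choose (j+1) : S) * h3 - iv S (j+1) * h2 + iv S (j+1) * h1

theorem sub_pow_p (hpS : (p:S)^2 = 0) (hodd : Odd p) (X : S) : (1-X)^p = 1 - X^p - p * (La S p).eval X := by
  obtain ⟨q, hq⟩ : ∃ q, p = q+1 := ⟨p-1, by have := hp.out.one_le; omega⟩
  have e : (La S p).eval X = ∑ i ∈ range q, iv S (i+1) * X^(i+1) := by
    rw [La, Polynomial.eval_finsetSum]
    have : range p = range (q+1) := by rw [hq]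
    rw [this, sum_range_succ', iv_zero]; simp
  rw [e, sub_eq_add_neg, add_comm, add_pow]
  have : range (p+1) = range (q+2) := by rw [hq]
  rw [this, sum_range_succ, sum_range_succ', show q+1 = p from hq.symm, hodd.neg_pow, mul_sum]
  have : ∑ k ∈ range q, (-X)^(k+1) * 1^(p-(k+1)) * (p.choose (k+1):S) = - ∑ i ∈ range q, p * (iv S (i+1) * X^(i+1)) := by
    rw [← sum_neg_distrib]
    refine sum_congr rfl fun k hk => ?_
    rw [mem_range] at hk
    rw [choose_p hpS (by omega) (by omega), neg_pow, one_pow]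
    have : ((-1:S)^(k+1))*(-1)^(k+1) = 1 := by rw [← mul_pow]; simp
    linear_combination -p * iv S (k+1) * X^(k+1) * this
  rw [this]; simp; ring

namespace Ctx

theorem uu (c : Ctx S p n θ q2 c7 η1 η2 X) (a b d : ℕ) : IsUnit ((2:S)^a * 3^b * 7^d) := unit237 c.hp2 c.hp3 c.hp7 c.hpS a b d
theorem e12 (c : Ctx S p n θ q2 c7 η1 η2 X) : (21-θ)*(21+θ) = 448 := by linear_combination -c.hθ
theorem ue1 (c : Ctx S p n θ q2 c7 η1 η2 X) : IsUnit (21-θ) := by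
  have := c.uu 6 0 1
  norm_num at this
  rw [← c.e12] at this
  exact isUnit_of_mul_isUnit_left this
theorem ue2 (c : Ctx S p n θ q2 c7 η1 η2 X) : IsUnit (21+θ) := by
  have := c.uu 6 0 1
  norm_num at this
  rw [← c.e12] at this
  exact isUnit_of_mul_isUnit_right this

theorem hXX (c : Ctx S p n θ q2 c7 η1 η2 X) : p * (X * X^p) = p := by
  apply c.ue1.mul_left_cancel
  have h := congrArg (· ^ p) c.hX
  simp only [mul_pow] at h
  rw [c.he1, c.he2] at h
  linear_combination X * p * h + p * c.hX - (X * X^p * η2 - X * η1) * c.hpS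

theorem pow448 (c : Ctx S p n θ q2 c7 η1 η2 X) : (448:S)^(2*n) = 1 + p * (6*q2-2*c7) := by
  have : (448:S)^(2*n) = (4^n)^6 * ((-7)^n)^2 := by
    rw [← pow_mul, ← pow_mul, mul_comm n 6, mul_comm n 2, pow_mul, pow_mul, pow_mul, ← mul_pow]; norm_num
  rw [this, c.h4, c.h7]
  have h2 := c.hpS
  have key : ∀ q : S, q^2 = 0 → (1 + q*q2)^6 * (-1 + q*c7)^2 = 1 + q * (6*q2-2*c7) := by
    intro q hq
    have h6 : (1+q*q2)^6 = 1 + 6*q*q2 := by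
      have e2 : (1+q*q2)^2 = 1+2*q*q2 := by linear_combination q2^2*hq
      have e4 : (1+2*q*q2)^3 = 1+6*q*q2 := by linear_combination (12*q2^2 + 8 * q * q2^3)*hq
      rw [show (6:ℕ) = 2*3 from rfl, pow_mul, e2, e4]
    have e7 : (-1+q*c7)^2 = 1-2*q*c7 := by linear_combination c7^2*hq
    rw [h6, e7]; linear_combination -12*q2*c7*hq
  exact key _ h2

theorem eta (c : Ctx S p n θ q2 c7 η1 η2 X) : p * ((21-θ)*η1+(21+θ)*η2) = 448 * p * (6*q2-2*c7) := by
  have h : (21-θ)^p * (21+θ)^p = 448 * 448^(2*n) := by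
    rw [← mul_pow, c.e12, ← pow_succ', ← c.hn]
  rw [c.he1, c.he2, c.pow448] at h
  linear_combination h - c.e12 - η1 * η2 * c.hpS

theorem lam (c : Ctx S p n θ q2 c7 η1 η2 X) : p * ((21-θ) * (La S p).eval X) = - (p * (η1 - η2 - 2*θ*q2 + 2*θ*c7)) := by
  have hodd : Odd p := ⟨n, c.hn⟩
  have h := sub_pow_p c.hpS hodd X
  have h1 : (21+θ)*(1-X) = 2*θ := by linear_combination -c.hX
  have h2 : (21+θ)^p * (1-X)^p = (2*θ)^p := by rw [← mul_pow, h1]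
  have h3 : (2*θ)^p = 2*θ*(4^n * (-7)^n) := by
    have : (2*θ)^p = (2*θ)^(2*n+1) := by rw [← c.hn]
    rw [this, pow_succ, pow_mul, mul_pow, c.hθ, mul_pow]; norm_num; ring
  have h4 : (21+θ)^p * X^p = (21-θ)^p := by rw [← mul_pow, mul_comm, c.hX]
  rw [h, h3, c.h4, c.h7, mul_sub, mul_sub, h4, c.he1, c.he2] at h2
  linear_combination -h2 + (-(2*θ*q2*c7) - η2 * (La S p).eval X) * c.hpS

end Ctx
end Sring
end Z7
end

section
open Finset
set_option linter.unusedSectionVars false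
set_option linter.unusedSimpArgs false
set_option linter.unusedVariables false
namespace Z7
section Sring
variable {S : Type*} [CommRing S] {p n : ℕ} [hp : Fact p.Prime] {θ q2 c7 η1 η2 X : S}

theorem choose_nu (hn : p = 2*n+1) (hpS : (p:S)^2 = 0) {i : ℕ} (hi : i ≤ n) :
    ((p+n).choose i : S) = (n.choose i : S) * (1 - 2*p*oS S i) := by
  induction i with
  | zero => simp [oS_zero]
  | succ i ih =>
    have ih := ih (by omega)
    have u : IsUnit ((i:S)+1) := by
      have := unitS hpS (S := S) (m := (i:ℤ)+1) (by
        have := not_dvd_lt (p := p) (m := i+1) (by omega) (by omega)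
        exact_mod_cast this)
      push_cast at this; exact this
    apply u.mul_left_cancel
    have h1 := congrArg (Int.cast (R := S)) (choose_down (p+n) i)
    have h2 := congrArg (Int.cast (R := S)) (choose_down n i)
    push_cast at h1 h2
    have h3 := iv_odd hn hpS (S := S) (l := i) (by omega)
    have h4 : 2*((n:S)-i) = p - (2*i+1) := by rw [pn (S := S) hn]; ring
    rw [oS_succ]
    linear_combination h1 + (p+n-i) * ih - (1-2*p*(oS S i + iv S (2*i+1))) * h2 + (n.choose i:S) * p * iv S (2*i+1) * h4 - (n.choose i : S) * p * h3 + (n.choose i:S) * (iv S (2*i+1) - 2 * oS S i) * hpS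

theorem choose_3n (hn : p = 2*n+1) (hpS : (p:S)^2 = 0) {i : ℕ} (hi : i ≤ n) :
    ((p:S)+n) * ((3*n).choose i : S) = (p+n-i) * ((n.choose i : S) * (1 - 2*p*oS S i)) := by
  rw [← choose_nu hn hpS hi]
  have h1 := congrArg (Int.cast (R := S)) (choose_down (p+n) i)
  have h2 := congrArg (Nat.cast (R := S)) (Nat.add_one_mul_choose_eq (3*n) i)
  rw [show 3*n+1 = p+n by omega] at h2
  push_cast at h1 h2
  have : (3*(n:S)+1) = p + n := by rw [pn (S := S) hn]; ring
  linear_combination h1 + h2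

/-- coefficients -/
def Hc (e1 e2 : S) (m k : ℕ) : S := ∑ i ∈ range (k+1), (m.choose i : S) * (m.choose (k-i) : S) * e1^i * e2^(k-i)

open Polynomial in
theorem qZ_coeff (e1 e2 : S) (hs : e1 + e2 = 42) (hm : e1 * e2 = 448) (m k : ℕ) :
    (((qZ^m).coeff k : ℤ) : S) = (-1)^k * Hc e1 e2 m k := by
  have h1 : (((qZ^m).coeff k : ℤ) : S) = ((qZ^m).map (Int.castRingHom S)).coeff k := by rw [coeff_map]; rfl
  have h2 : (qZ^m).map (Int.castRingHom S) = (1 + C (-e1) * X)^m * (1 + C (-e2) * X)^m := by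
    rw [← mul_pow, Polynomial.map_pow]
    congr 1
    simp only [qZ, Polynomial.map_add, Polynomial.map_sub, Polynomial.map_mul, Polynomial.map_one, Polynomial.map_pow, map_X, Polynomial.map_ofNat]
    have hs' : C e1 + C e2 = (42 : S[X]) := by rw [← C_add, hs]; rfl
    have hm' : C e1 * C e2 = (448 : S[X]) := by rw [← C_mul, hm]; rfl
    rw [C_neg, C_neg]
    linear_combination (-X^2) * hm' + X * hs'
  have h3 : ∀ (a : S) (i : ℕ), ((1 + C a * X)^m).coeff i = (m.choose i : S) * a^i := by
    intro a i
    have : (1 + C a * X : S[X])^m = ((1+X)^m).comp (C a * X) := by simp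
    rw [this, comp_C_mul_X_coeff, coeff_one_add_X_pow]
  have h4 := Finset.Nat.sum_antidiagonal_eq_sum_range_succ
    (fun a b => ((1 + C (-e1) * X : S[X])^m).coeff a * ((1 + C (-e2) * X : S[X])^m).coeff b) k
  rw [h1, h2, coeff_mul, h4, Hc, mul_sum]
  refine sum_congr rfl fun i hi => ?_
  rw [mem_range] at hi
  rw [h3, h3, neg_pow e1, neg_pow e2]
  have : (-1:S)^k = (-1)^i * (-1)^(k-i) := by rw [← pow_add]; congr 1; omega
  rw [this]; ring

theorem count_S (hn : p = 2*n+1) (hpS : (p:S)^2 = 0) (hn2 : 2 ≤ n) (h0 : (p:ℤ) ∣ (qZ^n).coeff n)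
    (e1 e2 : S) (hs : e1 + e2 = 42) (hm : e1 * e2 = 448) :
    3 * Hc e1 e2 n n = Hc e1 e2 (3*n) n + Hc e1 e2 (3*n) (3*n) + Hc e1 e2 (3*n) (5*n) := by
  have h := count_main hn hn2 h0
  have h' : ((3 * (qZ^n).coeff n : ℤ) : ZMod (p^2)) = (((qZ^(3*n)).coeff n + (qZ^(3*n)).coeff (3*n) + (qZ^(3*n)).coeff (5*n) : ℤ) : ZMod (p^2)) := by
    push_cast; exact h
  obtain ⟨c, hc⟩ := (ZMod.intCast_eq_intCast_iff_dvd_sub _ _ _).1 h'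
  have hc := congrArg (Int.cast (R := S)) hc
  push_cast at hc
  rw [hpS, zero_mul] at hc
  rw [qZ_coeff e1 e2 hs hm, qZ_coeff e1 e2 hs hm, qZ_coeff e1 e2 hs hm, qZ_coeff e1 e2 hs hm] at hc
  have s3 : (-1:S)^(3*n) = (-1)^n := by rw [pow_mul]; norm_num
  have s5 : (-1:S)^(5*n) = (-1)^n := by rw [pow_mul, Odd.neg_one_pow (by decide)]
  have s1 : (-1:S)^n * (-1)^n = 1 := by rw [← mul_pow]; simp
  rw [s3, s5] at hc
  linear_combination -(-1)^n * hc + (3 * Hc e1 e2 n n - (Hc e1 e2 (3*n) n + Hc e1 e2 (3*n) (3*n) + Hc e1 e2 (3*n) (5*n))) * (-s1)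

theorem pow_XE {e1 e2 X : S} (hX : X * e2 = e1) {i m : ℕ} (h : i ≤ m) : e1^i * e2^(m-i) = X^i * e2^m := by
  obtain ⟨k, rfl⟩ : ∃ k, m = i + k := ⟨m-i, by omega⟩
  rw [← hX, Nat.add_sub_cancel_left, mul_pow, pow_add]; ring

theorem Hc_nn {e1 e2 X : S} (hX : X * e2 = e1) : Hc e1 e2 n n = e2^n * g0 X n := by
  rw [Hc, g0, Ew, mul_sum]
  refine sum_congr rfl fun i hi => ?_
  have hi' : i ≤ n := by rw [mem_range] at hi; omega
  rw [Nat.choose_symm hi', fS]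
  linear_combination (n.choose i : S)^2 * pow_XE hX hi'

theorem Hc_3n_n (hn : p = 2*n+1) (hpS : (p:S)^2 = 0) {e1 e2 X : S} (hX : X * e2 = e1) :
    ((p:S)+n)^2 * Hc e1 e2 (3*n) n = e2^n * (p * (p+n) * g0 X n + n * g1 X n - g2 X n
      - 2 * p * (n * (A1 X n + B1 X n) - (A2 X n + B2 X n))) := by
  simp only [Hc, g0, g1, g2, A1, A2, B1, B2, Ew, mul_sum, ← sum_add_distrib, ← sum_sub_distrib]
  refine sum_congr rfl fun i hi => ?_
  have hi' : i ≤ n := by rw [mem_range] at hi; omega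
  have h1 := choose_3n hn hpS (S := S) hi'
  have h2 := choose_3n hn hpS (S := S) (show n - i ≤ n by omega)
  rw [Nat.choose_symm hi', Nat.cast_sub hi'] at h2
  have h3 := pow_XE hX hi'
  rw [fS]
  have h4 : ((p:S)+n)^2 * (((3*n).choose i : S) * ((3*n).choose (n-i) : S)) = (p+n-i) * (p+i) * ((n.choose i : S)^2 * (1 - 2*p*oS S i - 2*p*oS S (n-i))) := by
    linear_combination ((p+n) * ((3*n).choose (n-i) : S)) * h1 + (p+n-i) * ((n.choose i : S) * (1 - 2*p*oS S i)) * h2 + (p+n-i) * (p+i) * (n.choose i : S)^2 * 4 * oS S i * oS S (n-i) * hpS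
  linear_combination ((p:S)+n)^2 * (((3*n).choose i : S) * ((3*n).choose (n-i) : S)) * h3 + X^i * e2^n * h4
    - X^i * e2^n * (n.choose i : S)^2 * (2 * (p + n) * (oS S i + oS S (n-i))) * hpS


theorem Hc_3n_5n (e1 e2 : S) : Hc e1 e2 (3*n) (5*n) = (e1*e2)^(2*n) * Hc e1 e2 (3*n) n := by
  rw [Hc, show 5*n+1 = 2*n + ((n+1) + 2*n) by ring, sum_range_add, sum_range_add]
  rw [sum_eq_zero (s := range (2*n)) (fun i hi => by
    rw [mem_range] at hi
    rw [Nat.choose_eq_zero_of_lt (show 3*n < 5*n - i by omega)]; simp)]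
  have h2 : ∑ i ∈ range (2*n), ((3*n).choose (2*n+(n+1+i)) : S) * ((3*n).choose (5*n-(2*n+(n+1+i))) : S) * e1^(2*n+(n+1+i)) * e2^(5*n-(2*n+(n+1+i))) = 0 :=
    sum_eq_zero (fun i hi => by
      rw [Nat.choose_eq_zero_of_lt (show 3*n < 2*n+(n+1+i) by omega)]; simp)
  rw [h2, zero_add, add_zero, Hc, mul_sum]
  refine sum_congr rfl fun i hi => ?_
  rw [mem_range] at hi
  rw [← Nat.choose_symm (show 2*n + i ≤ 3*n by omega), ← Nat.choose_symm (show 5*n - (2*n+i) ≤ 3*n by omega),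
    show 3*n - (2*n+i) = n - i by omega, show 3*n - (5*n - (2*n+i)) = i by omega, show 5*n - (2*n+i) = 2*n + (n-i) by omega,
    pow_add, pow_add, mul_pow]
  ring

theorem Hc_3n_3n (hn : p = 2*n+1) (hpS : (p:S)^2 = 0) {e1 e2 X : S} (hX : X * e2 = e1) :
    ((p:S)+n)^2 * Hc e1 e2 (3*n) (3*n) = e2^n * (e2^(2*n) * ((p+n)^2 * g0 X n - 2 * (p+n) * g1 X n + g2 X n
      - 4 * p * (n^2 * A0 X n - 2 * n * A1 X n + A2 X n)) + e1^(2*n) * (g2 X n + 2 * p * g1 X n - 4 * p * B2 X n)) := by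
  have hsq : ∀ i ≤ n, ((p:S)+n)^2 * ((3*n).choose i : S)^2 = (p+n-i)^2 * (fS S n i * (1 - 4*p*oS S i)) := by
    intro i hi
    have h1 := choose_3n hn hpS (S := S) hi
    rw [fS]
    linear_combination (((p:S)+n) * ((3*n).choose i : S) + (p+n-i) * ((n.choose i : S) * (1 - 2*p*oS S i))) * h1 + 4 * (p+n-i)^2 * (n.choose i:S)^2 * (oS S i)^2 * hpS
  have e : Hc e1 e2 (3*n) (3*n) = ∑ i ∈ range (3*n+1), ((3*n).choose i : S)^2 * e1^i * e2^(3*n-i) := by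
    refine sum_congr rfl fun i hi => ?_
    rw [mem_range] at hi
    rw [Nat.choose_symm (by omega)]; ring
  have hmid : ∑ i ∈ range n, ((3*n).choose (n+1+i) : S)^2 * e1^(n+1+i) * e2^(3*n-(n+1+i)) = 0 := by
    refine sum_eq_zero fun i hi => ?_
    rw [mem_range] at hi
    have := hp.out.dvd_choose_add (a := n+1+i) (b := 3*n-(n+1+i)) (by omega) (by omega) (by omega)
    rw [show n+1+i + (3*n-(n+1+i)) = 3*n by omega] at this
    obtain ⟨c, hc⟩ := this
    rw [hc]; push_cast
    linear_combination c^2 * e1^(n+1+i) * e2^(3*n-(n+1+i)) * hpS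
  have hfst : ((p:S)+n)^2 * ∑ i ∈ range (n+1), ((3*n).choose i : S)^2 * e1^i * e2^(3*n-i) = e2^n * (e2^(2*n) * ((p+n)^2 * g0 X n - 2 * (p+n) * g1 X n + g2 X n
      - 4 * p * (n^2 * A0 X n - 2 * n * A1 X n + A2 X n))) := by
    simp only [g0, g1, g2, A0, A1, A2, Ew, mul_sum, ← sum_add_distrib, ← sum_sub_distrib]
    refine sum_congr rfl fun i hi => ?_
    have hi' : i ≤ n := by rw [mem_range] at hi; omega
    have h1 := hsq i hi'
    have h3 := pow_XE hX hi'
    have h4 : e2^(3*n-i) = e2^(2*n) * e2^(n-i) := by rw [← pow_add]; congr 1; omega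
    rw [h4]
    linear_combination ((p:S)+n)^2 * ((3*n).choose i : S)^2 * e2^(2*n) * h3 + X^i * e2^n * e2^(2*n) * h1
      - X^i * e2^n * e2^(2*n) * fS S n i * oS S i * 4 * (2 * (n - i) + p) * hpS
  have hlst : ((p:S)+n)^2 * ∑ i ∈ range n, ((3*n).choose (n+1+n+i) : S)^2 * e1^(n+1+n+i) * e2^(3*n-(n+1+n+i)) = e2^n * (e1^(2*n) * (g2 X n + 2 * p * g1 X n - 4 * p * B2 X n)) := by
    have e3 : g2 X n + 2 * p * g1 X n - 4 * p * B2 X n = ∑ i ∈ range (n+1), (p+i)^2 * (fS S n i * (1 - 4*p*oS S (n-i))) * X^i := by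
      simp only [g1, g2, B2, Ew, mul_sum, ← sum_add_distrib, ← sum_sub_distrib]
      refine sum_congr rfl fun i hi => ?_
      linear_combination (-(fS S n i * (1 - 4*p*oS S (n-i)) * X^i) + 8 * i * fS S n i * oS S (n-i) * X^i) * hpS
    rw [e3, sum_range_succ']
    have z : ((p:S)+(0:ℕ))^2 = 0 := by simp [hpS]
    rw [z, zero_mul, zero_mul, add_zero, mul_sum, mul_sum, mul_sum]
    refine sum_congr rfl fun i hi => ?_
    rw [mem_range] at hi
    rw [← Nat.choose_symm (show n+1+n+i ≤ 3*n by omega), show 3*n-(n+1+n+i) = n-(i+1) by omega]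
    have h1 := hsq (n-(i+1)) (by omega)
    rw [fS_symm (by omega), Nat.cast_sub (by omega)] at h1
    have h3 := pow_XE hX (show i+1 ≤ n by omega)
    have h4 : e1^(n+1+n+i) = e1^(2*n) * e1^(i+1) := by rw [← pow_add]; congr 1; omega
    rw [h4]
    linear_combination ((p:S)+n)^2 * ((3*n).choose (n-(i+1)) : S)^2 * e1^(2*n) * h3 + X^(i+1) * e2^n * e1^(2*n) * h1
  have sp : ∑ i ∈ range (3*n+1), ((3*n).choose i : S)^2 * e1^i * e2^(3*n-i) = ∑ i ∈ range (n+1), ((3*n).choose i : S)^2 * e1^i * e2^(3*n-i)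
      + ∑ i ∈ range n, ((3*n).choose (n+1+i) : S)^2 * e1^(n+1+i) * e2^(3*n-(n+1+i))
      + ∑ i ∈ range n, ((3*n).choose (n+1+n+i) : S)^2 * e1^(n+1+n+i) * e2^(3*n-(n+1+n+i)) := by
    rw [show 3*n+1 = (n+1)+n+n by ring, sum_range_add, sum_range_add]
  rw [e, sp, hmid]
  linear_combination hfst + hlst

theorem Ctx.R4 (c : Ctx S p n θ q2 c7 η1 η2 X) (hn2 : 2 ≤ n) (h0 : (p:ℤ) ∣ (qZ^n).coeff n) :
    3 * ((p:S)+n)^2 * g0 X n = (21+θ)^(2*n) * ((p+n)^2 * g0 X n - 2 * (p+n) * g1 X n + g2 X n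
      - 4 * p * (n^2 * A0 X n - 2 * n * A1 X n + A2 X n)) + (21-θ)^(2*n) * (g2 X n + 2 * p * g1 X n - 4 * p * B2 X n)
      + (2 + p * (6*q2-2*c7)) * (p * (p+n) * g0 X n + n * g1 X n - g2 X n
      - 2 * p * (n * (A1 X n + B1 X n) - (A2 X n + B2 X n))) := by
  have h := count_S c.hn c.hpS hn2 h0 (21-θ) (21+θ) (by ring) c.e12
  rw [Hc_3n_5n, Hc_nn c.hX, c.e12, c.pow448] at h
  have h1 := Hc_3n_n c.hn c.hpS c.hX
  have h2 := Hc_3n_3n c.hn c.hpS c.hX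
  apply (c.ue2.pow n).mul_left_cancel
  linear_combination ((p:S)+n)^2 * h + (2 + p * (6*q2-2*c7)) * h1 + h2

theorem Ctx.pg0 (c : Ctx S p n θ q2 c7 η1 η2 X) (h0 : (p:ℤ) ∣ (qZ^n).coeff n) : p * g0 X n = 0 := by
  obtain ⟨k, hk⟩ := h0
  have hk := congrArg (Int.cast (R := S)) hk
  rw [qZ_coeff (21-θ) (21+θ) (by ring) c.e12, Hc_nn c.hX] at hk
  push_cast at hk
  have s1 : (-1:S)^n * (-1)^n = 1 := by rw [← mul_pow]; simp
  apply (c.ue2.pow n).mul_left_cancel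
  linear_combination p * (-1)^n * hk - p * ((21+θ)^n * g0 X n) * s1 + (-1)^n * k * c.hpS

end Sring
end Z7
end

section
open Finset
set_option linter.unusedSectionVars false
set_option linter.unusedSimpArgs false
set_option linter.unusedVariables false
namespace Z7
section Sring

theorem alg1 {S : Type*} [CommRing S] (p n θ g g1 g2 A0 A1 A2 B0 B1 B2 q2 c7 η1 η2 E1 E2 : S) (hpn : p = 2*n+1)
    (hpS : p^2 = 0) (hg : p * g = 0) (hθ : θ^2 = -7) (hE1 : (21-θ)*E1 = 21+θ+p*η1) (hE2 : (21+θ)*E2 = 21-θ+p*η2)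
    (R4 : 3 * (p+n)^2 * g = E2 * ((p+n)^2 * g - 2 * (p+n) * g1 + g2
      - 4 * p * (n^2 * A0 - 2 * n * A1 + A2)) + E1 * (g2 + 2 * p * g1 - 4 * p * B2)
      + (2 + p * (6*q2-2*c7)) * (p * (p+n) * g + n * g1 - g2 - 2 * p * (n * (A1 + B1) - (A2 + B2))))
    (ER1 : 8*θ*g2 = (21-θ)*(g+4*(1-p)*g1)) (ER2 : 8*θ*p*A2 = p*(21-θ)*(A0+4*A1+2*g1))
    (ER3 : 8*θ*p*B2 = p*(21-θ)*(B0+4*B1)+2*p*(21+θ)*g1) :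
    7168 * (p*g1*(η1+η2)) = 7168 * (θ*g-4*θ*p*(A1-B1)+2*θ*p*B0+21*p*(6*q2-2*c7)*g1) := by
  have s1 : (4)*p*θ*g1*η2 + (-840)*p*θ*g1 + (-4)*p*θ*g2*η1 + (4)*p*θ*g2*η2 + (-168)*p*θ*A0 + (-672)*p*θ*A1 + (-672)*p*θ*A2 + (672)*p*θ*B2 + (5376)*p*g1*q2 + (-1792)*p*g1*c7 + (-84)*p*g1*η2 + (-56)*p*g1 + (10752)*p*g2*q2 + (-3584)*p*g2*c7 + (-84)*p*g2*η1 + (-84)*p*g2*η2 + (1736)*p*A0 + (3360)*p*A1 + (-224)*p*A2 + (-3584)*p*B1 + (-224)*p*B2 + (42)*θ*g + (168)*θ*g1 + (910)*g + (56)*g1 + (112)*g2 = 0 := by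
    linear_combination 4*(21-θ)*(21+θ)*R4
      + 4*(21-θ)*((p+n)^2 * g - 2 * (p+n) * g1 + g2 - 4 * p * (n^2 * A0 - 2 * n * A1 + A2)) * hE2
      + 4*(21+θ)*(g2 + 2 * p * g1 - 4 * p * B2) * hE1
      + ((-4)*p^3*θ*A0*η2 + (84)*p^3*A0*η2 + (-8)*p^2*n*θ*A0*η2 + (168)*p^2*n*A0*η2 + (12)*p^2*θ^2*g*q2 + (-4)*p^2*θ^2*g*c7 + (4)*p^2*θ^2*A0 + (-24)*p^2*θ^2*A1*q2 + (8)*p^2*θ^2*A1*c7 + (-24)*p^2*θ^2*B1*q2 + (8)*p^2*θ^2*B1*c7 + (5)*p^2*θ*g*η2 + (4)*p^2*θ*A0*η2 + (-168)*p^2*θ*A0 + (16)*p^2*θ*A1*η2 + (-5292)*p^2*g*q2 + (1764)*p^2*g*c7 + (-105)*p^2*g*η2 + (-84)*p^2*A0*η2 + (1764)*p^2*A0 + (10584)*p^2*A1*q2 + (-3528)*p^2*A1*c7 + (-336)*p^2*A1*η2 + (10584)*p^2*B1*q2 + (-3528)*p^2*B1*c7 + (8)*p*n*θ^2*A0 +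 (2)*p*n*θ*g*η2 + (-336)*p*n*θ*A0 + (-42)*p*n*g*η2 + (3528)*p*n*A0 + (-16)*p*θ^2*g + (12)*p*θ^2*g1*q2 + (-4)*p*θ^2*g1*c7 + (-4)*p*θ^2*A0 + (-24)*p*θ^2*A1 + (-8)*p*θ^2*B1 + (-1)*p*θ*g*η2 + (210)*p*θ*g + (-4)*p*θ*g1*η2 + (168)*p*θ*A0 + (672)*p*θ*A1 + (21)*p*g*η2 + (2646)*p*g + (-5292)*p*g1*q2 + (1764)*p*g1*c7 + (84)*p*g1*η2 + (-1764)*p*A0 + (-3528)*p*A1 + (3528)*p*B1 + (-8)*n*θ^2*g + (84)*n*θ*g + (1764)*n*g + (4)*θ^2*g + (8)*θ^2*g1 + (-42)*θ*g + (-168)*θ*g1 + (-882)*g) * hpn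
      - ((-4)*p^2*θ*A0*η2 + (84)*p^2*A0*η2 + (36)*p*θ^2*g*q2 + (-12)*p*θ^2*g*c7 + (4)*p*θ^2*A0 + (-24)*p*θ^2*A1*q2 + (8)*p*θ^2*A1*c7 + (-24)*p*θ^2*B1*q2 + (8)*p*θ^2*B1*c7 + (9)*p*θ*g*η2 + (8)*p*θ*A0*η2 + (-168)*p*θ*A0 + (16)*p*θ*A1*η2 + (-15876)*p*g*q2 + (5292)*p*g*c7 + (-189)*p*g*η2 + (-168)*p*A0*η2 + (1764)*p*A0 + (10584)*p*A1*q2 + (-3528)*p*A1*c7 + (-336)*p*A1*η2 + (10584)*p*B1*q2 + (-3528)*p*B1*c7 + (-12)*θ^2*g*q2 + (4)*θ^2*g*c7 + (-24)*θ^2*g + (12)*θ^2*g1*q2 + (-4)*θ^2*g1*c7 + (-8)*θ^2*A0 + (24)*θ^2*A1*q2 + (-8)*θ^2*A1*c7 + (-24)*θ^2*A1 + (48)*θ^2*A2*q2 + (-16)*θ^2*A2*c7 + (24)*θ^2*B1*q2 + (-8)*θ^2*B1*c7 + (-8)*θ^2*B1 + (48)*θ^2*B2*q2 + (-16)*θ^2*B2*c7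 + (-6)*θ*g*η2 + (378)*θ*g + (-8)*θ*g1*η1 + (-12)*θ*g1*η2 + (-4)*θ*A0*η2 + (336)*θ*A0 + (-16)*θ*A1*η2 + (672)*θ*A1 + (-16)*θ*A2*η2 + (16)*θ*B2*η1 + (5292)*g*q2 + (-1764)*g*c7 + (126)*g*η2 + (2646)*g + (-5292)*g1*q2 + (1764)*g1*c7 + (-168)*g1*η1 + (252)*g1*η2 + (84)*A0*η2 + (-3528)*A0 + (-10584)*A1*q2 + (3528)*A1*c7 + (336)*A1*η2 + (-3528)*A1 + (-21168)*A2*q2 + (7056)*A2*c7 + (336)*A2*η2 + (-10584)*B1*q2 + (3528)*B1*c7 + (3528)*B1 + (-21168)*B2*q2 + (7056)*B2*c7 + (336)*B2*η1) * hpS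
      - ((20)*θ^2 + (1)*θ*η2 + (-252)*θ + (-21)*η2 + (-3528)) * hg
      - ((-12)*p*g1*q2 + (4)*p*g1*c7 + (8)*p*g1 + (-24)*p*g2*q2 + (8)*p*g2*c7 + (4)*p*A0 + (24)*p*A1 + (32)*p*A2 + (8)*p*B1 + (32)*p*B2 + (-4)*g + (-8)*g1 + (-16)*g2) * hθ
  linear_combination -8*θ*s1 + ((-4)*p*θ*η1 + (4)*p*θ*η2 + (10752)*p*q2 + (-3584)*p*c7 + (-84)*p*η1 + (-84)*p*η2 + (112))*ER1 + ((-672)*θ + (-224))*ER2 + ((672)*θ + (-224))*ER3 + ((-16)*θ^2*g1*η1 + (16)*θ^2*g1*η2 + (43008)*θ*g1*q2 + (-14336)*θ*g1*c7 + (-672)*θ*g1*η2 + (-903168)*g1*q2 + (301056)*g1*c7 + (7056)*g1*η1 + (7056)*g1*η2)*hpS + ((4)*θ^2*η1 + (-4)*θ^2*η2 + (-10752)*θ*q2 + (3584)*θ*c7 + (168)*θ*η2 + (225792)*q2 + (-75264)*c7 + (-1764)*η1 + (-1764)*η2)*hg + ((16)*p*g1*η1 + (16)*p*g1*η2 + (-4032)*p*g1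 + (-672)*p*A0 + (-2688)*p*A1 + (-672)*p*B0 + (-2688)*p*B1 + (336)*g + (1344)*g1)*hθ

variable {S : Type*} [CommRing S] {p n : ℕ} [hp : Fact p.Prime] {θ q2 c7 η1 η2 X : S}

theorem Ctx.star (c : Ctx S p n θ q2 c7 η1 η2 X) (hn2 : 2 ≤ n) (h0 : (p:ℤ) ∣ (qZ^n).coeff n) :
    42 * g0 X n - 8 * θ * (p * (A1 X n + B1 X n)) + 2 * (21-θ) * (p * (A0 X n + B0 X n)) + 8 * θ * (p * q2 * g1 X n) = 0 := by
  have hpS := c.hpS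
  have hpn := pn (S := S) c.hn
  have hθ := c.hθ
  have hg := c.pg0 h0
  have hX := c.hX
  have er1 := ER1 X n
  have er2 := ER2 c.hn c.hpS X
  have er3 := ER3 c.hn c.hp2 c.hpS X
  have hE1 : (21-θ)*(21-θ)^(2*n) = 21+θ+p*η1 := by rw [← pow_succ', ← c.hn, c.he1]
  have hE2 : (21+θ)*(21+θ)^(2*n) = 21-θ+p*η2 := by rw [← pow_succ', ← c.hn, c.he2]
  have er1' : 8*θ*g2 X n = (21-θ)*(g0 X n+4*(1-p)*g1 X n) := by
    have : 4 * g2 X n = X * (g0 X n + 4*(1-p)*g1 X n + 4 * g2 X n) := by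
      rw [hpn] at hg hpS ⊢
      linear_combination 4 * er1 - 0 * hg + X * (2*n-1) * hg
    linear_combination (21+θ) * this + (g0 X n + 4*(1-p)*g1 X n + 4 * g2 X n) * hX
  have er2' : 8*θ*p*A2 X n = p*(21-θ)*(A0 X n+4*A1 X n+2*g1 X n) := by
    linear_combination (21+θ) * er2 + p * (A0 X n + 4 * A1 X n + 4 * A2 X n + 2 * g1 X n + g0 X n) * hX + (21-θ) * hg
  have er3' : 8*θ*p*B2 X n = p*(21-θ)*(B0 X n+4*B1 X n)+2*p*(21+θ)*g1 X n := by
    linear_combination (21+θ) * er3 + p * (B0 X n + 4 * B1 X n + 4 * B2 X n) * hX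
  have h := alg1 _ _ _ _ _ _ _ _ _ _ _ _ _ _ _ _ _ _ hpn hpS hg hθ hE1 hE2 (c.R4 hn2 h0) er1' er2' er3'
  have u := c.uu 10 0 1
  norm_num at u
  have h := u.mul_left_cancel h
  have r1 := C1r c.hn c.hp2 c.hpS X c.hXX hg
  have r2 := C2r c.hn c.hp2 c.hpS X c.hXX hg
  have hl := c.lam
  have he := c.eta
  have r1' : p * ((21-θ) * A0 X n) = p * ((21+θ) * B0 X n) := by
    linear_combination (21+θ) * r1 - p * A0 X n * hX
  have r2' : 4 * p * ((21-θ) * A1 X n - (21+θ) * B1 X n) = -(p * (η1 - η2 - 2*θ*q2 + 2*θ*c7)) * g1 X n := by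
    linear_combination g1 X n * hl - (21+θ) * r2 + p * ((La S p).eval X * g1 X n) * hX - 4 * p * A1 X n * hX
  have u7 := c.uu 0 0 1
  norm_num at u7
  apply u7.mul_left_cancel
  have : θ * (42 * g0 X n - 8 * θ * (p * (A1 X n + B1 X n)) + 2 * (21-θ) * (p * (A0 X n + B0 X n)) + 8 * θ * (p * q2 * g1 X n)) = 0 := by
    linear_combination 2*θ*r1' - 42*h + 2*θ*r2' + 2 * g1 X n * he + (4 * p * q2 - 4 * p * c7 + 8 * p * q2) * g1 X n * hθ
  linear_combination -θ * this + (42 * g0 X n - 8 * θ * (p * (A1 X n + B1 X n)) + 2 * (21-θ) * (p * (A0 X n + B0 X n)) + 8 * θ * (p * q2 * g1 X n)) * hθ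

end Sring
end Z7
end

section
open Finset
set_option linter.unusedSectionVars false
set_option linter.unusedSimpArgs false
set_option linter.unusedVariables false
namespace Z7
section Sring
variable {S : Type*} [CommRing S] {p n : ℕ} [hp : Fact p.Prime] {θ q2 c7 η1 η2 X : S}

open Polynomial in
theorem pl_rec (j : ℕ) : C ((j:S)+2) * pl (j+2) (fun _ => (1:S)) = C (2*(j:S)+3) * ((1 + Polynomial.X) * pl (j+1) (fun _ => (1:S)))
    - C ((j:S)+1) * ((1 - 2 * Polynomial.X + Polynomial.X^2) * pl j (fun _ => (1:S))) := by
  have h2 : (2 : S[X]) = C 2 := rfl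
  ext k
  simp only [add_mul, sub_mul, one_mul, coeff_sub, coeff_C_mul, coeff_add, h2, mul_assoc, coeff_X_pow_mul', pl_coeff]
  rcases k with _ | _ | i
  · simp [fS, pl_coeff]; ring
  · have hx : ∀ P : S[X], (Polynomial.X * P).coeff 1 = P.coeff 0 := fun P => Polynomial.coeff_X_mul P 0
    simp only [zero_add, hx]
    simp [fS, pl_coeff]; ring
  · rw [coeff_X_mul, coeff_X_mul, if_pos (by omega), show i+1+1-2 = i by omega]
    simp only [pl_coeff, one_mul, fS]
    rw [Nat.choose_succ_succ (j+1) (i+1), Nat.choose_succ_succ j (i+1), Nat.choose_succ_succ j i]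
    have ha := congrArg (Int.cast (R := S)) (choose_down j (i+1))
    have hb := congrArg (Int.cast (R := S)) (choose_down j i)
    simp only [Nat.succ_eq_add_one]
    push_cast at ha hb ⊢
    generalize (j.choose (i+1+1) : S) = x at *
    generalize (j.choose (i+1) : S) = y at *
    generalize (j.choose i : S) = z at *
    linear_combination (2 * (y + z)) * ha - (2 * (y + x)) * hb

open Polynomial in
theorem pl_next (n : ℕ) : C ((n:S)+1) * pl (n+1) (fun _ => (1:S)) = C ((n:S)+1) * ((1 + Polynomial.X) * pl n (fun _ => (1:S)))
    + C 2 * (C (n:S) * (Polynomial.X * pl n (fun _ => (1:S))) + (1-Polynomial.X) * pl n (fun i => (i:S))) := by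
  ext k
  simp only [add_mul, sub_mul, one_mul, coeff_sub, coeff_C_mul, coeff_add, mul_assoc, pl_coeff]
  rcases k with _ | i
  · simp [fS, pl_coeff]
  · rw [coeff_X_mul, coeff_X_mul]
    simp only [pl_coeff, one_mul, fS]
    rw [Nat.choose_succ_succ n i]
    have ha := congrArg (Int.cast (R := S)) (choose_down n i)
    simp only [Nat.succ_eq_add_one]
    push_cast at ha ⊢
    linear_combination (2 * (n.choose i : S) - 2 * (n.choose (i+1) : S)) * ha

theorem g0_rec (X : S) (j : ℕ) : ((j:S)+2) * g0 X (j+2) = (2*(j:S)+3) * ((1 + X) * g0 X (j+1))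
    - ((j:S)+1) * ((1 - 2 * X + X^2) * g0 X j) := by
  have h := congrArg (Polynomial.eval X) (pl_rec (S := S) j)
  simp only [Polynomial.eval_mul, Polynomial.eval_add, Polynomial.eval_sub, Polynomial.eval_C, Polynomial.eval_X, Polynomial.eval_one,
    Polynomial.eval_pow, Polynomial.eval_ofNat, pl_eval] at h
  exact h

theorem g0_next (X : S) (n : ℕ) : ((n:S)+1) * g0 X (n+1) = ((n:S)+1) * ((1 + X) * g0 X n)
    + 2 * (n * (X * g0 X n) + (1 - X) * g1 X n) := by
  have h := congrArg (Polynomial.eval X) (pl_next (S := S) n)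
  simp only [Polynomial.eval_mul, Polynomial.eval_add, Polynomial.eval_sub, Polynomial.eval_C, Polynomial.eval_X, Polynomial.eval_one,
    Polynomial.eval_pow, Polynomial.eval_ofNat, pl_eval] at h
  exact h

theorem unit_lt (hpS : (p:S)^2 = 0) {m : ℕ} (h0 : 0 < m) (h : m < p) : IsUnit (m:S) := by
  have := unitS hpS (S := S) (m := (m:ℤ)) (by
    have := not_dvd_lt (p := p) h0 h
    exact_mod_cast this)
  simpa using this

theorem Ctx.tau_eq (c : Ctx S p n θ q2 c7 η1 η2 X) (τ : ℕ → S) (t0 : τ 0 = 1) (t1 : τ 1 = 21)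
    (tr : ∀ j : ℕ, ((j:S)+2) * τ (j+2) = (2*j+3) * 21 * τ (j+1) - (j+1) * (-7) * τ j) :
    ∀ j, j < p → (21+θ)^j * g0 X j = 2^j * τ j := by
  intro j
  induction j using Nat.strong_induction_on with
  | _ j ih =>
    intro hj
    rcases j with _ | _ | j
    · simp [g0, Ew, fS, t0]
    · rw [zero_add, t1]
      simp [g0, Ew, fS, sum_range_succ]
      linear_combination c.hX
    · have h1 := ih (j+1) (by omega) (by omega)
      have h0 := ih j (by omega) (by omega)
      have u := unit_lt c.hpS (S := S) (m := j+2) (by omega) hj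
      push_cast at u
      apply u.mul_left_cancel
      have hr := g0_rec X j
      have hX := c.hX
      have hX2 : (21+θ)^2 * (1 - 2*X + X^2) = -28 := by
        linear_combination ((21+θ) * X + (21-θ) - 2 * (21+θ)) * hX + 4 * c.hθ
      have hX1 : (21+θ) * (1+X) = 42 := by linear_combination hX
      have := tr j
      linear_combination (21+θ)^(j+2) * hr - 2^(j+2) * this + (2*j+3) * (21+θ)^(j+1) * g0 X (j+1) * hX1
        - (j+1) * (21+θ)^j * g0 X j * hX2 + 42 * (2*j+3) * h1 + 28 * (j+1) * h0

/-- the convolution of central binomial coefficients -/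
def Fc (e1 e2 : S) (w : ℕ → ℕ → S) (j : ℕ) : S :=
  ∑ ab ∈ antidiagonal j, w ab.1 ab.2 * ((Nat.centralBinom ab.1 : S) * e1^ab.1) * ((Nat.centralBinom ab.2 : S) * e2^ab.2)

theorem Fc_sum (e1 e2 : S) (j : ℕ) : Fc e1 e2 (fun a _ => (a:S)) j + Fc e1 e2 (fun _ b => (b:S)) j = j * Fc e1 e2 (fun _ _ => 1) j := by
  simp only [Fc, mul_sum, ← sum_add_distrib]
  refine sum_congr rfl fun ab h => ?_
  rw [HasAntidiagonal.mem_antidiagonal] at h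
  have : (j:S) = ab.1 + ab.2 := by rw [← h]; push_cast; ring
  rw [this]; ring

theorem cbS_succ (k : ℕ) : ((k:S)+1) * (Nat.centralBinom (k+1) : S) = 2*(2*k+1) * (Nat.centralBinom k : S) := by
  have := Nat.succ_mul_centralBinom_succ k
  exact_mod_cast congrArg (Nat.cast (R := S)) this

theorem Fc_one (e1 e2 : S) (j : ℕ) : Fc e1 e2 (fun a _ => (a:S)) (j+1) = e1 * (4 * Fc e1 e2 (fun a _ => (a:S)) j + 2 * Fc e1 e2 (fun _ _ => 1) j) := by
  simp only [Fc]
  rw [Finset.Nat.sum_antidiagonal_succ]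
  simp only [Nat.cast_zero, zero_mul, zero_add, mul_sum, ← sum_add_distrib]
  refine sum_congr rfl fun ab h => ?_
  have := cbS_succ (S := S) ab.1
  push_cast
  rw [pow_succ]
  linear_combination (e1^ab.1 * e1 * ((Nat.centralBinom ab.2 : S) * e2^ab.2)) * this

theorem Fc_two (e1 e2 : S) (j : ℕ) : Fc e1 e2 (fun _ b => (b:S)) (j+1) = e2 * (4 * Fc e1 e2 (fun _ b => (b:S)) j + 2 * Fc e1 e2 (fun _ _ => 1) j) := by
  simp only [Fc]
  rw [Finset.Nat.sum_antidiagonal_succ']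
  simp only [Nat.cast_zero, zero_mul, zero_add, mul_sum, ← sum_add_distrib]
  refine sum_congr rfl fun ab h => ?_
  have := cbS_succ (S := S) ab.2
  push_cast
  rw [pow_succ]
  linear_combination (e2^ab.2 * e2 * ((Nat.centralBinom ab.1 : S) * e1^ab.1)) * this

theorem Fc_next (e1 e2 : S) (j : ℕ) : ((j:S)+1) * Fc e1 e2 (fun _ _ => 1) (j+1) =
    4 * (e1 * Fc e1 e2 (fun a _ => (a:S)) j + e2 * Fc e1 e2 (fun _ b => (b:S)) j) + 2 * (e1+e2) * Fc e1 e2 (fun _ _ => 1) j := by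
  have h := Fc_sum e1 e2 (j+1)
  rw [Fc_one, Fc_two] at h
  push_cast at h
  linear_combination -h

theorem Fc_rec (e1 e2 : S) (j : ℕ) : ((j:S)+2) * Fc e1 e2 (fun _ _ => 1) (j+2) =
    2 * (2*j+3) * (e1+e2) * Fc e1 e2 (fun _ _ => 1) (j+1) - 16 * (j+1) * (e1*e2) * Fc e1 e2 (fun _ _ => 1) j := by
  have h := Fc_next e1 e2 (j+1)
  have hs := Fc_sum e1 e2 (j+1)
  have hs0 := Fc_sum e1 e2 j
  have h1 := Fc_one e1 e2 j
  have h2 := Fc_two e1 e2 j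
  push_cast at h hs
  linear_combination h + 4 * (e1+e2) * hs - 4 * e2 * h1 - 4 * e1 * h2 - 16 * e1 * e2 * hs0

theorem Ctx.phi_eq (c : Ctx S p n θ q2 c7 η1 η2 X) (φ : ℕ → S) (t0 : φ 0 = 1) (t1 : φ 1 = 21)
    (tr : ∀ j : ℕ, ((j:S)+2) * φ (j+2) = (2*j+3) * 21 * φ (j+1) - (j+1) * 448 * φ j) :
    ∀ j, j < p → Fc (21-θ) (21+θ) (fun _ _ => 1) j = 4^j * φ j := by
  intro j
  induction j using Nat.strong_induction_on with
  | _ j ih =>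
    intro hj
    rcases j with _ | _ | j
    · simp [Fc, t0]
    · have h := Fc_next (21-θ) (21+θ) 0
      simp [Fc] at h
      rw [zero_add, t1]
      simp only [Fc]
      simp
      linear_combination h
    · have h1 := ih (j+1) (by omega) (by omega)
      have h0 := ih j (by omega) (by omega)
      have u := unit_lt c.hpS (S := S) (m := j+2) (by omega) hj
      push_cast at u
      apply u.mul_left_cancel
      have hr := Fc_rec (21-θ) (21+θ) j
      rw [c.e12] at hr
      have := tr j
      linear_combination hr - 4^(j+2) * this + 84 * (2*j+3) * h1 - 16 * 448 * (j+1) * h0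

theorem cb_mod (hn : p = 2*n+1) (hpS : (p:S)^2 = 0) {i : ℕ} (hi : i ≤ n) :
    (Nat.centralBinom i : S) = (-4)^i * ((n.choose i : S) * (1 + p * oS S i)) := by
  induction i with
  | zero => simp [oS_zero]
  | succ i ih =>
    have ih := ih (by omega)
    have u := unit_lt hpS (S := S) (m := i+1) (by omega) (by omega)
    push_cast at u
    apply u.mul_left_cancel
    have h2 := congrArg (Int.cast (R := S)) (choose_down n i)
    push_cast at h2
    have h3 := iv_odd hn hpS (S := S) (l := i) (by omega)
    have h4 : 2*((n:S)-i) = p - (2*i+1) := by rw [pn (S := S) hn]; ring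
    rw [oS_succ, cbS_succ, ih]
    linear_combination (-(-4)^(i+1) * (1 + p * (oS S i + iv S (2*i+1)))) * h2 - (-4)^i * (n.choose i : S) * (-2) * (1 + p * (oS S i + iv S (2*i+1))) * h4
      - (-4)^i * (n.choose i : S) * 2 * p * h3 + (-4)^i * (n.choose i : S) * 2 * (oS S i + iv S (2*i+1)) * hpS

theorem Fc_n (hn : p = 2*n+1) (hpS : (p:S)^2 = 0) {e1 e2 X : S} (hX : X * e2 = e1) (w : ℕ → S) :
    Fc e1 e2 (fun a _ => w a) n = (-4)^n * e2^n * Ew X n (fun i => w i * (1 + p * oS S i + p * oS S (n-i))) := by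
  rw [Fc, Finset.Nat.sum_antidiagonal_eq_sum_range_succ (fun a b => w a * ((Nat.centralBinom a : S) * e1^a) * ((Nat.centralBinom b : S) * e2^b)) n, Ew, mul_sum]
  refine sum_congr rfl fun i hi => ?_
  have hi' : i ≤ n := by rw [mem_range] at hi; omega
  rw [cb_mod hn hpS hi', cb_mod hn hpS (show n - i ≤ n by omega), Nat.choose_symm hi', fS]
  have h3 := pow_XE hX hi'
  have h4 : (-4:S)^n = (-4)^i * (-4)^(n-i) := by rw [← pow_add]; congr 1; omega
  rw [h4]
  linear_combination w i * ((-4)^i * (-4)^(n-i)) * (n.choose i : S)^2 * ((1 + p * oS S i) * (1 + p * oS S (n-i)) * h3 + X^i * e2^n * oS S i * oS S (n-i) * hpS)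

theorem Ctx.key (c : Ctx S p n θ q2 c7 η1 η2 X) (hn2 : 2 ≤ n) (h0 : (p:ℤ) ∣ (qZ^n).coeff n)
    (τ : ℕ → S) (t0 : τ 0 = 1) (t1 : τ 1 = 21)
    (tr : ∀ j : ℕ, ((j:S)+2) * τ (j+2) = (2*j+3) * 21 * τ (j+1) - (j+1) * (-7) * τ j)
    (φ : ℕ → S) (f0 : φ 0 = 1) (f1 : φ 1 = 21)
    (fr : ∀ j : ℕ, ((j:S)+2) * φ (j+2) = (2*j+3) * 21 * φ (j+1) - (j+1) * 448 * φ j) :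
    p * φ n = 0 ∧ p * τ n = 0 ∧ φ (n+1) + (-1)^n * 8^n * τ (n+1) = 0 := by
  have hpn := pn (S := S) c.hn
  have hn := c.hn
  have hpS := c.hpS
  have u2 : IsUnit (2:S) := by have := c.uu 1 0 0; norm_num at this; exact this
  have u4 : IsUnit (4:S) := by have := c.uu 2 0 0; norm_num at this; exact this
  have hg := c.pg0 h0
  have eF0 : Fc (21-θ) (21+θ) (fun _ _ => 1) n = (-4)^n * (21+θ)^n * (g0 X n + p * (A0 X n + B0 X n)) := by
    rw [Fc_n hn hpS c.hX (fun _ => 1)]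
    congr 1
    simp only [g0, A0, B0, Ew, mul_sum, ← sum_add_distrib]
    exact sum_congr rfl fun i _ => by ring
  have eF1 : Fc (21-θ) (21+θ) (fun a _ => (a:S)) n = (-4)^n * (21+θ)^n * (g1 X n + p * (A1 X n + B1 X n)) := by
    rw [Fc_n hn hpS c.hX (fun i => (i:S))]
    congr 1
    simp only [g1, A1, B1, Ew, mul_sum, ← sum_add_distrib]
    exact sum_congr rfl fun i _ => by ring
  have pF := c.phi_eq φ f0 f1 fr
  have pT := c.tau_eq τ t0 t1 tr
  refine ⟨?_, ?_, ?_⟩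
  · apply (u4.pow n).mul_left_cancel
    have := pF n (by omega)
    rw [eF0] at this
    linear_combination -p * this + (-4)^n * (21+θ)^n * (hg + (A0 X n + B0 X n) * hpS)
  · apply (u2.pow n).mul_left_cancel
    have := pT n (by omega)
    linear_combination -p * this + (21+θ)^n * hg
  · have un := unit_lt hpS (S := S) (m := n+1) (by omega) (by omega)
    push_cast at un
    apply ((u4.pow (n+1)).mul un).mul_left_cancel
    have hF := pF (n+1) (by omega)
    have hT := pT (n+1) (by omega)
    have hs := Fc_sum (21-θ) (21+θ) n
    have hFn := Fc_next (21-θ) (21+θ) n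
    have hgn := g0_next X n
    have hst := c.star hn2 h0
    have hX := c.hX
    rw [eF0] at hFn hs
    rw [eF1] at hFn hs
    have hPn : ((n:S)+1) * ((21+θ)^(n+1) * g0 X (n+1)) = (21+θ)^n * (42 * (n+1) * g0 X n + 2 * (n * (21-θ) * g0 X n + 2 * θ * g1 X n)) := by
      linear_combination (21+θ)^(n+1) * hgn + (21+θ)^n * ((n+1) * g0 X n + 2 * n * g0 X n - 2 * g1 X n) * hX
    have p8 : (8:S)^n = 2^n * 4^n := by rw [← mul_pow]; norm_num
    have m4 : (-4:S)^n = (-1)^n * 4^n := by rw [← mul_pow]; norm_num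
    have p4 : (4:S)^n = 2^n * 2^n := by rw [← mul_pow]; norm_num
    have h4 := c.h4
    have hFF : ((n:S)+1) * Fc (21-θ) (21+θ) (fun _ _ => 1) (n+1) = (-4)^n * (21+θ)^n * (-8 * θ * (g1 X n + p * (A1 X n + B1 X n)) + (4 * n * (21+θ) + 84) * (g0 X n + p * (A0 X n + B0 X n))) := by
      linear_combination hFn + 4 * (21+θ) * hs
    have brk : (-8 * θ * (g1 X n + p * (A1 X n + B1 X n)) + (4 * n * (21+θ) + 84) * (g0 X n + p * (A0 X n + B0 X n)))
        + 2 * (1 + p * q2) * (42 * (n+1) * g0 X n + 2 * (n * (21-θ) * g0 X n + 2 * θ * g1 X n)) = 0 := by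
      have e1 : 2 * (n:S) = p - 1 := by rw [hpn]; ring
      linear_combination hst + (2 * (21+θ) * (g0 X n + p * (A0 X n + B0 X n)) + (1 + p * q2) * (42 + 2 * (21-θ)) * g0 X n) * e1
        + (2 * (21+θ) + (1 + p * q2) * (42 + 2 * (21-θ)) + q2 * (84 - 42 - 2 * (21-θ))) * hg + 2 * (21+θ) * (A0 X n + B0 X n) * hpS
    have h2 : (2:S)^(n+1) * ((-1)^n * 8^n * τ (n+1)) * 2 * 2^n * (n+1) = 4 ^ (n+1) * (n+1) * ((-1)^n * 8^n * τ (n+1)) := by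
      rw [pow_succ, pow_succ, p4]; ring
    rw [mul_add, ← h2, mul_zero]
    have : (4:S)^(n+1) * (n+1) * φ (n+1) = (n+1) * Fc (21-θ) (21+θ) (fun _ _ => 1) (n+1) := by
      rw [hF]; ring
    rw [this, hFF, p8, m4]
    have e5 : (2:S)^(n+1) * ((-1)^n * (2^n * 4^n) * τ (n+1)) * 2 * 2^n * (n+1) = 2 * (-1)^n * 4^n * (1 + p*q2) * ((n+1) * (2^(n+1) * τ (n+1))) := by
      rw [← h4, p4]; ring
    rw [e5, ← hT, hPn]
    linear_combination (-1)^n * 4^n * (21+θ)^n * brk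

end Sring
end Z7
end

section
open Finset
set_option linter.unusedSectionVars false
set_option linter.unusedSimpArgs false
set_option linter.unusedVariables false
namespace Z7
section fin
variable {p : ℕ} [hp : Fact p.Prime]

theorem qa_sq {R : Type*} [CommRing R] : (⟨0, 1⟩ : QuadraticAlgebra R (-7) 0)^2 = -7 := by
  rw [sq]
  ext
  · rw [QuadraticAlgebra.re_mul, QuadraticAlgebra.re_neg, QuadraticAlgebra.re_ofNat]; simp
  · rw [QuadraticAlgebra.im_mul, QuadraticAlgebra.im_neg, QuadraticAlgebra.im_ofNat]; simp

theorem ring_ex : ∃ (S : Type) (_ : CommRing S) (ψ : ℤ_[p] →+* S) (θ : S), θ^2 = -7 ∧ (p:S)^2 = 0 ∧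
    ∀ z : ℤ_[p], ψ z = 0 → V p 2 (z:ℚ_[p]) := by
  refine ⟨QuadraticAlgebra (ZMod (p^2)) (-7) 0, inferInstance,
    (algebraMap (ZMod (p^2)) (QuadraticAlgebra (ZMod (p^2)) (-7) 0)).comp (PadicInt.toZModPow 2), ⟨0, 1⟩, ?_, ?_, ?_⟩
  · exact qa_sq
  · have : ((p^2 : ℕ) : ZMod (p^2)) = 0 := ZMod.natCast_self _
    have h := congrArg (algebraMap (ZMod (p^2)) (QuadraticAlgebra (ZMod (p^2)) (-7) 0)) this
    rw [map_natCast, map_zero] at h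
    exact_mod_cast h
  · intro z hz
    have h1 : PadicInt.toZModPow 2 z = 0 := by
      have := congrArg QuadraticAlgebra.re hz
      simpa using this
    have h2 : z ∈ RingHom.ker (PadicInt.toZModPow (p := p) 2) := h1
    rw [PadicInt.ker_toZModPow, Ideal.mem_span_singleton] at h2
    obtain ⟨w, hw⟩ := h2
    exact ⟨w, by rw [hw]; push_cast; ring⟩

theorem inert_key {n : ℕ} (hn : p = 2*n+1) (hp2 : p ≠ 2) (hp3 : p ≠ 3) (hp7 : p ≠ 7) 
    (h7 : p % 7 = 3 ∨ p % 7 = 5 ∨ p % 7 = 6) :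
    V p 1 (ph7 ℚ_[p] n) ∧ V p 1 (ta7 p n) ∧ V p 2 (ph7 ℚ_[p] (n+1) + (-1)^n * 8^n * ta7 p (n+1)) := by
  have e1 : ∀ j, ∃ z : ℤ_[p], ph7 ℚ_[p] j = z := fun j => by
    obtain ⟨z, hz⟩ := V_ph7 (p := p) hp2 j; exact ⟨z, by simpa using hz⟩
  have e2 : ∀ j, ∃ z : ℤ_[p], ta7 p j = z := fun j => by
    obtain ⟨z, hz⟩ := V_ta7 (p := p) j; exact ⟨z, by simpa using hz⟩
  choose f hf using e1
  choose t ht using e2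
  have inj : ∀ {a b : ℤ_[p]}, (a:ℚ_[p]) = b → a = b := fun h => Subtype.ext h
  have f0 : f 0 = 1 := inj (by rw [← hf 0, ph7]; simp)
  have t0 : t 0 = 1 := inj (by rw [← ht 0, ta7]; simp)
  have f1 : f 1 = 21 := inj (by rw [← hf 1, ph7]; push_cast; rfl)
  have t1 : t 1 = 21 := inj (by rw [← ht 1, ta7]; push_cast; rfl)
  have fr : ∀ j : ℕ, ((j:ℤ_[p])+2) * f (j+2) = (2*j+3) * 21 * f (j+1) - (j+1) * 448 * f j := fun j => inj (by
    have := ph7_rec ℚ_[p] j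
    rw [hf, hf, hf] at this
    push_cast; exact this)
  have tr : ∀ j : ℕ, ((j:ℤ_[p])+2) * t (j+2) = (2*j+3) * 21 * t (j+1) - (j+1) * (-7) * t j := fun j => inj (by
    have := ta7_rec (p := p) j
    rw [ht, ht, ht] at this
    push_cast; exact this)
  obtain ⟨S, _, ψ, θ, hθ, hpS, hker⟩ := ring_ex (p := p)
  have hn2 : 2 ≤ n := by have := hp.out.two_le; omega
  obtain ⟨q2, c7, η1, η2, X, c⟩ := ctx_exists (S := S) hn hp2 hp3 hp7 hpS hθ h7
  have e2 : ψ 2 = 2 := map_ofNat ψ 2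
  have e3 : ψ 3 = 3 := map_ofNat ψ 3
  have e7 : ψ 7 = 7 := map_ofNat ψ 7
  have e8 : ψ 8 = 8 := map_ofNat ψ 8
  have e21 : ψ 21 = 21 := map_ofNat ψ 21
  have e448 : ψ 448 = 448 := map_ofNat ψ 448
  obtain ⟨k1, k2, k3⟩ := c.key hn2 (I0_int hn h7) (fun j => ψ (t j)) (by simp [t0]) (by simp [t1, e21])
    (fun j => by have := congrArg ψ (tr j); simpa [e2, e3, e7, e8, e21, e448] using this) (fun j => ψ (f j)) (by simp [f0]) (by simp [f1, e21])
    (fun j => by have := congrArg ψ (fr j); simpa [e2, e3, e7, e8, e21, e448] using this)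
  refine ⟨?_, ?_, ?_⟩
  · apply V.cancel_p
    have := hker ((p:ℤ_[p]) * f n) (by simpa using k1)
    rw [hf]; exact_mod_cast this
  · apply V.cancel_p
    have := hker ((p:ℤ_[p]) * t n) (by simpa using k2)
    rw [ht]; exact_mod_cast this
  · have := hker (f (n+1) + (-1)^n * 8^n * t (n+1)) (by simpa [e8] using k3)
    rw [hf, ht]; exact_mod_cast this

theorem cb_eq (k : ℕ) : ((2*k).choose k : ℚ_[p]) = (cb k : ℚ_[p]) := by
  rw [cb, Nat.centralBinom_eq_two_mul_choose]

theorem final_split {n : ℕ} (hn : p = 2*n+1) (hp2 : p ≠ 2) (hp3 : p ≠ 3) (hp7 : p ≠ 7) {x y : ℤ} (h : (p:ℤ) = x^2+7*y^2) :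
    ratCongr p 3 ((-1:ℚ)^n * ∑ k ∈ range (n + 1), (k:ℚ)^2 * ((2*k).choose k : ℚ)^3 / 4096^k)
        (43/1323*(x:ℚ)^2 - 13/441*(p:ℚ) - (p:ℚ)^2/(1323*(x:ℚ)^2)) ∧
      ratCongr p 3 ((-1:ℚ)^n * ∑ k ∈ range (n + 1), (k:ℚ)^3 * ((2*k).choose k : ℚ)^3 / 4096^k)
        (169/55566*(x:ℚ)^2 - 31/74088*(p:ℚ) - 71*(p:ℚ)^2/(444528*(x:ℚ)^2)) := by
  obtain ⟨h1, h2⟩ := split_final hn hp2 hp3 hp7 h (fun θ hθ => exists_AD hθ (by rw [← hn]; exact h))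
  constructor
  · apply ratCongr_of_V
    unfold Sm at h1
    push_cast
    simp only [cb_eq]
    exact h1
  · apply ratCongr_of_V
    unfold Sm at h2
    push_cast
    simp only [cb_eq]
    exact h2

theorem final_inert {n : ℕ} (hn : p = 2*n+1) (hp2 : p ≠ 2) (hp3 : p ≠ 3) (hp7 : p ≠ 7)
    (h7 : p % 7 = 3 ∨ p % 7 = 5 ∨ p % 7 = 6) :
    ratCongr p 2 ((-1:ℚ)^n * ∑ k ∈ range (n + 1), (k:ℚ)^2 * ((2*k).choose k : ℚ)^3 / 4096^k)
        (8/63*R7 p + 349/2646*(p:ℚ)) ∧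
    ratCongr p 2 ((-1:ℚ)^n * ∑ k ∈ range (n + 1), (k:ℚ)^3 * ((2*k).choose k : ℚ)^3 / 4096^k)
        (4/1323*R7 p + 1013/222264*(p:ℚ)) := by
  obtain ⟨a, b, c⟩ := inert_key hn hp2 hp3 hp7 h7
  obtain ⟨h1, h2⟩ := inertB hn hp2 hp3 hp7 a b c
  have hd : (p-1)/2 = n := by omega
  unfold R7
  rw [hd]
  constructor
  · apply ratCongr_of_V
    unfold Sm Rm at h1
    push_cast
    simp only [cb_eq]
    exact h1
  · apply ratCongr_of_V
    unfold Sm Rm at h2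
    push_cast
    simp only [cb_eq]
    exact h2
end fin
end Z7
end

theorem statement7 (p : ℕ) (hp : p.Prime) (hp2 : p ≠ 2) (hp3 : p ≠ 3) (hp7 : p ≠ 7) :
    (∀ x y : ℤ, (p % 7 = 1 ∨ p % 7 = 2 ∨ p % 7 = 4) → (p : ℤ) = x^2 + 7*y^2 →
      ratCongr p 3
        ((-1:ℚ)^((p-1)/2) *
          ∑ k ∈ Finset.range ((p-1)/2 + 1), (k:ℚ)^2 * ((2*k).choose k : ℚ)^3 / 4096^k)
        (43/1323*(x:ℚ)^2 - 13/441*(p:ℚ) - (p:ℚ)^2/(1323*(x:ℚ)^2)) ∧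
      ratCongr p 3
        ((-1:ℚ)^((p-1)/2) *
          ∑ k ∈ Finset.range ((p-1)/2 + 1), (k:ℚ)^3 * ((2*k).choose k : ℚ)^3 / 4096^k)
        (169/55566*(x:ℚ)^2 - 31/74088*(p:ℚ) - 71*(p:ℚ)^2/(444528*(x:ℚ)^2))) ∧
    ((p % 7 = 3 ∨ p % 7 = 5 ∨ p % 7 = 6) →
      ratCongr p 2
        ((-1:ℚ)^((p-1)/2) *
          ∑ k ∈ Finset.range ((p-1)/2 + 1), (k:ℚ)^2 * ((2*k).choose k : ℚ)^3 / 4096^k)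
        (8/63*R7 p + 349/2646*(p:ℚ)) ∧
      ratCongr p 2
        ((-1:ℚ)^((p-1)/2) *
          ∑ k ∈ Finset.range ((p-1)/2 + 1), (k:ℚ)^3 * ((2*k).choose k : ℚ)^3 / 4096^k)
        (4/1323*R7 p + 1013/222264*(p:ℚ))) := by
  have : Fact p.Prime := ⟨hp⟩
  have hn : p = 2*((p-1)/2)+1 := by
    rcases hp.eq_two_or_odd with h | h <;> omega
  exact ⟨fun x y _ h => Z7.final_split hn hp2 hp3 hp7 h, fun h7 => Z7.final_inert hn hp2 hp3 hp7 h7⟩
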